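/- Let 𝔸 = (A_n)_{n∈ℕ} be a sequence of invertible linear operators on ℝ^d admitting a nonuniform strong polynomial dichotomy with nonuniformity exponent ε≥0, and let 𝒮 = (‖·‖_n)_{n∈ℕ} be a sequence of norms with respect to which 𝔸 admits a strong polynomial dichotomy and satisfying ‖x‖ ≤ ‖x‖_n ≤ C·n^{2ε}‖x‖ for all x∈ℝ^d, n∈ℕ, for some C>0. Suppose Σ_{PD,𝔸,𝒮} = ⋃_{i=1}^r [log a_i/log 2, log b_i/log 2] where a_1≤b_1<···<a_k≤b_k<1<a_{k+1}≤b_{k+1}<···<a_r≤b_r, a_{k+1}/b_k > max{b_r, a_1^{-1}}, b_i/a_i < b_k^{-1} for i=1,…,k, and b_j/a_j < a_{k+1} for j=k+1,…,r. Let g_n : ℝ^d → ℝ^d, n∈ℕ, be C¹ maps with g_n(0)=0, Dg_n(0)=0, ‖Dg_n(x)‖ ≤ c/(n+1)^{1+2ε} for all x∈ℝ^d, and ‖Dg_n(x)−Dg_n(y)‖ ≤ L/(n+1)^{1+2ε}·‖x−y‖ for all x,y∈ℝ^d, with constants c,L>0. Then there exists c₀>0 such that if c≤c₀, there exists a sequence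 of C¹-diffeomorphisms ψ_n : ℝ^d → ℝ^d, n∈ℕ, with ψ_{n+1}∘(A_n+g_n) = A_n∘ψ_n for all n∈ℕ, and there exist M̃,ρ̃>0 such that ‖Dψ_n(x)‖ ≤ M̃·n^{2ε} and ‖Dψ_n^{-1}(x)‖ ≤ M̃·n^{2ε} for all n∈ℕ and x∈ℝ^d with ‖x‖ ≤ ρ̃/n^{2ε}. -/

import Mathlib

noncomputable section

namespace NonautLin

variable {E : Type*} [NormedAddCommGroup E] [NormedSpace ℝ E]

/-- `N : E → ℝ` is a norm on the real vector space `E`. -/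
def IsNormOn (N : E → ℝ) : Prop :=
  (∀ x, 0 ≤ N x) ∧ (∀ x, N x = 0 ↔ x = 0) ∧
  (∀ (c : ℝ) (x : E), N (c • x) = |c| * N x) ∧
  (∀ x y : E, N (x + y) ≤ N x + N y)

/-- Multiplication by the scalar `c` as a continuous linear equivalence
(junk value `id` for `c = 0`). -/
def smulCLE (c : ℝ) : E ≃L[ℝ] E :=
  if hc : c = 0 then ContinuousLinearEquiv.refl ℝ E
  else
    { toFun := fun x => c • x
      invFun := fun x => c⁻¹ • x
      map_add' := fun x y => smul_add c x y
      map_smul' := fun a x => smul_comm c a x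
      left_inv := fun x => by simp [smul_smul, inv_mul_cancel₀ hc]
      right_inv := fun x => by simp [smul_smul, mul_inv_cancel₀ hc]
      continuous_toFun := continuous_const_smul c
      continuous_invFun := continuous_const_smul c⁻¹ }

/-- The operator `c • A` as a continuous linear equivalence. -/
def scale (c : ℝ) (A : E ≃L[ℝ] E) : E ≃L[ℝ] E := A.trans (smulCLE c)

/-- `fwd A n k` is the composition `A (n+k-1) ∘ ⋯ ∘ A n`. -/
def fwd (A : ℕ → (E ≃L[ℝ] E)) (n : ℕ) : ℕ → (E ≃L[ℝ] E)
  | 0 => ContinuousLinearEquiv.refl ℝ E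
  | k + 1 => (fwd A n k).trans (A (n + k))

/-- The cocycle `𝒜(m,n)` associated with the one-sided sequence `A`:
`𝒜(m,n) = A (m-1) ∘ ⋯ ∘ A n` for `m > n`, `𝒜(n,n) = Id`, and
`𝒜(m,n) = (𝒜(n,m))⁻¹` for `m < n`. -/
def coc (A : ℕ → (E ≃L[ℝ] E)) (m n : ℕ) : E ≃L[ℝ] E :=
  if n ≤ m then fwd A n (m - n) else (fwd A m (n - m)).symm

/-- Nonuniform strong polynomial dichotomy (indices `n ≥ 1`), with nonuniformity
exponent `eps`. -/
def NonuniformStrongPolyDichotomyWith (A : ℕ → (E ≃L[ℝ] E)) (eps : ℝ) : Prop :=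
  ∃ K lam a : ℝ, 0 < K ∧ 0 < lam ∧ lam ≤ a ∧
    ∃ P : ℕ → (E →L[ℝ] E),
      (∀ n, 1 ≤ n → (P n).comp (P n) = P n) ∧
      (∀ n, 1 ≤ n → ((A n : E →L[ℝ] E)).comp (P n) = (P (n + 1)).comp (A n : E →L[ℝ] E)) ∧
      (∀ m n : ℕ, 1 ≤ n → n ≤ m →
        ‖((coc A m n : E →L[ℝ] E)).comp (P n)‖ ≤ K * ((m : ℝ) / n) ^ (-lam) * (n : ℝ) ^ eps ∧
        ‖((coc A n m : E →L[ℝ] E)).comp (ContinuousLinearMap.id ℝ E - P m)‖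
          ≤ K * ((m : ℝ) / n) ^ (-lam) * (m : ℝ) ^ eps ∧
        ‖(coc A m n : E →L[ℝ] E)‖ ≤ K * ((m : ℝ) / n) ^ a * (n : ℝ) ^ eps ∧
        ‖(coc A n m : E →L[ℝ] E)‖ ≤ K * ((m : ℝ) / n) ^ a * (m : ℝ) ^ eps)

/-- Nonuniform strong polynomial dichotomy (indices `n ≥ 1`). -/
def NonuniformStrongPolyDichotomy (A : ℕ → (E ≃L[ℝ] E)) : Prop :=
  ∃ eps : ℝ, 0 ≤ eps ∧ NonuniformStrongPolyDichotomyWith A eps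

/-- Strong polynomial dichotomy with respect to a sequence of norms (indices `n ≥ 1`). -/
def StrongPolyDichotomyWRT (A : ℕ → (E ≃L[ℝ] E)) (N : ℕ → E → ℝ) : Prop :=
  ∃ K lam a : ℝ, 0 < K ∧ 0 < lam ∧ lam ≤ a ∧
    ∃ P : ℕ → (E →L[ℝ] E),
      (∀ n, 1 ≤ n → (P n).comp (P n) = P n) ∧
      (∀ n, 1 ≤ n → ((A n : E →L[ℝ] E)).comp (P n) = (P (n + 1)).comp (A n : E →L[ℝ] E)) ∧
      (∀ m n : ℕ, 1 ≤ n → n ≤ m → ∀ x : E,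
        N m (coc A m n (P n x)) ≤ K * ((m : ℝ) / n) ^ (-lam) * N n x ∧
        N n (coc A n m (x - P m x)) ≤ K * ((m : ℝ) / n) ^ (-lam) * N m x ∧
        N m (coc A m n x) ≤ K * ((m : ℝ) / n) ^ a * N n x ∧
        N n (coc A n m x) ≤ K * ((m : ℝ) / n) ^ a * N m x)

/-- The polynomial dichotomy spectrum: the set of `τ ∈ ℝ` such that
`(((n+1)/n)^{-τ} A_n)` does not admit a strong polynomial dichotomy w.r.t. `N`. -/
def SigmaPD (A : ℕ → (E ≃L[ℝ] E)) (N : ℕ → E → ℝ) : Set ℝ :=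
  {τ | ¬ StrongPolyDichotomyWRT (fun n => scale ((((n : ℝ) + 1) / n) ^ (-τ)) (A n)) N}

section

open Filter Topology

/-- A `C¹` map with derivative bounded by `c` and `L`-Lipschitz. -/
structure C11 {X Y : Type*} [NormedAddCommGroup X] [NormedSpace ℝ X]
    [NormedAddCommGroup Y] [NormedSpace ℝ Y] (f : X → Y) (c L : ℝ) : Prop where
  contDiff : ContDiff ℝ 1 f
  bound : ∀ x, ‖fderiv ℝ f x‖ ≤ c
  lip : ∀ x y, ‖fderiv ℝ f x - fderiv ℝ f y‖ ≤ L * ‖x - y‖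

section Toolkit

variable {X Y Z : Type*} [NormedAddCommGroup X] [NormedSpace ℝ X]
  [NormedAddCommGroup Y] [NormedSpace ℝ Y] [NormedAddCommGroup Z] [NormedSpace ℝ Z]

theorem continuous_of_norm_sub_le {X Y : Type*} [SeminormedAddCommGroup X]
    [SeminormedAddCommGroup Y] {f : X → Y} {L : ℝ}
    (h : ∀ x y, ‖f x - f y‖ ≤ L * ‖x - y‖) : Continuous f := by
  have : LipschitzWith (Real.toNNReal L) f :=
    LipschitzWith.of_dist_le_mul fun x y => by
      rw [dist_eq_norm, dist_eq_norm]
      refine (h x y).trans ?_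
      gcongr
      exact Real.le_coe_toNNReal L
  exact this.continuous

theorem contDiff_one_of_hasFDerivAt {f : X → Y} {f' : X → X →L[ℝ] Y}
    (hd : ∀ x, HasFDerivAt f (f' x) x) (hc : Continuous f') : ContDiff ℝ 1 f := by
  rw [contDiff_one_iff_fderiv]
  refine ⟨fun x => (hd x).differentiableAt, ?_⟩
  have : fderiv ℝ f = f' := funext fun x => (hd x).fderiv
  rwa [this]

theorem C11.of_hasFDerivAt {f : X → Y} {f' : X → X →L[ℝ] Y} {c L : ℝ}
    (hd : ∀ x, HasFDerivAt f (f' x) x) (hb : ∀ x, ‖f' x‖ ≤ c)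
    (hl : ∀ x y, ‖f' x - f' y‖ ≤ L * ‖x - y‖) : C11 f c L := by
  have : fderiv ℝ f = f' := funext fun x => (hd x).fderiv
  exact ⟨contDiff_one_of_hasFDerivAt hd (continuous_of_norm_sub_le hl),
    by rwa [this], by rwa [this]⟩

theorem C11.hasFDerivAt {f : X → Y} {c L : ℝ} (h : C11 f c L) (x : X) :
    HasFDerivAt f (fderiv ℝ f x) x :=
  (h.contDiff.differentiable one_ne_zero x).hasFDerivAt

theorem hasFDerivAt_of_contDiff {f : X → Y} (h : ContDiff ℝ 1 f) (x : X) :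
    HasFDerivAt f (fderiv ℝ f x) x :=
  (h.differentiable one_ne_zero x).hasFDerivAt

theorem C11.nonneg {f : X → Y} {c L : ℝ} (h : C11 f c L) : 0 ≤ c :=
  (norm_nonneg _).trans (h.bound 0)

theorem C11.mono {f : X → Y} {c L c' L' : ℝ} (h : C11 f c L) (hc : c ≤ c') (hL : L ≤ L') :
    C11 f c' L' :=
  ⟨h.contDiff, fun x => (h.bound x).trans hc, fun x y => (h.lip x y).trans (by gcongr)⟩

theorem norm_sub_le_of_fderiv {f : X → Y} {c : ℝ} (h : ContDiff ℝ 1 f)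
    (hb : ∀ x, ‖fderiv ℝ f x‖ ≤ c) (x y : X) : ‖f x - f y‖ ≤ c * ‖x - y‖ :=
  convex_univ.norm_image_sub_le_of_norm_fderiv_le (𝕜 := ℝ)
    (fun z _ => h.differentiable one_ne_zero z) (fun z _ => hb z) (Set.mem_univ y)
    (Set.mem_univ x)

theorem C11.lipschitz {f : X → Y} {c L : ℝ} (h : C11 f c L) (x y : X) :
    ‖f x - f y‖ ≤ c * ‖x - y‖ :=
  norm_sub_le_of_fderiv h.contDiff h.bound x y

theorem C11.norm_le {f : X → Y} {c L : ℝ} (h : C11 f c L) (h0 : f 0 = 0) (x : X) :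
    ‖f x‖ ≤ c * ‖x‖ := by
  simpa [h0] using h.lipschitz x 0

theorem C11.norm_fderiv_le {f : X → Y} {c L : ℝ} (h : C11 f c L) (h0 : fderiv ℝ f 0 = 0)
    (x : X) : ‖fderiv ℝ f x‖ ≤ L * ‖x‖ := by
  simpa [h0] using h.lip x 0

theorem C11.taylor {f : X → Y} {c L : ℝ} (h : C11 f c L) (hL : 0 ≤ L) (x v : X) :
    ‖f (x + v) - f x - fderiv ℝ f x v‖ ≤ L * ‖v‖ * ‖v‖ := by
  have key := (convex_segment (𝕜 := ℝ) x (x + v)).norm_image_sub_le_of_norm_hasFDerivWithin_le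
    (f := fun z => f z - fderiv ℝ f x z) (f' := fun z => fderiv ℝ f z - fderiv ℝ f x)
    (C := L * ‖v‖) (x := x) (y := x + v)
    (fun z _ => ((h.hasFDerivAt z).sub (fderiv ℝ f x).hasFDerivAt).hasFDerivWithinAt)
    (fun z hz => ?_) (left_mem_segment ℝ _ _) (right_mem_segment ℝ _ _)
  · have e : f (x + v) - (fderiv ℝ f x) (x + v) - (f x - (fderiv ℝ f x) x)
        = f (x + v) - f x - fderiv ℝ f x v := by
      rw [map_add]; abel
    rw [e] at key
    simpa using key
  · refine (h.lip z x).trans ?_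
    gcongr
    obtain ⟨t, ht, rfl⟩ := (segment_eq_image' ℝ x (x + v)) ▸ hz
    simp only [add_sub_cancel_left, norm_smul, Real.norm_eq_abs, abs_of_nonneg ht.1]
    exact mul_le_of_le_one_left (norm_nonneg _) ht.2

theorem C11.comp {g : Y → Z} {f : X → Y} {c L c' L' : ℝ} (hg : C11 g c L) (hf : C11 f c' L')
    (hL : 0 ≤ L) : C11 (fun x => g (f x)) (c * c') (L * c' ^ 2 + c * L') := by
  have hc := hg.nonneg
  have hc' := hf.nonneg
  refine C11.of_hasFDerivAt (f' := fun x => (fderiv ℝ g (f x)).comp (fderiv ℝ f x))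
    (fun x => (hg.hasFDerivAt (f x)).comp x (hf.hasFDerivAt x)) (fun x => ?_) (fun x y => ?_)
  · refine (ContinuousLinearMap.opNorm_comp_le _ _).trans ?_
    gcongr
    · exact hg.bound _
    · exact hf.bound _
  · have e : (fderiv ℝ g (f x)).comp (fderiv ℝ f x) - (fderiv ℝ g (f y)).comp (fderiv ℝ f y)
        = (fderiv ℝ g (f x) - fderiv ℝ g (f y)).comp (fderiv ℝ f x)
          + (fderiv ℝ g (f y)).comp (fderiv ℝ f x - fderiv ℝ f y) := by
      ext v; simp
    rw [e]
    refine (norm_add_le _ _).trans ?_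
    have h1 : ‖(fderiv ℝ g (f x) - fderiv ℝ g (f y)).comp (fderiv ℝ f x)‖
        ≤ L * (c' * ‖x - y‖) * c' := by
      refine (ContinuousLinearMap.opNorm_comp_le _ _).trans ?_
      gcongr
      · exact (hg.lip _ _).trans (by gcongr; exact hf.lipschitz x y)
      · exact hf.bound _
    have h2 : ‖(fderiv ℝ g (f y)).comp (fderiv ℝ f x - fderiv ℝ f y)‖ ≤ c * (L' * ‖x - y‖) := by
      refine (ContinuousLinearMap.opNorm_comp_le _ _).trans ?_
      gcongr
      · exact hg.bound _
      · exact hf.lip _ _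
    refine (add_le_add h1 h2).trans (le_of_eq ?_)
    ring

theorem C11.add {f g : X → Y} {c L c' L' : ℝ} (hf : C11 f c L) (hg : C11 g c' L') :
    C11 (fun x => f x + g x) (c + c') (L + L') := by
  refine C11.of_hasFDerivAt (fun x => (hf.hasFDerivAt x).add (hg.hasFDerivAt x)) (fun x => ?_)
    (fun x y => ?_)
  · exact (norm_add_le _ _).trans (add_le_add (hf.bound x) (hg.bound x))
  · rw [add_sub_add_comm, add_mul]
    exact (norm_add_le _ _).trans (add_le_add (hf.lip x y) (hg.lip x y))

theorem C11.clm (T : X →L[ℝ] Y) : C11 (fun x => T x) ‖T‖ 0 :=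
  C11.of_hasFDerivAt (fun _ => T.hasFDerivAt) (fun _ => le_rfl) (fun x y => by simp)

theorem C11.clm_of_le (T : X →L[ℝ] Y) {c : ℝ} (hc : 0 ≤ c) (h : ∀ x, ‖T x‖ ≤ c * ‖x‖) :
    C11 (fun x => T x) c 0 :=
  (C11.clm T).mono (T.opNorm_le_bound hc h) le_rfl

theorem C11.zero {c L : ℝ} (hc : 0 ≤ c) (hL : 0 ≤ L) : C11 (fun _ : X => (0 : Y)) c L :=
  C11.of_hasFDerivAt (fun x => hasFDerivAt_const 0 x) (fun _ => by simpa)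
    (fun x y => by simpa using mul_nonneg hL (norm_nonneg (x - y)))

theorem C11.prodMk {f : X → Y} {g : X → Z} {c L c' L' : ℝ} (hf : C11 f c L) (hg : C11 g c' L') :
    C11 (fun x => (f x, g x)) (max c c') (max L L') := by
  refine C11.of_hasFDerivAt (fun x => (hf.hasFDerivAt x).prodMk (hg.hasFDerivAt x)) (fun x => ?_)
    (fun x y => ?_)
  · rw [ContinuousLinearMap.opNorm_prod]
    exact max_le_max (hf.bound x) (hg.bound x)
  · have e : (fderiv ℝ f x).prod (fderiv ℝ g x) - (fderiv ℝ f y).prod (fderiv ℝ g y)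
        = (fderiv ℝ f x - fderiv ℝ f y).prod (fderiv ℝ g x - fderiv ℝ g y) := by
      ext v <;> simp
    rw [e, ContinuousLinearMap.opNorm_prod]
    refine max_le ((hf.lip x y).trans ?_) ((hg.lip x y).trans ?_)
    · gcongr; exact le_max_left _ _
    · gcongr; exact le_max_right _ _

theorem C11.comp_clm {g : Y → Z} {c L : ℝ} (hg : C11 g c L) (hL : 0 ≤ L) (T : X →L[ℝ] Y)
    (hT : ‖T‖ ≤ 1) : C11 (fun x => g (T x)) c L := by
  refine (hg.comp (C11.clm T) hL).mono ?_ ?_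
  · exact mul_le_of_le_one_right hg.nonneg hT
  · have : ‖T‖ ^ 2 ≤ 1 := pow_le_one₀ (norm_nonneg _) hT
    nlinarith

theorem C11.clm_comp {g : X → Y} {c L : ℝ} (hg : C11 g c L) (hL : 0 ≤ L) (T : Y →L[ℝ] Z)
    (hT : ‖T‖ ≤ 1) : C11 (fun x => T (g x)) c L := by
  refine ((C11.clm T).comp hg le_rfl).mono ?_ ?_
  · exact mul_le_of_le_one_left hg.nonneg hT
  · nlinarith [norm_nonneg T]

/-- A pointwise limit of maps that are uniformly `C^{1,1}` is `C^{1,1}`, with the same constants,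
and the derivatives converge pointwise. -/
theorem C11.of_tendsto [CompleteSpace Y] {f : ℕ → X → Y} {g : X → Y} {c L : ℝ} (hL : 0 ≤ L)
    (hf : ∀ j, C11 (f j) c L) (hlim : ∀ x, Tendsto (fun j => f j x) atTop (𝓝 (g x))) :
    C11 g c L ∧ ∀ x v, Tendsto (fun j => fderiv ℝ (f j) x v) atTop (𝓝 (fderiv ℝ g x v)) := by
  have hcau : ∀ x v, CauchySeq (fun j => fderiv ℝ (f j) x v) := by
    intro x v
    rw [Metric.cauchySeq_iff']
    intro ε hε
    set B := L * ‖v‖ * ‖v‖ with hB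
    have hB0 : 0 ≤ B := by positivity
    set t := ε / (4 * (B + 1)) with ht
    have ht0 : 0 < t := by positivity
    have htB : 2 * (t * B) ≤ ε / 2 := by
      have : t * (4 * (B + 1)) = ε := by rw [ht]; field_simp
      nlinarith
    have hc : CauchySeq (fun j => f j (x + t • v) - f j x) :=
      ((hlim (x + t • v)).sub (hlim x)).cauchySeq
    obtain ⟨n0, hn0⟩ := Metric.cauchySeq_iff'.1 hc (t * (ε / 2)) (by positivity)
    refine ⟨n0, fun n hn => ?_⟩
    have h1 := hn0 n hn
    rw [dist_eq_norm] at h1 ⊢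
    have T1 := (hf n).taylor hL x (t • v)
    have T2 := (hf n0).taylor hL x (t • v)
    have hs : L * ‖t • v‖ * ‖t • v‖ = t * (t * B) := by
      rw [norm_smul, Real.norm_eq_abs, abs_of_pos ht0, hB]; ring
    rw [hs] at T1 T2
    have e : t • (fderiv ℝ (f n) x v - fderiv ℝ (f n0) x v)
        = (f n (x + t • v) - f n x - (f n0 (x + t • v) - f n0 x))
          - (f n (x + t • v) - f n x - fderiv ℝ (f n) x (t • v))
          + (f n0 (x + t • v) - f n0 x - fderiv ℝ (f n0) x (t • v)) := by
      rw [map_smul, map_smul, smul_sub]; abel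
    have h2 : t * ‖fderiv ℝ (f n) x v - fderiv ℝ (f n0) x v‖ < t * ε := by
      calc t * ‖fderiv ℝ (f n) x v - fderiv ℝ (f n0) x v‖
          = ‖t • (fderiv ℝ (f n) x v - fderiv ℝ (f n0) x v)‖ := by
            rw [norm_smul, Real.norm_eq_abs, abs_of_pos ht0]
        _ ≤ ‖f n (x + t • v) - f n x - (f n0 (x + t • v) - f n0 x)‖ + t * (t * B)
              + t * (t * B) := by
            rw [e]
            exact (norm_add_le _ _).trans
              (add_le_add ((norm_sub_le _ _).trans (add_le_add le_rfl T1)) T2)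
        _ < t * ε := by nlinarith
    exact lt_of_mul_lt_mul_left h2 ht0.le
  choose G hG using fun x v => cauchySeq_tendsto_of_complete (hcau x v)
  have hGb : ∀ x v, ‖G x v‖ ≤ c * ‖v‖ := fun x v =>
    le_of_tendsto (hG x v).norm (Eventually.of_forall fun j =>
      ((fderiv ℝ (f j) x).le_opNorm v).trans (by gcongr; exact (hf j).bound x))
  let G' : X → X →L[ℝ] Y := fun x =>
    LinearMap.mkContinuous
      { toFun := G x
        map_add' := fun v w => tendsto_nhds_unique (hG x (v + w)) (by
          simpa using (hG x v).add (hG x w))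
        map_smul' := fun t v => tendsto_nhds_unique (hG x (t • v)) (by
          simpa using (hG x v).const_smul t) } c (hGb x)
  have hG' : ∀ x v, G' x v = G x v := fun _ _ => rfl
  have hc : 0 ≤ c := (hf 0).nonneg
  have hT : ∀ x v, ‖g (x + v) - g x - G' x v‖ ≤ L * ‖v‖ * ‖v‖ := fun x v =>
    le_of_tendsto (((hlim (x + v)).sub (hlim x)).sub (hG x v)).norm
      (Eventually.of_forall fun j => (hf j).taylor hL x v)
  have hd : ∀ x, HasFDerivAt g (G' x) x := by
    intro x
    rw [hasFDerivAt_iff_isLittleO_nhds_zero, Asymptotics.isLittleO_iff]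
    intro ε hε
    have : ∀ᶠ v in 𝓝 (0 : X), ‖v‖ < ε / (L + 1) := by
      have := Metric.ball_mem_nhds (0 : X) (ε := ε / (L + 1)) (by positivity)
      filter_upwards [this] with v hv
      simpa using hv
    filter_upwards [this] with v hv
    refine (hT x v).trans ?_
    gcongr
    rw [lt_div_iff₀ (by positivity)] at hv
    nlinarith [norm_nonneg v]
  have hC : C11 g c L := by
    refine C11.of_hasFDerivAt hd (fun x => LinearMap.mkContinuous_norm_le _ hc _) (fun x y => ?_)
    refine ContinuousLinearMap.opNorm_le_bound _ (by positivity) fun v => ?_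
    refine le_of_tendsto ((hG x v).sub (hG y v)).norm (Eventually.of_forall fun j => ?_)
    have := (fderiv ℝ (f j) x - fderiv ℝ (f j) y).le_opNorm v
    exact this.trans (by gcongr; exact (hf j).lip x y)
  refine ⟨hC, fun x v => ?_⟩
  rw [(hd x).fderiv]
  exact hG x v

theorem le_norm_fderiv_of_expanding {f : X → Y} {f' : X →L[ℝ] Y} {x : X} {κ : ℝ}
    (hd : HasFDerivAt f f' x) (h : ∀ᶠ y in 𝓝 x, κ * ‖y - x‖ ≤ ‖f y - f x‖) (v : X) :
    κ * ‖v‖ ≤ ‖f' v‖ := by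
  have h1 : Tendsto (fun n : ℕ => ((n : ℝ) + 1) • (f (x + ((n : ℝ) + 1)⁻¹ • v) - f x)) atTop
      (𝓝 (f' v)) := by
    apply hd.lim v
    refine tendsto_norm_atTop_atTop.comp ?_
    exact tendsto_atTop_add_const_right atTop (1 : ℝ) tendsto_natCast_atTop_atTop
  have h2 : Tendsto (fun n : ℕ => x + ((n : ℝ) + 1)⁻¹ • v) atTop (𝓝 x) := by
    have h3 : Tendsto (fun n : ℕ => ((n : ℝ) + 1)⁻¹) atTop (𝓝 0) :=
      tendsto_inv_atTop_zero.comp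
        (tendsto_atTop_add_const_right atTop (1 : ℝ) tendsto_natCast_atTop_atTop)
    simpa using (tendsto_const_nhds (x := x)).add (h3.smul_const v)
  refine ge_of_tendsto h1.norm ?_
  filter_upwards [h2.eventually h] with n hn
  have hp : (0 : ℝ) < (n : ℝ) + 1 := by positivity
  rw [norm_smul, Real.norm_eq_abs, abs_of_pos hp]
  rw [add_sub_cancel_left, norm_smul, norm_inv, Real.norm_eq_abs, abs_of_pos hp] at hn
  calc κ * ‖v‖ = ((n : ℝ) + 1) * (κ * (((n : ℝ) + 1)⁻¹ * ‖v‖)) := by field_simp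
    _ ≤ _ := by gcongr

/-- A proper, locally uniformly expanding `C¹` self-map of a finite-dimensional space is a
`C¹` diffeomorphism. -/
theorem exists_equiv_of_expanding [FiniteDimensional ℝ X] {f : X → X} (hf : ContDiff ℝ 1 f)
    (hloc : ∀ R : ℝ, ∃ κ > 0, ∀ x y, ‖x‖ ≤ R → ‖y‖ ≤ R → κ * ‖x - y‖ ≤ ‖f x - f y‖)
    {κ₀ : ℝ} (hκ₀ : 0 < κ₀) (hprop : ∀ x, κ₀ * ‖x‖ ≤ ‖f x‖) :
    ∃ e : X ≃ X, (∀ x, e x = f x) ∧ ContDiff ℝ 1 e.symm ∧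
      ∀ x, ∃ T : X ≃L[ℝ] X, (T : X →L[ℝ] X) = fderiv ℝ f x ∧
        fderiv ℝ e.symm (f x) = (T.symm : X →L[ℝ] X) := by
  have hinj : Function.Injective f := by
    intro x y hxy
    obtain ⟨κ, hκ, h⟩ := hloc (max ‖x‖ ‖y‖)
    have := h x y (le_max_left _ _) (le_max_right _ _)
    rw [hxy, sub_self, norm_zero] at this
    have : ‖x - y‖ ≤ 0 := by
      by_contra hc
      push Not at hc
      nlinarith
    exact sub_eq_zero.1 (norm_le_zero_iff.1 this)
  have hder : ∀ x, ∃ T : X ≃L[ℝ] X, (T : X →L[ℝ] X) = fderiv ℝ f x := by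
    intro x
    obtain ⟨κ, hκ, h⟩ := hloc (‖x‖ + 1)
    have hlow := le_norm_fderiv_of_expanding (hasFDerivAt_of_contDiff hf x) (κ := κ) (by
      filter_upwards [Metric.ball_mem_nhds x one_pos] with y hy
      rw [Metric.mem_ball, dist_eq_norm] at hy
      refine h y x ?_ (by linarith)
      have := norm_add_le (y - x) x
      rw [sub_add_cancel] at this
      linarith)
    have hinj' : Function.Injective (fderiv ℝ f x : X →ₗ[ℝ] X) := by
      rw [← LinearMap.ker_eq_bot, LinearMap.ker_eq_bot']
      intro v hv
      have := hlow v
      rw [show fderiv ℝ f x v = 0 from hv, norm_zero] at this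
      have : ‖v‖ ≤ 0 := by
        by_contra hc
        push Not at hc
        nlinarith
      exact norm_le_zero_iff.1 this
    refine ⟨(LinearEquiv.ofInjectiveEndo _ hinj').toContinuousLinearEquiv, ?_⟩
    ext v
    rfl
  choose T hT using hder
  have hopen : IsOpenMap f := by
    refine isOpenMap_of_hasStrictFDerivAt_equiv (f' := T) fun x => ?_
    rw [hT x]
    exact hf.hasStrictFDerivAt one_ne_zero
  have hclosed : IsClosed (Set.range f) := by
    refine isClosed_of_closure_subset fun y hy => ?_
    obtain ⟨u, hu, hlim⟩ := mem_closure_iff_seq_limit.1 hy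
    choose x hx using hu
    have hbdd : Bornology.IsBounded (Set.range x) := by
      obtain ⟨R, hR⟩ := (Metric.isBounded_range_of_tendsto u hlim).exists_norm_le
      refine isBounded_iff_forall_norm_le.2 ⟨R / κ₀, ?_⟩
      rintro _ ⟨n, rfl⟩
      rw [le_div_iff₀ hκ₀, mul_comm]
      exact (hprop _).trans (by rw [hx]; exact hR _ ⟨n, rfl⟩)
    have := FiniteDimensional.proper_real X
    obtain ⟨a, -, φ, hφ, ha⟩ := tendsto_subseq_of_bounded hbdd (fun n => ⟨n, rfl⟩)
    refine ⟨a, tendsto_nhds_unique ((hf.continuous.tendsto a).comp ha) ?_⟩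
    have : f ∘ x ∘ φ = u ∘ φ := by ext n; simp [hx]
    rw [this]
    exact hlim.comp hφ.tendsto_atTop
  have hsurj : Function.Surjective f := by
    rw [← Set.range_eq_univ]
    exact IsClopen.eq_univ ⟨hclosed, hopen.isOpen_range⟩ ⟨f 0, ⟨0, rfl⟩⟩
  let e : X ≃ X := Equiv.ofBijective f ⟨hinj, hsurj⟩
  let E : X ≃ₜ X := e.toHomeomorphOfContinuousOpen hf.continuous hopen
  have hd : ∀ a, HasFDerivAt E (T a : X →L[ℝ] X) a := fun a => by
    rw [hT a]; exact hasFDerivAt_of_contDiff hf a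
  refine ⟨e, fun _ => rfl, Homeomorph.contDiff_symm E hd hf, fun x => ⟨T x, hT x, ?_⟩⟩
  have := HasFDerivAt.of_local_left_inverse (f := f) (g := e.symm) (f' := T x) (a := f x)
    E.symm.continuous.continuousAt (by
      have : e.symm (f x) = x := e.symm_apply_apply x
      rw [this]; exact hd x) (Eventually.of_forall fun y => e.apply_symm_apply y)
  exact this.fderiv

theorem C11.exists_inverse [FiniteDimensional ℝ X] {f : X → X} {c L κ : ℝ} (hf : C11 f c L)
    (hL : 0 ≤ L) (hκ : 0 < κ) (h0 : f 0 = 0) (hexp : ∀ x y, κ * ‖x - y‖ ≤ ‖f x - f y‖) :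
    ∃ e : X ≃ X, (∀ x, e x = f x) ∧ C11 e.symm κ⁻¹ (L * κ⁻¹ ^ 3) ∧
      ∀ x, ∃ T : X ≃L[ℝ] X, (T : X →L[ℝ] X) = fderiv ℝ f x ∧
        fderiv ℝ e.symm (f x) = (T.symm : X →L[ℝ] X) := by
  obtain ⟨e, he, hes, hT⟩ := exists_equiv_of_expanding hf.contDiff
    (fun R => ⟨κ, hκ, fun x y _ _ => hexp x y⟩) hκ (fun x => by simpa [h0] using hexp x 0)
  have hlip : ∀ x y, ‖e.symm x - e.symm y‖ ≤ κ⁻¹ * ‖x - y‖ := by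
    intro x y
    have := hexp (e.symm x) (e.symm y)
    rw [← he, ← he, e.apply_symm_apply, e.apply_symm_apply] at this
    rw [← div_eq_inv_mul, le_div_iff₀ hκ, mul_comm]
    exact this
  have hb : ∀ x, ‖fderiv ℝ e.symm x‖ ≤ κ⁻¹ := fun x => by
    have hl : LipschitzWith (Real.toNNReal κ⁻¹) e.symm := LipschitzWith.of_dist_le_mul fun a b => by
      rw [dist_eq_norm, dist_eq_norm, Real.coe_toNNReal _ (by positivity)]
      exact hlip a b
    have := norm_fderiv_le_of_lipschitz ℝ hl (x₀ := x)
    rwa [Real.coe_toNNReal _ (by positivity)] at this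
  refine ⟨e, he, ⟨hes, hb, fun x y => ?_⟩, hT⟩
  obtain ⟨a, rfl⟩ := e.surjective x
  obtain ⟨b, rfl⟩ := e.surjective y
  obtain ⟨Ta, hTa, hTa'⟩ := hT a
  obtain ⟨Tb, hTb, hTb'⟩ := hT b
  have hba := hb (f a)
  have hbb := hb (f b)
  rw [he, he, hTa', hTb']
  rw [hTa'] at hba
  rw [hTb'] at hbb
  have e1 : (Ta.symm : X →L[ℝ] X) - (Tb.symm : X →L[ℝ] X)
      = (Ta.symm : X →L[ℝ] X).comp
        ((fderiv ℝ f b - fderiv ℝ f a).comp (Tb.symm : X →L[ℝ] X)) := by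
    ext v
    simp [← hTa, ← hTb]
  rw [e1]
  have hab : ‖a - b‖ ≤ κ⁻¹ * ‖f a - f b‖ := by
    have := hlip (e a) (e b)
    rw [e.symm_apply_apply, e.symm_apply_apply, he, he] at this
    exact this
  calc _ ≤ κ⁻¹ * (L * (κ⁻¹ * ‖f a - f b‖) * κ⁻¹) := by
        refine (ContinuousLinearMap.opNorm_comp_le _ _).trans ?_
        gcongr
        refine (ContinuousLinearMap.opNorm_comp_le _ _).trans ?_
        gcongr
        refine (hf.lip b a).trans ?_
        rw [norm_sub_rev]
        gcongr
    _ = _ := by ring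

/-- `C¹` limits of sequences whose derivatives converge geometrically fast. -/
theorem contDiff_limit_of_geometric [CompleteSpace Y] {f : ℕ → X → Y} {g : X → Y} {s : Set X}
    (hs : IsOpen s) {C μ : ℝ} (hμ0 : 0 ≤ μ) (hμ : μ < 1)
    (hf : ∀ j, ContDiff ℝ 1 (f j))
    (hdiff : ∀ j, ∀ x ∈ s, ‖fderiv ℝ (f (j + 1)) x - fderiv ℝ (f j) x‖ ≤ C * μ ^ j)
    (hlim : ∀ x ∈ s, Tendsto (fun j => f j x) atTop (𝓝 (g x))) :
    ContinuousOn (fderiv ℝ g) s ∧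
    ∀ x ∈ s, HasFDerivAt g (fderiv ℝ g x) x ∧
      Tendsto (fun j => fderiv ℝ (f j) x) atTop (𝓝 (fderiv ℝ g x)) := by
  have hdist : ∀ x ∈ s, ∀ j, dist (fderiv ℝ (f j) x) (fderiv ℝ (f (j + 1)) x) ≤ C * μ ^ j := by
    intro x hx j
    rw [dist_comm, dist_eq_norm]
    exact hdiff j x hx
  have hcau : ∀ x ∈ s, ∃ T, Tendsto (fun j => fderiv ℝ (f j) x) atTop (𝓝 T) := fun x hx =>
    cauchySeq_tendsto_of_complete (cauchySeq_of_le_geometric μ C hμ (hdist x hx))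
  classical
  let G : X → X →L[ℝ] Y := fun x => if hx : x ∈ s then (hcau x hx).choose else 0
  have hG : ∀ x ∈ s, Tendsto (fun j => fderiv ℝ (f j) x) atTop (𝓝 (G x)) := fun x hx => by
    simp only [G, dif_pos hx]
    exact (hcau x hx).choose_spec
  have hunif : TendstoUniformlyOn (fun j => fderiv ℝ (f j)) G atTop s := by
    rw [Metric.tendstoUniformlyOn_iff]
    intro ε hε
    have h0 : Tendsto (fun j : ℕ => C * μ ^ j / (1 - μ)) atTop (𝓝 0) := by
      have := ((tendsto_pow_atTop_nhds_zero_of_lt_one hμ0 hμ).const_mul C).div_const (1 - μ)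
      simpa using this
    filter_upwards [h0.eventually_lt_const hε] with j hj x hx
    rw [dist_comm]
    exact (dist_le_of_le_geometric_of_tendsto μ C hμ (hdist x hx) (hG x hx) j).trans_lt hj
  have hd : ∀ x ∈ s, HasFDerivAt g (G x) x := fun x hx =>
    hasFDerivAt_of_tendstoUniformlyOn hs hunif
      (fun j z _ => hasFDerivAt_of_contDiff (hf j) z) hlim hx
  have heq : ∀ x ∈ s, fderiv ℝ g x = G x := fun x hx => (hd x hx).fderiv
  refine ⟨?_, fun x hx => ?_⟩
  · have : ContinuousOn G s := hunif.continuousOn (Eventually.of_forall fun j =>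
      ((hf j).continuous_fderiv one_ne_zero).continuousOn).frequently
    exact this.congr heq
  · rw [heq x hx]
    exact ⟨hd x hx, hG x hx⟩

end Toolkit

/-- A nonautonomous perturbed block-diagonal system over `ℤ`. -/
structure Sys (S U : Type*) [NormedAddCommGroup S] [NormedSpace ℝ S]
    [NormedAddCommGroup U] [NormedSpace ℝ U] where
  A : ℤ → S ≃L[ℝ] S
  B : ℤ → U ≃L[ℝ] U
  gs : ℤ → S × U → S
  gu : ℤ → S × U → U

section Graph

variable {S U : Type*} [NormedAddCommGroup S] [NormedSpace ℝ S]
  [NormedAddCommGroup U] [NormedSpace ℝ U]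

/-- The first component of the system. -/
def Sys.s (F : Sys S U) (n : ℤ) (x : S × U) : S := F.A n x.1 + F.gs n x

/-- The second component of the system. -/
def Sys.u (F : Sys S U) (n : ℤ) (x : S × U) : U := F.B n x.2 + F.gu n x

/-- The system is contracting at rate `b` in the first variable, expanding at rate `a` in the
second, up to a small `C^{1,1}` perturbation. -/
structure Sys.Good (F : Sys S U) (b a c L : ℝ) : Prop where
  hA : ∀ n s, ‖F.A n s‖ ≤ b * ‖s‖
  hB : ∀ n u, a * ‖u‖ ≤ ‖F.B n u‖
  gs : ∀ n, C11 (F.gs n) c L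
  gu : ∀ n, C11 (F.gu n) c L
  gs0 : ∀ n, F.gs n 0 = 0
  gu0 : ∀ n, F.gu n 0 = 0
  dgs0 : ∀ n, fderiv ℝ (F.gs n) 0 = 0
  dgu0 : ∀ n, fderiv ℝ (F.gu n) 0 = 0
  b0 : 0 ≤ b
  L0 : 0 ≤ L

/-- The numerical conditions under which the graph transform is well defined. -/
structure GraphCond (b a c L δ Λ : ℝ) : Prop where
  δ0 : 0 < δ
  δ1 : δ ≤ 1
  hac : 1 ≤ a - c
  hδ : c * (1 + δ) ≤ δ * (a - b)
  hb : b < 1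
  hbc : (b + c) * (1 + c) ≤ (1 + b) / 2
  hbc2 : b + 2 * c < 1
  hΛ : Λ = 4 * L / (1 - b)

/-- Candidates for invariant graphs. -/
structure IsGraph (h : U → S) (δ Λ : ℝ) : Prop where
  c11 : C11 h δ Λ
  zero : h 0 = 0
  dzero : fderiv ℝ h 0 = 0

theorem Sys.Good.c0 {F : Sys S U} {b a c L : ℝ} (hF : F.Good b a c L) : 0 ≤ c :=
  (hF.gs 0).nonneg

theorem Sys.Good.norm_s_sub {F : Sys S U} {b a c L : ℝ} (hF : F.Good b a c L) (n : ℤ)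
    (x y : S × U) : ‖F.s n x - F.s n y‖ ≤ b * ‖x.1 - y.1‖ + c * ‖x - y‖ := by
  have e : F.s n x - F.s n y = F.A n (x.1 - y.1) + (F.gs n x - F.gs n y) := by
    simp only [Sys.s, map_sub]; abel
  rw [e]
  exact (norm_add_le _ _).trans (add_le_add (hF.hA n _) ((hF.gs n).lipschitz x y))

theorem Sys.Good.norm_u_sub {F : Sys S U} {b a c L : ℝ} (hF : F.Good b a c L) (n : ℤ)
    (x y : S × U) : a * ‖x.2 - y.2‖ - c * ‖x - y‖ ≤ ‖F.u n x - F.u n y‖ := by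
  have e : F.u n x - F.u n y = F.B n (x.2 - y.2) + (F.gu n x - F.gu n y) := by
    simp only [Sys.u, map_sub]; abel
  rw [e]
  have h1 := hF.hB n (x.2 - y.2)
  have h2 := (hF.gu n).lipschitz x y
  have h3 := norm_sub_le (F.B n (x.2 - y.2) + (F.gu n x - F.gu n y)) (F.gu n x - F.gu n y)
  rw [add_sub_cancel_right] at h3
  linarith

theorem Sys.Good.s_zero {F : Sys S U} {b a c L : ℝ} (hF : F.Good b a c L) (n : ℤ) :
    F.s n 0 = 0 := by simp [Sys.s, hF.gs0]

theorem Sys.Good.u_zero {F : Sys S U} {b a c L : ℝ} (hF : F.Good b a c L) (n : ℤ) :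
    F.u n 0 = 0 := by simp [Sys.u, hF.gu0]

theorem IsGraph.section_c11 {h : U → S} {δ Λ : ℝ} (hh : IsGraph h δ Λ) (hδ : δ ≤ 1)
    (hΛ : 0 ≤ Λ) : C11 (fun u => (h u, u)) 1 Λ := by
  have hid : C11 (fun u : U => u) 1 0 :=
    (C11.clm (ContinuousLinearMap.id ℝ U)).mono ContinuousLinearMap.norm_id_le le_rfl
  exact (hh.c11.prodMk hid).mono (max_le hδ le_rfl) (max_le le_rfl hΛ)

theorem IsGraph.norm_section_sub {h : U → S} {δ Λ : ℝ} (hh : IsGraph h δ Λ) (hδ : δ ≤ 1)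
    (u v : U) : ‖(h u, u) - (h v, v)‖ = ‖u - v‖ := by
  rw [Prod.mk_sub_mk, Prod.norm_mk]
  refine max_eq_right ((hh.c11.lipschitz u v).trans ?_)
  exact mul_le_of_le_one_left (norm_nonneg _) hδ

/-- A graph and its transform attract at rate `b + c + δ c`. -/
theorem IsGraph.attract {F : Sys S U} {b a c L δ Λ : ℝ} (hF : F.Good b a c L) (δ0 : 0 ≤ δ)
    {h h' : U → S} (hh' : IsGraph h' δ Λ) {n : ℤ}
    (hinv : ∀ u, h' (F.u n (h u, u)) = F.s n (h u, u)) (x : S × U) :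
    ‖F.s n x - h' (F.u n x)‖ ≤ (b + c + δ * c) * ‖x.1 - h x.2‖ := by
  have hxy : ‖x - (h x.2, x.2)‖ = ‖x.1 - h x.2‖ := by
    rw [Prod.norm_def]; simp
  have h1 := hF.norm_s_sub n x (h x.2, x.2)
  rw [hxy] at h1
  have h2 : ‖F.u n (h x.2, x.2) - F.u n x‖ ≤ c * ‖x.1 - h x.2‖ := by
    have : F.u n (h x.2, x.2) - F.u n x = F.gu n (h x.2, x.2) - F.gu n x := by
      simp [Sys.u]
    rw [this, ← hxy, norm_sub_rev x]
    exact (hF.gu n).lipschitz _ _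
  have h3 := hh'.c11.lipschitz (F.u n (h x.2, x.2)) (F.u n x)
  rw [hinv] at h3
  calc ‖F.s n x - h' (F.u n x)‖
      = ‖(F.s n x - F.s n (h x.2, x.2)) + (F.s n (h x.2, x.2) - h' (F.u n x))‖ := by
        congr 1; abel
    _ ≤ (b * ‖x.1 - h x.2‖ + c * ‖x.1 - h x.2‖) + δ * (c * ‖x.1 - h x.2‖) :=
        (norm_add_le _ _).trans (add_le_add h1 (h3.trans (by gcongr)))
    _ = _ := by ring

variable [FiniteDimensional ℝ U]

/-- The base map of a graph is a diffeomorphism. -/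
theorem IsGraph.exists_base {F : Sys S U} {b a c L δ Λ : ℝ} (hF : F.Good b a c L)
    (hc : GraphCond b a c L δ Λ) {h : U → S} (hh : IsGraph h δ Λ) (n : ℤ) :
    C11 (fun u => F.gu n (h u, u)) c (L + c * Λ) ∧
    ∃ e : U ≃ U, (∀ u, e u = F.u n (h u, u)) ∧ e.symm 0 = 0 ∧
      C11 e.symm (a - c)⁻¹ ((L + c * Λ) * (a - c)⁻¹ ^ 3) ∧ ∀ u, ‖u‖ ≤ ‖F.u n (h u, u)‖ := by
  have hc0 := hF.c0
  have hL := hF.L0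
  have hΛ : 0 ≤ Λ := by
    rw [hc.hΛ]
    exact div_nonneg (by linarith) (by linarith [hc.hb])
  have hg : C11 (fun u => F.gu n (h u, u)) c (L + c * Λ) :=
    ((hF.gu n).comp (hh.section_c11 hc.δ1 hΛ) hF.L0).mono (by simp) (by simp)
  have hw : C11 (fun u => F.u n (h u, u)) (‖(F.B n : U →L[ℝ] U)‖ + c) (0 + (L + c * Λ)) :=
    (C11.clm (F.B n : U →L[ℝ] U)).add hg
  rw [zero_add] at hw
  have hz : F.u n (h 0, 0) = 0 := by
    rw [hh.zero]; exact hF.u_zero n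
  have hexp : ∀ u v, (a - c) * ‖u - v‖ ≤ ‖F.u n (h u, u) - F.u n (h v, v)‖ := by
    intro u v
    have := hF.norm_u_sub n (h u, u) (h v, v)
    rw [hh.norm_section_sub hc.δ1] at this
    simp only at this
    linarith
  have hac : 0 < a - c := by linarith [hc.hac]
  obtain ⟨e, he, hes, -⟩ := hw.exists_inverse (by positivity) hac hz hexp
  refine ⟨hg, e, he, ?_, hes, fun u => ?_⟩
  · rw [Equiv.symm_apply_eq, he, hz]
  · have := hexp u 0
    rw [hz, sub_zero, sub_zero] at this
    nlinarith [norm_nonneg u, hc.hac]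

theorem IsGraph.step {F : Sys S U} {b a c L δ Λ : ℝ} (hF : F.Good b a c L)
    (hc : GraphCond b a c L δ Λ) {h : U → S} (hh : IsGraph h δ Λ) (n : ℤ) :
    ∃ h' : U → S, IsGraph h' δ Λ ∧ ∀ u, h' (F.u n (h u, u)) = F.s n (h u, u) := by
  have hc0 := hF.c0
  have hL := hF.L0
  have hb0 := hF.b0
  obtain ⟨δ0, δ1, hac, hδ, hb, hbc, hbc2, hΛe⟩ := hc
  have hc : GraphCond b a c L δ Λ := ⟨δ0, δ1, hac, hδ, hb, hbc, hbc2, hΛe⟩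
  have hΛ : 0 ≤ Λ := by
    rw [hΛe]
    exact div_nonneg (by linarith) (by linarith)
  have hΛe' : Λ * (1 - b) = 4 * L := by
    rw [hΛe, div_mul_cancel₀]; linarith
  obtain ⟨-, e, he, hez, hes, -⟩ := hh.exists_base hF hc n
  have hA : C11 (fun s => F.A n s) b 0 := C11.clm_of_le (F.A n : S →L[ℝ] S) hb0 (hF.hA n)
  have hs : C11 (fun u => F.s n (h u, u)) (b * δ + c) (b * Λ + (L + c * Λ)) := by
    refine ((hA.comp hh.c11 le_rfl).add
      ((hF.gs n).comp (hh.section_c11 δ1 hΛ) hL)).mono ?_ ?_ <;> simp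
  have hK1 : (a - c)⁻¹ ≤ 1 := inv_le_one_of_one_le₀ hac
  have hK0 : 0 ≤ (a - c)⁻¹ := by positivity
  refine ⟨fun u => F.s n (h (e.symm u), e.symm u), ⟨?_, ?_, ?_⟩, fun u => ?_⟩
  · refine (hs.comp hes (by positivity)).mono ?_ ?_
    · rw [mul_inv_le_iff₀ (by linarith)]
      linarith
    · have hK2 : (a - c)⁻¹ ^ 2 ≤ 1 := pow_le_one₀ hK0 hK1
      have hK3 : (a - c)⁻¹ ^ 3 ≤ 1 := pow_le_one₀ hK0 hK1
      calc (b * Λ + (L + c * Λ)) * (a - c)⁻¹ ^ 2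
            + (b * δ + c) * ((L + c * Λ) * (a - c)⁻¹ ^ 3)
          ≤ (b * Λ + (L + c * Λ)) * 1 + (b * 1 + c) * ((L + c * Λ) * 1) := by gcongr
        _ = (b + c) * (1 + c) * Λ + L * (1 + b + c) := by ring
        _ ≤ (1 + b) / 2 * Λ + L * 2 := by
            gcongr
            linarith
        _ = Λ := by linarith
  · rw [hez, hh.zero]; exact hF.s_zero n
  · have h2 : HasFDerivAt (fun u => F.s n (h u, u)) (0 : U →L[ℝ] S) 0 := by
      have hσ0 : (fun u => (h u, u)) (0 : U) = 0 := by simp [hh.zero]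
      have h1 : HasFDerivAt (fun u => (h u, u))
          ((fderiv ℝ h 0).prod (ContinuousLinearMap.id ℝ U)) (0 : U) :=
        (hh.c11.hasFDerivAt 0).prodMk (hasFDerivAt_id 0)
      set σ : U → S × U := fun u => (h u, u) with hσ
      have h3 : HasFDerivAt (F.gs n) (fderiv ℝ (F.gs n) 0) (σ 0) := by
        rw [hσ0]; exact (hF.gs n).hasFDerivAt 0
      have h4 := ((F.A n : S →L[ℝ] S).hasFDerivAt.comp (0 : U) (hh.c11.hasFDerivAt 0)).add
        (h3.comp (0 : U) h1)
      rw [hh.dzero, hF.dgs0, ContinuousLinearMap.comp_zero, ContinuousLinearMap.zero_comp,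
        add_zero] at h4
      exact h4
    have h5 := (hs.contDiff.differentiable one_ne_zero (e.symm 0)).hasFDerivAt
    have h6 := h5.comp (0 : U) (hes.hasFDerivAt 0)
    have h7 := h6.fderiv
    rw [hez, h2.fderiv, ContinuousLinearMap.zero_comp] at h7
    exact h7
  · simp only
    rw [← he, e.symm_apply_apply]

theorem exists_invariant_graph [CompleteSpace S] {F : Sys S U} {b a c L δ Λ : ℝ}
    (hF : F.Good b a c L) (hc : GraphCond b a c L δ Λ) :
    ∃ h : ℤ → U → S, (∀ n, IsGraph (h n) δ Λ) ∧
      ∀ n u, h (n + 1) (F.u n (h n u, u)) = F.s n (h n u, u) := by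
  have hc0 := hF.c0
  have hb0 := hF.b0
  have hL := hF.L0
  have hδ0 := hc.δ0
  have hΛ : 0 ≤ Λ := by
    rw [hc.hΛ]
    exact div_nonneg (by linarith) (by linarith [hc.hb])
  have h0 : IsGraph (fun _ : U => (0 : S)) δ Λ :=
    ⟨C11.zero hc.δ0.le hΛ, rfl, by simp⟩
  choose T hT1 hT2 using fun (n : ℤ) (h : {h : U → S // IsGraph h δ Λ}) => h.2.step hF hc n
  let H : ℕ → ℤ → {h : U → S // IsGraph h δ Λ} := fun j => Nat.rec (fun _ => ⟨_, h0⟩)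
    (fun _ Hj n => ⟨T (n - 1) (Hj (n - 1)), hT1 _ _⟩) j
  have hH0 : ∀ n u, (H 0 n).1 u = 0 := fun _ _ => rfl
  have hHs : ∀ j n u, (H (j + 1) (n + 1)).1 (F.u n ((H j n).1 u, u)) = F.s n ((H j n).1 u, u) := by
    intro j n u
    have : (H (j + 1) (n + 1)).1 = T n (H j n) := by
      change T (n + 1 - 1) (H j (n + 1 - 1)) = _
      rw [add_sub_cancel_right]
    rw [this]
    exact hT2 n (H j n) u
  set θ := b + c + δ * c with hθ
  have hθ0 : 0 ≤ θ := by positivity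
  have hθ1 : θ < 1 := by nlinarith [hc.hbc2, hc.δ1]
  have hdiff : ∀ j n u, ‖(H (j + 1) n).1 u - (H j n).1 u‖ ≤ θ ^ j * δ * ‖u‖ := by
    intro j
    induction j with
    | zero =>
      intro n u
      rw [hH0, sub_zero, pow_zero, one_mul]
      exact (H 1 n).2.c11.norm_le (H 1 n).2.zero u
    | succ j ih =>
      intro n y
      obtain ⟨n, rfl⟩ : ∃ m, n = m + 1 := ⟨n - 1, by ring⟩
      obtain ⟨-, e, he, -, -, hle⟩ := (H (j + 1) n).2.exists_base hF hc n
      obtain ⟨u, rfl⟩ := e.surjective y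
      rw [he, hHs (j + 1)]
      refine ((H (j + 1) (n + 1)).2.attract hF hc.δ0.le (hHs j n) _).trans ?_
      calc θ * ‖(H (j + 1) n).1 u - (H j n).1 u‖ ≤ θ * (θ ^ j * δ * ‖u‖) := by
            gcongr; exact ih n u
        _ = θ ^ (j + 1) * δ * ‖u‖ := by ring
        _ ≤ _ := by gcongr; exact hle u
  have hcau : ∀ n u, CauchySeq (fun j => (H j n).1 u) := fun n u =>
    cauchySeq_of_le_geometric θ (δ * ‖u‖) hθ1 fun j => by
      rw [dist_comm, dist_eq_norm]
      refine (hdiff j n u).trans (le_of_eq (by ring))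
  choose h hlim using fun n u => cauchySeq_tendsto_of_complete (hcau n u)
  have hC := fun n => C11.of_tendsto hΛ (fun j => (H j n).2.c11) (hlim n)
  refine ⟨h, fun n => ⟨(hC n).1, ?_, ?_⟩, fun n u => ?_⟩
  · refine tendsto_nhds_unique (hlim n 0) ?_
    simp only [(H _ n).2.zero]
    exact tendsto_const_nhds
  · ext v
    refine tendsto_nhds_unique ((hC n).2 0 v) ?_
    simp only [(H _ n).2.dzero]
    exact tendsto_const_nhds
  · have hx : Tendsto (fun j => ((H j n).1 u, u)) atTop (𝓝 (h n u, u)) :=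
      (hlim n u).prodMk_nhds tendsto_const_nhds
    have hgs := ((hF.gs n).contDiff.continuous.tendsto (h n u, u)).comp hx
    have hgu := ((hF.gu n).contDiff.continuous.tendsto (h n u, u)).comp hx
    have hs : Tendsto (fun j => F.s n ((H j n).1 u, u)) atTop (𝓝 (F.s n (h n u, u))) :=
      (((F.A n).continuous.tendsto _).comp (hlim n u)).add hgs
    have hu : Tendsto (fun j => F.u n ((H j n).1 u, u)) atTop (𝓝 (F.u n (h n u, u))) :=
      tendsto_const_nhds.add hgu
    refine tendsto_nhds_unique ?_ hs
    have h1 := (hlim (n + 1) (F.u n (h n u, u))).comp (tendsto_add_atTop_nat 1)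
    have h2 : Tendsto (fun j => (H (j + 1) (n + 1)).1 (F.u n ((H j n).1 u, u))
        - (H (j + 1) (n + 1)).1 (F.u n (h n u, u))) atTop (𝓝 0) := by
      have h3 := ((hu.sub_const (F.u n (h n u, u))).norm.const_mul δ)
      rw [sub_self, norm_zero, mul_zero] at h3
      exact squeeze_zero_norm (fun j => (H (j + 1) (n + 1)).2.c11.lipschitz _ _) h3
    have h4 := h1.add h2
    rw [add_zero] at h4
    refine h4.congr fun j => ?_
    simp only [Function.comp]
    rw [add_sub_cancel, hHs]

end Graph

section Foliation

variable {S U : Type*} [NormedAddCommGroup S] [NormedSpace ℝ S]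
  [NormedAddCommGroup U] [NormedSpace ℝ U]

/-- A system leaving `{0} × U` invariant, contracting in the first variable. -/
structure Flat (Sf : ℤ → S × U → S) (Uf : ℤ → S × U → U) (G : ℤ → U → U)
    (b β a c L LG : ℝ) : Prop where
  cS : ∀ n, ContDiff ℝ 1 (Sf n)
  cU : ∀ n, ContDiff ℝ 1 (Uf n)
  S0 : ∀ n u, Sf n (0, u) = 0
  U0 : ∀ n, Uf n 0 = 0
  dS : ∀ n x ξ η, ‖fderiv ℝ (Sf n) x (ξ, η)‖ ≤ b * ‖ξ‖ + L * ‖x.1‖ * ‖η‖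
  dU : ∀ n x ξ η, ‖fderiv ℝ (Uf n) x (ξ, η)‖ ≤ c * ‖ξ‖ + β * ‖η‖
  dU2 : ∀ n s u η, ‖fderiv ℝ (Uf n) (s, u) (0, η) - fderiv ℝ (Uf n) (0, u) (0, η)‖
    ≤ L * ‖s‖ * ‖η‖
  cG : ∀ n, C11 (G n) (1 / a) LG
  GU : ∀ n u, G n (Uf n (0, u)) = u
  UG : ∀ n u, Uf n (0, G n u) = u
  b0 : 0 ≤ b
  b1 : b < 1
  β0 : 0 ≤ β
  a0 : 0 < a
  c0 : 0 ≤ c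
  L0 : 0 ≤ L
  LG0 : 0 ≤ LG
  hba : b < a
  hbβ : b * β < a

variable {Sf : ℤ → S × U → S} {Uf : ℤ → S × U → U} {G : ℤ → U → U} {b β a c L LG : ℝ}

theorem Flat.norm_S_le (h : Flat Sf Uf G b β a c L LG) (n : ℤ) (x : S × U) :
    ‖Sf n x‖ ≤ b * ‖x.1‖ := by
  have hd : ∀ s, HasFDerivAt (fun s => Sf n (s, x.2))
      ((fderiv ℝ (Sf n) (s, x.2)).comp ((ContinuousLinearMap.id ℝ S).prod 0)) s := fun s =>
    (hasFDerivAt_of_contDiff (h.cS n) (s, x.2)).comp s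
      ((hasFDerivAt_id s).prodMk (hasFDerivAt_const x.2 s))
  have := convex_univ.norm_image_sub_le_of_norm_hasFDerivWithin_le (𝕜 := ℝ) (C := b)
    (fun s _ => (hd s).hasFDerivWithinAt) (fun s _ => ?_) (Set.mem_univ (0 : S))
    (Set.mem_univ x.1)
  · simpa [h.S0] using this
  · refine ContinuousLinearMap.opNorm_le_bound _ h.b0 fun ξ => ?_
    simpa using h.dS n (s, x.2) ξ 0

theorem Flat.norm_U_sub_le (h : Flat Sf Uf G b β a c L LG) (n : ℤ) (s : S) (u : U) :
    ‖Uf n (s, u) - Uf n (0, u)‖ ≤ c * ‖s‖ := by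
  have hd : ∀ s, HasFDerivAt (fun s => Uf n (s, u))
      ((fderiv ℝ (Uf n) (s, u)).comp ((ContinuousLinearMap.id ℝ S).prod 0)) s := fun s =>
    (hasFDerivAt_of_contDiff (h.cU n) (s, u)).comp s
      ((hasFDerivAt_id s).prodMk (hasFDerivAt_const u s))
  have := convex_univ.norm_image_sub_le_of_norm_hasFDerivWithin_le (𝕜 := ℝ) (C := c)
    (fun s _ => (hd s).hasFDerivWithinAt) (fun s _ => ?_) (Set.mem_univ (0 : S))
    (Set.mem_univ s)
  · simpa using this
  · refine ContinuousLinearMap.opNorm_le_bound _ h.c0 fun ξ => ?_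
    simpa using h.dU n (s, u) ξ 0

/-- Backward iterates of the projection onto the second factor. -/
def flatIter (Sf : ℤ → S × U → S) (Uf : ℤ → S × U → U) (G : ℤ → U → U) :
    ℕ → ℤ → S × U → U
  | 0 => fun _ x => x.2
  | j + 1 => fun n x => G n (flatIter Sf Uf G j (n + 1) (Sf n x, Uf n x))

theorem Flat.iter_contDiff (h : Flat Sf Uf G b β a c L LG) (j : ℕ) (n : ℤ) :
    ContDiff ℝ 1 (flatIter Sf Uf G j n) := by
  induction j generalizing n with
  | zero => exact contDiff_snd
  | succ j ih => exact (h.cG n).contDiff.comp ((ih (n + 1)).comp ((h.cS n).prodMk (h.cU n)))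

theorem Flat.iter_fderiv (h : Flat Sf Uf G b β a c L LG) (j : ℕ) (n : ℤ) (x v : S × U) :
    fderiv ℝ (flatIter Sf Uf G (j + 1) n) x v
      = fderiv ℝ (G n) (flatIter Sf Uf G j (n + 1) (Sf n x, Uf n x))
        (fderiv ℝ (flatIter Sf Uf G j (n + 1)) (Sf n x, Uf n x)
          (fderiv ℝ (Sf n) x v, fderiv ℝ (Uf n) x v)) := by
  have h1 : HasFDerivAt (fun x => (Sf n x, Uf n x))
      ((fderiv ℝ (Sf n) x).prod (fderiv ℝ (Uf n) x)) x :=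
    (hasFDerivAt_of_contDiff (h.cS n) x).prodMk (hasFDerivAt_of_contDiff (h.cU n) x)
  have h2 := (hasFDerivAt_of_contDiff (h.iter_contDiff j (n + 1)) (Sf n x, Uf n x)).comp x h1
  have h3 := ((h.cG n).hasFDerivAt (flatIter Sf Uf G j (n + 1) (Sf n x, Uf n x))).comp x h2
  have h4 : fderiv ℝ (flatIter Sf Uf G (j + 1) n) x = _ := h3.fderiv
  rw [h4]
  rfl

theorem Flat.iter_diff (h : Flat Sf Uf G b β a c L LG) (j : ℕ) (n : ℤ) (x : S × U) :
    ‖flatIter Sf Uf G (j + 1) n x - flatIter Sf Uf G j n x‖ ≤ c / a * (b / a) ^ j * ‖x.1‖ := by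
  have ha := h.a0
  have hb := h.b0
  have hc := h.c0
  induction j generalizing n x with
  | zero =>
    have : flatIter Sf Uf G (0 + 1) n x - flatIter Sf Uf G 0 n x
        = G n (Uf n (x.1, x.2)) - G n (Uf n (0, x.2)) := by
      rw [h.GU]; rfl
    rw [this, pow_zero, mul_one]
    refine ((h.cG n).lipschitz _ _).trans ?_
    calc 1 / a * ‖Uf n (x.1, x.2) - Uf n (0, x.2)‖ ≤ 1 / a * (c * ‖x.1‖) := by
          gcongr; exact h.norm_U_sub_le n _ _
      _ = _ := by ring
  | succ j ih =>
    refine ((h.cG n).lipschitz _ _).trans ?_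
    calc _ ≤ 1 / a * (c / a * (b / a) ^ j * (b * ‖x.1‖)) := by
          gcongr
          refine (ih (n + 1) (Sf n x, Uf n x)).trans ?_
          gcongr
          exact h.norm_S_le n x
      _ = _ := by rw [pow_succ]; ring

theorem geom_sum_bound {μ : ℝ} (h0 : 0 ≤ μ) (h1 : μ < 1) (j : ℕ) :
    ∑ i ∈ Finset.range j, μ ^ i ≤ 1 / (1 - μ) := by
  rw [geom_sum_eq h1.ne, ← neg_div_neg_eq, neg_sub, neg_sub]
  have : 0 ≤ μ ^ j := pow_nonneg h0 j
  have : 0 < 1 - μ := by linarith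
  gcongr
  linarith

set_option maxHeartbeats 2000000 in
/-- Derivative estimates for the iterates on a strip. -/
theorem Flat.exists_strip (h : Flat Sf Uf G b β a c L LG)
    (hsmall : 16 * c ≤ a - max b (b * β)) :
    ∃ R μ κ : ℝ, 0 < R ∧ 0 ≤ μ ∧ μ < 1 ∧ 0 ≤ κ ∧ κ / (1 - μ) ≤ 1 / 4 ∧
      ∀ j n x, ‖x.1‖ ≤ R →
        ‖fderiv ℝ (flatIter Sf Uf G (j + 1) n) x - fderiv ℝ (flatIter Sf Uf G j n) x‖
          ≤ κ * μ ^ j := by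
  obtain ⟨b0, b1, β0, a0, c0, L0, LG0, hba, hbβ⟩ :=
    (⟨h.b0, h.b1, h.β0, h.a0, h.c0, h.L0, h.LG0, h.hba, h.hbβ⟩ :
      0 ≤ b ∧ b < 1 ∧ 0 ≤ β ∧ 0 < a ∧ 0 ≤ c ∧ 0 ≤ L ∧ 0 ≤ LG ∧ b < a ∧ b * β < a)
  set μ0 := max b (b * β) / a with hμ0
  have hμ00 : 0 ≤ μ0 := div_nonneg (le_max_of_le_left b0) a0.le
  have hμ01 : μ0 < 1 := by
    rw [hμ0, div_lt_one a0]; exact max_lt hba hbβ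
  have hb1 : b / a ≤ μ0 := by rw [hμ0]; gcongr; exact le_max_left _ _
  have hb2 : b * β / a ≤ μ0 := by rw [hμ0]; gcongr; exact le_max_right _ _
  set μ := (1 + μ0) / 2 with hμ
  set σ := (1 - μ0) / 2 with hσ
  have hσμ : μ = μ0 + σ := by rw [hμ, hσ]; ring
  have hσ0 : 0 < σ := by rw [hσ]; linarith
  have h1μ : 1 - μ = σ := by rw [hμ, hσ]; ring
  set κ1 := σ / 8 with hκ1
  have hκ10 : 0 < κ1 := by positivity
  have hcκ : c / a ≤ κ1 := by
    have : 16 * (c / a) ≤ 1 - μ0 := by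
      rw [hμ0]
      have := div_le_div_of_nonneg_right hsmall a0.le
      rw [sub_div, div_self a0.ne'] at this
      linarith [mul_div_assoc 16 c a]
    rw [hκ1, hσ]; linarith
  set C2 := LG * (c / a) * b * 2 * (b + L + c + β) with hC2
  have hC20 : 0 ≤ C2 := by positivity
  set κ2 := (κ1 * L / a + C2) / σ + (LG * c * β + L / a) with hκ2
  have hκ20 : 0 ≤ κ2 := by positivity
  have hκ2a : κ1 * L / a + C2 ≤ σ * κ2 := by
    rw [hκ2, mul_add, mul_div_cancel₀ _ hσ0.ne']
    have : 0 ≤ σ * (LG * c * β + L / a) := by positivity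
    linarith
  have hκ2b : LG * c * β + L / a ≤ κ2 := by
    rw [hκ2]
    have : 0 ≤ (κ1 * L / a + C2) / σ := by positivity
    linarith
  obtain ⟨R, hR0, hR1, hR2, hR3⟩ : ∃ R : ℝ, 0 < R ∧ R ≤ 1 ∧ κ2 * R ≤ κ1 ∧
      κ2 * b * R * c / a + C2 * R ≤ σ * κ1 := by
    set D := κ2 * b * c / a + C2 with hD
    have hD0 : 0 ≤ D := by positivity
    refine ⟨min 1 (min (κ1 / (κ2 + 1)) (σ * κ1 / (D + 1))), by positivity, min_le_left _ _, ?_, ?_⟩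
    · set R := min 1 (min (κ1 / (κ2 + 1)) (σ * κ1 / (D + 1)))
      have h1 : R ≤ κ1 / (κ2 + 1) := (min_le_right _ _).trans (min_le_left _ _)
      have h0 : 0 < R := by positivity
      rw [le_div_iff₀ (by positivity)] at h1
      nlinarith
    · set R := min 1 (min (κ1 / (κ2 + 1)) (σ * κ1 / (D + 1)))
      have h1 : R ≤ σ * κ1 / (D + 1) := (min_le_right _ _).trans (min_le_right _ _)
      have h0 : 0 < R := by positivity
      rw [le_div_iff₀ (by positivity)] at h1
      have : κ2 * b * R * c / a + C2 * R = D * R := by rw [hD]; ring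
      rw [this]
      nlinarith
  have hμ00' : 0 ≤ μ := by rw [hσμ]; positivity
  have hκs : (κ1 + κ2 * R) / (1 - μ) ≤ 1 / 4 := by
    rw [h1μ, div_le_iff₀ hσ0]
    linarith
  refine ⟨R, μ, κ1 + κ2 * R, hR0, hμ00', by linarith, by positivity, hκs, ?_⟩
  have hbμ : b / a ≤ μ := by linarith
  clear_value μ0 μ σ κ1 κ2 C2
  have key : ∀ j n x, ‖x.1‖ ≤ R → ∀ ξ η,
      ‖fderiv ℝ (flatIter Sf Uf G (j + 1) n) x (ξ, η)
        - fderiv ℝ (flatIter Sf Uf G j n) x (ξ, η)‖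
        ≤ μ ^ j * (κ1 * ‖ξ‖ + κ2 * ‖x.1‖ * ‖η‖) := by
    intro j
    induction j using Nat.strong_induction_on with
    | _ j ih =>
    intro n x hx ξ η
    rcases j with _ | j
    · rw [h.iter_fderiv]
      have e0 : ∀ m y, fderiv ℝ (flatIter Sf Uf G 0 m) y = ContinuousLinearMap.snd ℝ S U :=
        fun m y => (ContinuousLinearMap.snd ℝ S U).fderiv
      rw [e0, e0]
      obtain ⟨s, u⟩ := x
      have hid : fderiv ℝ (G n) (Uf n (0, u)) (fderiv ℝ (Uf n) (0, u) (0, η)) = η := by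
        have h1 : HasFDerivAt (fun u => Uf n (0, u))
            ((fderiv ℝ (Uf n) (0, u)).comp
              ((0 : U →L[ℝ] S).prod (ContinuousLinearMap.id ℝ U))) u :=
          (hasFDerivAt_of_contDiff (h.cU n) (0, u)).comp u
            ((hasFDerivAt_const (0 : S) u).prodMk (hasFDerivAt_id u))
        have h2 := ((h.cG n).hasFDerivAt (Uf n (0, u))).comp u h1
        have h3 : G n ∘ (fun u => Uf n (0, u)) = fun u => u := funext fun u => h.GU n u
        rw [h3] at h2
        have h4 := h2.unique (hasFDerivAt_id u)
        simpa using congrArg (fun T => T η) h4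
      have hsplit : fderiv ℝ (Uf n) (s, u) (ξ, η)
          = fderiv ℝ (Uf n) (s, u) (ξ, 0) + fderiv ℝ (Uf n) (s, u) (0, η) := by
        rw [← map_add]; simp
      have e : fderiv ℝ (G n) (Uf n (s, u)) (fderiv ℝ (Uf n) (s, u) (ξ, η)) - η
          = fderiv ℝ (G n) (Uf n (s, u)) (fderiv ℝ (Uf n) (s, u) (ξ, 0))
            + (fderiv ℝ (G n) (Uf n (s, u)) - fderiv ℝ (G n) (Uf n (0, u)))
              (fderiv ℝ (Uf n) (s, u) (0, η))
            + fderiv ℝ (G n) (Uf n (0, u))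
              (fderiv ℝ (Uf n) (s, u) (0, η) - fderiv ℝ (Uf n) (0, u) (0, η)) := by
        rw [hsplit, map_add, map_sub, hid, sub_apply]; abel
      change ‖fderiv ℝ (G n) (Uf n (s, u)) (fderiv ℝ (Uf n) (s, u) (ξ, η)) - η‖ ≤ _
      rw [e, pow_zero, one_mul]
      have t1 : ‖fderiv ℝ (G n) (Uf n (s, u)) (fderiv ℝ (Uf n) (s, u) (ξ, 0))‖
          ≤ 1 / a * (c * ‖ξ‖) := by
        refine ContinuousLinearMap.le_of_opNorm_le_of_le _ ((h.cG n).bound _) ?_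
        simpa using h.dU n (s, u) ξ 0
      have t2 : ‖(fderiv ℝ (G n) (Uf n (s, u)) - fderiv ℝ (G n) (Uf n (0, u)))
              (fderiv ℝ (Uf n) (s, u) (0, η))‖ ≤ LG * (c * ‖s‖) * (β * ‖η‖) := by
        refine ContinuousLinearMap.le_of_opNorm_le_of_le _ ?_ ?_
        · exact ((h.cG n).lip _ _).trans (by gcongr; exact h.norm_U_sub_le n s u)
        · simpa using h.dU n (s, u) 0 η
      have t3 : ‖fderiv ℝ (G n) (Uf n (0, u))
              (fderiv ℝ (Uf n) (s, u) (0, η) - fderiv ℝ (Uf n) (0, u) (0, η))‖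
          ≤ 1 / a * (L * ‖s‖ * ‖η‖) :=
        ContinuousLinearMap.le_of_opNorm_le_of_le _ ((h.cG n).bound _) (h.dU2 n s u η)
      refine (norm_add₃_le.trans (add_le_add (add_le_add t1 t2) t3)).trans ?_
      calc 1 / a * (c * ‖ξ‖) + LG * (c * ‖s‖) * (β * ‖η‖) + 1 / a * (L * ‖s‖ * ‖η‖)
          = c / a * ‖ξ‖ + (LG * c * β + L / a) * ‖s‖ * ‖η‖ := by ring
        _ ≤ _ := by gcongr
    · rw [h.iter_fderiv (j + 1) n x (ξ, η), h.iter_fderiv j n x (ξ, η)]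
      set y : S × U := (Sf n x, Uf n x) with hy
      set ξ' := fderiv ℝ (Sf n) x (ξ, η)
      set η' := fderiv ℝ (Uf n) x (ξ, η)
      set p1 := flatIter Sf Uf G (j + 1) (n + 1)
      set p0 := flatIter Sf Uf G j (n + 1) with hp0
      have hξ' : ‖ξ'‖ ≤ b * ‖ξ‖ + L * ‖x.1‖ * ‖η‖ := h.dS n x ξ η
      have hη' : ‖η'‖ ≤ c * ‖ξ‖ + β * ‖η‖ := h.dU n x ξ η
      have hy1 : ‖y.1‖ ≤ b * ‖x.1‖ := h.norm_S_le n x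
      have hyR : ‖y.1‖ ≤ R := by nlinarith [norm_nonneg x.1]
      have hDp : ‖fderiv ℝ p0 y (ξ', η')‖ ≤ 2 * (‖ξ'‖ + ‖η'‖) := by
        have hsum : fderiv ℝ p0 y (ξ', η') = η' + ∑ i ∈ Finset.range j,
            (fderiv ℝ (flatIter Sf Uf G (i + 1) (n + 1)) y (ξ', η')
              - fderiv ℝ (flatIter Sf Uf G i (n + 1)) y (ξ', η')) := by
          rw [Finset.sum_range_sub (fun i => fderiv ℝ (flatIter Sf Uf G i (n + 1)) y (ξ', η'))]
          have : fderiv ℝ (flatIter Sf Uf G 0 (n + 1)) y = ContinuousLinearMap.snd ℝ S U :=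
            (ContinuousLinearMap.snd ℝ S U).fderiv
          rw [this]
          simp [hp0]
        rw [hsum]
        have hs : ‖∑ i ∈ Finset.range j,
            (fderiv ℝ (flatIter Sf Uf G (i + 1) (n + 1)) y (ξ', η')
              - fderiv ℝ (flatIter Sf Uf G i (n + 1)) y (ξ', η'))‖
            ≤ (∑ i ∈ Finset.range j, μ ^ i) * ((κ1 + κ2 * R) * (‖ξ'‖ + ‖η'‖)) := by
          rw [Finset.sum_mul]
          refine norm_sum_le_of_le _ fun i hi => ?_
          refine (ih i (by have := Finset.mem_range.1 hi; omega) (n + 1) y hyR ξ' η').trans ?_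
          gcongr
          have : κ2 * ‖y.1‖ ≤ κ2 * R := by gcongr
          have h1 : 0 ≤ κ2 * R := by positivity
          nlinarith [norm_nonneg ξ', norm_nonneg η']
        have hg := geom_sum_bound hμ00' (by linarith : μ < 1) j
        have h4 : (∑ i ∈ Finset.range j, μ ^ i) * ((κ1 + κ2 * R) * (‖ξ'‖ + ‖η'‖))
            ≤ 1 / 4 * (‖ξ'‖ + ‖η'‖) := by
          calc _ ≤ 1 / (1 - μ) * ((κ1 + κ2 * R) * (‖ξ'‖ + ‖η'‖)) := by gcongr
            _ = (κ1 + κ2 * R) / (1 - μ) * (‖ξ'‖ + ‖η'‖) := by ring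
            _ ≤ _ := by gcongr
        have := norm_add_le η' (∑ i ∈ Finset.range j,
            (fderiv ℝ (flatIter Sf Uf G (i + 1) (n + 1)) y (ξ', η')
              - fderiv ℝ (flatIter Sf Uf G i (n + 1)) y (ξ', η')))
        linarith [norm_nonneg ξ', norm_nonneg η']
      have e : fderiv ℝ (G n) (p1 y) (fderiv ℝ p1 y (ξ', η'))
            - fderiv ℝ (G n) (p0 y) (fderiv ℝ p0 y (ξ', η'))
          = fderiv ℝ (G n) (p1 y) (fderiv ℝ p1 y (ξ', η') - fderiv ℝ p0 y (ξ', η'))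
            + (fderiv ℝ (G n) (p1 y) - fderiv ℝ (G n) (p0 y)) (fderiv ℝ p0 y (ξ', η')) := by
        rw [map_sub, sub_apply]; abel
      rw [e]
      have t1 : ‖fderiv ℝ (G n) (p1 y) (fderiv ℝ p1 y (ξ', η') - fderiv ℝ p0 y (ξ', η'))‖
          ≤ 1 / a * (μ ^ j * (κ1 * (b * ‖ξ‖ + L * ‖x.1‖ * ‖η‖)
            + κ2 * (b * ‖x.1‖) * (c * ‖ξ‖ + β * ‖η‖))) := by
        refine ContinuousLinearMap.le_of_opNorm_le_of_le _ ((h.cG n).bound _) ?_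
        refine (ih j (by omega) (n + 1) y hyR ξ' η').trans ?_
        gcongr
      have t2 : ‖(fderiv ℝ (G n) (p1 y) - fderiv ℝ (G n) (p0 y)) (fderiv ℝ p0 y (ξ', η'))‖
          ≤ LG * (c / a * μ ^ j * (b * ‖x.1‖))
            * (2 * ((b * ‖ξ‖ + L * ‖x.1‖ * ‖η‖) + (c * ‖ξ‖ + β * ‖η‖))) := by
        refine ContinuousLinearMap.le_of_opNorm_le_of_le _ ?_ (hDp.trans (by gcongr))
        refine ((h.cG n).lip _ _).trans ?_
        gcongr
        refine (h.iter_diff j (n + 1) y).trans ?_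
        gcongr
      refine (norm_add_le _ _).trans ((add_le_add t1 t2).trans ?_)
      have hx1 : ‖x.1‖ ≤ 1 := hx.trans hR1
      have hbβ0 : 0 ≤ b * β := by positivity
      obtain ⟨W, hW⟩ : ∃ W, W = b + L + c + β := ⟨_, rfl⟩
      have hW1 : b + c ≤ W := by linarith
      have hW2 : L * ‖x.1‖ + β ≤ W := by nlinarith
      have hW0 : 0 ≤ W := by linarith
      calc 1 / a * (μ ^ j * (κ1 * (b * ‖ξ‖ + L * ‖x.1‖ * ‖η‖)
            + κ2 * (b * ‖x.1‖) * (c * ‖ξ‖ + β * ‖η‖)))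
            + LG * (c / a * μ ^ j * (b * ‖x.1‖))
            * (2 * ((b * ‖ξ‖ + L * ‖x.1‖ * ‖η‖) + (c * ‖ξ‖ + β * ‖η‖)))
          = μ ^ j * ((κ1 * (b / a) + κ2 * b * ‖x.1‖ * c / a
                + LG * (c / a) * b * 2 * (b + c) * ‖x.1‖) * ‖ξ‖
              + (κ1 * L / a + κ2 * (b * β / a)
                + LG * (c / a) * b * 2 * (L * ‖x.1‖ + β)) * ‖x.1‖ * ‖η‖) := by ring
        _ ≤ μ ^ j * ((κ1 * μ0 + κ2 * b * R * c / a
                + LG * (c / a) * b * 2 * W * R) * ‖ξ‖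
              + (κ1 * L / a + κ2 * μ0
                + LG * (c / a) * b * 2 * W) * ‖x.1‖ * ‖η‖) := by
            gcongr
        _ ≤ μ ^ j * ((μ * κ1) * ‖ξ‖ + (μ * κ2) * ‖x.1‖ * ‖η‖) := by
            rw [hW, ← hC2, hσμ]
            gcongr
            · linarith
            · linarith
        _ = _ := by ring
  intro j n x hx
  refine ContinuousLinearMap.opNorm_le_bound _ (by positivity) fun v => ?_
  refine (key j n x hx v.1 v.2).trans ?_
  have h1 := norm_fst_le v
  have h2 := norm_snd_le v
  calc μ ^ j * (κ1 * ‖v.1‖ + κ2 * ‖x.1‖ * ‖v.2‖) ≤ μ ^ j * (κ1 * ‖v‖ + κ2 * R * ‖v‖) := by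
        gcongr
    _ = _ := by ring

/-- A flat system is semiconjugate to its restriction to `{0} × U` through a `C¹` projection. -/
theorem Flat.exists_projection [CompleteSpace U] (h : Flat Sf Uf G b β a c L LG)
    (hsmall : 16 * c ≤ a - max b (b * β)) :
    ∃ Q : ℤ → S × U → U, ∃ R : ℝ, 0 < R ∧ ∀ n, ContDiff ℝ 1 (Q n) ∧ (∀ u, Q n (0, u) = u) ∧
      (∀ x, Q (n + 1) (Sf n x, Uf n x) = Uf n (0, Q n x)) ∧
      (∀ x, ‖Q n x - x.2‖ ≤ c / (a - b) * ‖x.1‖) ∧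
      (∀ x, ‖x.1‖ < R → ‖fderiv ℝ (Q n) x - ContinuousLinearMap.snd ℝ S U‖ ≤ 1 / 4) := by
  obtain ⟨R, μ, κ, hR, hμ0, hμ1, hκ, hκμ, hstrip⟩ := h.exists_strip hsmall
  have a0 := h.a0
  have b0 := h.b0
  have hr1 : b / a < 1 := (div_lt_one a0).2 h.hba
  have hr0 : 0 ≤ b / a := by positivity
  have hdist : ∀ n x j, dist (flatIter Sf Uf G j n x) (flatIter Sf Uf G (j + 1) n x)
      ≤ c / a * ‖x.1‖ * (b / a) ^ j := fun n x j => by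
    rw [dist_comm, dist_eq_norm]
    exact (h.iter_diff j n x).trans (le_of_eq (by ring))
  choose Q hQ using fun n x => cauchySeq_tendsto_of_complete
    (cauchySeq_of_le_geometric (b / a) (c / a * ‖x.1‖) hr1 (hdist n x))
  have hrec : ∀ n x, Q n x = G n (Q (n + 1) (Sf n x, Uf n x)) := fun n x =>
    tendsto_nhds_unique ((hQ n x).comp (tendsto_add_atTop_nat 1))
      (((h.cG n).contDiff.continuous.tendsto _).comp (hQ (n + 1) (Sf n x, Uf n x)))
  have hopen : IsOpen {x : S × U | ‖x.1‖ < R} :=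
    isOpen_lt (continuous_norm.comp continuous_fst) continuous_const
  have hT5 := fun n => contDiff_limit_of_geometric (f := fun j => flatIter Sf Uf G j n)
    (g := Q n) hopen hμ0 hμ1 (fun j => h.iter_contDiff j n)
    (fun j x hx => hstrip j n x (le_of_lt hx)) (fun x _ => hQ n x)
  have hloc : ∀ m : ℕ, ∀ n x, ‖x.1‖ * b ^ m < R → ContDiffAt ℝ 1 (Q n) x := by
    intro m
    induction m with
    | zero =>
      intro n x hx
      rw [pow_zero, mul_one] at hx
      refine contDiffAt_one_iff.2 ⟨fderiv ℝ (Q n), {x : S × U | ‖x.1‖ < R}, hopen.mem_nhds hx,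
        (hT5 n).1, fun y hy => ((hT5 n).2 y hy).1⟩
    | succ m ih =>
      intro n x hx
      have h1 : ContDiffAt ℝ 1 (Q (n + 1)) (Sf n x, Uf n x) := by
        refine ih (n + 1) _ (lt_of_le_of_lt ?_ hx)
        calc ‖Sf n x‖ * b ^ m ≤ b * ‖x.1‖ * b ^ m := by gcongr; exact h.norm_S_le n x
          _ = _ := by ring
      have h2 : Q n = fun x => G n (Q (n + 1) (Sf n x, Uf n x)) := funext (hrec n)
      rw [h2]
      have h3 : ContDiffAt ℝ 1 (fun x => (Sf n x, Uf n x)) x :=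
        ((h.cS n).prodMk (h.cU n)).contDiffAt
      exact (h.cG n).contDiff.contDiffAt.comp x
        (ContDiffAt.comp (g := Q (n + 1)) (f := fun x => (Sf n x, Uf n x)) x h1 h3)
  refine ⟨Q, R, hR, fun n => ⟨?_, fun u => ?_, fun x => ?_, fun x => ?_, fun x hx => ?_⟩⟩
  · rw [contDiff_iff_contDiffAt]
    intro x
    obtain ⟨m, hm⟩ := exists_pow_lt_of_lt_one (show 0 < R / (‖x.1‖ + 1) by positivity) h.b1
    refine hloc m n x ?_
    rw [lt_div_iff₀ (by positivity)] at hm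
    have : 0 ≤ b ^ m := by positivity
    nlinarith
  · refine tendsto_nhds_unique (hQ n (0, u)) ?_
    have : ∀ j n u, flatIter Sf Uf G j n (0, u) = u := by
      intro j
      induction j with
      | zero => intro n u; rfl
      | succ j ih =>
        intro n u
        simp only [flatIter]
        rw [h.S0, ih, h.GU]
    simp only [this]
    exact tendsto_const_nhds
  · rw [hrec n x, h.UG]
  · have := dist_le_of_le_geometric_of_tendsto₀ (b / a) (c / a * ‖x.1‖) hr1 (hdist n x) (hQ n x)
    rw [dist_comm, dist_eq_norm] at this
    refine this.trans (le_of_eq ?_)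
    have : a - b ≠ 0 := by linarith [h.hba]
    field_simp
  · have h1 := (((hT5 n).2 x hx).2)
    have hd : ∀ j, dist (fderiv ℝ (flatIter Sf Uf G j n) x)
        (fderiv ℝ (flatIter Sf Uf G (j + 1) n) x) ≤ κ * μ ^ j := fun j => by
      rw [dist_comm, dist_eq_norm]
      exact hstrip j n x (le_of_lt hx)
    have := dist_le_of_le_geometric_of_tendsto₀ μ κ hμ1 hd h1
    rw [dist_comm, dist_eq_norm] at this
    have e : fderiv ℝ (flatIter Sf Uf G 0 n) x = ContinuousLinearMap.snd ℝ S U :=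
      (ContinuousLinearMap.snd ℝ S U).fderiv
    rw [e] at this
    exact this.trans hκμ

end Foliation

section Projection

variable {S U : Type*} [NormedAddCommGroup S] [NormedSpace ℝ S]
  [NormedAddCommGroup U] [NormedSpace ℝ U]

/-- The first component of the system in coordinates flattening the graphs `h`. -/
def Sys.flatS (F : Sys S U) (h : ℤ → U → S) (n : ℤ) (x : S × U) : S :=
  F.s n (x.1 + h n x.2, x.2) - h (n + 1) (F.u n (x.1 + h n x.2, x.2))

/-- The second component of the system in coordinates flattening the graphs `h`. -/
def Sys.flatU (F : Sys S U) (h : ℤ → U → S) (n : ℤ) (x : S × U) : U :=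
  F.u n (x.1 + h n x.2, x.2)

theorem hasFDerivAt_unflatten {h : U → S} {δ Λ : ℝ} (hh : IsGraph h δ Λ) (x : S × U) :
    HasFDerivAt (fun x : S × U => (x.1 + h x.2, x.2))
      ((ContinuousLinearMap.fst ℝ S U
        + (fderiv ℝ h x.2).comp (ContinuousLinearMap.snd ℝ S U)).prod
        (ContinuousLinearMap.snd ℝ S U)) x :=
  (hasFDerivAt_fst.add ((hh.c11.hasFDerivAt x.2).comp x hasFDerivAt_snd)).prodMk hasFDerivAt_snd

variable {F : Sys S U} {b a β c L δ Λ : ℝ} {h : ℤ → U → S}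

theorem Sys.Good.s_fderiv (hF : F.Good b a c L) (n : ℤ) (x : S × U) :
    HasFDerivAt (F.s n)
      ((F.A n : S →L[ℝ] S).comp (ContinuousLinearMap.fst ℝ S U) + fderiv ℝ (F.gs n) x) x :=
  ((F.A n : S →L[ℝ] S).hasFDerivAt.comp x hasFDerivAt_fst).add ((hF.gs n).hasFDerivAt x)

theorem Sys.Good.u_fderiv (hF : F.Good b a c L) (n : ℤ) (x : S × U) :
    HasFDerivAt (F.u n)
      ((F.B n : U →L[ℝ] U).comp (ContinuousLinearMap.snd ℝ S U) + fderiv ℝ (F.gu n) x) x :=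
  ((F.B n : U →L[ℝ] U).hasFDerivAt.comp x hasFDerivAt_snd).add ((hF.gu n).hasFDerivAt x)

theorem Sys.Good.flatU_fderiv (hF : F.Good b a c L) (hh : ∀ n, IsGraph (h n) δ Λ) (n : ℤ)
    (x : S × U) (ξ : S) (η : U) :
    fderiv ℝ (F.flatU h n) x (ξ, η) = F.B n η
      + fderiv ℝ (F.gu n) (x.1 + h n x.2, x.2) (ξ + fderiv ℝ (h n) x.2 η, η) := by
  have h1 := (hF.u_fderiv n (x.1 + h n x.2, x.2)).comp x (hasFDerivAt_unflatten (hh n) x)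
  have h2 : fderiv ℝ (F.flatU h n) x = _ := h1.fderiv
  rw [h2]; simp

theorem Sys.Good.flatS_fderiv (hF : F.Good b a c L) (hh : ∀ n, IsGraph (h n) δ Λ) (n : ℤ)
    (x : S × U) (ξ : S) (η : U) :
    fderiv ℝ (F.flatS h n) x (ξ, η) = F.A n (ξ + fderiv ℝ (h n) x.2 η)
      + fderiv ℝ (F.gs n) (x.1 + h n x.2, x.2) (ξ + fderiv ℝ (h n) x.2 η, η)
      - fderiv ℝ (h (n + 1)) (F.flatU h n x) (fderiv ℝ (F.flatU h n) x (ξ, η)) := by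
  have hu := (hF.u_fderiv n (x.1 + h n x.2, x.2)).comp x (hasFDerivAt_unflatten (hh n) x)
  have hu' : HasFDerivAt (F.flatU h n) (fderiv ℝ (F.flatU h n) x) x :=
    hu.differentiableAt.hasFDerivAt
  have hs := (hF.s_fderiv n (x.1 + h n x.2, x.2)).comp x (hasFDerivAt_unflatten (hh n) x)
  have h1 := hs.sub (((hh (n + 1)).c11.hasFDerivAt (F.flatU h n x)).comp x hu')
  have h2 : fderiv ℝ (F.flatS h n) x = _ := h1.fderiv
  rw [h2]; simp

theorem IsGraph.norm_tangent_le {g : U → S} (hg : IsGraph g δ Λ) (hδ : δ ≤ 1) (u : U) (ξ : S)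
    (η : U) : ‖(ξ + fderiv ℝ g u η, η)‖ ≤ ‖ξ‖ + ‖η‖ := by
  rw [Prod.norm_mk]
  have : ‖fderiv ℝ g u η‖ ≤ 1 * ‖η‖ :=
    ContinuousLinearMap.le_of_opNorm_le _ ((hg.c11.bound u).trans hδ) η
  refine max_le ((norm_add_le _ _).trans (by linarith)) (by linarith [norm_nonneg ξ])

theorem Sys.Good.flat [FiniteDimensional ℝ U] (hF : F.Good b a c L) (hβ0 : 0 ≤ β)
    (hβ : ∀ n u, ‖F.B n u‖ ≤ β * ‖u‖) (hc : GraphCond b a c L δ Λ) (c0 : 0 < c)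
    (hh : ∀ n, IsGraph (h n) δ Λ)
    (hinv : ∀ n u, h (n + 1) (F.u n (h n u, u)) = F.s n (h n u, u))
    (hsmall : 16 * c ≤ (a - c) - max (b + c + δ * c) ((b + c + δ * c) * (β + c))) :
    ∃ G, Flat (F.flatS h) (F.flatU h) G (b + c + δ * c) (β + c) (a - c) c
      (L + Λ * c * (β + c) + δ * L) ((L + c * Λ) * (a - c)⁻¹ ^ 3) := by
  have hL := hF.L0
  have hb0 := hF.b0
  have hδ0 := hc.δ0
  have hΛ : 0 ≤ Λ := by
    rw [hc.hΛ]
    exact div_nonneg (by linarith) (by linarith [hc.hb])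
  choose hg e he hez hes hle using fun n => (hh n).exists_base hF hc n
  have hac := hc.hac
  have cU : ∀ n, ContDiff ℝ 1 (F.flatU h n) := fun n => by
    have h1 : ContDiff ℝ 1 (fun x : S × U => (x.1 + h n x.2, x.2)) :=
      (contDiff_fst.add ((hh n).c11.contDiff.comp contDiff_snd)).prodMk contDiff_snd
    exact ((F.B n).contDiff.comp contDiff_snd).add ((hF.gu n).contDiff.comp h1)
  have cS : ∀ n, ContDiff ℝ 1 (F.flatS h n) := fun n => by
    have h1 : ContDiff ℝ 1 (fun x : S × U => (x.1 + h n x.2, x.2)) :=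
      (contDiff_fst.add ((hh n).c11.contDiff.comp contDiff_snd)).prodMk contDiff_snd
    exact (((F.A n).contDiff.comp (contDiff_fst.comp h1)).add
      ((hF.gs n).contDiff.comp h1)).sub ((hh (n + 1)).c11.contDiff.comp (cU n))
  have S0 : ∀ n u, F.flatS h n (0, u) = 0 := fun n u => by
    simp only [Sys.flatS, zero_add, hinv, sub_self]
  have dU : ∀ n x ξ η, ‖fderiv ℝ (F.flatU h n) x (ξ, η)‖ ≤ c * ‖ξ‖ + (β + c) * ‖η‖ := by
    intro n x ξ η
    rw [hF.flatU_fderiv hh]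
    have t1 := hβ n η
    have t2 := ContinuousLinearMap.le_of_opNorm_le_of_le _
      ((hF.gu n).bound (x.1 + h n x.2, x.2)) ((hh n).norm_tangent_le hc.δ1 x.2 ξ η)
    refine (norm_add_le _ _).trans ((add_le_add t1 t2).trans (le_of_eq (by ring)))
  have hx0 : ∀ n s u, ‖(s + h n u, u) - (0 + h n u, u)‖ = ‖s‖ := fun n s u => by
    simp [Prod.norm_def]
  have dU2 : ∀ n s u η, ‖fderiv ℝ (F.flatU h n) (s, u) (0, η)
      - fderiv ℝ (F.flatU h n) (0, u) (0, η)‖ ≤ L * ‖s‖ * ‖η‖ := by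
    intro n s u η
    rw [hF.flatU_fderiv hh, hF.flatU_fderiv hh, add_sub_add_left_eq_sub, ← sub_apply]
    refine ContinuousLinearMap.le_of_opNorm_le_of_le _ ?_ ?_
    · have := (hF.gu n).lip (s + h n u, u) (0 + h n u, u)
      rwa [hx0] at this
    · have := (hh n).norm_tangent_le hc.δ1 u 0 η
      simpa using this
  have hUd : ∀ n s u, ‖F.flatU h n (s, u) - F.flatU h n (0, u)‖ ≤ c * ‖s‖ := by
    intro n s u
    have : F.flatU h n (s, u) - F.flatU h n (0, u)
        = F.gu n (s + h n u, u) - F.gu n (0 + h n u, u) := by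
      simp [Sys.flatU, Sys.u]
    rw [this, ← hx0 n s u]
    exact (hF.gu n).lipschitz _ _
  have dS : ∀ n x ξ η, ‖fderiv ℝ (F.flatS h n) x (ξ, η)‖
      ≤ (b + c + δ * c) * ‖ξ‖ + (L + Λ * c * (β + c) + δ * L) * ‖x.1‖ * ‖η‖ := by
    rintro n ⟨s, u⟩ ξ η
    have hz : fderiv ℝ (F.flatS h n) (0, u) (0, η) = 0 := by
      have h1 : HasFDerivAt (fun u => F.flatS h n (0, u))
          ((fderiv ℝ (F.flatS h n) (0, u)).comp
            ((0 : U →L[ℝ] S).prod (ContinuousLinearMap.id ℝ U))) u :=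
        (hasFDerivAt_of_contDiff (cS n) (0, u)).comp u
          ((hasFDerivAt_const (0 : S) u).prodMk (hasFDerivAt_id u))
      have h3 : (fun u => F.flatS h n (0, u)) = fun _ => 0 := funext fun u => S0 n u
      rw [h3] at h1
      have h4 := h1.unique (hasFDerivAt_const (0 : S) u)
      simpa using congrArg (fun T => T η) h4
    have hsplit : fderiv ℝ (F.flatS h n) (s, u) (ξ, η)
        = fderiv ℝ (F.flatS h n) (s, u) (ξ, 0)
          + (fderiv ℝ (F.flatS h n) (s, u) (0, η) - fderiv ℝ (F.flatS h n) (0, u) (0, η)) := by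
      rw [hz, sub_zero, ← map_add]; simp
    rw [hsplit]
    have t1 : ‖fderiv ℝ (F.flatS h n) (s, u) (ξ, 0)‖ ≤ (b + c + δ * c) * ‖ξ‖ := by
      rw [hF.flatS_fderiv hh]
      have u1 := hF.hA n (ξ + fderiv ℝ (h n) u 0)
      have u2 := ContinuousLinearMap.le_of_opNorm_le_of_le _
        ((hF.gs n).bound (s + h n u, u)) ((hh n).norm_tangent_le hc.δ1 u ξ 0)
      have u3 := ContinuousLinearMap.le_of_opNorm_le_of_le _
        ((hh (n + 1)).c11.bound (F.flatU h n (s, u))) (dU n (s, u) ξ 0)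
      refine (norm_sub_le _ _).trans ((add_le_add ((norm_add_le _ _).trans
        (add_le_add u1 u2)) u3).trans (le_of_eq ?_))
      simp only [map_zero, norm_zero, add_zero]
      ring
    have t2 : ‖fderiv ℝ (F.flatS h n) (s, u) (0, η) - fderiv ℝ (F.flatS h n) (0, u) (0, η)‖
        ≤ (L + Λ * c * (β + c) + δ * L) * ‖s‖ * ‖η‖ := by
      rw [hF.flatS_fderiv hh, hF.flatS_fderiv hh]
      set v := fderiv ℝ (F.flatU h n) (s, u) (0, η)
      set v0 := fderiv ℝ (F.flatU h n) (0, u) (0, η)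
      set w := fderiv ℝ (h n) u η
      have e1 : F.A n (0 + w) + fderiv ℝ (F.gs n) (s + h n u, u) (0 + w, η)
            - fderiv ℝ (h (n + 1)) (F.flatU h n (s, u)) v
          - (F.A n (0 + w) + fderiv ℝ (F.gs n) (0 + h n u, u) (0 + w, η)
            - fderiv ℝ (h (n + 1)) (F.flatU h n (0, u)) v0)
          = (fderiv ℝ (F.gs n) (s + h n u, u) - fderiv ℝ (F.gs n) (0 + h n u, u)) (0 + w, η)
            - (fderiv ℝ (h (n + 1)) (F.flatU h n (s, u))
              - fderiv ℝ (h (n + 1)) (F.flatU h n (0, u))) v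
            - fderiv ℝ (h (n + 1)) (F.flatU h n (0, u)) (v - v0) := by
        rw [sub_apply, sub_apply, map_sub]; abel
      change ‖F.A n (0 + w) + fderiv ℝ (F.gs n) (s + h n u, u) (0 + w, η)
            - fderiv ℝ (h (n + 1)) (F.flatU h n (s, u)) v
          - (F.A n (0 + w) + fderiv ℝ (F.gs n) (0 + h n u, u) (0 + w, η)
            - fderiv ℝ (h (n + 1)) (F.flatU h n (0, u)) v0)‖ ≤ _
      rw [e1]
      have hgs := (hF.gs n).lip (s + h n u, u) (0 + h n u, u)
      rw [hx0] at hgs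
      have u1 := ContinuousLinearMap.le_of_opNorm_le_of_le _ hgs
        ((hh n).norm_tangent_le hc.δ1 u 0 η)
      have u2 := ContinuousLinearMap.le_of_opNorm_le_of_le _
        (((hh (n + 1)).c11.lip (F.flatU h n (s, u)) (F.flatU h n (0, u))).trans
          (mul_le_mul_of_nonneg_left (hUd n s u) hΛ)) (dU n (s, u) 0 η)
      have u3 := ContinuousLinearMap.le_of_opNorm_le_of_le _
        ((hh (n + 1)).c11.bound (F.flatU h n (0, u))) (dU2 n s u η)
      refine (norm_sub_le _ _).trans ((add_le_add ((norm_sub_le _ _).trans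
        (add_le_add u1 u2)) u3).trans (le_of_eq ?_))
      simp only [norm_zero]
      ring
    exact (norm_add_le _ _).trans (add_le_add t1 t2)
  have hm1 := le_max_left (b + c + δ * c) ((b + c + δ * c) * (β + c))
  have hm2 := le_max_right (b + c + δ * c) ((b + c + δ * c) * (β + c))
  have hbc : 0 ≤ β + c := by linarith
  have hLL : L ≤ L + Λ * c * (β + c) + δ * L := by
    have h1 : 0 ≤ Λ * c * (β + c) := by positivity
    have h2 : 0 ≤ δ * L := by positivity
    linarith
  refine ⟨fun n => (e n).symm, ⟨cS, cU, S0, fun n => ?_, dS, dU, fun n s u η =>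
    (dU2 n s u η).trans (by gcongr), fun n => ?_, fun n u => ?_,
    fun n u => ?_, by positivity, ?_, by positivity, by linarith, c0.le, by positivity, ?_, ?_, ?_⟩⟩
  · have h1 : F.gu n (0, 0) = 0 := hF.gu0 n
    simp [Sys.flatU, (hh n).zero, Sys.u, h1]
  · rw [one_div]
    exact hes n
  · simp only [Sys.flatU, zero_add, ← he, Equiv.symm_apply_apply]
  · simp only [Sys.flatU, zero_add, ← he, Equiv.apply_symm_apply]
  · nlinarith [hc.hbc2, hc.δ1]
  · have : 0 < a - c := by linarith
    positivity
  · linarith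
  · linarith

/-- The unstable part of a perturbed hyperbolic system is a `C¹` factor of the system. -/
theorem exists_unstable_factor [FiniteDimensional ℝ U] [CompleteSpace S]
    (hF : F.Good b a c L) (hβ0 : 0 ≤ β)
    (hβ : ∀ n u, ‖F.B n u‖ ≤ β * ‖u‖) (hc : GraphCond b a c L δ Λ) (c0 : 0 < c)
    (hsmall : 16 * c ≤ (a - c) - max (b + c + δ * c) ((b + c + δ * c) * (β + c))) :
    ∃ (Q : ℤ → S × U → U) (γ : ℤ → U → U) (ρ : ℝ), 0 < ρ ∧
      (∀ n, ContDiff ℝ 1 (Q n)) ∧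
      (∀ n x, Q (n + 1) (F.s n x, F.u n x) = F.B n (Q n x) + γ n (Q n x)) ∧
      (∀ n, C11 (γ n) c (L + c * Λ) ∧ γ n 0 = 0 ∧ fderiv ℝ (γ n) 0 = 0) ∧
      (∀ n x, ‖Q n x - x.2‖ ≤ 1 / 2 * ‖x‖) ∧
      (∀ n x, ‖x‖ < ρ → ‖fderiv ℝ (Q n) x - ContinuousLinearMap.snd ℝ S U‖ ≤ 1 / 2) ∧
      ∀ R : ℝ, ∃ κ > 0, ∀ n x y, ‖x‖ ≤ R → ‖y‖ ≤ R → ‖x.1 - y.1‖ ≤ ‖x.2 - y.2‖ →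
        κ * ‖x.2 - y.2‖ ≤ ‖Q n x - Q n y‖ := by
  obtain ⟨h, hh, hinv⟩ := exists_invariant_graph hF hc
  obtain ⟨G, hflat⟩ := hF.flat hβ0 hβ hc c0 hh hinv hsmall
  obtain ⟨Q, R, hR, hQ⟩ := hflat.exists_projection hsmall
  have hb0 := hF.b0
  have hδ0 := hc.δ0
  have hδ1 := hc.δ1
  set be := b + c + δ * c with hbe
  have hH : ∀ n (x : S × U), ‖x.1 - h n x.2‖ ≤ 2 * ‖x‖ := by
    intro n x
    have h1 := (hh n).c11.norm_le (hh n).zero x.2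
    have h2 := norm_fst_le x
    have h3 := norm_snd_le x
    refine (norm_sub_le _ _).trans ?_
    nlinarith [norm_nonneg x.2]
  have hflatS : ∀ n (x : S × U), F.flatS h n (x.1 - h n x.2, x.2)
      = F.s n x - h (n + 1) (F.u n x) := fun n x => by
    simp [Sys.flatS]
  have hflatU : ∀ n (x : S × U), F.flatU h n (x.1 - h n x.2, x.2) = F.u n x := fun n x => by
    simp [Sys.flatU]
  have hsemi : ∀ n x, Q (n + 1) (F.s n x - h (n + 1) (F.u n x), F.u n x)
      = F.B n (Q n (x.1 - h n x.2, x.2)) + F.gu n (h n (Q n (x.1 - h n x.2, x.2)),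
        Q n (x.1 - h n x.2, x.2)) := by
    intro n x
    rw [← hflatS, ← hflatU n x, (hQ n).2.2.1]
    simp [Sys.flatU, Sys.u]
  have hac := hc.hac
  have hmax := le_max_left be (be * (β + c))
  refine ⟨fun n x => Q n (x.1 - h n x.2, x.2), fun n u => F.gu n (h n u, u), R / 2, by positivity,
    fun n => ?_, hsemi, fun n => ?_, fun n x => ?_, fun n x hx => ?_, fun R0 => ?_⟩
  · exact (hQ n).1.comp ((contDiff_fst.sub ((hh n).c11.contDiff.comp contDiff_snd)).prodMk
      contDiff_snd)
  · refine ⟨((hh n).exists_base hF hc n).1, (by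
      change F.gu n (h n 0, 0) = 0
      rw [(hh n).zero]
      exact hF.gu0 n), ?_⟩
    have hσ0 : (fun u => (h n u, u)) (0 : U) = 0 := by simp [(hh n).zero]
    have h1 : HasFDerivAt (fun u => (h n u, u))
        ((fderiv ℝ (h n) 0).prod (ContinuousLinearMap.id ℝ U)) (0 : U) :=
      ((hh n).c11.hasFDerivAt 0).prodMk (hasFDerivAt_id 0)
    have h3 : HasFDerivAt (F.gu n) (fderiv ℝ (F.gu n) 0) ((fun u => (h n u, u)) (0 : U)) := by
      rw [hσ0]; exact (hF.gu n).hasFDerivAt 0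
    have h4 := (HasFDerivAt.comp (f := fun u => (h n u, u)) (0 : U) h3 h1).fderiv
    rw [hF.dgu0, ContinuousLinearMap.zero_comp] at h4
    exact h4
  · have h1 := (hQ n).2.2.2.1 (x.1 - h n x.2, x.2)
    refine h1.trans ?_
    have h2 : c / (a - c - be) ≤ 1 / 16 := by
      rw [div_le_iff₀ (by linarith)]; linarith
    calc c / (a - c - be) * ‖x.1 - h n x.2‖ ≤ 1 / 16 * (2 * ‖x‖) := by
          gcongr; exact hH n x
      _ ≤ _ := by linarith [norm_nonneg x]
  · have h1 := (hQ n).2.2.2.2 (x.1 - h n x.2, x.2) (by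
      have := hH n x
      simp only
      linarith)
    have hd : HasFDerivAt (fun x : S × U => (x.1 - h n x.2, x.2))
        ((ContinuousLinearMap.fst ℝ S U
          - (fderiv ℝ (h n) x.2).comp (ContinuousLinearMap.snd ℝ S U)).prod
          (ContinuousLinearMap.snd ℝ S U)) x :=
      (hasFDerivAt_fst.sub (((hh n).c11.hasFDerivAt x.2).comp x hasFDerivAt_snd)).prodMk
        hasFDerivAt_snd
    have h2 := HasFDerivAt.comp (g := Q n) (f := fun x : S × U => (x.1 - h n x.2, x.2)) x
      (hasFDerivAt_of_contDiff (hQ n).1 _) hd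
    have h3 : fderiv ℝ (fun x : S × U => Q n (x.1 - h n x.2, x.2)) x = _ := h2.fderiv
    rw [h3]
    refine ContinuousLinearMap.opNorm_le_bound _ (by norm_num) fun v => ?_
    set v' : S × U := (v.1 - fderiv ℝ (h n) x.2 v.2, v.2) with hv'
    have hv'n : ‖v'‖ ≤ 2 * ‖v‖ := by
      have h1 : ‖fderiv ℝ (h n) x.2 v.2‖ ≤ 1 * ‖v.2‖ :=
        ContinuousLinearMap.le_of_opNorm_le _ (((hh n).c11.bound _).trans hδ1) _
      have h2 := norm_fst_le v
      have h3 := norm_snd_le v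
      rw [hv', Prod.norm_mk]
      exact max_le ((norm_sub_le _ _).trans (by linarith)) (by linarith [norm_nonneg v])
    have e : (fderiv ℝ (Q n) (x.1 - h n x.2, x.2) - ContinuousLinearMap.snd ℝ S U) v'
        = _ := rfl
    have h4 := ContinuousLinearMap.le_of_opNorm_le_of_le _ h1 hv'n
    calc _ = ‖(fderiv ℝ (Q n) (x.1 - h n x.2, x.2) - ContinuousLinearMap.snd ℝ S U) v'‖ := by
          simp [hv']
      _ ≤ _ := h4
      _ = _ := by ring
  · have hcone : ∀ m : ℕ, ∀ n (x y : S × U), ‖x.1 - h n x.2‖ * be ^ m < R →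
        ‖y.1 - h n y.2‖ * be ^ m < R → ‖x.1 - y.1‖ ≤ ‖x.2 - y.2‖ →
        1 / 2 * ‖x.2 - y.2‖ ≤ (β + c + 1) ^ m
          * ‖Q n (x.1 - h n x.2, x.2) - Q n (y.1 - h n y.2, y.2)‖ := by
      intro m
      induction m with
      | zero =>
        intro n x y hx hy hxy
        rw [pow_zero, mul_one] at hx hy
        rw [pow_zero, one_mul]
        have hconv : Convex ℝ {z : S × U | ‖z.1‖ < R} := by
          have : {z : S × U | ‖z.1‖ < R} = (LinearMap.fst ℝ S U) ⁻¹' Metric.ball 0 R := by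
            ext z; simp
          rw [this]
          exact (convex_ball 0 R).linear_preimage _
        have key := hconv.norm_image_sub_le_of_norm_hasFDerivWithin_le (𝕜 := ℝ) (C := 1 / 4)
          (f := fun z => Q n z - z.2) (f' := fun z => fderiv ℝ (Q n) z
            - ContinuousLinearMap.snd ℝ S U) (x := (y.1 - h n y.2, y.2))
          (y := (x.1 - h n x.2, x.2))
          (fun z _ => ((hasFDerivAt_of_contDiff (hQ n).1 z).sub hasFDerivAt_snd).hasFDerivWithinAt)
          (fun z hz => (hQ n).2.2.2.2 z hz) hy hx
        have h1 : ‖(x.1 - h n x.2, x.2) - (y.1 - h n y.2, y.2)‖ ≤ 2 * ‖x.2 - y.2‖ := by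
          have h2 := (hh n).c11.lipschitz x.2 y.2
          have h3 : δ * ‖x.2 - y.2‖ ≤ ‖x.2 - y.2‖ := mul_le_of_le_one_left (norm_nonneg _) hδ1
          rw [Prod.mk_sub_mk, Prod.norm_mk, sub_sub_sub_comm]
          exact max_le ((norm_sub_le _ _).trans (by linarith)) (by linarith [norm_nonneg (x.2 - y.2)])
        simp only at key
        have h4 := norm_sub_le (Q n (x.1 - h n x.2, x.2) - Q n (y.1 - h n y.2, y.2))
          (Q n (x.1 - h n x.2, x.2) - x.2 - (Q n (y.1 - h n y.2, y.2) - y.2))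
        have e : Q n (x.1 - h n x.2, x.2) - Q n (y.1 - h n y.2, y.2)
          - (Q n (x.1 - h n x.2, x.2) - x.2 - (Q n (y.1 - h n y.2, y.2) - y.2)) = x.2 - y.2 := by
          abel
        rw [e] at h4
        linarith
      | succ m ih =>
        intro n x y hx hy hxy
        have hn : ‖x - y‖ = ‖x.2 - y.2‖ := by
          rw [Prod.norm_def]; exact max_eq_right hxy
        have hs := hF.norm_s_sub n x y
        have hu := hF.norm_u_sub n x y
        rw [hn] at hs hu
        have hgrow : ‖x.2 - y.2‖ ≤ ‖F.u n x - F.u n y‖ := by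
          nlinarith [norm_nonneg (x.2 - y.2)]
        have hcone' : ‖F.s n x - F.s n y‖ ≤ ‖F.u n x - F.u n y‖ := by
          have : b * ‖x.1 - y.1‖ ≤ b * ‖x.2 - y.2‖ := by gcongr
          nlinarith [norm_nonneg (x.2 - y.2), hc.hbc2]
        have hdec : ∀ z : S × U, ‖z.1 - h n z.2‖ * be ^ (m + 1) < R →
            ‖F.s n z - h (n + 1) (F.u n z)‖ * be ^ m < R := by
          intro z hz
          refine lt_of_le_of_lt ?_ hz
          have := hflat.norm_S_le n (z.1 - h n z.2, z.2)
          rw [hflatS] at this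
          simp only at this
          calc _ ≤ be * ‖z.1 - h n z.2‖ * be ^ m := by gcongr
            _ = _ := by ring
        have h1 := ih (n + 1) (F.s n x, F.u n x) (F.s n y, F.u n y) (hdec x hx) (hdec y hy) hcone'
        simp only at h1
        rw [hsemi, hsemi] at h1
        set p := Q n (x.1 - h n x.2, x.2)
        set q := Q n (y.1 - h n y.2, y.2)
        have h2 : ‖F.B n p + F.gu n (h n p, p) - (F.B n q + F.gu n (h n q, q))‖
            ≤ (β + c + 1) * ‖p - q‖ := by
          have e : F.B n p + F.gu n (h n p, p) - (F.B n q + F.gu n (h n q, q))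
              = F.B n (p - q) + (F.gu n (h n p, p) - F.gu n (h n q, q)) := by
            rw [map_sub]; abel
          rw [e]
          have h3 := hβ n (p - q)
          have h4 := ((hh n).exists_base hF hc n).1.lipschitz p q
          refine (norm_add_le _ _).trans ?_
          nlinarith [norm_nonneg (p - q)]
        calc 1 / 2 * ‖x.2 - y.2‖ ≤ 1 / 2 * ‖F.u n x - F.u n y‖ := by gcongr
          _ ≤ _ := h1
          _ ≤ (β + c + 1) ^ m * ((β + c + 1) * ‖p - q‖) := by gcongr
          _ = _ := by ring
    have hbe0 : 0 ≤ be := hflat.b0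
    obtain ⟨m, hm⟩ := exists_pow_lt_of_lt_one (show 0 < R / (2 * |R0| + 1) by positivity) hflat.b1
    rw [lt_div_iff₀ (by positivity)] at hm
    have hlt : ∀ n (x : S × U), ‖x‖ ≤ R0 → ‖x.1 - h n x.2‖ * be ^ m < R := by
      intro n x hx
      have h1 := hH n x
      have h2 : 0 ≤ be ^ m := by positivity
      have h3 := le_abs_self R0
      calc ‖x.1 - h n x.2‖ * be ^ m ≤ (2 * |R0| + 1) * be ^ m := by gcongr; linarith
        _ < R := by linarith
    refine ⟨1 / 2 / (β + c + 1) ^ m, by positivity, fun n x y hx hy hxy => ?_⟩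
    have := hcone m n x y (hlt n x hx) (hlt n y hy) hxy
    rw [div_mul_eq_mul_div, div_le_iff₀ (by positivity)]
    linarith

end Projection

section PerturbInverse

variable {X : Type*} [NormedAddCommGroup X] [NormedSpace ℝ X] [FiniteDimensional ℝ X]

/-- A small `C^{1,1}` perturbation of an invertible linear map is invertible, and its inverse is a
small `C^{1,1}` perturbation of the linear inverse. -/
theorem exists_perturb_inverse (A : X ≃L[ℝ] X) {g : X → X} {q c L : ℝ} (hq : 0 < q)
    (hA : ∀ x, ‖A.symm x‖ ≤ q * ‖x‖) (hg : C11 g c L) (hL : 0 ≤ L) (g0 : g 0 = 0)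
    (dg0 : fderiv ℝ g 0 = 0) (hqc : 2 * q * c ≤ 1) :
    ∃ (e : X ≃ X) (γ : X → X), (∀ x, e x = A x + g x) ∧ (∀ y, e.symm y = A.symm y + γ y) ∧
      C11 γ (2 * q ^ 2 * c) (8 * q ^ 3 * L) ∧ γ 0 = 0 ∧ fderiv ℝ γ 0 = 0 := by
  have hc := hg.nonneg
  have hf : C11 (fun x => A x + g x) (‖(A : X →L[ℝ] X)‖ + c) (0 + L) :=
    (C11.clm (A : X →L[ℝ] X)).add hg
  have hexp : ∀ x y, (2 * q)⁻¹ * ‖x - y‖ ≤ ‖A x + g x - (A y + g y)‖ := by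
    intro x y
    have h1 := hA (A (x - y))
    rw [A.symm_apply_apply] at h1
    have h2 := hg.lipschitz x y
    have h3 := norm_sub_le (A x + g x - (A y + g y)) (g x - g y)
    have e : A x + g x - (A y + g y) - (g x - g y) = A (x - y) := by rw [map_sub]; abel
    rw [e] at h3
    rw [inv_mul_le_iff₀ (by positivity)]
    nlinarith [norm_nonneg (x - y)]
  obtain ⟨e, he, hes, -⟩ := hf.exists_inverse (by linarith) (by positivity) (by simp [g0]) hexp
  have hesy : ∀ y, e.symm y = A.symm y + -A.symm (g (e.symm y)) := by
    intro y
    have h1 := he (e.symm y)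
    rw [e.apply_symm_apply] at h1
    have h2 : A.symm y = e.symm y + A.symm (g (e.symm y)) := by
      conv_lhs => rw [h1, map_add, A.symm_apply_apply]
    rw [h2]
    abel
  have hT : C11 (fun x => (-(A.symm : X →L[ℝ] X)) x) q 0 :=
    C11.clm_of_le _ hq.le fun x => by simpa using hA x
  have h0 : e.symm 0 = 0 := by
    rw [Equiv.symm_apply_eq, he]; simp [g0]
  have key := hT.comp (hg.comp hes hL) le_rfl
  refine ⟨e, fun y => -A.symm (g (e.symm y)), he, hesy, ?_, by simp [h0, g0], ?_⟩
  · refine key.mono (le_of_eq ?_) ?_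
    · rw [inv_inv]; ring
    · rw [inv_inv]
      have : c * ((0 + L) * (2 * q) ^ 3) ≤ 4 * q ^ 2 * L := by
        calc c * ((0 + L) * (2 * q) ^ 3) = (2 * q * c) * (4 * q ^ 2 * L) := by ring
          _ ≤ 1 * (4 * q ^ 2 * L) := by gcongr
          _ = _ := one_mul _
      nlinarith
  · have h1 : HasFDerivAt g (0 : X →L[ℝ] X) (e.symm 0) := by
      rw [h0, ← dg0]; exact hg.hasFDerivAt 0
    have h2 := (-(A.symm : X →L[ℝ] X)).hasFDerivAt.comp (0 : X)
      (h1.comp (0 : X) (hes.hasFDerivAt 0))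
    have h3 := h2.fderiv
    rw [ContinuousLinearMap.zero_comp, ContinuousLinearMap.comp_zero] at h3
    exact h3

end PerturbInverse

theorem exists_smallness {a b β : ℝ} (ha : 1 < a) (hb : b < 1) (hβ : b * β < a) :
    ∃ c₀ > 0, ∀ c, 0 < c → c ≤ c₀ → (∀ L, GraphCond b a c L 1 (4 * L / (1 - b))) ∧
      16 * c ≤ (a - c) - max (b + c + 1 * c) ((b + c + 1 * c) * (β + c)) := by
  have h : ∀ (f g : ℝ → ℝ), Continuous f → Continuous g → f 0 < g 0 → ∀ᶠ c in 𝓝 (0 : ℝ),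
      f c < g c := fun f g hf hg h =>
    hf.continuousAt.eventually_lt hg.continuousAt h
  have h1 := h (fun _ => 1) (fun c => a - c) (by fun_prop) (by fun_prop) (by simpa)
  have h2 := h (fun c => c * (1 + 1)) (fun _ => 1 * (a - b)) (by fun_prop) (by fun_prop)
    (by simp; linarith)
  have h3 := h (fun c => (b + c) * (1 + c)) (fun _ => (1 + b) / 2) (by fun_prop) (by fun_prop)
    (by simp; linarith)
  have h4 := h (fun c => b + 2 * c) (fun _ => 1) (by fun_prop) (by fun_prop) (by simpa)
  have h5 := h (fun c => 16 * c + max (b + c + 1 * c) ((b + c + 1 * c) * (β + c)))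
    (fun c => a - c) (by fun_prop) (by fun_prop) (by
      simp only [mul_zero, add_zero, zero_add, sub_zero]
      exact max_lt (by linarith) hβ)
  obtain ⟨r, hr, hball⟩ := Metric.eventually_nhds_iff.1
    (h1.and (h2.and (h3.and (h4.and h5))))
  refine ⟨r / 2, by positivity, fun c hc hcr => ?_⟩
  obtain ⟨k1, k2, k3, k4, k5⟩ := hball (y := c) (by
    rw [Real.dist_eq, sub_zero, abs_of_pos hc]; linarith)
  exact ⟨fun L => ⟨one_pos, le_rfl, k1.le, k2.le, hb, k3.le, k4, rfl⟩, by linarith⟩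

section Decoupling

variable {S U : Type*} [NormedAddCommGroup S] [NormedSpace ℝ S]
  [NormedAddCommGroup U] [NormedSpace ℝ U]

/-- Derivative bounds near a point from closeness of the derivative to the identity. -/
theorem norm_fderiv_le_two {X : Type*} [NormedAddCommGroup X] [NormedSpace ℝ X]
    {T : X →L[ℝ] X} (hT : ‖T - ContinuousLinearMap.id ℝ X‖ ≤ 1 / 2) :
    ‖T‖ ≤ 2 ∧ ∀ T' : X ≃L[ℝ] X, (T' : X →L[ℝ] X) = T → ‖(T'.symm : X →L[ℝ] X)‖ ≤ 2 := by
  constructor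
  · have h1 := norm_add_le (T - ContinuousLinearMap.id ℝ X) (ContinuousLinearMap.id ℝ X)
    rw [sub_add_cancel] at h1
    have h2 : ‖ContinuousLinearMap.id ℝ X‖ ≤ 1 := ContinuousLinearMap.norm_id_le
    linarith
  · rintro T' rfl
    refine ContinuousLinearMap.opNorm_le_bound _ (by norm_num) fun v => ?_
    have h1 := ContinuousLinearMap.le_of_opNorm_le _ hT (T'.symm v)
    have e : ((T' : X →L[ℝ] X) - ContinuousLinearMap.id ℝ X) (T'.symm v) = v - T'.symm v := by
      rw [sub_apply]; simp
    rw [e] at h1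
    have h2 := norm_sub_norm_le (T'.symm v) v
    rw [norm_sub_rev] at h2
    simp only [ContinuousLinearEquiv.coe_coe]
    linarith

variable [FiniteDimensional ℝ S] [FiniteDimensional ℝ U]

/-- A small perturbation of a saddle splits, after a `C¹` change of variables, into an expansion
and a contraction, the latter being described by its inverse. -/
theorem exists_decoupling {a b α β : ℝ} (ha : 1 < a) (hb0 : 0 < b) (hb : b < 1) (hα0 : 0 < α)
    (hβ0 : 0 ≤ β) (hbβ : b * β < a) (hbα : b / α < a) :
    ∃ c₀ > 0, ∃ K > 0, ∀ c, 0 < c → c ≤ c₀ → ∀ L, 0 ≤ L → ∃ L', ∀ F : Sys S U, F.Good b a c L →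
      (∀ n s, α * ‖s‖ ≤ ‖F.A n s‖) → (∀ n u, ‖F.B n u‖ ≤ β * ‖u‖) →
      ∃ (Ψ : ℤ → (S × U ≃ S × U)) (γs : ℤ → S → S) (γu : ℤ → U → U) (ρ : ℝ), 0 < ρ ∧
        (∀ n, ContDiff ℝ 1 (Ψ n) ∧ ContDiff ℝ 1 (Ψ n).symm ∧ Ψ n 0 = 0) ∧
        (∀ n x, (Ψ n x).1 = (F.A n).symm (Ψ (n + 1) (F.s n x, F.u n x)).1
          + γs n (Ψ (n + 1) (F.s n x, F.u n x)).1) ∧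
        (∀ n x, (Ψ (n + 1) (F.s n x, F.u n x)).2 = F.B n (Ψ n x).2 + γu n (Ψ n x).2) ∧
        (∀ n, C11 (γs n) (K * c) L' ∧ γs n 0 = 0 ∧ fderiv ℝ (γs n) 0 = 0) ∧
        (∀ n, C11 (γu n) (K * c) L' ∧ γu n 0 = 0 ∧ fderiv ℝ (γu n) 0 = 0) ∧
        (∀ n x, ‖x‖ < ρ → ‖fderiv ℝ (Ψ n) x‖ ≤ 2 ∧ ‖fderiv ℝ (Ψ n).symm x‖ ≤ 2) := by
  have ha0 : 0 < a := by linarith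
  set q := max 1 α⁻¹ with hq
  have hq1 : 1 ≤ q := le_max_left _ _
  obtain ⟨c₁, hc₁, hs₁⟩ := exists_smallness ha hb hbβ
  obtain ⟨c₂, hc₂, hs₂⟩ := exists_smallness (a := 1 / b) (b := 1 / a) (β := 1 / α)
    (by rwa [lt_div_iff₀ hb0, one_mul]) (by rwa [div_lt_one ha0]) (by
      rw [div_lt_iff₀ hα0] at hbα
      rw [div_mul_div_comm, one_mul, div_lt_div_iff₀ (by positivity) hb0]
      linarith)
  refine ⟨min c₁ (min (c₂ / (2 * q ^ 2)) (1 / (2 * q))), by positivity, 2 * q ^ 2,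
    by positivity, fun c hc hcc L hL => ?_⟩
  have hcc₁ := hcc.trans (min_le_left _ _)
  have hcc₂ := hcc.trans ((min_le_right _ _).trans (min_le_left _ _))
  have hcc₃ := hcc.trans ((min_le_right _ _).trans (min_le_right _ _))
  rw [le_div_iff₀ (by positivity)] at hcc₂ hcc₃
  set c' := 2 * q ^ 2 * c with hc'
  set L₁ := 8 * q ^ 3 * L with hL₁
  have hc'0 : 0 < c' := by positivity
  have hL₁0 : 0 ≤ L₁ := by positivity
  obtain ⟨hg₁, hsm₁⟩ := hs₁ c hc hcc₁
  obtain ⟨hg₂, hsm₂⟩ := hs₂ c' hc'0 (by linarith)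
  refine ⟨max (L + c * (4 * L / (1 - b))) (L₁ + c' * (4 * L₁ / (1 - 1 / a))),
    fun F hF hα hβ => ?_⟩
  -- the inverse maps
  have hinv : ∀ n, ∃ (e : S × U ≃ S × U) (γ : S × U → S × U), (∀ x, e x = (F.s n x, F.u n x)) ∧
      (∀ y, e.symm y = ((F.A n).symm y.1, (F.B n).symm y.2) + γ y) ∧
      C11 γ c' L₁ ∧ γ 0 = 0 ∧ fderiv ℝ γ 0 = 0 := by
    intro n
    have hgg : C11 (fun x => (F.gs n x, F.gu n x)) c L :=
      ((hF.gs n).prodMk (hF.gu n)).mono (max_self c).le (max_self L).le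
    obtain ⟨e, γ, h1, h2, h3⟩ := exists_perturb_inverse ((F.A n).prodCongr (F.B n)) (q := q)
      (by positivity) (fun x => by
        have h1 := hα n ((F.A n).symm x.1)
        have h2 := hF.hB n ((F.B n).symm x.2)
        rw [ContinuousLinearEquiv.apply_symm_apply] at h1 h2
        have h3 := norm_fst_le x
        have h4 := norm_snd_le x
        have hqα : 1 ≤ q * α := by
          have : α⁻¹ * α ≤ q * α := by gcongr; exact le_max_right _ _
          rwa [inv_mul_cancel₀ hα0.ne'] at this
        change ‖((F.A n).symm x.1, (F.B n).symm x.2)‖ ≤ _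
        rw [Prod.norm_mk]
        refine max_le ?_ ?_
        · have h5 : 1 * ‖(F.A n).symm x.1‖ ≤ q * α * ‖(F.A n).symm x.1‖ := by gcongr
          nlinarith
        · nlinarith [norm_nonneg ((F.B n).symm x.2), norm_nonneg x.2])
      hgg hL (by simp [hF.gs0, hF.gu0]) (by
        have h1 := ((hF.gs n).hasFDerivAt 0).prodMk ((hF.gu n).hasFDerivAt 0)
        rw [h1.fderiv, hF.dgs0, hF.dgu0]
        ext <;> simp) (by linarith)
    exact ⟨e, γ, h1, h2, h3⟩
  choose e γ he hes hγ hγ0 hdγ0 using hinv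
  -- the time-reversed system
  let sw : U × S →L[ℝ] S × U :=
    (ContinuousLinearMap.snd ℝ U S).prod (ContinuousLinearMap.fst ℝ U S)
  have hsw : ‖sw‖ ≤ 1 := ContinuousLinearMap.opNorm_le_bound _ zero_le_one fun x => by
    rw [one_mul]
    change ‖(x.2, x.1)‖ ≤ ‖x‖
    rw [Prod.norm_mk]
    exact max_le (norm_snd_le x) (norm_fst_le x)
  let G : Sys U S :=
    { A := fun n => (F.B (-n - 1)).symm
      B := fun n => (F.A (-n - 1)).symm
      gs := fun n x => (γ (-n - 1) (sw x)).2
      gu := fun n x => (γ (-n - 1) (sw x)).1 }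
  have hcomp : ∀ n, C11 (fun x => γ n (sw x)) c' L₁ := fun n => (hγ n).comp_clm hL₁0 sw hsw
  have hγd : ∀ n, HasFDerivAt (fun x => γ n (sw x)) (0 : U × S →L[ℝ] S × U) 0 := by
    intro n
    have h1 : HasFDerivAt (γ n) (0 : S × U →L[ℝ] S × U) (sw 0) := by
      rw [map_zero, ← hdγ0 n]; exact (hγ n).hasFDerivAt 0
    have h2 := HasFDerivAt.comp (f := fun x => sw x) (0 : U × S) h1 (sw.hasFDerivAt)
    rwa [ContinuousLinearMap.zero_comp] at h2
  have hG : G.Good (1 / a) (1 / b) c' L₁ := by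
    refine ⟨fun n s => ?_, fun n u => ?_, fun n => ?_, fun n => ?_, fun n => ?_, fun n => ?_,
      fun n => ?_, fun n => ?_, by positivity, hL₁0⟩
    · have h2 := hF.hB (-n - 1) ((F.B (-n - 1)).symm s)
      rw [ContinuousLinearEquiv.apply_symm_apply] at h2
      rw [one_div_mul_eq_div, le_div_iff₀ ha0, mul_comm]
      exact h2
    · have h2 := hF.hA (-n - 1) ((F.A (-n - 1)).symm u)
      rw [ContinuousLinearEquiv.apply_symm_apply] at h2
      rw [one_div_mul_eq_div, div_le_iff₀ hb0, mul_comm]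
      exact h2
    · exact (hcomp _).clm_comp hL₁0 (ContinuousLinearMap.snd ℝ S U)
        (ContinuousLinearMap.norm_snd_le _ _ _)
    · exact (hcomp _).clm_comp hL₁0 (ContinuousLinearMap.fst ℝ S U)
        (ContinuousLinearMap.norm_fst_le _ _ _)
    · simp [G, hγ0]
    · simp [G, hγ0]
    · have h := (ContinuousLinearMap.snd ℝ S U).hasFDerivAt.comp (0 : U × S) (hγd (-n - 1))
      rw [ContinuousLinearMap.comp_zero] at h
      exact h.fderiv
    · have h := (ContinuousLinearMap.fst ℝ S U).hasFDerivAt.comp (0 : U × S) (hγd (-n - 1))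
      rw [ContinuousLinearMap.comp_zero] at h
      exact h.fderiv
  obtain ⟨Q, γu, ρ₁, hρ₁, hQ1, hQ2, hQ3, hQ4, hQ5, hQ6⟩ :=
    exists_unstable_factor hF hβ0 hβ (hg₁ L) hc hsm₁
  obtain ⟨P, γs, ρ₂, hρ₂, hP1, hP2, hP3, hP4, hP5, hP6⟩ :=
    exists_unstable_factor (β := 1 / α) hG (by positivity) (fun n u => by
      have h2 := hα (-n - 1) ((F.A (-n - 1)).symm u)
      rw [ContinuousLinearEquiv.apply_symm_apply] at h2
      rw [one_div_mul_eq_div, le_div_iff₀ hα0, mul_comm]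
      exact h2) (hg₂ L₁) hc'0 hsm₂
  let f : ℤ → S × U → S × U := fun n x => (P (-n) (x.2, x.1), Q n x)
  have hfd : ∀ n, ContDiff ℝ 1 (f n) := fun n =>
    ((hP1 (-n)).comp (contDiff_snd.prodMk contDiff_fst)).prodMk (hQ1 n)
  have hfx : ∀ n x, ‖f n x - x‖ ≤ 1 / 2 * ‖x‖ := by
    intro n x
    have h1 := hP4 (-n) (x.2, x.1)
    have h2 : ‖((x.2, x.1) : U × S)‖ = ‖x‖ := by rw [Prod.norm_mk, max_comm, Prod.norm_def]
    rw [h2] at h1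
    rw [Prod.norm_def]
    exact max_le h1 (hQ4 n x)
  have hloc : ∀ n, ∀ R : ℝ, ∃ κ > 0, ∀ x y, ‖x‖ ≤ R → ‖y‖ ≤ R →
      κ * ‖x - y‖ ≤ ‖f n x - f n y‖ := by
    intro n R
    obtain ⟨κ₁, hκ₁, h1⟩ := hQ6 R
    obtain ⟨κ₂, hκ₂, h2⟩ := hP6 R
    refine ⟨min κ₁ κ₂, by positivity, fun x y hx hy => ?_⟩
    have hswn : ∀ x : S × U, ‖((x.2, x.1) : U × S)‖ = ‖x‖ := fun x => by
      rw [Prod.norm_mk, max_comm, Prod.norm_def]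
    rw [Prod.norm_def (f n x - f n y)]
    rcases le_total ‖x.1 - y.1‖ ‖x.2 - y.2‖ with hxy | hxy
    · have e : ‖x - y‖ = ‖x.2 - y.2‖ := by rw [Prod.norm_def]; exact max_eq_right hxy
      rw [e]
      refine le_max_of_le_right (le_trans ?_ (h1 n x y hx hy hxy))
      gcongr
      exact min_le_left _ _
    · have e : ‖x - y‖ = ‖x.1 - y.1‖ := by rw [Prod.norm_def]; exact max_eq_left hxy
      rw [e]
      refine le_max_of_le_left (le_trans ?_ (h2 (-n) (x.2, x.1) (y.2, y.1)
        ((hswn x).le.trans hx) ((hswn y).le.trans hy) hxy))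
      gcongr
      exact min_le_right _ _
  have hprop : ∀ n x, 1 / 2 * ‖x‖ ≤ ‖f n x‖ := by
    intro n x
    have h1 := hfx n x
    have h2 := norm_sub_norm_le x (f n x)
    rw [norm_sub_rev] at h2
    linarith
  choose Ψ hΨ hΨs hT using fun n =>
    exists_equiv_of_expanding (hfd n) (hloc n) (κ₀ := 1 / 2) (by norm_num) (hprop n)
  have hΨeq : ∀ n, (Ψ n : S × U → S × U) = f n := fun n => funext (hΨ n)
  have hfD : ∀ n x, ‖x‖ < min ρ₁ ρ₂ →
      ‖fderiv ℝ (f n) x - ContinuousLinearMap.id ℝ (S × U)‖ ≤ 1 / 2 := by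
    intro n x hx
    have hsx : ‖((x.2, x.1) : U × S)‖ = ‖x‖ := by rw [Prod.norm_mk, max_comm, Prod.norm_def]
    have h1 := hP5 (-n) (x.2, x.1) (by rw [hsx]; exact hx.trans_le (min_le_right _ _))
    have h2 := hQ5 n x (hx.trans_le (min_le_left _ _))
    have hd1 : HasFDerivAt (fun x : S × U => P (-n) (x.2, x.1))
        ((fderiv ℝ (P (-n)) (x.2, x.1)).comp
          ((ContinuousLinearMap.snd ℝ S U).prod (ContinuousLinearMap.fst ℝ S U))) x :=
      HasFDerivAt.comp (g := P (-n)) (f := fun x : S × U => (x.2, x.1)) x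
        (hasFDerivAt_of_contDiff (hP1 (-n)) _) (hasFDerivAt_snd.prodMk hasFDerivAt_fst)
    have hd := (hd1.prodMk (hasFDerivAt_of_contDiff (hQ1 n) x)).fderiv
    have hd' : fderiv ℝ (f n) x = _ := hd
    rw [hd']
    refine ContinuousLinearMap.opNorm_le_bound _ (by norm_num) fun v => ?_
    have hsv : ‖((v.2, v.1) : U × S)‖ = ‖v‖ := by rw [Prod.norm_mk, max_comm, Prod.norm_def]
    have k1 := ContinuousLinearMap.le_of_opNorm_le _ h1 (v.2, v.1)
    rw [hsv] at k1
    exact max_le k1 (ContinuousLinearMap.le_of_opNorm_le _ h2 v)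
  have hΨ0 : ∀ n, Ψ n 0 = 0 := fun n => by
    have := hfx n 0
    rw [norm_zero, mul_zero, sub_zero, norm_le_zero_iff] at this
    rw [hΨ, this]
  refine ⟨Ψ, fun n => γs (-n - 1), γu, min ρ₁ ρ₂ / 2, by positivity, fun n => ⟨?_, hΨs n, hΨ0 n⟩,
    fun n x => ?_, fun n x => ?_, fun n => ?_, fun n => ?_, fun n x hx => ⟨?_, ?_⟩⟩
  · rw [hΨeq]; exact hfd n
  · have h1 := hP2 (-n - 1) ((F.u n x), (F.s n x))
    have h2 := hes n (F.s n x, F.u n x)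
    rw [← he, Equiv.symm_apply_apply] at h2
    have e1 : -(-n - 1) - 1 = n := by ring
    have e2 : -n - 1 = -(n + 1) := by ring
    have h3 : (G.s (-n - 1) (F.u n x, F.s n x), G.u (-n - 1) (F.u n x, F.s n x))
        = (x.2, x.1) := by
      simp only [Sys.s, Sys.u, G, e1]
      rw [he] at h2
      have h2a := congrArg Prod.fst h2
      have h2b := congrArg Prod.snd h2
      exact Prod.ext h2b.symm h2a.symm
    rw [h3] at h1
    rw [hΨ, hΨ]
    change P (-n) (x.2, x.1) = (F.A n).symm (P (-(n + 1)) (F.u n x, F.s n x))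
      + γs (-n - 1) (P (-(n + 1)) (F.u n x, F.s n x))
    have e3 : -n - 1 + 1 = -n := by ring
    rw [e3] at h1
    rw [h1, ← e2]
    simp only [G, e1]
  · rw [hΨ, hΨ]
    exact hQ2 n x
  · obtain ⟨h1, h2, h3⟩ := hP3 (-n - 1)
    exact ⟨h1.mono le_rfl (le_max_right _ _), h2, h3⟩
  · obtain ⟨h1, h2, h3⟩ := hQ3 n
    refine ⟨h1.mono ?_ (le_max_left _ _), h2, h3⟩
    have h4 : 1 ≤ 2 * q ^ 2 := by nlinarith
    rw [hc']
    exact le_mul_of_one_le_left hc.le h4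
  · rw [hΨeq]
    exact (norm_fderiv_le_two (hfD n x (by have := norm_nonneg x; linarith))).1
  · obtain ⟨y, rfl⟩ := (Ψ n).surjective x
    obtain ⟨T, hT1, hT2⟩ := hT n y
    have h1 : ‖y‖ < min ρ₁ ρ₂ := by
      have := hprop n y
      rw [hΨ] at hx
      linarith
    have h2 := (norm_fderiv_le_two (hfD n y h1)).2 T hT1
    rw [hΨ, hT2]
    exact h2

end Decoupling

section Cutoff

variable {X : Type*} [NormedAddCommGroup X] [NormedSpace ℝ X]

/-- A smooth map with bounded range that is the identity on the unit ball. -/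
theorem exists_retract [FiniteDimensional ℝ X] :
    ∃ (s : X → X) (C : ℝ), 1 ≤ C ∧ C11 s C C ∧ (∀ x, ‖x‖ ≤ 1 → s x = x) ∧ ∀ x, ‖s x‖ ≤ C := by
  let χ : ContDiffBump (0 : X) := ⟨1, 2, one_pos, one_lt_two⟩
  let s : X → X := fun x => χ x • x
  have hs : ContDiff ℝ 2 s := χ.contDiff.smul contDiff_id
  have hcs : HasCompactSupport s := χ.hasCompactSupport.smul_right
  have h1 : ContDiff ℝ 1 (fderiv ℝ s) := hs.fderiv_right (by norm_num)
  obtain ⟨C₀, hC₀⟩ := hcs.exists_bound_of_continuous hs.continuous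
  obtain ⟨C₁, hC₁⟩ := (hcs.fderiv (𝕜 := ℝ)).exists_bound_of_continuous h1.continuous
  obtain ⟨C₂, hC₂⟩ := ((hcs.fderiv (𝕜 := ℝ)).fderiv (𝕜 := ℝ)).exists_bound_of_continuous
    (h1.continuous_fderiv one_ne_zero)
  refine ⟨s, max 1 (max C₀ (max C₁ C₂)), le_max_left _ _, ⟨hs.of_le (by norm_num), fun x => ?_,
    fun x y => ?_⟩, fun x hx => ?_, fun x => ?_⟩
  · exact (hC₁ x).trans ((le_max_left _ _).trans ((le_max_right _ _).trans (le_max_right _ _)))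
  · exact norm_sub_le_of_fderiv h1 (fun z => (hC₂ z).trans
      ((le_max_right _ _).trans ((le_max_right _ _).trans (le_max_right _ _)))) x y
  · have : χ x = 1 := χ.one_of_mem_closedBall (by simpa using hx)
    simp [s, this]
  · exact (hC₀ x).trans ((le_max_left _ _).trans (le_max_right _ _))

/-- Complementary projections of norm at most one. -/
structure Proj2 (P Q : X →L[ℝ] X) : Prop where
  add : ∀ x, P x + Q x = x
  PP : ∀ x, P (P x) = P x
  QQ : ∀ x, Q (Q x) = Q x
  PQ : ∀ x, P (Q x) = 0
  QP : ∀ x, Q (P x) = 0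
  nP : ∀ x, ‖P x‖ ≤ ‖x‖
  nQ : ∀ x, ‖Q x‖ ≤ ‖x‖

/-- A smooth map of small range that is the identity near zero and respects the fibres of `Q`. -/
theorem exists_fibred_retract [FiniteDimensional ℝ X] {P Q : X →L[ℝ] X} (hPQ : Proj2 P Q) :
    ∃ C : ℝ, 1 ≤ C ∧ ∀ ρ : ℝ, 0 < ρ → ∃ r : X → X, C11 r C (C / ρ) ∧
      (∀ x, ‖x‖ ≤ ρ → r x = x) ∧ (∀ x, ‖r x‖ ≤ C * ρ) ∧ (∀ x, ‖r x‖ ≤ C * ‖x‖) ∧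
      ∀ x y, Q x = Q y → Q (r x) = Q (r y) := by
  obtain ⟨s, C, hC, hs, hs1, hsC⟩ := exists_retract (X := X)
  have hP1 : ‖P‖ ≤ 1 := P.opNorm_le_bound zero_le_one fun x => by simpa using hPQ.nP x
  have hQ1 : ‖Q‖ ≤ 1 := Q.opNorm_le_bound zero_le_one fun x => by simpa using hPQ.nQ x
  refine ⟨2 * C, by linarith, fun ρ hρ => ?_⟩
  let t : X → X := fun x => ρ • s (ρ⁻¹ • x)
  have ht : C11 t C (C / ρ) := by
    have h1 : C11 (fun x => (ρ⁻¹ • ContinuousLinearMap.id ℝ X) x) ρ⁻¹ 0 :=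
      C11.clm_of_le _ (by positivity) fun x => by
        simp [norm_smul, abs_of_pos hρ]
    have h2 : C11 (fun x => (ρ • ContinuousLinearMap.id ℝ X) x) ρ 0 :=
      C11.clm_of_le _ (by positivity) fun x => by
        simp [norm_smul, abs_of_pos hρ]
    refine (h2.comp (hs.comp h1 (by linarith)) le_rfl).mono ?_ ?_
    · rw [mul_comm C, mul_inv_cancel_left₀ hρ.ne']
    · apply le_of_eq; field_simp; ring
  have ht1 : ∀ x, ‖x‖ ≤ ρ → t x = x := by
    intro x hx
    have h1 : ‖ρ⁻¹ • x‖ ≤ 1 := by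
      rw [norm_smul, norm_inv, Real.norm_eq_abs, abs_of_pos hρ, inv_mul_le_iff₀ hρ, mul_one]
      exact hx
    simp only [t]
    rw [hs1 _ h1, smul_inv_smul₀ hρ.ne']
  have htC : ∀ x, ‖t x‖ ≤ C * ρ := by
    intro x
    simp only [t]
    rw [norm_smul, Real.norm_eq_abs, abs_of_pos hρ, mul_comm]
    gcongr
    exact hsC _
  have ht0 : t 0 = 0 := ht1 0 (by simpa using hρ.le)
  have htle : ∀ x, ‖t x‖ ≤ C * ‖x‖ := ht.norm_le ht0
  have hCρ : 0 ≤ C / ρ := by positivity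
  have hr : C11 (fun x => P (t (P x)) + Q (t (Q x))) (C + C) (C / ρ + C / ρ) :=
    ((ht.comp_clm hCρ P hP1).clm_comp hCρ P hP1).add
      ((ht.comp_clm hCρ Q hQ1).clm_comp hCρ Q hQ1)
  refine ⟨fun x => P (t (P x)) + Q (t (Q x)), hr.mono (by linarith) (by apply le_of_eq; ring),
    fun x hx => ?_, fun x => ?_, fun x => ?_, fun x y hxy => ?_⟩
  · simp only
    rw [ht1 _ ((hPQ.nP x).trans hx), ht1 _ ((hPQ.nQ x).trans hx), hPQ.PP, hPQ.QQ, hPQ.add]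
  · refine (norm_add_le _ _).trans ?_
    have h1 := (hPQ.nP (t (P x))).trans (htC _)
    have h2 := (hPQ.nQ (t (Q x))).trans (htC _)
    linarith
  · refine (norm_add_le _ _).trans ?_
    have h1 := (hPQ.nP (t (P x))).trans (htle _)
    have h2 := (hPQ.nQ (t (Q x))).trans (htle _)
    nlinarith [hPQ.nP x, hPQ.nQ x]
  · simp only
    rw [map_add, map_add, hPQ.QP, hPQ.QP, hxy]

/-- Nonlinearities with values in the range of `P` which are of second order at the origin and of
class `C^{1,1}` along the fibres of `Q`. -/
structure SClass (P Q : X →L[ℝ] X) (g : X → X) (L : ℝ) : Prop where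
  contDiff : ContDiff ℝ 1 g
  zero : g 0 = 0
  mem : ∀ x, P (g x) = g x
  bound : ∀ x, ‖fderiv ℝ g x‖ ≤ L * ‖x‖
  lip : ∀ x y, Q x = Q y → ‖fderiv ℝ g x - fderiv ℝ g y‖ ≤ L * ‖x - y‖

theorem map_fderiv_of_forall {f : X → X} (hf : ContDiff ℝ 1 f) {T : X →L[ℝ] X}
    (h : ∀ x, T (f x) = f x) (x ζ : X) : T (fderiv ℝ f x ζ) = fderiv ℝ f x ζ := by
  have h1 := T.hasFDerivAt.comp x (hasFDerivAt_of_contDiff hf x)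
  have e : T ∘ f = f := funext h
  rw [e] at h1
  conv_rhs => rw [h1.fderiv]
  rfl

theorem map_fderiv_eq_zero {f : X → X} (hf : ContDiff ℝ 1 f) {T : X →L[ℝ] X}
    (h : ∀ x, T (f x) = 0) (x ζ : X) : T (fderiv ℝ f x ζ) = 0 := by
  have h1 := T.hasFDerivAt.comp x (hasFDerivAt_of_contDiff hf x)
  have e : T ∘ f = fun _ => 0 := funext h
  rw [e] at h1
  have := h1.unique (hasFDerivAt_const 0 x)
  exact congrArg (fun S : X →L[ℝ] X => S ζ) this

theorem SClass.mono {P Q : X →L[ℝ] X} {g : X → X} {L L' : ℝ} (hg : SClass P Q g L) (h : L ≤ L') :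
    SClass P Q g L' :=
  ⟨hg.contDiff, hg.zero, hg.mem, fun x => (hg.bound x).trans (by gcongr),
    fun x y hxy => (hg.lip x y hxy).trans (by gcongr)⟩

/-- Cutting off a second order nonlinearity makes its derivative globally small. -/
theorem SClass.of_cutoff {P Q : X →L[ℝ] X} {g r : X → X} {L C ρ : ℝ} (hL : 0 ≤ L)
    (hC : 1 ≤ C) (hρ : 0 < ρ) (hgc : ContDiff ℝ 1 g) (hg0 : g 0 = 0)
    (hgm : ∀ x, P (g x) = g x) (hgb : ∀ x, ‖x‖ ≤ C * ρ → ‖fderiv ℝ g x‖ ≤ L * ‖x‖)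
    (hgl : ∀ x y, ‖x‖ ≤ C * ρ → ‖y‖ ≤ C * ρ → Q x = Q y →
      ‖fderiv ℝ g x - fderiv ℝ g y‖ ≤ L * ‖x - y‖) (hr : C11 r C (C / ρ))
    (hr1 : ∀ x, ‖x‖ ≤ ρ → r x = x) (hrρ : ∀ x, ‖r x‖ ≤ C * ρ) (hrx : ∀ x, ‖r x‖ ≤ C * ‖x‖)
    (hrQ : ∀ x y, Q x = Q y → Q (r x) = Q (r y)) :
    SClass P Q (fun x => g (r x)) (2 * C ^ 2 * L) ∧
      (∀ x, ‖fderiv ℝ (fun x => g (r x)) x‖ ≤ C ^ 2 * L * ρ) ∧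
      ∀ x, ‖g (r x)‖ ≤ L * (C * ρ) * (C * ρ) := by
  have hd : ∀ x, HasFDerivAt (fun x => g (r x)) ((fderiv ℝ g (r x)).comp (fderiv ℝ r x)) x :=
    fun x => (hasFDerivAt_of_contDiff hgc (r x)).comp x (hr.hasFDerivAt x)
  have hfd : ∀ x, fderiv ℝ (fun x => g (r x)) x = (fderiv ℝ g (r x)).comp (fderiv ℝ r x) :=
    fun x => (hd x).fderiv
  have hb : ∀ x, ‖(fderiv ℝ g (r x)).comp (fderiv ℝ r x)‖ ≤ L * ‖r x‖ * C := fun x =>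
    (ContinuousLinearMap.opNorm_comp_le _ _).trans
      (mul_le_mul (hgb _ (hrρ _)) (hr.bound x) (norm_nonneg _) (by positivity))
  refine ⟨⟨hgc.comp hr.contDiff, ?_, fun x => hgm _, fun x => ?_, fun x y hxy => ?_⟩,
    fun x => ?_, fun x => ?_⟩
  · rw [hr1 0 (by simpa using hρ.le), hg0]
  · rw [hfd]
    refine (hb x).trans ?_
    have h1 : L * ‖r x‖ * C ≤ L * (C * ‖x‖) * C := by gcongr; exact hrx x
    have h2 : 0 ≤ C ^ 2 * L * ‖x‖ := by positivity
    nlinarith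
  · rw [hfd, hfd]
    have e : (fderiv ℝ g (r x)).comp (fderiv ℝ r x) - (fderiv ℝ g (r y)).comp (fderiv ℝ r y)
        = (fderiv ℝ g (r x)).comp (fderiv ℝ r x - fderiv ℝ r y)
          + (fderiv ℝ g (r x) - fderiv ℝ g (r y)).comp (fderiv ℝ r y) := by
      ext v; simp
    rw [e]
    have h1 : ‖(fderiv ℝ g (r x)).comp (fderiv ℝ r x - fderiv ℝ r y)‖
        ≤ (L * (C * ρ)) * (C / ρ * ‖x - y‖) :=
      (ContinuousLinearMap.opNorm_comp_le _ _).trans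
        (mul_le_mul ((hgb _ (hrρ _)).trans (by gcongr; exact hrρ x)) (hr.lip x y) (norm_nonneg _)
          (by positivity))
    have h2 : ‖(fderiv ℝ g (r x) - fderiv ℝ g (r y)).comp (fderiv ℝ r y)‖
        ≤ (L * (C * ‖x - y‖)) * C :=
      (ContinuousLinearMap.opNorm_comp_le _ _).trans
        (mul_le_mul ((hgl _ _ (hrρ x) (hrρ y) (hrQ x y hxy)).trans (by gcongr; exact hr.lipschitz x y))
          (hr.bound y) (norm_nonneg _) (by positivity))
    refine (norm_add_le _ _).trans ((add_le_add h1 h2).trans (le_of_eq ?_))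
    field_simp
    ring
  · rw [hfd]
    refine (hb x).trans ?_
    have h1 : L * ‖r x‖ * C ≤ L * (C * ρ) * C := by gcongr; exact hrρ x
    linarith
  · have key := (convex_closedBall (0 : X) (C * ρ)).norm_image_sub_le_of_norm_fderiv_le (𝕜 := ℝ)
      (f := g) (C := L * (C * ρ)) (x := 0) (y := r x)
      (fun z _ => hgc.differentiable one_ne_zero z)
      (fun z hz => (hgb z (by simpa using hz)).trans (by gcongr; simpa using hz))
      (by simp; positivity) (by simpa using hrρ x)
    rw [hg0, sub_zero, sub_zero] at key
    exact key.trans (by gcongr; exact hrρ x)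

end Cutoff

section SlowGraph

variable {X : Type*} [NormedAddCommGroup X] [NormedSpace ℝ X]

/-- A contracting block-diagonal linear family: rate at most `b` on the range of `P`, at least
`a` on the range of `Q`, and at most `B` everywhere. -/
structure Rates (P Q : X →L[ℝ] X) (A : ℤ → X ≃L[ℝ] X) (b a B : ℝ) : Prop where
  comm : ∀ n x, Q (A n x) = A n (Q x)
  up : ∀ n x, P x = x → ‖A n x‖ ≤ b * ‖x‖
  lo : ∀ n x, Q x = x → a * ‖x‖ ≤ ‖A n x‖
  all : ∀ n x, ‖A n x‖ ≤ B * ‖x‖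

theorem Rates.norm_symm {P Q : X →L[ℝ] X} {A : ℤ → X ≃L[ℝ] X} {b a B : ℝ} (hPQ : Proj2 P Q)
    (hA : Rates P Q A b a B) (ha : 0 < a) (n : ℤ) (x : X) :
    ‖Q ((A n).symm x)‖ ≤ ‖Q x‖ / a := by
  have h := hA.lo n (Q ((A n).symm x)) (hPQ.QQ _)
  rw [← hA.comm, ContinuousLinearEquiv.apply_symm_apply] at h
  rw [le_div_iff₀ ha, mul_comm]
  exact h

/-- The iterates of the graph transform of the slow manifold. -/
def slowIter (Q : X →L[ℝ] X) (A : ℤ → X ≃L[ℝ] X) (g : ℤ → X → X) : ℕ → ℤ → X → X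
  | 0, _ => fun _ => 0
  | j + 1, n => fun w =>
      A (n - 1) (slowIter Q A g j (n - 1) ((A (n - 1)).symm w))
        + g (n - 1) (slowIter Q A g j (n - 1) ((A (n - 1)).symm w) + Q ((A (n - 1)).symm w))

theorem exists_slow_graph [CompleteSpace X] {P Q : X →L[ℝ] X} (hPQ : Proj2 P Q)
    {A : ℤ → X ≃L[ℝ] X} {b a B : ℝ} (hA : Rates P Q A b a B) {g : ℤ → X → X} {L η G : ℝ}
    (hL : 0 ≤ L) (hg : ∀ n, SClass P Q (g n) L) (hη : ∀ n x, ‖fderiv ℝ (g n) x‖ ≤ η)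
    (hG : ∀ n x, ‖g n x‖ ≤ G) (hb0 : 0 ≤ b) (hab : b + 2 * η ≤ a) (hηpos : 0 < η)
    (hb1 : b + η < 1) :
    ∃ h : ℤ → X → X, (∀ n, ContDiff ℝ 1 (h n)) ∧ (∀ n, h n 0 = 0) ∧
      (∀ n x, P (h n x) = h n x) ∧ (∀ n x ζ, ‖fderiv ℝ (h n) x ζ‖ ≤ ‖Q ζ‖) ∧
      ∀ n x, h (n + 1) (A n x) = A n (h n x) + g n (h n x + Q x) := by
  have ha : 0 < a := by linarith
  have hG0 : 0 ≤ G := (norm_nonneg _).trans (hG 0 0)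
  set H := slowIter Q A g with hH
  have hPA : ∀ n x, P x = x → P (A n x) = A n x := by
    intro n x hx
    have h1 := hPQ.add (A n x)
    have h2 : Q x = 0 := by rw [← hx, hPQ.QP]
    rw [hA.comm, h2, map_zero, add_zero] at h1
    exact h1
  have hCD : ∀ j n, ContDiff ℝ 1 (H j n) := by
    intro j
    induction j with
    | zero => intro n; exact contDiff_const
    | succ j ih =>
      intro n
      have h1 : ContDiff ℝ 1 fun w => H j (n - 1) ((A (n - 1)).symm w) :=
        (ih (n - 1)).comp (A (n - 1)).symm.contDiff
      exact ((A (n - 1)).contDiff.comp h1).add ((hg (n - 1)).contDiff.comp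
        (h1.add (Q.contDiff.comp (A (n - 1)).symm.contDiff)))
  have hPH : ∀ j n x, P (H j n x) = H j n x := by
    intro j
    induction j with
    | zero => intro n x; exact map_zero P
    | succ j ih =>
      intro n x
      change P (_ + _) = _ + _
      rw [map_add, hPA _ _ (ih _ _), (hg _).mem]
  have hQH : ∀ j n x, Q (H j n x) = 0 := fun j n x => by rw [← hPH, hPQ.QP]
  have hfd : ∀ j n w ζ, fderiv ℝ (H (j + 1) n) w ζ
      = A (n - 1) (fderiv ℝ (H j (n - 1)) ((A (n - 1)).symm w) ((A (n - 1)).symm ζ))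
        + fderiv ℝ (g (n - 1)) (H j (n - 1) ((A (n - 1)).symm w) + Q ((A (n - 1)).symm w))
          (fderiv ℝ (H j (n - 1)) ((A (n - 1)).symm w) ((A (n - 1)).symm ζ)
            + Q ((A (n - 1)).symm ζ)) := by
    intro j n w ζ
    have h0 : HasFDerivAt (fun w => (A (n - 1)).symm w)
        ((A (n - 1)).symm : X →L[ℝ] X) w := (A (n - 1)).symm.hasFDerivAt
    have h1 := HasFDerivAt.comp (f := fun w => (A (n - 1)).symm w) w
      (hasFDerivAt_of_contDiff (hCD j (n - 1)) ((A (n - 1)).symm w)) h0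
    have h2 := (Q.hasFDerivAt (x := (A (n - 1)).symm w)).comp w h0
    have h3 := HasFDerivAt.comp (f := fun w => H j (n - 1) ((A (n - 1)).symm w)
      + Q ((A (n - 1)).symm w)) w (hasFDerivAt_of_contDiff (hg (n - 1)).contDiff _) (h1.add h2)
    have h4 := ((A (n - 1) : X →L[ℝ] X).hasFDerivAt.comp w h1).add h3
    have h5 : fderiv ℝ (H (j + 1) n) w = _ := h4.fderiv
    rw [h5]
    rfl
  have hD : ∀ j n x ζ, ‖fderiv ℝ (H j n) x ζ‖ ≤ ‖Q ζ‖ := by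
    intro j
    induction j with
    | zero =>
      intro n x ζ
      have : fderiv ℝ (H 0 n) x = 0 := fderiv_const_apply 0
      rw [this]; simp
    | succ j ih =>
      intro n w ζ
      rw [hfd]
      set v := (A (n - 1)).symm w
      set ζ' := (A (n - 1)).symm ζ with hζ'
      have h1 : ‖Q ζ'‖ ≤ ‖Q ζ‖ / a := hA.norm_symm hPQ ha _ _
      have h2 := ih (n - 1) v ζ'
      have h3 := hA.up (n - 1) _ (map_fderiv_of_forall (hCD j (n - 1)) (hPH j (n - 1)) v ζ')
      have h4 := ContinuousLinearMap.le_of_opNorm_le_of_le _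
        (hη (n - 1) (H j (n - 1) v + Q v)) ((norm_add_le (fderiv ℝ (H j (n - 1)) v ζ') (Q ζ')).trans
          (add_le_add_left h2 _))
      rw [le_div_iff₀ ha] at h1
      refine (norm_add_le _ _).trans ((add_le_add h3 h4).trans ?_)
      calc b * ‖fderiv ℝ (H j (n - 1)) v ζ'‖ + η * (‖Q ζ'‖ + ‖Q ζ'‖)
          ≤ b * ‖Q ζ'‖ + η * (‖Q ζ'‖ + ‖Q ζ'‖) := by gcongr
        _ = (b + 2 * η) * ‖Q ζ'‖ := by ring
        _ ≤ a * ‖Q ζ'‖ := by gcongr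
        _ ≤ ‖Q ζ‖ := by linarith
  set μ := max (b + η) ((b + 2 * η) / (a + η)) with hμdef
  have hμ1 : μ < 1 := max_lt hb1 (by rw [div_lt_one (by positivity)]; linarith)
  have hμ0 : 0 < μ := lt_max_of_lt_left (by linarith)
  have hμa : (b + 2 * η) ≤ μ * (a + η) := by
    rw [← div_le_iff₀ (by positivity)]; exact le_max_right _ _
  have hμb : b + η ≤ μ := le_max_left _ _
  have hE : ∀ j n x, ‖H (j + 1) n x - H j n x‖ ≤ G * μ ^ j := by
    intro j
    induction j with
    | zero =>
      intro n x
      change ‖A (n - 1) 0 + g (n - 1) (0 + _) - 0‖ ≤ _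
      rw [map_zero, sub_zero, zero_add, pow_zero, mul_one]
      exact hG _ _
    | succ j ih =>
      intro n w
      set v := (A (n - 1)).symm w with hv
      have h1 := ih (n - 1) v
      have h2 := hA.up (n - 1) (H (j + 1) (n - 1) v - H j (n - 1) v) (by
        rw [map_sub, hPH, hPH])
      have h3 := norm_sub_le_of_fderiv (hg (n - 1)).contDiff (hη (n - 1))
        (H (j + 1) (n - 1) v + Q v) (H j (n - 1) v + Q v)
      rw [add_sub_add_right_eq_sub] at h3
      have e : H (j + 1 + 1) n w - H (j + 1) n w
          = A (n - 1) (H (j + 1) (n - 1) v - H j (n - 1) v)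
            + (g (n - 1) (H (j + 1) (n - 1) v + Q v) - g (n - 1) (H j (n - 1) v + Q v)) := by
        change A (n - 1) (H (j + 1) (n - 1) v) + g (n - 1) (H (j + 1) (n - 1) v + Q v)
          - (A (n - 1) (H j (n - 1) v) + g (n - 1) (H j (n - 1) v + Q v)) = _
        rw [map_sub]; abel
      rw [e]
      refine (norm_add_le _ _).trans ((add_le_add h2 h3).trans ?_)
      rw [← add_mul, pow_succ]
      calc (b + η) * ‖H (j + 1) (n - 1) v - H j (n - 1) v‖ ≤ μ * (G * μ ^ j) := by gcongr
        _ = _ := by ring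
  obtain ⟨D, hD0, hD1, hDL⟩ : ∃ D : ℝ, 0 ≤ D ∧ 1 ≤ D ∧
      ((b + η) * D + 2 * L * G) ≤ D * μ * a := by
    have hpos : 0 < μ * a - (b + η) := by nlinarith
    refine ⟨1 + 2 * L * G / (μ * a - (b + η)), by positivity, by
      have : 0 ≤ 2 * L * G / (μ * a - (b + η)) := by positivity
      linarith, ?_⟩
    have : 2 * L * G / (μ * a - (b + η)) * (μ * a - (b + η)) = 2 * L * G :=
      div_mul_cancel₀ _ hpos.ne'
    nlinarith
  have hDD : ∀ j n x ζ, ‖fderiv ℝ (H (j + 1) n) x ζ - fderiv ℝ (H j n) x ζ‖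
      ≤ D * μ ^ j * ‖Q ζ‖ := by
    intro j
    induction j with
    | zero =>
      intro n x ζ
      have : fderiv ℝ (H 0 n) x = 0 := fderiv_const_apply 0
      rw [this, zero_apply, sub_zero, pow_zero, mul_one]
      exact (hD 1 n x ζ).trans (le_mul_of_one_le_left (norm_nonneg _) hD1)
    | succ j ih =>
      intro n w ζ
      rw [hfd (j + 1) n w ζ, hfd j n w ζ]
      set v := (A (n - 1)).symm w
      set ζ' := (A (n - 1)).symm ζ with hζ'
      have h1 : ‖Q ζ'‖ ≤ ‖Q ζ‖ / a := hA.norm_symm hPQ ha _ _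
      rw [le_div_iff₀ ha] at h1
      have h2 := ih (n - 1) v ζ'
      set p₁ := fderiv ℝ (H (j + 1) (n - 1)) v ζ' with hp₁
      set p₀ := fderiv ℝ (H j (n - 1)) v ζ' with hp₀
      have h3 := hA.up (n - 1) (p₁ - p₀) (by
        rw [map_sub, hp₁, hp₀, map_fderiv_of_forall (hCD (j + 1) (n - 1)) (hPH (j + 1) (n - 1)) v ζ',
          map_fderiv_of_forall (hCD j (n - 1)) (hPH j (n - 1)) v ζ'])
      set y₁ := H (j + 1) (n - 1) v + Q v with hy₁
      set y₀ := H j (n - 1) v + Q v with hy₀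
      have h4 : ‖y₁ - y₀‖ ≤ G * μ ^ j := by
        rw [hy₁, hy₀, add_sub_add_right_eq_sub]
        exact hE j (n - 1) v
      have h5 := (hg (n - 1)).lip y₁ y₀ (by
        rw [hy₁, hy₀, map_add, map_add, hQH, hQH])
      have h6 := ContinuousLinearMap.le_of_opNorm_le _ (hη (n - 1) y₁) (p₁ - p₀)
      have h7 : ‖p₀ + Q ζ'‖ ≤ 2 * ‖Q ζ'‖ := by
        have := hD j (n - 1) v ζ'
        exact (norm_add_le _ _).trans (by linarith)
      have h8 := ContinuousLinearMap.le_of_opNorm_le_of_le _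
        (h5.trans (mul_le_mul_of_nonneg_left h4 hL)) h7
      have e : A (n - 1) p₁ + fderiv ℝ (g (n - 1)) y₁ (p₁ + Q ζ')
          - (A (n - 1) p₀ + fderiv ℝ (g (n - 1)) y₀ (p₀ + Q ζ'))
          = A (n - 1) (p₁ - p₀) + fderiv ℝ (g (n - 1)) y₁ (p₁ - p₀)
            + (fderiv ℝ (g (n - 1)) y₁ - fderiv ℝ (g (n - 1)) y₀) (p₀ + Q ζ') := by
        rw [sub_apply, map_sub, map_sub, map_add, map_add, map_add]; abel
      rw [e]
      refine (norm_add₃_le).trans ((add_le_add (add_le_add h3 h6) h8).trans ?_)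
      have h9 : 0 ≤ μ ^ j := by positivity
      calc b * ‖p₁ - p₀‖ + η * ‖p₁ - p₀‖ + L * (G * μ ^ j) * (2 * ‖Q ζ'‖)
          = (b + η) * ‖p₁ - p₀‖ + L * (G * μ ^ j) * (2 * ‖Q ζ'‖) := by ring
        _ ≤ (b + η) * (D * μ ^ j * ‖Q ζ'‖) + L * (G * μ ^ j) * (2 * ‖Q ζ'‖) := by gcongr
        _ = ((b + η) * D + 2 * L * G) * (μ ^ j * ‖Q ζ'‖) := by ring
        _ ≤ D * μ * a * (μ ^ j * ‖Q ζ'‖) := by gcongr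
        _ = D * μ ^ (j + 1) * (‖Q ζ'‖ * a) := by ring
        _ ≤ _ := by gcongr
  have hcau : ∀ n x, ∃ y, Tendsto (fun j => H j n x) atTop (𝓝 y) := by
    intro n x
    refine cauchySeq_tendsto_of_complete (cauchySeq_of_le_geometric μ G hμ1 fun j => ?_)
    rw [dist_eq_norm, norm_sub_rev]
    exact hE j n x
  choose h hlim using hcau
  have hlimit := fun n => contDiff_limit_of_geometric (f := fun j => H j n) (g := h n) isOpen_univ
    hμ0.le hμ1 (fun j => hCD j n) (C := D) (fun j x _ => by
      refine ContinuousLinearMap.opNorm_le_bound _ (by positivity) fun ζ => ?_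
      rw [sub_apply]
      refine (hDD j n x ζ).trans ?_
      gcongr
      exact hPQ.nQ ζ) (fun x _ => hlim n x)
  refine ⟨h, fun n => ?_, fun n => ?_, fun n x => ?_, fun n x ζ => ?_, fun n x => ?_⟩
  · exact contDiff_one_of_hasFDerivAt (fun x => ((hlimit n).2 x trivial).1)
      (continuousOn_univ.1 (hlimit n).1)
  · refine tendsto_nhds_unique (hlim n 0) ?_
    have : ∀ j, ∀ n, H j n 0 = 0 := by
      intro j
      induction j with
      | zero => intro n; rfl
      | succ j ih =>
        intro n
        change A (n - 1) (H j (n - 1) ((A (n - 1)).symm 0))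
          + g (n - 1) (H j (n - 1) ((A (n - 1)).symm 0) + Q ((A (n - 1)).symm 0)) = 0
        simp [ih, (hg (n - 1)).zero]
    simp only [this]
    exact tendsto_const_nhds
  · refine tendsto_nhds_unique ((P.continuous.tendsto _).comp (hlim n x)) ?_
    exact (hlim n x).congr fun j => (hPH j n x).symm
  · have h1 := ((hlimit n).2 x trivial).2
    have h2 : Tendsto (fun j => fderiv ℝ (H j n) x ζ) atTop (𝓝 (fderiv ℝ (h n) x ζ)) :=
      ((ContinuousLinearMap.apply ℝ X ζ).continuous.tendsto _).comp h1
    exact le_of_tendsto h2.norm (Eventually.of_forall fun j => hD j n x ζ)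
  · have h1 := (hlim (n + 1) (A n x)).comp (tendsto_add_atTop_nat 1)
    have h2 : Tendsto (fun j => A n (H j n x) + g n (H j n x + Q x)) atTop
        (𝓝 (A n (h n x) + g n (h n x + Q x))) :=
      (((A n).continuous.tendsto _).comp (hlim n x)).add
        (((hg n).contDiff.continuous.tendsto _).comp ((hlim n x).add_const _))
    refine tendsto_nhds_unique h1 (h2.congr fun j => ?_)
    change _ = A (n + 1 - 1) (H j (n + 1 - 1) ((A (n + 1 - 1)).symm (A n x)))
      + g (n + 1 - 1) (H j (n + 1 - 1) ((A (n + 1 - 1)).symm (A n x))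
        + Q ((A (n + 1 - 1)).symm (A n x)))
    rw [add_sub_cancel_right, (A n).symm_apply_apply]

end SlowGraph

section Series

variable {X : Type*} [NormedAddCommGroup X] [NormedSpace ℝ X]

theorem geom_sum_le_inv {μ : ℝ} (hμ0 : 0 ≤ μ) (hμ1 : μ < 1) (J : ℕ) :
    ∑ j ∈ Finset.range J, μ ^ j ≤ (1 - μ)⁻¹ := by
  rw [← tsum_geometric_of_lt_one hμ0 hμ1]
  exact (summable_geometric_of_lt_one hμ0 hμ1).sum_le_tsum _ fun j _ => pow_nonneg hμ0 j

theorem SClass.series [CompleteSpace X] {P Q : X →L[ℝ] X} {f : ℕ → X → X} {K D μ : ℝ}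
    (hμ0 : 0 ≤ μ) (hμ1 : μ < 1) (hK : 0 ≤ K) (hD : 0 ≤ D) (hf : ∀ j, SClass P Q (f j) (K * μ ^ j))
    (hb : ∀ j x, ‖fderiv ℝ (f j) x‖ ≤ D * μ ^ j) :
    ∃ φ : X → X, SClass P Q φ (K * (1 - μ)⁻¹) ∧ (∀ x, HasSum (fun j => f j x) (φ x)) ∧
      ∀ x, ‖fderiv ℝ φ x‖ ≤ D * (1 - μ)⁻¹ := by
  have hsum : ∀ x, Summable fun j => f j x := fun x => by
    refine Summable.of_norm_bounded (g := fun j => D * ‖x‖ * μ ^ j)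
      ((summable_geometric_of_lt_one hμ0 hμ1).mul_left _) fun j => ?_
    have := norm_sub_le_of_fderiv (hf j).contDiff (hb j) x 0
    rw [(hf j).zero, sub_zero, sub_zero] at this
    exact this.trans (le_of_eq (by ring))
  have hS : ∀ J, ContDiff ℝ 1 fun x => ∑ j ∈ Finset.range J, f j x := fun J =>
    ContDiff.sum fun j _ => (hf j).contDiff
  have hfd : ∀ J x, fderiv ℝ (fun x => ∑ j ∈ Finset.range J, f j x) x
      = ∑ j ∈ Finset.range J, fderiv ℝ (f j) x := fun J x =>
    (HasFDerivAt.fun_sum fun j _ => hasFDerivAt_of_contDiff (hf j).contDiff x).fderiv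
  have hlim := contDiff_limit_of_geometric (f := fun J x => ∑ j ∈ Finset.range J, f j x)
    (g := fun x => ∑' j, f j x) isOpen_univ hμ0 hμ1 hS (C := D) (fun J x _ => by
      rw [hfd, hfd, Finset.sum_range_succ, add_sub_cancel_left]
      exact hb J x) (fun x _ => (hsum x).hasSum.tendsto_sum_nat)
  have hT := fun x => (hlim.2 x trivial).2
  simp only [hfd] at hT
  refine ⟨fun x => ∑' j, f j x, ⟨?_, ?_, fun x => ?_, fun x => ?_, fun x y hxy => ?_⟩,
    fun x => (hsum x).hasSum, fun x => ?_⟩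
  · exact contDiff_one_of_hasFDerivAt (fun x => (hlim.2 x trivial).1) (continuousOn_univ.1 hlim.1)
  · simp [(hf _).zero]
  · rw [P.map_tsum (hsum x)]
    simp only [(hf _).mem]
  · refine le_of_tendsto (hT x).norm (Eventually.of_forall fun J => ?_)
    calc ‖∑ j ∈ Finset.range J, fderiv ℝ (f j) x‖
        ≤ ∑ j ∈ Finset.range J, K * ‖x‖ * μ ^ j := norm_sum_le_of_le _ fun j _ =>
          ((hf j).bound x).trans (le_of_eq (by ring))
      _ = K * ‖x‖ * ∑ j ∈ Finset.range J, μ ^ j := (Finset.mul_sum _ _ _).symm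
      _ ≤ K * ‖x‖ * (1 - μ)⁻¹ := by gcongr; exact geom_sum_le_inv hμ0 hμ1 J
      _ = _ := by ring
  · refine le_of_tendsto ((hT x).sub (hT y)).norm (Eventually.of_forall fun J => ?_)
    rw [← Finset.sum_sub_distrib]
    calc ‖∑ j ∈ Finset.range J, (fderiv ℝ (f j) x - fderiv ℝ (f j) y)‖
        ≤ ∑ j ∈ Finset.range J, K * ‖x - y‖ * μ ^ j := norm_sum_le_of_le _ fun j _ =>
          ((hf j).lip x y hxy).trans (le_of_eq (by ring))
      _ = K * ‖x - y‖ * ∑ j ∈ Finset.range J, μ ^ j := (Finset.mul_sum _ _ _).symm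
      _ ≤ K * ‖x - y‖ * (1 - μ)⁻¹ := by gcongr; exact geom_sum_le_inv hμ0 hμ1 J
      _ = _ := by ring
  · refine le_of_tendsto (hT x).norm (Eventually.of_forall fun J => ?_)
    calc ‖∑ j ∈ Finset.range J, fderiv ℝ (f j) x‖
        ≤ ∑ j ∈ Finset.range J, D * μ ^ j := norm_sum_le_of_le _ fun j _ => hb j x
      _ = D * ∑ j ∈ Finset.range J, μ ^ j := (Finset.mul_sum _ _ _).symm
      _ ≤ D * (1 - μ)⁻¹ := by gcongr; exact geom_sum_le_inv hμ0 hμ1 J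

theorem norm_sub_le_of_fderiv_apply {f : X → X} (hf : ContDiff ℝ 1 f) {x y : X} {C : ℝ}
    (h : ∀ t ∈ Set.Icc (0 : ℝ) 1, ‖fderiv ℝ f (y + t • (x - y)) (x - y)‖ ≤ C) :
    ‖f x - f y‖ ≤ C := by
  have h1 : ∀ t : ℝ, HasDerivAt (fun t : ℝ => f (y + t • (x - y)))
      (fderiv ℝ f (y + t • (x - y)) (x - y)) t := fun t => by
    have h2 : HasDerivAt (fun t : ℝ => y + t • (x - y)) (x - y) t := by
      simpa using ((hasDerivAt_id t).smul_const (x - y)).const_add y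
    exact (hasFDerivAt_of_contDiff hf _).comp_hasDerivAt t h2
  have := norm_image_sub_le_of_norm_deriv_le_segment_01' (f := fun t : ℝ => f (y + t • (x - y)))
    (fun t _ => (h1 t).hasDerivWithinAt) (fun t ht => h t ⟨ht.1, ht.2.le⟩)
  simpa using this

end Series

section Shear

variable {X : Type*} [NormedAddCommGroup X] [NormedSpace ℝ X]

/-- Nonlinearities vanishing on the range of `Q`. -/
structure FlatClass (P Q : X →L[ℝ] X) (g : X → X) (η Λ : ℝ) : Prop where
  contDiff : ContDiff ℝ 1 g
  zero : ∀ x, g (Q x) = 0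
  mem : ∀ x, P (g x) = g x
  small : ∀ x ζ, ‖fderiv ℝ g x ζ‖ ≤ η * ‖P ζ‖ + Λ * ‖P x‖ * ‖Q ζ‖
  bound : ∀ x ζ, ‖fderiv ℝ g x ζ‖ ≤ Λ * (‖x‖ * ‖P ζ‖ + ‖P x‖ * ‖Q ζ‖)
  unif : ∀ x, ‖fderiv ℝ g x‖ ≤ 5 * η
  lip : ∀ x y, Q x = Q y → ‖fderiv ℝ g x - fderiv ℝ g y‖ ≤ Λ * ‖x - y‖

theorem eq_of_fderiv_apply_le {Q : X →L[ℝ] X} {h : X → X} (hh : ContDiff ℝ 1 h)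
    (hb : ∀ x ζ, ‖fderiv ℝ h x ζ‖ ≤ ‖Q ζ‖) {x y : X} (hxy : Q x = Q y) : h x = h y := by
  rw [← sub_eq_zero, ← norm_le_zero_iff]
  refine norm_sub_le_of_fderiv_apply hh fun t _ => (hb _ _).trans ?_
  rw [map_sub, hxy, sub_self, norm_zero]

theorem SClass.flat {P Q : X →L[ℝ] X} (hPQ : Proj2 P Q) {g h : X → X} {L η : ℝ}
    (hL : 0 ≤ L) (hg : SClass P Q g L) (hη : ∀ x, ‖fderiv ℝ g x‖ ≤ η) (hh : ContDiff ℝ 1 h)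
    (h0 : h 0 = 0) (hP : ∀ x, P (h x) = h x) (hb : ∀ x ζ, ‖fderiv ℝ h x ζ‖ ≤ ‖Q ζ‖) :
    FlatClass P Q (fun x => g (x + h x) - g (h x + Q x)) η (2 * L) := by
  have hQh : ∀ x, Q (h x) = 0 := fun x => by rw [← hP, hPQ.QP]
  have hQ : ∀ x, h (Q x) = h x := fun x => eq_of_fderiv_apply_le hh hb (hPQ.QQ x)
  have hle : ∀ x, ‖h x‖ ≤ ‖x‖ := fun x => by
    have := norm_sub_le_of_fderiv_apply hh (x := x) (y := 0) (C := ‖x‖) fun t _ =>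
      (hb _ _).trans (by rw [sub_zero]; exact hPQ.nQ x)
    rwa [h0, sub_zero] at this
  have hdh : ∀ x y, Q x = Q y → fderiv ℝ h x = fderiv ℝ h y := by
    have e : h = fun x => h (Q x) := funext fun x => (hQ x).symm
    have h1 : ∀ x, fderiv ℝ h x = (fderiv ℝ h (Q x)).comp Q := fun x => by
      conv_lhs => rw [e]
      exact ((hasFDerivAt_of_contDiff hh (Q x)).comp x Q.hasFDerivAt).fderiv
    intro x y hxy
    rw [h1 x, h1 y, hxy]
  have hfd : ∀ x, HasFDerivAt (fun x => g (x + h x) - g (h x + Q x))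
      ((fderiv ℝ g (x + h x)).comp (ContinuousLinearMap.id ℝ X + fderiv ℝ h x)
        - (fderiv ℝ g (h x + Q x)).comp (fderiv ℝ h x + Q)) x := fun x => by
    have h1 : HasFDerivAt (fun x => x + h x) (ContinuousLinearMap.id ℝ X + fderiv ℝ h x) x :=
      (hasFDerivAt_id x).add (hasFDerivAt_of_contDiff hh x)
    have h2 : HasFDerivAt (fun x => h x + Q x) (fderiv ℝ h x + Q) x :=
      (hasFDerivAt_of_contDiff hh x).add Q.hasFDerivAt
    exact (HasFDerivAt.comp (f := fun x => x + h x) x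
      (hasFDerivAt_of_contDiff hg.contDiff (x + h x)) h1).sub
      (HasFDerivAt.comp (f := fun x => h x + Q x) x
        (hasFDerivAt_of_contDiff hg.contDiff (h x + Q x)) h2)
  have hap : ∀ x ζ, fderiv ℝ (fun x => g (x + h x) - g (h x + Q x)) x ζ
      = fderiv ℝ g (x + h x) (P ζ)
        + (fderiv ℝ g (x + h x) - fderiv ℝ g (h x + Q x)) (fderiv ℝ h x ζ + Q ζ) := by
    intro x ζ
    rw [(hfd x).fderiv]
    have e := hPQ.add ζ
    have : fderiv ℝ g (x + h x) ζ = fderiv ℝ g (x + h x) (P ζ) + fderiv ℝ g (x + h x) (Q ζ) := by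
      rw [← map_add, e]
    simp [this]
    abel
  have hsecond : ∀ x ζ, ‖(fderiv ℝ g (x + h x) - fderiv ℝ g (h x + Q x)) (fderiv ℝ h x ζ + Q ζ)‖
      ≤ 2 * L * ‖P x‖ * ‖Q ζ‖ := by
    intro x ζ
    have h1 := hg.lip (x + h x) (h x + Q x) (by rw [map_add, map_add, hPQ.QQ, add_comm])
    have e : x + h x - (h x + Q x) = P x := by
      have := hPQ.add x
      rw [sub_eq_iff_eq_add]
      nth_rewrite 1 [← this]
      abel
    rw [e] at h1
    have h2 : ‖fderiv ℝ h x ζ + Q ζ‖ ≤ 2 * ‖Q ζ‖ :=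
      (norm_add_le _ _).trans (by linarith [hb x ζ])
    exact (ContinuousLinearMap.le_of_opNorm_le_of_le _ h1 h2).trans (le_of_eq (by ring))
  have hη0 : 0 ≤ η := (norm_nonneg _).trans (hη 0)
  refine ⟨?_, fun x => ?_, fun x => ?_, fun x ζ => ?_, fun x ζ => ?_, fun x => ?_,
    fun x y hxy => ?_⟩
  · exact (hg.contDiff.comp (contDiff_id.add hh)).sub (hg.contDiff.comp (hh.add Q.contDiff))
  · rw [hPQ.QQ, add_comm, sub_self]
  · rw [map_sub, hg.mem, hg.mem]
  · rw [hap]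
    exact (norm_add_le _ _).trans (add_le_add (ContinuousLinearMap.le_of_opNorm_le _ (hη _) _)
      (hsecond x ζ))
  · rw [hap]
    refine (norm_add_le _ _).trans ((add_le_add (ContinuousLinearMap.le_of_opNorm_le _
      ((hg.bound (x + h x)).trans (?_ : _ ≤ L * (2 * ‖x‖))) _) (hsecond x ζ)).trans ?_)
    · gcongr
      exact (norm_add_le _ _).trans (by linarith [hle x])
    · apply le_of_eq; ring
  · refine ContinuousLinearMap.opNorm_le_bound _ (by positivity) fun ζ => ?_
    rw [hap]
    have h2 : ‖fderiv ℝ h x ζ + Q ζ‖ ≤ 2 * ‖ζ‖ :=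
      (norm_add_le _ _).trans (by linarith [hb x ζ, hPQ.nQ ζ])
    have h3 : ‖fderiv ℝ g (x + h x) - fderiv ℝ g (h x + Q x)‖ ≤ 2 * η :=
      (norm_sub_le _ _).trans (by linarith [hη (x + h x), hη (h x + Q x)])
    refine (norm_add_le _ _).trans ((add_le_add
      (ContinuousLinearMap.le_of_opNorm_le_of_le _ (hη _) (hPQ.nP ζ))
      (ContinuousLinearMap.le_of_opNorm_le_of_le _ h3 h2)).trans (le_of_eq (by ring)))
  · have e1 : h x = h y := eq_of_fderiv_apply_le hh hb hxy
    rw [(hfd x).fderiv, (hfd y).fderiv, e1, hxy, hdh x y hxy, sub_sub_sub_cancel_right,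
      ← ContinuousLinearMap.sub_comp]
    have h1 := hg.lip (x + h y) (y + h y) (by rw [map_add, map_add, hxy])
    rw [add_sub_add_right_eq_sub] at h1
    have h2 : ‖ContinuousLinearMap.id ℝ X + fderiv ℝ h y‖ ≤ 2 :=
      ContinuousLinearMap.opNorm_le_bound _ zero_le_two fun ζ =>
        (norm_add_le ζ (fderiv ℝ h y ζ)).trans (by linarith [(hb y ζ).trans (hPQ.nQ ζ)])
    refine (ContinuousLinearMap.opNorm_comp_le _ _).trans
      ((mul_le_mul h1 h2 (norm_nonneg _) (by positivity)).trans (le_of_eq (by ring)))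

theorem FlatClass.norm_sub_le {P Q : X →L[ℝ] X} (hPQ : Proj2 P Q) {g : X → X} {η Λ : ℝ}
    (hg : FlatClass P Q g η Λ) {x y : X} (hxy : Q x = Q y) :
    ‖g x - g y‖ ≤ η * ‖x - y‖ := by
  have e : Q (x - y) = 0 := by rw [map_sub, hxy, sub_self]
  have e2 : P (x - y) = x - y := by
    have := hPQ.add (x - y)
    rwa [e, add_zero] at this
  refine norm_sub_le_of_fderiv_apply hg.contDiff fun t _ => (hg.small _ _).trans ?_
  rw [e, e2, norm_zero, mul_zero, add_zero]

theorem FlatClass.norm_le {P Q : X →L[ℝ] X} (hPQ : Proj2 P Q) {g : X → X} {η Λ : ℝ}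
    (hg : FlatClass P Q g η Λ) (x : X) : ‖g x‖ ≤ η * ‖P x‖ := by
  have := hg.norm_sub_le hPQ (hPQ.QQ x).symm
  rw [hg.zero, sub_zero] at this
  rwa [show x - Q x = P x by rw [sub_eq_iff_eq_add]; exact (hPQ.add x).symm] at this

end Shear

section Correction

variable {X : Type*} [NormedAddCommGroup X] [NormedSpace ℝ X]

/-- The terms of the series conjugating away the components of `g` in the range of `R`. -/
def corrIter (R : X →L[ℝ] X) (A : ℤ → X ≃L[ℝ] X) (g : ℤ → X → X) : ℕ → ℤ → X → X
  | 0, n => fun x => (A n).symm (R (g n x))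
  | j + 1, n => fun x => (A n).symm (corrIter R A g j (n + 1) (A n x + g n x))

theorem exists_correction [FiniteDimensional ℝ X] {P Q R : X →L[ℝ] X} (hPQ : Proj2 P Q)
    (hRR : ∀ x, R (R x) = R x) (hRn : ∀ x, ‖R x‖ ≤ ‖x‖)
    {A : ℤ → X ≃L[ℝ] X} {b a B aR η Λ μ : ℝ} (hA : Rates P Q A b a B)
    (hRA : ∀ n x, R (A n x) = A n (R x)) (haR : 0 < aR)
    (hlo : ∀ n x, R x = x → aR * ‖x‖ ≤ ‖A n x‖) {g : ℤ → X → X}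
    (hg : ∀ n, FlatClass P Q (g n) η Λ) (hη : 0 < η) (hΛ : 0 ≤ Λ) (hb0 : 0 ≤ b) (hB0 : 0 ≤ B)
    (hμ0 : 0 < μ) (hμ1 : μ < 1) (hμ : (b + 2 * η) * (B + 2 * η) ≤ μ * aR) (hB : B + 2 * η ≤ 1) :
    ∃ ρ K : ℝ, 0 < ρ ∧ 0 ≤ K ∧ ∃ φ : ℤ → X → X, (∀ n, SClass R Q (φ n) K) ∧
      (∀ n x, ‖fderiv ℝ (φ n) x‖ ≤ 1 / 2) ∧
      ∀ n x, ‖x‖ ≤ ρ → A n (φ n x) = R (g n x) + φ (n + 1) (A n x + g n x) := by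
  have hg0 : ∀ n, g n 0 = 0 := fun n => by simpa using (hg n).zero 0
  have hle : ∀ n x, ‖g n x‖ ≤ η * ‖P x‖ := fun n x => (hg n).norm_le hPQ x
  have hAP : ∀ n x, P (A n x) = A n (P x) := fun n x => by
    have h1 := hPQ.add (A n x)
    rw [hA.comm, ← eq_sub_iff_add_eq, ← map_sub] at h1
    rw [h1]
    congr 1
    rw [sub_eq_iff_eq_add]
    exact (hPQ.add x).symm
  have hinv : ∀ n x, R x = x → ‖(A n).symm x‖ ≤ ‖x‖ / aR := by
    intro n x hx
    rw [le_div_iff₀ haR, mul_comm]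
    have := hlo n ((A n).symm x) (by
      rw [ContinuousLinearEquiv.eq_symm_apply, ← hRA, ContinuousLinearEquiv.apply_symm_apply, hx])
    rwa [ContinuousLinearEquiv.apply_symm_apply] at this
  have hAR : ∀ n x, R x = x → R ((A n).symm x) = (A n).symm x := by
    intro n x hx
    rw [ContinuousLinearEquiv.eq_symm_apply, ← hRA, ContinuousLinearEquiv.apply_symm_apply, hx]
  set f := corrIter R A g with hf
  have hF : ∀ n x, HasFDerivAt (fun x => A n x + g n x)
      ((A n : X →L[ℝ] X) + fderiv ℝ (g n) x) x := fun n x =>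
    (A n).hasFDerivAt.add (hasFDerivAt_of_contDiff (hg n).contDiff x)
  have hFcd : ∀ n, ContDiff ℝ 1 fun x => A n x + g n x := fun n =>
    (A n).contDiff.add (hg n).contDiff
  have hcd : ∀ j n, ContDiff ℝ 1 (f j n) := by
    intro j
    induction j with
    | zero => intro n; exact (A n).symm.contDiff.comp (R.contDiff.comp (hg n).contDiff)
    | succ j ih => intro n; exact (A n).symm.contDiff.comp ((ih (n + 1)).comp (hFcd n))
  have hf0 : ∀ j n, f j n 0 = 0 := by
    intro j
    induction j with
    | zero => intro n; simp [hf, corrIter, hg0]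
    | succ j ih =>
      intro n
      change (A n).symm (f j (n + 1) (A n 0 + g n 0)) = 0
      rw [map_zero, hg0, add_zero, ih, map_zero]
  have hfR : ∀ j n x, R (f j n x) = f j n x := by
    intro j
    induction j with
    | zero => intro n x; exact hAR _ _ (hRR _)
    | succ j ih => intro n x; exact hAR _ _ (ih _ _)
  have hd0 : ∀ n x, fderiv ℝ (f 0 n) x
      = ((A n).symm : X →L[ℝ] X).comp (R.comp (fderiv ℝ (g n) x)) := fun n x =>
    ((A n).symm.hasFDerivAt.comp x
      (R.hasFDerivAt.comp x (hasFDerivAt_of_contDiff (hg n).contDiff x))).fderiv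
  have hd1 : ∀ j n x, fderiv ℝ (f (j + 1) n) x = ((A n).symm : X →L[ℝ] X).comp
      ((fderiv ℝ (f j (n + 1)) (A n x + g n x)).comp
        ((A n : X →L[ℝ] X) + fderiv ℝ (g n) x)) := fun j n x =>
    ((A n).symm.hasFDerivAt.comp x (HasFDerivAt.comp (f := fun x => A n x + g n x) x
      (hasFDerivAt_of_contDiff (hcd j (n + 1)) (A n x + g n x)) (hF n x))).fderiv
  obtain ⟨ρ₁, hρ₁, hρΛ⟩ : ∃ ρ₁ : ℝ, 0 < ρ₁ ∧ Λ * ρ₁ ≤ η := by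
    refine ⟨η / (Λ + 1), by positivity, ?_⟩
    rw [mul_div_assoc', div_le_iff₀ (by positivity)]
    nlinarith
  have hFle : ∀ n x, ‖A n x + g n x‖ ≤ (B + η) * ‖x‖ := fun n x => by
    refine (norm_add_le _ _).trans ?_
    have h1 := hA.all n x
    have h2 := (hle n x).trans (mul_le_mul_of_nonneg_left (hPQ.nP x) hη.le)
    linarith
  have hFball : ∀ n x, ‖x‖ ≤ ρ₁ → ‖A n x + g n x‖ ≤ ρ₁ := fun n x hx => by
    refine (hFle n x).trans ?_
    nlinarith [norm_nonneg x]
  have hPF : ∀ n x, ‖P (A n x + g n x)‖ ≤ (b + η) * ‖P x‖ := fun n x => by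
    rw [map_add, hAP, (hg n).mem]
    refine (norm_add_le _ _).trans ?_
    have h1 := hA.up n (P x) (hPQ.PP x)
    have h2 := hle n x
    linarith
  have hQg : ∀ n x ζ, Q (fderiv ℝ (g n) x ζ) = 0 := fun n x ζ =>
    map_fderiv_eq_zero (hg n).contDiff (fun y => by rw [← (hg n).mem, hPQ.QP]) x ζ
  have hPg : ∀ n x ζ, P (fderiv ℝ (g n) x ζ) = fderiv ℝ (g n) x ζ := fun n x ζ =>
    map_fderiv_of_forall (hg n).contDiff (hg n).mem x ζ
  set κ := Λ / aR with hκ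
  have hκ0 : 0 ≤ κ := by positivity
  have hmain : ∀ j n, (∀ x, ‖x‖ ≤ ρ₁ → ∀ ζ, ‖fderiv ℝ (f j n) x ζ‖
        ≤ κ * μ ^ j * (‖x‖ * ‖P ζ‖ + ‖P x‖ * ‖Q ζ‖)) ∧
      ∀ x y, ‖x‖ ≤ ρ₁ → ‖y‖ ≤ ρ₁ → Q x = Q y →
        ‖fderiv ℝ (f j n) x - fderiv ℝ (f j n) y‖ ≤ κ * μ ^ j * ‖x - y‖ := by
    intro j
    induction j with
    | zero =>
      intro n
      refine ⟨fun x _ ζ => ?_, fun x y _ _ hxy => ?_⟩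
      · rw [hd0]
        refine (hinv n _ (hRR _)).trans ?_
        rw [div_le_iff₀ haR, pow_zero, mul_one]
        refine (hRn _).trans (((hg n).bound x ζ).trans (le_of_eq ?_))
        rw [hκ]; field_simp
      · rw [hd0, hd0]
        refine ContinuousLinearMap.opNorm_le_bound _ (by positivity) fun ζ => ?_
        have e : (((A n).symm : X →L[ℝ] X).comp (R.comp (fderiv ℝ (g n) x))
            - ((A n).symm : X →L[ℝ] X).comp (R.comp (fderiv ℝ (g n) y))) ζ
            = (A n).symm (R ((fderiv ℝ (g n) x - fderiv ℝ (g n) y) ζ)) := by simp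
        rw [e]
        refine (hinv n _ (hRR _)).trans ?_
        rw [div_le_iff₀ haR, pow_zero, mul_one]
        refine (hRn _).trans ((ContinuousLinearMap.le_of_opNorm_le _
          ((hg n).lip x y hxy) ζ).trans (le_of_eq ?_))
        rw [hκ]; field_simp
    | succ j ih =>
      intro n
      obtain ⟨ih1, ih2⟩ := ih (n + 1)
      have hκj : 0 ≤ κ * μ ^ j := by positivity
      refine ⟨fun x hx ζ => ?_, fun x y hx hy hxy => ?_⟩
      · rw [hd1]
        refine (hinv n _ (map_fderiv_of_forall (hcd j (n + 1)) (hfR j (n + 1)) _ _)).trans ?_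
        rw [div_le_iff₀ haR]
        refine (ih1 _ (hFball n x hx) _).trans ?_
        have e1 : ‖Q (((A n : X →L[ℝ] X) + fderiv ℝ (g n) x) ζ)‖ ≤ B * ‖Q ζ‖ := by
          change ‖Q (A n ζ + fderiv ℝ (g n) x ζ)‖ ≤ _
          rw [map_add, hQg, add_zero, hA.comm]
          exact hA.all n _
        have e2 : ‖P (((A n : X →L[ℝ] X) + fderiv ℝ (g n) x) ζ)‖
            ≤ (b + η) * ‖P ζ‖ + Λ * ‖P x‖ * ‖Q ζ‖ := by
          change ‖P (A n ζ + fderiv ℝ (g n) x ζ)‖ ≤ _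
          rw [map_add, hPg, hAP]
          refine (norm_add_le _ _).trans ?_
          have h1 := hA.up n (P ζ) (hPQ.PP ζ)
          have h2 := (hg n).small x ζ
          linarith
        have h1 : ‖A n x + g n x‖ * ‖P (((A n : X →L[ℝ] X) + fderiv ℝ (g n) x) ζ)‖
            ≤ ((B + η) * ‖x‖) * ((b + η) * ‖P ζ‖ + Λ * ‖P x‖ * ‖Q ζ‖) :=
          mul_le_mul (hFle n x) e2 (norm_nonneg _) (by positivity)
        have h2 : ‖P (A n x + g n x)‖ * ‖Q (((A n : X →L[ℝ] X) + fderiv ℝ (g n) x) ζ)‖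
            ≤ ((b + η) * ‖P x‖) * (B * ‖Q ζ‖) :=
          mul_le_mul (hPF n x) e1 (norm_nonneg _) (by positivity)
        have h3 : Λ * ‖x‖ ≤ η := (mul_le_mul_of_nonneg_left hx hΛ).trans hρΛ
        have hxP : 0 ≤ ‖x‖ * ‖P ζ‖ := by positivity
        have hPQ' : 0 ≤ ‖P x‖ * ‖Q ζ‖ := by positivity
        have h4 : ((B + η) * ‖x‖) * ((b + η) * ‖P ζ‖ + Λ * ‖P x‖ * ‖Q ζ‖)
            + ((b + η) * ‖P x‖) * (B * ‖Q ζ‖)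
            ≤ (b + 2 * η) * (B + 2 * η) * (‖x‖ * ‖P ζ‖ + ‖P x‖ * ‖Q ζ‖) := by
          calc _ = (B + η) * (b + η) * (‖x‖ * ‖P ζ‖)
                + ((B + η) * (Λ * ‖x‖) + (b + η) * B) * (‖P x‖ * ‖Q ζ‖) := by ring
            _ ≤ (b + 2 * η) * (B + 2 * η) * (‖x‖ * ‖P ζ‖)
                + (b + 2 * η) * (B + 2 * η) * (‖P x‖ * ‖Q ζ‖) := by
              refine add_le_add (mul_le_mul_of_nonneg_right ?_ hxP)
                (mul_le_mul_of_nonneg_right ?_ hPQ')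
              · nlinarith
              · nlinarith
            _ = _ := by ring
        calc κ * μ ^ j * (‖A n x + g n x‖ * ‖P (((A n : X →L[ℝ] X) + fderiv ℝ (g n) x) ζ)‖
              + ‖P (A n x + g n x)‖ * ‖Q (((A n : X →L[ℝ] X) + fderiv ℝ (g n) x) ζ)‖)
            ≤ κ * μ ^ j * ((μ * aR) * (‖x‖ * ‖P ζ‖ + ‖P x‖ * ‖Q ζ‖)) := by
              refine mul_le_mul_of_nonneg_left ?_ hκj
              refine (add_le_add h1 h2).trans (h4.trans ?_)
              gcongr
          _ = _ := by ring
      · rw [hd1, hd1]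
        refine ContinuousLinearMap.opNorm_le_bound _ (by positivity) fun ζ => ?_
        set x' := A n x + g n x with hx'
        set y' := A n y + g n y with hy'
        have hb1 : ‖A n ζ + fderiv ℝ (g n) x ζ‖ ≤ (B + 2 * η) * ‖ζ‖ := by
          refine (norm_add_le _ _).trans ?_
          have h1 := hA.all n ζ
          have h2 := (hg n).small x ζ
          have h3 : Λ * ‖P x‖ ≤ η :=
            (mul_le_mul_of_nonneg_left ((hPQ.nP x).trans hx) hΛ).trans hρΛ
          have h4 : Λ * ‖P x‖ * ‖Q ζ‖ ≤ η * ‖ζ‖ :=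
            mul_le_mul h3 (hPQ.nQ ζ) (norm_nonneg _) hη.le
          have h5 := mul_le_mul_of_nonneg_left (hPQ.nP ζ) hη.le
          linarith
        have hQx : Q x' = Q y' := by
          rw [hx', hy', map_add, map_add, hA.comm, hA.comm, hxy, ← (hg n).mem x, ← (hg n).mem y,
            hPQ.QP, hPQ.QP]
        have hxy' : ‖x' - y'‖ ≤ (b + η) * ‖x - y‖ := by
          have e : x' - y' = A n (x - y) + (g n x - g n y) := by
            rw [map_sub, hx', hy']; abel
          have e2 : P (x - y) = x - y := by
            have := hPQ.add (x - y)
            rwa [map_sub Q, hxy, sub_self, add_zero] at this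
          rw [e]
          refine (norm_add_le _ _).trans ?_
          have h1 := hA.up n _ e2
          have h2 := (hg n).norm_sub_le hPQ hxy
          linarith
        have e : (((A n).symm : X →L[ℝ] X).comp ((fderiv ℝ (f j (n + 1)) x').comp
              ((A n : X →L[ℝ] X) + fderiv ℝ (g n) x))
            - ((A n).symm : X →L[ℝ] X).comp ((fderiv ℝ (f j (n + 1)) y').comp
              ((A n : X →L[ℝ] X) + fderiv ℝ (g n) y))) ζ
            = (A n).symm ((fderiv ℝ (f j (n + 1)) x' - fderiv ℝ (f j (n + 1)) y')
                (A n ζ + fderiv ℝ (g n) x ζ)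
              + fderiv ℝ (f j (n + 1)) y' ((fderiv ℝ (g n) x - fderiv ℝ (g n) y) ζ)) := by
          simp
          abel
        rw [e]
        refine (hinv n _ ?_).trans ?_
        · rw [map_add, sub_apply, map_sub R, map_fderiv_of_forall (hcd j (n + 1)) (hfR j (n + 1)),
            map_fderiv_of_forall (hcd j (n + 1)) (hfR j (n + 1)),
            map_fderiv_of_forall (hcd j (n + 1)) (hfR j (n + 1))]
        rw [div_le_iff₀ haR]
        have h1 := ContinuousLinearMap.le_of_opNorm_le_of_le _
          ((ih2 x' y' (hFball n x hx) (hFball n y hy) hQx).trans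
            (mul_le_mul_of_nonneg_left hxy' hκj)) hb1
        have h2 := ih1 y' (hFball n y hy) ((fderiv ℝ (g n) x - fderiv ℝ (g n) y) ζ)
        have hQ0 : Q ((fderiv ℝ (g n) x - fderiv ℝ (g n) y) ζ) = 0 := by
          rw [sub_apply, map_sub, hQg, hQg, sub_zero]
        have h3 := (hPQ.nP ((fderiv ℝ (g n) x - fderiv ℝ (g n) y) ζ)).trans
          (ContinuousLinearMap.le_of_opNorm_le _ ((hg n).lip x y hxy) ζ)
        rw [hQ0, norm_zero, mul_zero, add_zero] at h2
        have h4 : ‖y'‖ * ‖P ((fderiv ℝ (g n) x - fderiv ℝ (g n) y) ζ)‖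
            ≤ ((B + η) * ρ₁) * (Λ * ‖x - y‖ * ‖ζ‖) :=
          mul_le_mul ((hFle n y).trans (by gcongr)) h3 (norm_nonneg _) (by positivity)
        have h5 := h2.trans (mul_le_mul_of_nonneg_left h4 hκj)
        refine (norm_add_le _ _).trans ((add_le_add h1 h5).trans ?_)
        have hz : 0 ≤ ‖x - y‖ * ‖ζ‖ := by positivity
        calc κ * μ ^ j * ((b + η) * ‖x - y‖) * ((B + 2 * η) * ‖ζ‖)
              + κ * μ ^ j * ((B + η) * ρ₁ * (Λ * ‖x - y‖ * ‖ζ‖))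
            = κ * μ ^ j * (((b + η) * (B + 2 * η) + (B + η) * (Λ * ρ₁))
                * (‖x - y‖ * ‖ζ‖)) := by ring
          _ ≤ κ * μ ^ j * ((μ * aR) * (‖x - y‖ * ‖ζ‖)) := by
              refine mul_le_mul_of_nonneg_left (mul_le_mul_of_nonneg_right ?_ hz) hκj
              refine le_trans ?_ hμ
              nlinarith
          _ = _ := by ring
  obtain ⟨C, hC, hCr⟩ := exists_fibred_retract hPQ
  obtain ⟨ρ, hρ, hρ1, hρ2⟩ : ∃ ρ : ℝ, 0 < ρ ∧ C * ρ ≤ ρ₁ ∧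
      C ^ 2 * (2 * κ) * ρ * (1 - μ)⁻¹ ≤ 1 / 2 := by
    have h1 : 0 < 1 - μ := by linarith
    set Z := C ^ 2 * (2 * κ) * (1 - μ)⁻¹ with hZ
    have hZ0 : 0 ≤ Z := by positivity
    refine ⟨min (ρ₁ / C) (1 / (2 * (Z + 1))), by positivity, ?_, ?_⟩
    · calc C * min (ρ₁ / C) (1 / (2 * (Z + 1))) ≤ C * (ρ₁ / C) := by gcongr; exact min_le_left _ _
        _ = ρ₁ := by field_simp
    · have h2 : min (ρ₁ / C) (1 / (2 * (Z + 1))) ≤ 1 / (2 * (Z + 1)) := min_le_right _ _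
      calc _ = Z * min (ρ₁ / C) (1 / (2 * (Z + 1))) := by rw [hZ]; ring
        _ ≤ Z * (1 / (2 * (Z + 1))) := by gcongr
        _ ≤ 1 / 2 := by
          rw [mul_one_div, div_le_div_iff₀ (by positivity) two_pos]; linarith
  obtain ⟨r, hr, hr1, hrρ, hrx, hrQ⟩ := hCr ρ hρ
  have hcut : ∀ j n, SClass R Q (fun x => f j n (r x)) (2 * C ^ 2 * (2 * (κ * μ ^ j))) ∧
      (∀ x, ‖fderiv ℝ (fun x => f j n (r x)) x‖ ≤ C ^ 2 * (2 * (κ * μ ^ j)) * ρ) ∧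
      ∀ x, ‖f j n (r x)‖ ≤ 2 * (κ * μ ^ j) * (C * ρ) * (C * ρ) := fun j n => by
    have hκj : 0 ≤ κ * μ ^ j := by positivity
    refine SClass.of_cutoff (by positivity) hC hρ (hcd j n) (hf0 j n) (hfR j n) (fun x hx => ?_)
      (fun x y hx hy hxy => ?_) hr hr1 hrρ hrx hrQ
    · refine ContinuousLinearMap.opNorm_le_bound _ (by positivity) fun ζ => ?_
      refine ((hmain j n).1 x (hx.trans hρ1) ζ).trans ?_
      have h1 : ‖x‖ * ‖P ζ‖ ≤ ‖x‖ * ‖ζ‖ := by gcongr; exact hPQ.nP ζ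
      have h2 : ‖P x‖ * ‖Q ζ‖ ≤ ‖x‖ * ‖ζ‖ := by gcongr; exacts [hPQ.nP x, hPQ.nQ ζ]
      calc _ ≤ κ * μ ^ j * (‖x‖ * ‖ζ‖ + ‖x‖ * ‖ζ‖) := by gcongr
        _ = _ := by ring
    · refine ((hmain j n).2 x y (hx.trans hρ1) (hy.trans hρ1) hxy).trans ?_
      exact mul_le_mul_of_nonneg_right (by linarith) (norm_nonneg _)
  have hser := fun n => SClass.series (f := fun j x => f j n (r x)) (K := 2 * C ^ 2 * (2 * κ))
    (D := C ^ 2 * (2 * κ) * ρ) hμ0.le hμ1 (by positivity) (by positivity)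
    (fun j => (hcut j n).1.mono (le_of_eq (by ring)))
    (fun j x => ((hcut j n).2.1 x).trans (le_of_eq (by ring)))
  choose φ hφ hφs hφd using hser
  have h1μ : 0 < 1 - μ := by linarith
  refine ⟨ρ, _, hρ, by positivity, φ, hφ, fun n x => (hφd n x).trans hρ2, fun n x hx => ?_⟩
  have h1 := hφs n x
  have h2 := hφs (n + 1) (A n x + g n x)
  have hx1 : ‖A n x + g n x‖ ≤ ρ := (hFle n x).trans (by nlinarith [norm_nonneg x])
  simp only [hr1 x hx] at h1
  simp only [hr1 _ hx1] at h2
  have h3 := (hasSum_nat_add_iff' 1).2 h1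
  have h4 := ((A n).symm : X →L[ℝ] X).hasSum h2
  have h5 := h3.unique h4
  rw [Finset.sum_range_one] at h5
  have h6 : φ n x - (A n).symm (R (g n x)) = (A n).symm (φ (n + 1) (A n x + g n x)) := h5
  rw [sub_eq_iff_eq_add] at h6
  rw [h6, map_add, ContinuousLinearEquiv.apply_symm_apply, ContinuousLinearEquiv.apply_symm_apply,
    add_comm]

end Correction

section Peel

variable {X : Type*} [NormedAddCommGroup X] [NormedSpace ℝ X]

theorem exists_peel_constants {b a B aR : ℝ} (hb0 : 0 ≤ b) (hba : b < a) (hbB : b ≤ B) (hB1 : B < 1)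
    (haR : 0 < aR) (hband : b * B < aR) : ∃ η μ : ℝ, 0 < η ∧ b + 2 * η ≤ a ∧ b + η < 1 ∧
      B + 2 * η ≤ 1 ∧ 0 < μ ∧ μ < 1 ∧ (b + 2 * η) * (B + 2 * η) ≤ μ * aR := by
  have hB0 : 0 ≤ B := hb0.trans hbB
  obtain ⟨μ, h1, h2⟩ := exists_between ((div_lt_one haR).2 hband)
  rw [div_lt_iff₀ haR] at h1
  have hμ0 : 0 < μ := by
    by_contra hμ
    nlinarith [mul_nonneg hb0 hB0]
  have e1 : ∀ᶠ η : ℝ in 𝓝[>] 0, b + 2 * η < a :=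
    nhdsWithin_le_nhds ((Continuous.tendsto' (by fun_prop) (0 : ℝ) b (by simp)).eventually_lt_const
      hba)
  have e2 : ∀ᶠ η : ℝ in 𝓝[>] 0, B + 2 * η < 1 :=
    nhdsWithin_le_nhds ((Continuous.tendsto' (by fun_prop) (0 : ℝ) B (by simp)).eventually_lt_const
      hB1)
  have e3 : ∀ᶠ η : ℝ in 𝓝[>] 0, (b + 2 * η) * (B + 2 * η) < μ * aR :=
    nhdsWithin_le_nhds ((Continuous.tendsto' (f := fun η : ℝ => (b + 2 * η) * (B + 2 * η))
      (by fun_prop) (0 : ℝ) (b * B) (by simp)).eventually_lt_const h1)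
  obtain ⟨η, ⟨⟨h3, h4⟩, h5⟩, h6⟩ :=
    (((e1.and e2).and e3).and (self_mem_nhdsWithin (a := (0 : ℝ)) (s := Set.Ioi 0))).exists
  have hη : 0 < η := h6
  exact ⟨η, μ, hη, h3.le, by linarith, h4.le, hμ0, h2, h5.le⟩

/-- The components of a contracting system in one spectral band can be linearized at the cost of
losing smoothness of the other components along that band. -/
theorem exists_peel [FiniteDimensional ℝ X] {P Q R : X →L[ℝ] X} (hPQ : Proj2 P Q)
    (hPR : ∀ x, P (R x) = R x) (hRR : ∀ x, R (R x) = R x) (hRn : ∀ x, ‖R x‖ ≤ ‖x‖)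
    (hRc : ∀ x, ‖x - R x‖ ≤ ‖x‖) {A : ℤ → X ≃L[ℝ] X} {b a B aR : ℝ} (hA : Rates P Q A b a B)
    (hRA : ∀ n x, R (A n x) = A n (R x)) (hb0 : 0 ≤ b) (hba : b < a) (hbB : b ≤ B) (hB1 : B < 1)
    (haR : 0 < aR) (hband : b * B < aR) (hlo : ∀ n x, R x = x → aR * ‖x‖ ≤ ‖A n x‖)
    {g : ℤ → X → X} {L : ℝ} (hL : 0 ≤ L) (hg : ∀ n, SClass P Q (g n) L) :
    ∃ L' ρ : ℝ, 0 ≤ L' ∧ 0 < ρ ∧ ∃ (Φ : ℤ → X ≃ X) (g' : ℤ → X → X),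
      (∀ n, ContDiff ℝ 1 (Φ n) ∧ ContDiff ℝ 1 (Φ n).symm ∧ Φ n 0 = 0) ∧
      (∀ n x, ‖fderiv ℝ (Φ n) x‖ ≤ 4 ∧ ‖fderiv ℝ (Φ n).symm x‖ ≤ 4) ∧
      (∀ n, SClass (P - R) (Q + R) (g' n) L') ∧
      ∀ n x, ‖x‖ ≤ ρ → Φ (n + 1) (A n x + g n x) = A n (Φ n x) + g' n (Φ n x) := by
  obtain ⟨η, μ, hη, h1, h2, h3, hμ0, hμ1, h4⟩ := exists_peel_constants hb0 hba hbB hB1 haR hband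
  obtain ⟨C, hC, hCr⟩ := exists_fibred_retract hPQ
  obtain ⟨ρ₀, hρ₀, hρη⟩ : ∃ ρ₀ : ℝ, 0 < ρ₀ ∧ C ^ 2 * L * ρ₀ ≤ η := by
    refine ⟨η / (C ^ 2 * L + 1), by positivity, ?_⟩
    rw [mul_div_assoc', div_le_iff₀ (by positivity)]
    nlinarith
  obtain ⟨r, hr, hr1, hrρ, hrx, hrQ⟩ := hCr ρ₀ hρ₀
  have hcut := fun n => SClass.of_cutoff hL hC hρ₀ (hg n).contDiff (hg n).zero (hg n).mem
    (fun x _ => (hg n).bound x) (fun x y _ _ => (hg n).lip x y) hr hr1 hrρ hrx hrQ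
  have hL1 : 0 ≤ 2 * C ^ 2 * L := by positivity
  obtain ⟨h, hh, hh0, hhP, hhD, hheq⟩ := exists_slow_graph hPQ hA hL1 (fun n => (hcut n).1)
    (fun n x => ((hcut n).2.1 x).trans hρη) (fun n => (hcut n).2.2) hb0 h1 hη h2
  have hflat := fun n => SClass.flat hPQ hL1 (hcut n).1 (fun x => ((hcut n).2.1 x).trans hρη)
    (hh n) (hh0 n) (hhP n) (hhD n)
  set Λ := 2 * (2 * C ^ 2 * L) with hΛ
  have hΛ0 : 0 ≤ Λ := by positivity
  set gt : ℤ → X → X := fun n x => g n (r (x + h n x)) - g n (r (h n x + Q x)) with hgt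
  replace hflat : ∀ n, FlatClass P Q (gt n) η Λ := hflat
  obtain ⟨ρ₁, K, hρ₁, hK, φ, hφ, hφd, hφe⟩ := exists_correction hPQ hRR hRn hA hRA haR hlo hflat hη
    hΛ0 hb0 (hb0.trans hbB) hμ0 hμ1 h4 h3
  have hhQ : ∀ n x y, Q x = Q y → h n x = h n y := fun n x y hxy =>
    eq_of_fderiv_apply_le (hh n) (hhD n) hxy
  have hQh : ∀ n x, Q (h n x) = 0 := fun n x => by rw [← hhP, hPQ.QP]
  have hhle : ∀ n x, ‖h n x‖ ≤ ‖x‖ := fun n x => by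
    have := norm_sub_le_of_fderiv_apply (hh n) (x := x) (y := 0) (C := ‖x‖) fun t _ =>
      (hhD n _ _).trans (by rw [sub_zero]; exact hPQ.nQ x)
    rwa [hh0, sub_zero] at this
  have hhd : ∀ n x, ‖fderiv ℝ (h n) x‖ ≤ 1 := fun n x =>
    ContinuousLinearMap.opNorm_le_bound _ zero_le_one fun ζ => by
      rw [one_mul]; exact (hhD n x ζ).trans (hPQ.nQ ζ)
  -- the shear along the slow graph
  let S : ℤ → X ≃ X := fun n =>
    { toFun := fun x => x - h n x
      invFun := fun x => x + h n x
      left_inv := fun x => by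
        have : h n (x - h n x) = h n x := hhQ n _ _ (by rw [map_sub, hQh, sub_zero])
        simp only [this, sub_add_cancel]
      right_inv := fun x => by
        have : h n (x + h n x) = h n x := hhQ n _ _ (by rw [map_add, hQh, add_zero])
        simp only [this, add_sub_cancel_right] }
  have hScd : ∀ n, ContDiff ℝ 1 (S n) := fun n => contDiff_id.sub (hh n)
  have hScd' : ∀ n, ContDiff ℝ 1 (S n).symm := fun n => contDiff_id.add (hh n)
  have hSd : ∀ n x, ‖fderiv ℝ (S n) x‖ ≤ 2 := fun n x => by
    have : fderiv ℝ (S n) x = ContinuousLinearMap.id ℝ X - fderiv ℝ (h n) x :=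
      ((hasFDerivAt_id x).sub (hasFDerivAt_of_contDiff (hh n) x)).fderiv
    rw [this]
    have := ContinuousLinearMap.norm_id_le (𝕜 := ℝ) (E := X)
    exact (norm_sub_le _ _).trans (by linarith [hhd n x])
  have hSd' : ∀ n x, ‖fderiv ℝ (S n).symm x‖ ≤ 2 := fun n x => by
    have : fderiv ℝ (S n).symm x = ContinuousLinearMap.id ℝ X + fderiv ℝ (h n) x :=
      ((hasFDerivAt_id x).add (hasFDerivAt_of_contDiff (hh n) x)).fderiv
    rw [this]
    have := ContinuousLinearMap.norm_id_le (𝕜 := ℝ) (E := X)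
    exact (norm_add_le _ _).trans (by linarith [hhd n x])
  have hSle : ∀ n x, ‖S n x‖ ≤ 2 * ‖x‖ := fun n x =>
    (norm_sub_le x (h n x)).trans (by linarith [hhle n x])
  have hSconj : ∀ n x, ‖x‖ ≤ ρ₀ → S (n + 1) (A n x + g n x) = A n (S n x) + gt n (S n x) := by
    intro n x hx
    have e1 : h (n + 1) (A n x + g n x) = h (n + 1) (A n x) :=
      hhQ _ _ _ (by rw [map_add, ← (hg n).mem, hPQ.QP, add_zero])
    have e2 : h n (x - h n x) = h n x := hhQ n _ _ (by rw [map_sub, hQh, sub_zero])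
    have e3 : Q (x - h n x) = Q x := by rw [map_sub, hQh, sub_zero]
    change A n x + g n x - h (n + 1) (A n x + g n x) = A n (x - h n x)
      + (g n (r (x - h n x + h n (x - h n x))) - g n (r (h n (x - h n x) + Q (x - h n x))))
    rw [e1, e2, e3, hheq, sub_add_cancel, hr1 x hx, map_sub]
    abel
  -- the near-identity change of variables
  have hφlip : ∀ n x y, ‖φ n x - φ n y‖ ≤ 1 / 2 * ‖x - y‖ := fun n =>
    norm_sub_le_of_fderiv (hφ n).contDiff (hφd n)
  have hψcd : ∀ n, ContDiff ℝ 1 fun x => x + φ n x := fun n => contDiff_id.add (hφ n).contDiff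
  have hψexp : ∀ n x y, 1 / 2 * ‖x - y‖ ≤ ‖(x + φ n x) - (y + φ n y)‖ := by
    intro n x y
    have e : x - y = ((x + φ n x) - (y + φ n y)) - (φ n x - φ n y) := by abel
    have h1 := norm_sub_le ((x + φ n x) - (y + φ n y)) (φ n x - φ n y)
    rw [← e] at h1
    linarith [hφlip n x y]
  have hψ0 : ∀ n, ∀ x, 1 / 2 * ‖x‖ ≤ ‖x + φ n x‖ := fun n x => by
    simpa [(hφ n).zero] using hψexp n x 0
  have hex := fun n => exists_equiv_of_expanding (hψcd n)
    (fun _ => ⟨1 / 2, by norm_num, fun x y _ _ => hψexp n x y⟩) (by norm_num : (0 : ℝ) < 1 / 2)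
    (hψ0 n)
  choose e he hesymm heD using hex
  have hefun : ∀ n, (e n : X → X) = fun x => x + φ n x := fun n => funext (he n)
  have hecd : ∀ n, ContDiff ℝ 1 (e n) := fun n => by rw [hefun]; exact hψcd n
  have hefd : ∀ n x, fderiv ℝ (fun x => x + φ n x) x
      = ContinuousLinearMap.id ℝ X + fderiv ℝ (φ n) x := fun n x =>
    ((hasFDerivAt_id x).add (hasFDerivAt_of_contDiff (hφ n).contDiff x)).fderiv
  have htwo : ∀ n x, ‖fderiv ℝ (fun x => x + φ n x) x‖ ≤ 2 ∧ ∀ T' : X ≃L[ℝ] X,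
      (T' : X →L[ℝ] X) = fderiv ℝ (fun x => x + φ n x) x → ‖(T'.symm : X →L[ℝ] X)‖ ≤ 2 :=
    fun n x => norm_fderiv_le_two (by rw [hefd, add_sub_cancel_left]; exact hφd n x)
  have hed : ∀ n x, ‖fderiv ℝ (e n) x‖ ≤ 2 := fun n x => by rw [hefun]; exact (htwo n x).1
  have hed' : ∀ n x, ‖fderiv ℝ (e n).symm x‖ ≤ 2 := fun n x => by
    obtain ⟨T, hT, hT'⟩ := heD n ((e n).symm x)
    rw [← he, Equiv.apply_symm_apply] at hT'
    rw [hT']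
    exact (htwo n _).2 T hT
  have he0 : ∀ n, e n 0 = 0 := fun n => by rw [he, (hφ n).zero, add_zero]
  have hes0 : ∀ n, (e n).symm 0 = 0 := fun n => by rw [Equiv.symm_apply_eq, he0]
  have hesle : ∀ n x, ‖(e n).symm x‖ ≤ 2 * ‖x‖ := fun n x => by
    have := norm_sub_le_of_fderiv (hesymm n) (hed' n) x 0
    rwa [hes0, sub_zero, sub_zero] at this
  have hQR : ∀ x, Q (R x) = 0 := fun x => by rw [← hPR, hPQ.QP]
  have hQe : ∀ n x, Q ((e n).symm x) = Q x := fun n x => by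
    conv_rhs => rw [← (e n).apply_symm_apply x, he, map_add, ← (hφ n).mem, hQR, add_zero]
  have hgtd : ∀ n x, ‖fderiv ℝ (gt n) x‖ ≤ 2 * Λ * ‖x‖ := fun n x =>
    ContinuousLinearMap.opNorm_le_bound _ (by positivity) fun ζ => by
      refine ((hflat n).bound x ζ).trans ?_
      have h1 : ‖x‖ * ‖P ζ‖ ≤ ‖x‖ * ‖ζ‖ := by gcongr; exact hPQ.nP ζ
      have h2 : ‖P x‖ * ‖Q ζ‖ ≤ ‖x‖ * ‖ζ‖ := by gcongr; exacts [hPQ.nP x, hPQ.nQ ζ]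
      calc _ ≤ Λ * (‖x‖ * ‖ζ‖ + ‖x‖ * ‖ζ‖) := by gcongr
        _ = _ := by ring
  have hesd : ∀ n x y, Q x = Q y →
      ‖fderiv ℝ (e n).symm x - fderiv ℝ (e n).symm y‖ ≤ 8 * K * ‖x - y‖ := by
    intro n x y hxy
    obtain ⟨T, hT, hT'⟩ := heD n ((e n).symm x)
    obtain ⟨T₁, hT₁, hT₁'⟩ := heD n ((e n).symm y)
    rw [← he, Equiv.apply_symm_apply] at hT' hT₁'
    rw [hT', hT₁']
    have e1 : (T.symm : X →L[ℝ] X) - T₁.symm = (T.symm : X →L[ℝ] X).comp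
        (((T₁ : X →L[ℝ] X) - T).comp (T₁.symm : X →L[ℝ] X)) := by
      ext v; simp
    rw [e1]
    have h1 : ‖(T₁ : X →L[ℝ] X) - T‖ ≤ K * (2 * ‖x - y‖) := by
      rw [hT₁, hT, hefd, hefd, add_sub_add_left_eq_sub]
      refine ((hφ n).lip _ _ (by rw [hQe, hQe, hxy])).trans ?_
      rw [norm_sub_rev]
      gcongr
      exact norm_sub_le_of_fderiv (hesymm n) (hed' n) x y
    refine (ContinuousLinearMap.opNorm_comp_le _ _).trans ((mul_le_mul ((htwo n _).2 T hT)
      ((ContinuousLinearMap.opNorm_comp_le _ _).trans (mul_le_mul h1 ((htwo n _).2 T₁ hT₁)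
        (norm_nonneg _) (by positivity))) (norm_nonneg _) zero_le_two).trans (le_of_eq (by ring)))
  let V : X →L[ℝ] X := ContinuousLinearMap.id ℝ X - R
  have hV : ‖V‖ ≤ 1 := ContinuousLinearMap.opNorm_le_bound _ zero_le_one fun x => by
    rw [one_mul]; exact hRc x
  have hVap : ∀ x, V x = x - R x := fun x => rfl
  have hg'fd : ∀ n x, HasFDerivAt (fun x => V (gt n ((e n).symm x)))
      (V.comp ((fderiv ℝ (gt n) ((e n).symm x)).comp (fderiv ℝ (e n).symm x))) x := fun n x =>
    V.hasFDerivAt.comp x (HasFDerivAt.comp (f := (e n).symm) x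
      (hasFDerivAt_of_contDiff (hflat n).contDiff _) (hasFDerivAt_of_contDiff (hesymm n) x))
  refine ⟨max (8 * Λ) (5 * η * (8 * K) + 4 * Λ), min ρ₀ (ρ₁ / 2), le_max_of_le_left (by positivity),
    by positivity, fun n => (S n).trans (e n), fun n x => V (gt n ((e n).symm x)),
    fun n => ⟨(hecd n).comp (hScd n), (hScd' n).comp (hesymm n), ?_⟩, fun n x => ⟨?_, ?_⟩,
    fun n => ⟨?_, ?_, fun x => ?_, fun x => ?_, fun x y hxy => ?_⟩, fun n x hx => ?_⟩
  · change e n (0 - h n 0) = 0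
    rw [hh0, sub_zero, he0]
  · have := (HasFDerivAt.comp (f := S n) x (hasFDerivAt_of_contDiff (hecd n) _)
      (hasFDerivAt_of_contDiff (hScd n) x)).fderiv
    change ‖fderiv ℝ (e n ∘ S n) x‖ ≤ 4
    rw [this]
    refine (ContinuousLinearMap.opNorm_comp_le _ _).trans ((mul_le_mul (hed n _) (hSd n x)
      (norm_nonneg _) zero_le_two).trans (by norm_num))
  · have := (HasFDerivAt.comp (f := (e n).symm) x (hasFDerivAt_of_contDiff (hScd' n) _)
      (hasFDerivAt_of_contDiff (hesymm n) x)).fderiv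
    change ‖fderiv ℝ ((S n).symm ∘ (e n).symm) x‖ ≤ 4
    rw [this]
    refine (ContinuousLinearMap.opNorm_comp_le _ _).trans ((mul_le_mul (hSd' n _) (hed' n x)
      (norm_nonneg _) zero_le_two).trans (by norm_num))
  · exact V.contDiff.comp ((hflat n).contDiff.comp (hesymm n))
  · have := (hflat n).zero 0
    rw [map_zero] at this
    simp only [hes0]
    rw [this, map_zero]
  · have := (hflat n).mem ((e n).symm x)
    simp only [hVap, sub_apply, map_sub, hPR, hRR]
    rw [this]
    abel
  · rw [(hg'fd n x).fderiv]
    refine (ContinuousLinearMap.opNorm_comp_le _ _).trans ((mul_le_mul hV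
      ((ContinuousLinearMap.opNorm_comp_le _ _).trans (mul_le_mul ((hgtd n _).trans
        (mul_le_mul_of_nonneg_left (hesle n x) (by positivity))) (hed' n x) (norm_nonneg _)
        (by positivity))) (norm_nonneg _) zero_le_one).trans ?_)
    calc 1 * (2 * Λ * (2 * ‖x‖) * 2) = 8 * Λ * ‖x‖ := by ring
      _ ≤ _ := mul_le_mul_of_nonneg_right (le_max_left _ _) (norm_nonneg _)
  · have hQxy : Q x = Q y := by
      have := congrArg Q hxy
      simpa [hPQ.QQ, hQR] using this
    rw [(hg'fd n x).fderiv, (hg'fd n y).fderiv, ← ContinuousLinearMap.comp_sub]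
    have e1 : (fderiv ℝ (gt n) ((e n).symm x)).comp (fderiv ℝ (e n).symm x)
        - (fderiv ℝ (gt n) ((e n).symm y)).comp (fderiv ℝ (e n).symm y)
        = (fderiv ℝ (gt n) ((e n).symm x)).comp (fderiv ℝ (e n).symm x - fderiv ℝ (e n).symm y)
          + (fderiv ℝ (gt n) ((e n).symm x) - fderiv ℝ (gt n) ((e n).symm y)).comp
            (fderiv ℝ (e n).symm y) := by
      ext v; simp
    rw [e1]
    have b1 : ‖(fderiv ℝ (gt n) ((e n).symm x)).comp
        (fderiv ℝ (e n).symm x - fderiv ℝ (e n).symm y)‖ ≤ 5 * η * (8 * K * ‖x - y‖) :=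
      (ContinuousLinearMap.opNorm_comp_le _ _).trans (mul_le_mul ((hflat n).unif _)
        (hesd n x y hQxy) (norm_nonneg _) (by positivity))
    have b2 : ‖(fderiv ℝ (gt n) ((e n).symm x) - fderiv ℝ (gt n) ((e n).symm y)).comp
        (fderiv ℝ (e n).symm y)‖ ≤ Λ * (2 * ‖x - y‖) * 2 := by
      refine (ContinuousLinearMap.opNorm_comp_le _ _).trans (mul_le_mul
        (((hflat n).lip _ _ (by rw [hQe, hQe, hQxy])).trans ?_) (hed' n y) (norm_nonneg _)
        (by positivity))
      gcongr
      exact norm_sub_le_of_fderiv (hesymm n) (hed' n) x y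
    refine (ContinuousLinearMap.opNorm_comp_le _ _).trans ((mul_le_mul hV
      ((norm_add_le _ _).trans (add_le_add b1 b2)) (norm_nonneg _) zero_le_one).trans ?_)
    calc 1 * (5 * η * (8 * K * ‖x - y‖) + Λ * (2 * ‖x - y‖) * 2)
        = (5 * η * (8 * K) + 4 * Λ) * ‖x - y‖ := by ring
      _ ≤ _ := mul_le_mul_of_nonneg_right (le_max_right _ _) (norm_nonneg _)
  · have hx0 : ‖x‖ ≤ ρ₀ := hx.trans (min_le_left _ _)
    have hx1 : ‖S n x‖ ≤ ρ₁ := (hSle n x).trans (by linarith [hx.trans (min_le_right _ _)])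
    change e (n + 1) (S (n + 1) (A n x + g n x))
      = A n (e n (S n x)) + V (gt n ((e n).symm (e n (S n x))))
    rw [hSconj n x hx0, Equiv.symm_apply_apply, he, he, map_add, hφe n _ hx1, hVap]
    abel

end Peel

section Bands

variable {ι : Type*} [Fintype ι]

open Classical in
/-- The coordinate projection onto the labels satisfying `p`. -/
def rst (ℓ : ι → ℕ) (p : ℕ → Prop) : (ι → ℝ) →L[ℝ] (ι → ℝ) :=
  ContinuousLinearMap.pi fun i => if p (ℓ i) then ContinuousLinearMap.proj i else 0

open Classical in
theorem rst_apply (ℓ : ι → ℕ) (p : ℕ → Prop) (x : ι → ℝ) (i : ι) :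
    rst ℓ p x i = if p (ℓ i) then x i else 0 := by
  simp only [rst, ContinuousLinearMap.pi_apply]
  split_ifs <;> rfl

theorem norm_rst_le (ℓ : ι → ℕ) (p : ℕ → Prop) (x : ι → ℝ) : ‖rst ℓ p x‖ ≤ ‖x‖ := by
  refine (pi_norm_le_iff_of_nonneg (norm_nonneg _)).2 fun i => ?_
  rw [rst_apply]
  split_ifs
  · exact norm_le_pi_norm x i
  · simp

theorem rst_rst (ℓ : ι → ℕ) (p q : ℕ → Prop) (x : ι → ℝ) :
    rst ℓ p (rst ℓ q x) = rst ℓ (fun k => p k ∧ q k) x := by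
  ext i
  simp only [rst_apply]
  split_ifs <;> simp_all

theorem rst_congr (ℓ : ι → ℕ) {p q : ℕ → Prop} (h : ∀ i, p (ℓ i) ↔ q (ℓ i)) : rst ℓ p = rst ℓ q := by
  ext x i
  simp only [rst_apply]
  by_cases e : p (ℓ i)
  · rw [if_pos e, if_pos ((h i).1 e)]
  · rw [if_neg e, if_neg (mt (h i).2 e)]

theorem rst_eq_zero (ℓ : ι → ℕ) {p : ℕ → Prop} (h : ∀ i, ¬ p (ℓ i)) (x : ι → ℝ) :
    rst ℓ p x = 0 := by
  ext i
  simp [rst_apply, h]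

theorem proj2_rst (ℓ : ι → ℕ) {p q : ℕ → Prop} (h : ∀ k, q k ↔ ¬ p k) :
    Proj2 (rst ℓ p) (rst ℓ q) where
  add x := by ext i; by_cases hi : p (ℓ i) <;> simp [rst_apply, h, hi]
  PP x := by rw [rst_rst]; exact congrArg (fun T : (ι → ℝ) →L[ℝ] (ι → ℝ) => T x)
              (rst_congr ℓ fun i => by tauto)
  QQ x := by rw [rst_rst]; exact congrArg (fun T : (ι → ℝ) →L[ℝ] (ι → ℝ) => T x)
              (rst_congr ℓ fun i => by tauto)
  PQ x := by rw [rst_rst]; exact rst_eq_zero ℓ (fun i => by rw [h]; tauto) x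
  QP x := by rw [rst_rst]; exact rst_eq_zero ℓ (fun i => by rw [h]; tauto) x
  nP := norm_rst_le ℓ p
  nQ := norm_rst_le ℓ q

/-- Linear families which are block diagonal with respect to the labels `ℓ`, the block with label
`k` having rates between `lo k` and `hi k`. -/
structure Banded (ℓ : ι → ℕ) (A : ℤ → (ι → ℝ) ≃L[ℝ] (ι → ℝ)) (lo hi : ℕ → ℝ) : Prop where
  comm : ∀ n k x, rst ℓ (· = k) (A n x) = A n (rst ℓ (· = k) x)
  up : ∀ n k x, rst ℓ (· = k) x = x → ‖A n x‖ ≤ hi k * ‖x‖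
  low : ∀ n k x, rst ℓ (· = k) x = x → lo k * ‖x‖ ≤ ‖A n x‖

variable {ℓ : ι → ℕ} {A : ℤ → (ι → ℝ) ≃L[ℝ] (ι → ℝ)} {lo hi : ℕ → ℝ}

theorem rst_self_apply (x : ι → ℝ) (i : ι) : rst ℓ (· = ℓ i) x i = x i := by
  simp [rst_apply]

theorem Banded.apply_eq (h : Banded ℓ A lo hi) (n : ℤ) (x : ι → ℝ) (i : ι) :
    A n x i = A n (rst ℓ (· = ℓ i) x) i := by
  rw [← h.comm, rst_self_apply]

theorem Banded.comm_rst (h : Banded ℓ A lo hi) (p : ℕ → Prop) (n : ℤ) (x : ι → ℝ) :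
    rst ℓ p (A n x) = A n (rst ℓ p x) := by
  ext i
  rw [rst_apply, h.apply_eq n (rst ℓ p x), rst_rst]
  split_ifs with hi
  · rw [h.apply_eq n x, rst_congr ℓ (p := fun k => k = ℓ i ∧ p k) (q := (· = ℓ i)) fun j =>
      ⟨fun e => e.1, fun e => ⟨e, e ▸ hi⟩⟩]
  · rw [rst_eq_zero ℓ (fun j (e : ℓ j = ℓ i ∧ p (ℓ j)) => hi (e.1 ▸ e.2)), map_zero]
    rfl

theorem rst_idem (p : ℕ → Prop) (x : ι → ℝ) : rst ℓ p (rst ℓ p x) = rst ℓ p x := by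
  rw [rst_rst]
  exact congrArg (fun T : (ι → ℝ) →L[ℝ] (ι → ℝ) => T x) (rst_congr ℓ fun i => by tauto)

theorem Banded.norm_le (h : Banded ℓ A lo hi) {p : ℕ → Prop} {b : ℝ} (hb : 0 ≤ b)
    (hp : ∀ i, p (ℓ i) → hi (ℓ i) ≤ b) (n : ℤ) (x : ι → ℝ) (hx : rst ℓ p x = x) :
    ‖A n x‖ ≤ b * ‖x‖ := by
  refine (pi_norm_le_iff_of_nonneg (by positivity)).2 fun i => ?_
  by_cases hi : p (ℓ i)
  · rw [h.apply_eq]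
    refine (norm_le_pi_norm _ i).trans ((h.up n (ℓ i) _ (rst_idem _ x)).trans ?_)
    exact mul_le_mul (hp i hi) (norm_rst_le _ _ _) (norm_nonneg _) hb
  · rw [← hx, ← h.comm_rst, rst_apply, if_neg hi, norm_zero]
    positivity

theorem Banded.le_norm (h : Banded ℓ A lo hi) {p : ℕ → Prop} {a : ℝ} (ha : 0 < a)
    (hp : ∀ i, p (ℓ i) → a ≤ lo (ℓ i)) (n : ℤ) (x : ι → ℝ) (hx : rst ℓ p x = x) :
    a * ‖x‖ ≤ ‖A n x‖ := by
  rw [mul_comm, ← le_div_iff₀ ha]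
  refine (pi_norm_le_iff_of_nonneg (by positivity)).2 fun i => ?_
  by_cases hi : p (ℓ i)
  · rw [← rst_self_apply (ℓ := ℓ) x i, le_div_iff₀ ha]
    have h1 := h.low n (ℓ i) _ (rst_idem _ x)
    rw [← h.comm] at h1
    have h2 : a * ‖rst ℓ (· = ℓ i) x‖ ≤ lo (ℓ i) * ‖rst ℓ (· = ℓ i) x‖ :=
      mul_le_mul_of_nonneg_right (hp i hi) (norm_nonneg _)
    have h3 := norm_rst_le ℓ (· = ℓ i) (A n x)
    have h4 := norm_le_pi_norm (rst ℓ (· = ℓ i) x) i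
    nlinarith
  · rw [← hx, rst_apply, if_neg hi, norm_zero]
    positivity

/-- Local linearization of a banded contraction, the nonlinearity having only components with
labels less than `p`. -/
theorem Banded.exists_local_linearization (h : Banded ℓ A lo hi) {k : ℕ} {B : ℝ}
    (hℓ : ∀ i, ℓ i < k)
    (hband : ∀ j < k, 0 < lo j ∧ lo j ≤ hi j ∧ hi j ≤ B ∧ hi j * B < lo j)
    (hord : ∀ i j, i < j → j < k → hi i < lo j) (hB0 : 0 ≤ B) (hB1 : B < 1) :
    ∀ p ≤ k, ∀ (g : ℤ → (ι → ℝ) → (ι → ℝ)) (L : ℝ), 0 ≤ L →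
      (∀ n, SClass (rst ℓ (· < p)) (rst ℓ (p ≤ ·)) (g n) L) →
      ∃ M ρ : ℝ, 0 < M ∧ 0 < ρ ∧ ∃ Φ : ℤ → (ι → ℝ) ≃ (ι → ℝ),
        (∀ n, ContDiff ℝ 1 (Φ n) ∧ ContDiff ℝ 1 (Φ n).symm ∧ Φ n 0 = 0) ∧
        (∀ n x, ‖fderiv ℝ (Φ n) x‖ ≤ M ∧ ‖fderiv ℝ (Φ n).symm x‖ ≤ M) ∧
        ∀ n x, ‖x‖ ≤ ρ → Φ (n + 1) (A n x + g n x) = A n (Φ n x) := by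
  intro p
  induction p with
  | zero =>
    intro _ g L _ hg
    have hg0 : ∀ n x, g n x = 0 := fun n x => by
      rw [← (hg n).mem, rst_eq_zero ℓ fun i => by simp]
    refine ⟨1, 1, one_pos, one_pos, fun _ => Equiv.refl _, fun n => ⟨contDiff_id, contDiff_id, rfl⟩,
      fun n x => ⟨?_, ?_⟩, fun n x _ => ?_⟩
    · exact (congrArg norm (fderiv_id (𝕜 := ℝ) (x := x))).trans_le ContinuousLinearMap.norm_id_le
    · exact (congrArg norm (fderiv_id (𝕜 := ℝ) (x := x))).trans_le ContinuousLinearMap.norm_id_le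
    · simp [hg0]
  | succ p ih =>
    intro hpk g L hL hg
    have hp : p < k := hpk
    obtain ⟨hlo, hlohi, hhiB, hpB⟩ := hband p hp
    obtain ⟨a, ha, haQ⟩ : ∃ a, hi p < a ∧ ∀ i, p + 1 ≤ ℓ i → a ≤ lo (ℓ i) := by
      by_cases hk : p + 1 < k
      · refine ⟨lo (p + 1), hord p (p + 1) (by omega) hk, fun i hi' => ?_⟩
        rcases hi'.eq_or_lt with e | e
        · rw [e]
        · exact ((hband (p + 1) hk).2.1).trans (hord _ _ e (hℓ i)).le
      · exact ⟨hi p + 1, by linarith, fun i hi' => absurd (hℓ i) (by omega)⟩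
    have hPQ : Proj2 (rst ℓ (· < p + 1)) (rst ℓ (p + 1 ≤ ·)) := proj2_rst ℓ fun k => by simp
    have hhi0 : 0 ≤ hi p := hlo.le.trans hlohi
    have hA : Rates (rst ℓ (· < p + 1)) (rst ℓ (p + 1 ≤ ·)) A (hi p) a B :=
      { comm := h.comm_rst _
        up := h.norm_le hhi0 fun i hi' => by
          rcases (Nat.lt_succ_iff.1 hi').eq_or_lt with e | e
          · rw [e]
          · exact ((hord _ _ e hp).le).trans hlohi
        lo := h.le_norm (hhi0.trans_lt ha) haQ
        all := fun n x => h.norm_le (p := fun _ => True) hB0 (fun i _ => (hband _ (hℓ i)).2.2.1) n x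
          (by ext i; simp [rst_apply]) }
    obtain ⟨L', ρ, hL', hρ, Φ, g', hΦ, hΦd, hg', hconj⟩ := exists_peel (R := rst ℓ (· = p)) hPQ
      (fun x => by
        rw [rst_rst]
        exact congrArg (fun T : (ι → ℝ) →L[ℝ] (ι → ℝ) => T x) (rst_congr ℓ fun i => by omega))
      (rst_idem _) (norm_rst_le ℓ _)
      (fun x => by
        have h1 : x - rst ℓ (· = p) x = rst ℓ (fun k => ¬ k = p) x := by
          ext i
          by_cases e : ℓ i = p <;> simp [rst_apply, e]
        rw [h1]
        exact norm_rst_le ℓ _ x)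
      hA (h.comm_rst _) hhi0 ha hhiB hB1 hlo hpB (fun n x => h.low n p x) hL hg
    have e1 : rst ℓ (· < p + 1) - rst ℓ (· = p) = rst ℓ (· < p) := by
      ext x i
      simp only [sub_apply, Pi.sub_apply, rst_apply]
      split_ifs <;> first | omega | simp
    have e2 : rst ℓ (p + 1 ≤ ·) + rst ℓ (· = p) = rst ℓ (p ≤ ·) := by
      ext x i
      simp only [add_apply, Pi.add_apply, rst_apply]
      split_ifs <;> first | omega | simp
    rw [e1, e2] at hg'
    obtain ⟨M, ρ', hM, hρ', Φ', hΦ', hΦd', hconj'⟩ := ih hp.le g' L' hL' hg'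
    refine ⟨M * 4, min ρ (ρ' / 4), by positivity, by positivity, fun n => (Φ n).trans (Φ' n),
      fun n => ⟨(hΦ' n).1.comp (hΦ n).1, (hΦ n).2.1.comp (hΦ' n).2.1, ?_⟩, fun n x => ⟨?_, ?_⟩,
      fun n x hx => ?_⟩
    · rw [Equiv.trans_apply, (hΦ n).2.2, (hΦ' n).2.2]
    · have := (HasFDerivAt.comp (f := Φ n) x (hasFDerivAt_of_contDiff (hΦ' n).1 _)
        (hasFDerivAt_of_contDiff (hΦ n).1 x)).fderiv
      change ‖fderiv ℝ (Φ' n ∘ Φ n) x‖ ≤ _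
      rw [this]
      exact (ContinuousLinearMap.opNorm_comp_le _ _).trans
        (mul_le_mul (hΦd' n _).1 (hΦd n x).1 (norm_nonneg _) hM.le)
    · have := (HasFDerivAt.comp (f := (Φ' n).symm) x (hasFDerivAt_of_contDiff (hΦ n).2.1 _)
        (hasFDerivAt_of_contDiff (hΦ' n).2.1 x)).fderiv
      change ‖fderiv ℝ ((Φ n).symm ∘ (Φ' n).symm) x‖ ≤ _
      rw [this, mul_comm]
      exact (ContinuousLinearMap.opNorm_comp_le _ _).trans
        (mul_le_mul (hΦd n _).2 (hΦd' n x).2 (norm_nonneg _) zero_le_four)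
    · have h1 := norm_sub_le_of_fderiv (hΦ n).1 (fun z => (hΦd n z).1) x 0
      rw [(hΦ n).2.2, sub_zero, sub_zero] at h1
      simp only [Equiv.trans_apply]
      rw [hconj n x (hx.trans (min_le_left _ _)), hconj' n _ (h1.trans ?_)]
      linarith [hx.trans (min_le_right _ _)]

end Bands

section Globalize

variable {X : Type*} [NormedAddCommGroup X] [NormedSpace ℝ X]

theorem contDiff_of_eventually {T : ℕ → X → X} (hT : ∀ m, ContDiff ℝ 1 (T m)) {f : X → X}
    {m₀ : ℝ → ℕ} (h : ∀ R, ∀ m ≥ m₀ R, ∀ x, ‖x‖ ≤ R → T m x = T (m₀ R) x)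
    (hf : ∀ x, f x = T (m₀ ‖x‖) x) :
    ContDiff ℝ 1 f ∧ ∀ x, ∀ᶠ m in atTop, f x = T m x := by
  have h1 : ∀ x, ∀ᶠ m in atTop, f x = T m x := fun x => by
    filter_upwards [eventually_ge_atTop (m₀ ‖x‖)] with m hm
    rw [hf, h ‖x‖ m hm x le_rfl]
  refine ⟨contDiff_iff_contDiffAt.2 fun x => ?_, h1⟩
  refine (hT (m₀ (‖x‖ + 1))).contDiffAt.congr_of_eventuallyEq ?_
  filter_upwards [Metric.ball_mem_nhds x one_pos] with z hz
  obtain ⟨m, hm1, hm2⟩ := ((h1 z).and (eventually_ge_atTop (m₀ (‖x‖ + 1)))).exists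
  rw [hm1, h _ m hm2]
  have h2 := norm_add_le x (z - x)
  rw [add_sub_cancel] at h2
  have h3 : ‖z - x‖ < 1 := by simpa [dist_eq_norm] using hz
  linarith

theorem exists_equiv_of_eventually {T : ℕ → X ≃ X} (hT : ∀ m, ContDiff ℝ 1 (T m))
    (hT' : ∀ m, ContDiff ℝ 1 (T m).symm)
    (h : ∀ R : ℝ, ∃ m₀, ∀ m ≥ m₀, ∀ x, ‖x‖ ≤ R → T m x = T m₀ x)
    (h' : ∀ R : ℝ, ∃ m₀, ∀ m ≥ m₀, ∀ x, ‖x‖ ≤ R → (T m).symm x = (T m₀).symm x) :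
    ∃ Ψ : X ≃ X, ContDiff ℝ 1 Ψ ∧ ContDiff ℝ 1 Ψ.symm ∧ (∀ x, ∀ᶠ m in atTop, Ψ x = T m x) ∧
      ∀ x, ∀ᶠ m in atTop, Ψ.symm x = (T m).symm x := by
  choose m₀ hm₀ using h
  choose m₁ hm₁ using h'
  obtain ⟨c1, e1⟩ := contDiff_of_eventually hT hm₀ (f := fun x => T (m₀ ‖x‖) x) fun _ => rfl
  obtain ⟨c2, e2⟩ := contDiff_of_eventually hT' hm₁ (f := fun x => (T (m₁ ‖x‖)).symm x) fun _ => rfl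
  refine ⟨⟨fun x => T (m₀ ‖x‖) x, fun x => (T (m₁ ‖x‖)).symm x, fun x => ?_, fun x => ?_⟩,
    c1, c2, e1, e2⟩
  · obtain ⟨m, h1, h2⟩ := ((e1 x).and (e2 (T (m₀ ‖x‖) x))).exists
    change (T (m₁ ‖T (m₀ ‖x‖) x‖)).symm (T (m₀ ‖x‖) x) = x
    rw [h2, h1, Equiv.symm_apply_apply]
  · obtain ⟨m, h1, h2⟩ := ((e2 x).and (e1 ((T (m₁ ‖x‖)).symm x))).exists
    change T (m₀ ‖(T (m₁ ‖x‖)).symm x‖) ((T (m₁ ‖x‖)).symm x) = x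
    rw [h2, h1, Equiv.apply_symm_apply]

/-- The composition `F (n + m - 1) ∘ ⋯ ∘ F n`. -/
def iterE (F : ℤ → X ≃ X) (n : ℤ) : ℕ → X ≃ X
  | 0 => Equiv.refl X
  | m + 1 => (iterE F n m).trans (F (n + m))

theorem iterE_succ' (F : ℤ → X ≃ X) (n : ℤ) (m : ℕ) (x : X) :
    iterE F n (m + 1) x = iterE F (n + 1) m (F n x) := by
  induction m with
  | zero => simp [iterE]
  | succ m ih =>
    change F (n + ((m + 1 : ℕ) : ℤ)) (iterE F n (m + 1) x)
      = F (n + 1 + (m : ℤ)) (iterE F (n + 1) m (F n x))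
    rw [ih]
    congr 2
    push_cast
    ring

theorem iterE_contDiff {F : ℤ → X ≃ X} (hF : ∀ n, ContDiff ℝ 1 (F n)) (n : ℤ) (m : ℕ) :
    ContDiff ℝ 1 (iterE F n m) := by
  induction m with
  | zero => exact contDiff_id
  | succ m ih => exact (hF _).comp ih

theorem iterE_symm_contDiff {F : ℤ → X ≃ X} (hF : ∀ n, ContDiff ℝ 1 (F n).symm) (n : ℤ) (m : ℕ) :
    ContDiff ℝ 1 (iterE F n m).symm := by
  induction m with
  | zero => exact contDiff_id
  | succ m ih => exact ih.comp (hF _)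

theorem iterE_norm_le {F : ℤ → X ≃ X} {q : ℝ} (hq : 0 ≤ q) (hF : ∀ n x, ‖F n x‖ ≤ q * ‖x‖) (n : ℤ)
    (m : ℕ) (x : X) : ‖iterE F n m x‖ ≤ q ^ m * ‖x‖ := by
  induction m with
  | zero => simp [iterE]
  | succ m ih =>
    calc ‖F (n + m) (iterE F n m x)‖ ≤ q * ‖iterE F n m x‖ := hF _ _
      _ ≤ q * (q ^ m * ‖x‖) := by gcongr
      _ = _ := by ring

/-- A local conjugacy of a contraction to its linear part extends to a global one. -/
theorem exists_global_conjugacy {A : ℤ → X ≃L[ℝ] X} {F Φ : ℤ → X ≃ X} {q M ρ : ℝ} (hq0 : 0 ≤ q)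
    (hq1 : q < 1) (hA : ∀ n x, ‖A n x‖ ≤ q * ‖x‖) (hFq : ∀ n x, ‖F n x‖ ≤ q * ‖x‖)
    (hF : ∀ n, ContDiff ℝ 1 (F n)) (hF' : ∀ n, ContDiff ℝ 1 (F n).symm)
    (hΦ : ∀ n, ContDiff ℝ 1 (Φ n) ∧ ContDiff ℝ 1 (Φ n).symm ∧ Φ n 0 = 0) (hM : 0 < M) (hρ : 0 < ρ)
    (hΦd : ∀ n x, ‖fderiv ℝ (Φ n) x‖ ≤ M ∧ ‖fderiv ℝ (Φ n).symm x‖ ≤ M)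
    (hconj : ∀ n x, ‖x‖ ≤ ρ → Φ (n + 1) (F n x) = A n (Φ n x)) :
    ∃ (Ψ : ℤ → X ≃ X) (ρ' : ℝ), 0 < ρ' ∧
      (∀ n, ContDiff ℝ 1 (Ψ n) ∧ ContDiff ℝ 1 (Ψ n).symm ∧ Ψ n 0 = 0) ∧
      (∀ n x, Ψ (n + 1) (F n x) = A n (Ψ n x)) ∧
      ∀ n x, ‖x‖ < ρ' → ‖fderiv ℝ (Ψ n) x‖ ≤ M ∧ ‖fderiv ℝ (Ψ n).symm x‖ ≤ M := by
  let AE : ℤ → X ≃ X := fun n => (A n).toEquiv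
  let T : ℤ → ℕ → X ≃ X := fun n m =>
    (iterE F n m).trans ((Φ (n + m)).trans (iterE AE n m).symm)
  have hT : ∀ n m, ContDiff ℝ 1 (T n m) := fun n m =>
    (iterE_symm_contDiff (fun n => (A n).symm.contDiff) n m).comp
      ((hΦ _).1.comp (iterE_contDiff hF n m))
  have hT' : ∀ n m, ContDiff ℝ 1 (T n m).symm := fun n m =>
    (iterE_symm_contDiff hF' n m).comp
      ((hΦ _).2.1.comp (iterE_contDiff (fun n => (A n).contDiff) n m))
  have hle' : ∀ n x, ‖(Φ n).symm x‖ ≤ M * ‖x‖ := fun n x => by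
    have h0 : (Φ n).symm 0 = 0 := by rw [Equiv.symm_apply_eq, (hΦ n).2.2]
    have := norm_sub_le_of_fderiv (hΦ n).2.1 (fun z => (hΦd n z).2) x 0
    rwa [h0, sub_zero, sub_zero] at this
  have hidx : ∀ (n : ℤ) (m : ℕ), n + ((m + 1 : ℕ) : ℤ) = n + m + 1 := fun n m => by
    push_cast; ring
  have hstep : ∀ (n : ℤ) (m : ℕ) x, ‖iterE F n m x‖ ≤ ρ → T n (m + 1) x = T n m x := by
    intro n m x hx
    change (iterE AE n m).symm ((A (n + m)).symm (Φ (n + ((m + 1 : ℕ) : ℤ))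
      (F (n + m) (iterE F n m x)))) = (iterE AE n m).symm (Φ (n + m) (iterE F n m x))
    rw [hidx, hconj _ _ hx, ContinuousLinearEquiv.symm_apply_apply]
  have hstep' : ∀ (n : ℤ) (m : ℕ) y, ‖(Φ (n + m)).symm (iterE AE n m y)‖ ≤ ρ →
      (T n (m + 1)).symm y = (T n m).symm y := by
    intro n m y hy
    change (iterE F n m).symm ((F (n + m)).symm ((Φ (n + ((m + 1 : ℕ) : ℤ))).symm
      (A (n + m) (iterE AE n m y)))) = (iterE F n m).symm ((Φ (n + m)).symm (iterE AE n m y))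
    have h1 := hconj (n + m) _ hy
    rw [Equiv.apply_symm_apply] at h1
    rw [hidx, ← h1, Equiv.symm_apply_apply, Equiv.symm_apply_apply]
  have hsmall : ∀ R Z : ℝ, ∃ m₀, ∀ m ≥ m₀, Z * (q ^ m * R) ≤ ρ := by
    intro R Z
    have h1 : Tendsto (fun m : ℕ => Z * (q ^ m * R)) atTop (𝓝 0) := by
      simpa using ((tendsto_pow_atTop_nhds_zero_of_lt_one hq0 hq1).mul_const R).const_mul Z
    exact eventually_atTop.1 ((h1.eventually_lt_const hρ).mono fun _ h => h.le)
  have hex := fun n => exists_equiv_of_eventually (hT n) (hT' n)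
    (fun R => by
      obtain ⟨m₀, hm₀⟩ := hsmall R 1
      refine ⟨m₀, fun m hm x hx => ?_⟩
      induction m, hm using Nat.le_induction with
      | base => rfl
      | succ m hm ih =>
        rw [hstep n m x, ih]
        refine (iterE_norm_le hq0 hFq n m x).trans (le_trans ?_ (hm₀ m hm))
        rw [one_mul]
        gcongr)
    (fun R => by
      obtain ⟨m₀, hm₀⟩ := hsmall R M
      refine ⟨m₀, fun m hm x hx => ?_⟩
      induction m, hm using Nat.le_induction with
      | base => rfl
      | succ m hm ih =>
        rw [hstep' n m x, ih]
        refine (hle' _ _).trans (le_trans ?_ (hm₀ m hm))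
        gcongr
        exact (iterE_norm_le (F := AE) hq0 hA n m x).trans (by gcongr))
  choose Ψ hΨ hΨ' he he' using hex
  have hpow : ∀ m : ℕ, q ^ m ≤ 1 := fun m => pow_le_one₀ hq0 hq1.le
  have hloc : ∀ n x, ‖x‖ ≤ ρ → Ψ n x = Φ n x := by
    intro n x hx
    obtain ⟨m, hm⟩ := (he n x).exists
    rw [hm]
    clear hm
    induction m with
    | zero =>
      change Φ (n + ((0 : ℕ) : ℤ)) x = _
      simp
    | succ m ih =>
      rw [hstep n m x, ih]
      exact (iterE_norm_le hq0 hFq n m x).trans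
        ((mul_le_of_le_one_left (norm_nonneg _) (hpow m)).trans hx)
  have hloc' : ∀ n x, M * ‖x‖ ≤ ρ → (Ψ n).symm x = (Φ n).symm x := by
    intro n x hx
    obtain ⟨m, hm⟩ := (he' n x).exists
    rw [hm]
    clear hm
    induction m with
    | zero =>
      change (Φ (n + ((0 : ℕ) : ℤ))).symm x = _
      simp
    | succ m ih =>
      rw [hstep' n m x, ih]
      refine (hle' _ _).trans (le_trans ?_ hx)
      gcongr
      exact (iterE_norm_le (F := AE) hq0 hA n m x).trans
        (mul_le_of_le_one_left (norm_nonneg _) (hpow m))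
  refine ⟨Ψ, min ρ (ρ / M), by positivity, fun n => ⟨hΨ n, hΨ' n, ?_⟩, fun n x => ?_,
    fun n x hx => ⟨?_, ?_⟩⟩
  · rw [hloc n 0 (by simpa using hρ.le), (hΦ n).2.2]
  · obtain ⟨m, h1, h2⟩ := ((he (n + 1) (F n x)).and ((tendsto_add_atTop_nat 1).eventually
      (he n x))).exists
    rw [h1, h2]
    have hn : n + 1 + (m : ℤ) = n + ((m + 1 : ℕ) : ℤ) := by push_cast; ring
    change (iterE AE (n + 1) m).symm (Φ (n + 1 + m) (iterE F (n + 1) m (F n x)))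
      = AE n ((iterE AE n (m + 1)).symm (Φ (n + ((m + 1 : ℕ) : ℤ)) (iterE F n (m + 1) x)))
    rw [Equiv.symm_apply_eq, ← iterE_succ', ← iterE_succ', Equiv.apply_symm_apply, hn]
  · have : Ψ n =ᶠ[𝓝 x] Φ n := by
      filter_upwards [(isOpen_lt continuous_norm continuous_const).mem_nhds
        (hx.trans_le (min_le_left _ _))] with z hz
      exact hloc n z (le_of_lt hz)
    rw [this.fderiv_eq]
    exact (hΦd n x).1
  · have : (Ψ n).symm =ᶠ[𝓝 x] (Φ n).symm := by
      filter_upwards [(isOpen_lt continuous_norm continuous_const).mem_nhds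
        (hx.trans_le (min_le_right _ _))] with z hz
      refine hloc' n z ?_
      rw [mul_comm, ← le_div_iff₀ hM]
      exact le_of_lt hz
    rw [this.fderiv_eq]
    exact (hΦd n x).2

end Globalize

section Contraction

variable {ι : Type*} [Fintype ι]

/-- A banded contraction whose bands satisfy the conditions needed for a smooth linearization. -/
structure ContractionBands (ℓ : ι → ℕ) (k : ℕ) (A : ℤ → (ι → ℝ) ≃L[ℝ] (ι → ℝ)) (lo hi : ℕ → ℝ)
    (B : ℝ) : Prop where
  banded : Banded ℓ A lo hi
  label_lt : ∀ i, ℓ i < k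
  band : ∀ j < k, 0 < lo j ∧ lo j ≤ hi j ∧ hi j ≤ B ∧ hi j * B < lo j
  ord : ∀ i j, i < j → j < k → hi i < lo j
  nonneg : 0 ≤ B
  lt_one : B < 1

variable {ℓ : ι → ℕ} {k : ℕ} {A : ℤ → (ι → ℝ) ≃L[ℝ] (ι → ℝ)} {lo hi : ℕ → ℝ} {B : ℝ}

theorem rst_true (x : ι → ℝ) : rst ℓ (fun _ => True) x = x := by
  ext i
  simp [rst_apply]

theorem ContractionBands.norm_le (h : ContractionBands ℓ k A lo hi B) (n : ℤ) (x : ι → ℝ) :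
    ‖A n x‖ ≤ B * ‖x‖ :=
  h.banded.norm_le (p := fun _ => True) h.nonneg (fun i _ => (h.band _ (h.label_lt i)).2.2.1) n x
    (rst_true x)

theorem ContractionBands.le_norm (h : ContractionBands ℓ k A lo hi B) {a : ℝ} (ha : 0 < a)
    (hal : ∀ j < k, a ≤ lo j) (n : ℤ) (x : ι → ℝ) : a * ‖x‖ ≤ ‖A n x‖ :=
  h.banded.le_norm (p := fun _ => True) ha (fun i _ => hal _ (h.label_lt i)) n x (rst_true x)

theorem ContractionBands.reindex (h : ContractionBands ℓ k A lo hi B) (e : ℤ → ℤ) :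
    ContractionBands ℓ k (fun n => A (e n)) lo hi B where
  banded := ⟨fun n => h.banded.comm _, fun n => h.banded.up _, fun n => h.banded.low _⟩
  label_lt := h.label_lt
  band := h.band
  ord := h.ord
  nonneg := h.nonneg
  lt_one := h.lt_one

theorem ContractionBands.exists_linearization (h : ContractionBands ℓ k A lo hi B) {c L : ℝ}
    (hc : B + c < 1) {F : ℤ → (ι → ℝ) ≃ (ι → ℝ)} {g : ℤ → (ι → ℝ) → (ι → ℝ)} (hL : 0 ≤ L)
    (hg : ∀ n, C11 (g n) c L ∧ g n 0 = 0 ∧ fderiv ℝ (g n) 0 = 0)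
    (hF : ∀ n x, F n x = A n x + g n x) (hF' : ∀ n, ContDiff ℝ 1 (F n).symm) :
    ∃ (Ψ : ℤ → (ι → ℝ) ≃ (ι → ℝ)) (M ρ : ℝ), 0 < M ∧ 0 < ρ ∧
      (∀ n, ContDiff ℝ 1 (Ψ n) ∧ ContDiff ℝ 1 (Ψ n).symm ∧ Ψ n 0 = 0) ∧
      (∀ n x, Ψ (n + 1) (F n x) = A n (Ψ n x)) ∧
      ∀ n x, ‖x‖ < ρ → ‖fderiv ℝ (Ψ n) x‖ ≤ M ∧ ‖fderiv ℝ (Ψ n).symm x‖ ≤ M := by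
  have hc0 : 0 ≤ c := (hg 0).1.nonneg
  have hk : ∀ x : ι → ℝ, rst ℓ (· < k) x = x := fun x => by
    ext i
    simp [rst_apply, h.label_lt]
  have hk' : ∀ x : ι → ℝ, rst ℓ (k ≤ ·) x = 0 :=
    rst_eq_zero ℓ fun i => not_le.2 (h.label_lt i)
  obtain ⟨M, ρ, hM, hρ, Φ, hΦ, hΦd, hconj⟩ := h.banded.exists_local_linearization h.label_lt h.band
    h.ord h.nonneg h.lt_one k le_rfl g L hL fun n =>
      { contDiff := (hg n).1.contDiff
        zero := (hg n).2.1
        mem := fun x => hk _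
        bound := (hg n).1.norm_fderiv_le (hg n).2.2
        lip := fun x y _ => (hg n).1.lip x y }
  have hFd : ∀ n, ContDiff ℝ 1 (F n) := fun n => by
    have : (F n : (ι → ℝ) → (ι → ℝ)) = fun x => A n x + g n x := funext (hF n)
    rw [this]
    exact (A n).contDiff.add (hg n).1.contDiff
  obtain ⟨Ψ, ρ', hρ', h1, h2, h3⟩ := exists_global_conjugacy (q := B + c) (add_nonneg h.nonneg hc0)
    hc (fun n x => (h.norm_le n x).trans (by nlinarith [norm_nonneg x]))
    (fun n x => by
      rw [hF]
      refine (norm_add_le _ _).trans ?_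
      rw [add_mul]
      exact add_le_add (h.norm_le n x) ((hg n).1.norm_le (hg n).2.1 x))
    hFd hF' hΦ hM hρ hΦd (fun n x hx => by rw [hF]; exact hconj n x hx)
  exact ⟨Ψ, M, ρ', hM, hρ', h1, h2, h3⟩

end Contraction

section Saddle

theorem norm_prodMap_le {X Y : Type*} [NormedAddCommGroup X] [NormedSpace ℝ X]
    [NormedAddCommGroup Y] [NormedSpace ℝ Y] {S : X →L[ℝ] X} {T : Y →L[ℝ] Y} {M : ℝ} (hS : ‖S‖ ≤ M)
    (hT : ‖T‖ ≤ M) : ‖S.prodMap T‖ ≤ M :=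
  ContinuousLinearMap.opNorm_le_bound _ ((norm_nonneg _).trans hS) fun v => max_le
    (S.le_of_opNorm_le_of_le hS (norm_fst_le v)) (T.le_of_opNorm_le_of_le hT (norm_snd_le v))

variable {ιs ιu : Type*} [Fintype ιs] [Fintype ιu]

theorem exists_saddle_linearization {ℓs : ιs → ℕ} {ℓu : ιu → ℕ} {ks ku : ℕ} {los his lou hiu : ℕ → ℝ}
    {a b α β : ℝ} (ha : 1 < a) (hb0 : 0 < b) (hb : b < 1) (hα0 : 0 < α) (hβ0 : 0 < β)
    (hbβ : b * β < a) (hbα : b / α < a) (hα : ∀ j < ks, α ≤ los j) (hβ : ∀ j < ku, β⁻¹ ≤ lou j) :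
    ∃ c₀ > 0, ∀ c, 0 < c → c ≤ c₀ → ∀ L, 0 ≤ L → ∀ F : Sys (ιs → ℝ) (ιu → ℝ),
      ContractionBands ℓs ks F.A los his b → 
      ContractionBands ℓu ku (fun n => (F.B n).symm) lou hiu a⁻¹ →
      (∀ n, C11 (F.gs n) c L ∧ F.gs n 0 = 0 ∧ fderiv ℝ (F.gs n) 0 = 0) →
      (∀ n, C11 (F.gu n) c L ∧ F.gu n 0 = 0 ∧ fderiv ℝ (F.gu n) 0 = 0) →
      ∃ (Ψ : ℤ → ((ιs → ℝ) × (ιu → ℝ) ≃ (ιs → ℝ) × (ιu → ℝ))) (M ρ : ℝ), 0 < M ∧ 0 < ρ ∧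
        (∀ n, ContDiff ℝ 1 (Ψ n) ∧ ContDiff ℝ 1 (Ψ n).symm ∧ Ψ n 0 = 0) ∧
        (∀ n x, Ψ (n + 1) (F.s n x, F.u n x) = (F.A n (Ψ n x).1, F.B n (Ψ n x).2)) ∧
        (∀ n x, ‖x‖ < ρ → ‖fderiv ℝ (Ψ n) x‖ ≤ M ∧ ‖fderiv ℝ (Ψ n).symm x‖ ≤ M) := by
  have ha0 : 0 < a := one_pos.trans ha
  obtain ⟨c₀, hc₀, K, hK, hdec⟩ := exists_decoupling (S := ιs → ℝ) (U := ιu → ℝ) ha hb0 hb hα0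
    hβ0.le hbβ hbα
  have ha1 : a⁻¹ < 1 := inv_lt_one_of_one_lt₀ ha
  refine ⟨min c₀ (min (min (1 / (2 * b * K)) (1 / (2 * a⁻¹ * K)))
    (min ((1 - b) / (4 * b ^ 2 * K)) ((1 - a⁻¹) / (4 * a⁻¹ ^ 2 * K)))), ?_,
    fun c hc hcc L hL F hA hB hgs hgu => ?_⟩
  · have := sub_pos.2 hb
    have := sub_pos.2 ha1
    positivity
  have hcc₁ := hcc.trans (min_le_left _ _)
  have hcc₂ := hcc.trans ((min_le_right _ _).trans ((min_le_left _ _).trans (min_le_left _ _)))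
  have hcc₃ := hcc.trans ((min_le_right _ _).trans ((min_le_left _ _).trans (min_le_right _ _)))
  have hcc₄ := hcc.trans ((min_le_right _ _).trans ((min_le_right _ _).trans (min_le_left _ _)))
  have hcc₅ := hcc.trans ((min_le_right _ _).trans ((min_le_right _ _).trans (min_le_right _ _)))
  rw [le_div_iff₀ (by positivity)] at hcc₂ hcc₃ hcc₄ hcc₅
  have hBn : ∀ n u, ‖(F.B n).symm u‖ ≤ a⁻¹ * ‖u‖ := hB.norm_le
  have hgood : F.Good b a c L :=
    { hA := hA.norm_le
      hB := fun n u => by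
        have := hBn n (F.B n u)
        rwa [ContinuousLinearEquiv.symm_apply_apply, inv_mul_eq_div, le_div_iff₀ ha0, mul_comm]
          at this
      gs := fun n => (hgs n).1
      gu := fun n => (hgu n).1
      gs0 := fun n => (hgs n).2.1
      gu0 := fun n => (hgu n).2.1
      dgs0 := fun n => (hgs n).2.2
      dgu0 := fun n => (hgu n).2.2
      b0 := hb0.le
      L0 := hL }
  obtain ⟨L', hF⟩ := hdec c hc hcc₁ L hL
  obtain ⟨Ψ, γs, γu, ρ, hρ, hΨ, hΨs, hΨu, hγs, hγu, hΨd⟩ := hF F hgood (hA.le_norm hα0 hα)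
    (fun n u => by
      have := hB.le_norm (inv_pos.2 hβ0) hβ n (F.B n u)
      rwa [ContinuousLinearEquiv.symm_apply_apply, inv_mul_eq_div, div_le_iff₀ hβ0, mul_comm]
        at this)
  have hL' : 0 ≤ max L' 0 := le_max_right _ _
  have hγs' := fun n => (hγs n).1.mono le_rfl (le_max_left L' 0)
  have hγu' := fun n => (hγu n).1.mono le_rfl (le_max_left L' 0)
  have hes := fun n => exists_perturb_inverse (F.A n).symm (q := b) hb0 (hA.norm_le n) (hγs' n) hL'
    (hγs n).2.1 (hγs n).2.2 (by linarith)
  have heu := fun n => exists_perturb_inverse (F.B n) (q := a⁻¹) (by positivity) (hBn n) (hγu' n) hL'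
    (hγu n).2.1 (hγu n).2.2 (by linarith)
  choose es γs₂ hes1 hes2 hes3 hes4 hes5 using hes
  choose eu γu₂ heu1 heu2 heu3 heu4 heu5 using heu
  obtain ⟨ψs, Ms, ρs, hMs, hρs, hψs, hψs', hψsd⟩ := hA.exists_linearization
    (c := 2 * b ^ 2 * (K * c)) (L := 8 * b ^ 3 * max L' 0) (by linarith [sub_pos.2 hb])
    (by positivity) (F := fun n => (es n).symm) (g := γs₂) (fun n => ⟨hes3 n, hes4 n, hes5 n⟩)
    (fun n x => hes2 n x) (fun n => by
      have : ((es n).symm.symm : (ιs → ℝ) → (ιs → ℝ)) = fun x => (F.A n).symm x + γs n x :=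
        funext (hes1 n)
      rw [this]
      exact (F.A n).symm.contDiff.add (hγs' n).contDiff)
  obtain ⟨ψu, Mu, ρu, hMu, hρu, hψu, hψu', hψud⟩ := (hB.reindex fun m => -m - 1).exists_linearization
    (c := 2 * a⁻¹ ^ 2 * (K * c)) (L := 8 * a⁻¹ ^ 3 * max L' 0) (by linarith [sub_pos.2 ha1])
    (by positivity) (F := fun m => (eu (-m - 1)).symm) (g := fun m => γu₂ (-m - 1))
    (fun n => ⟨heu3 _, heu4 _, heu5 _⟩)
    (fun n x => heu2 _ x) (fun m => by
      have : ((eu (-m - 1)).symm.symm : (ιu → ℝ) → (ιu → ℝ))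
        = fun x => F.B (-m - 1) x + γu (-m - 1) x := funext (heu1 _)
      rw [this]
      exact (F.B _).contDiff.add (hγu' _).contDiff)
  have hpd : ∀ (n m : ℤ) x, ‖x‖ < min ρs ρu →
      HasFDerivAt (Prod.map (ψs n) (ψu m)) ((fderiv ℝ (ψs n) x.1).prodMap (fderiv ℝ (ψu m) x.2)) x ∧
      HasFDerivAt (Prod.map (ψs n).symm (ψu m).symm)
        ((fderiv ℝ (ψs n).symm x.1).prodMap (fderiv ℝ (ψu m).symm x.2)) x ∧
      ‖(fderiv ℝ (ψs n) x.1).prodMap (fderiv ℝ (ψu m) x.2)‖ ≤ max Ms Mu ∧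
      ‖(fderiv ℝ (ψs n).symm x.1).prodMap (fderiv ℝ (ψu m).symm x.2)‖ ≤ max Ms Mu := by
    intro n m x hx
    have hx1 := (norm_fst_le x).trans_lt (hx.trans_le (min_le_left _ _))
    have hx2 := (norm_snd_le x).trans_lt (hx.trans_le (min_le_right _ _))
    refine ⟨HasFDerivAt.prodMap x (hasFDerivAt_of_contDiff (hψs n).1 _)
      (hasFDerivAt_of_contDiff (hψu m).1 _), HasFDerivAt.prodMap x
      (hasFDerivAt_of_contDiff (hψs n).2.1 _) (hasFDerivAt_of_contDiff (hψu m).2.1 _), ?_, ?_⟩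
    · exact norm_prodMap_le ((hψsd n _ hx1).1.trans (le_max_left _ _))
        ((hψud m _ hx2).1.trans (le_max_right _ _))
    · exact norm_prodMap_le ((hψsd n _ hx1).2.trans (le_max_left _ _))
        ((hψud m _ hx2).2.trans (le_max_right _ _))
  set M := max Ms Mu with hM
  have hM0 : 0 < M := by positivity
  have hsmall : ∀ (f : (ιs → ℝ) × (ιu → ℝ) → (ιs → ℝ) × (ιu → ℝ)) (R Z : ℝ), 0 ≤ Z →
      ContDiff ℝ 1 f → f 0 = 0 → (∀ x, ‖x‖ < R → ‖fderiv ℝ f x‖ ≤ Z) → ∀ x, ‖x‖ < R →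
        ‖f x‖ ≤ Z * ‖x‖ := by
    intro f R Z _ hf f0 hb x hx
    have := (convex_ball (0 : (ιs → ℝ) × (ιu → ℝ)) R).norm_image_sub_le_of_norm_fderiv_le (𝕜 := ℝ)
      (f := f) (C := Z) (fun z _ => (hf.differentiable one_ne_zero).differentiableAt)
      (fun z hz => hb z (by simpa using hz)) (x := 0) (y := x)
      (by simpa using (norm_nonneg x).trans_lt hx) (by simpa using hx)
    rwa [f0, sub_zero, sub_zero] at this
  refine ⟨fun n => (Ψ n).trans ((ψs n).prodCongr (ψu (-n))), 2 * M,
    min (min ρ (min ρs ρu / 2)) (min (min ρs ρu) (ρ / M)), by positivity, by positivity,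
    fun n => ⟨?_, ?_, ?_⟩, fun n x => ?_, fun n x hx => ⟨?_, ?_⟩⟩
  · exact ((hψs n).1.prodMap (hψu (-n)).1).comp (hΨ n).1
  · exact (hΨ n).2.1.comp ((hψs n).2.1.prodMap (hψu (-n)).2.1)
  · change (ψs n (Ψ n 0).1, ψu (-n) (Ψ n 0).2) = 0
    rw [(hΨ n).2.2]
    exact Prod.ext (hψs n).2.2 (hψu _).2.2
  · change (ψs (n + 1) (Ψ (n + 1) (F.s n x, F.u n x)).1,
      ψu (-(n + 1)) (Ψ (n + 1) (F.s n x, F.u n x)).2) = _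
    refine Prod.ext ?_ ?_
    · change _ = F.A n (ψs n (Ψ n x).1)
      have h1 : (Ψ n x).1 = es n (Ψ (n + 1) (F.s n x, F.u n x)).1 := by rw [hes1]; exact hΨs n x
      rw [h1, ← hψs', Equiv.symm_apply_apply]
    · change _ = F.B n (ψu (-n) (Ψ n x).2)
      have h1 := hψu' (-n - 1) (eu n (Ψ n x).2)
      simp only [show -(-n - 1) - 1 = n by ring, show -n - 1 + 1 = -n by ring,
        Equiv.symm_apply_apply] at h1
      rw [h1, ContinuousLinearEquiv.apply_symm_apply, hΨu, heu1, neg_add']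
  · have hx1 := hx.trans_le ((min_le_left _ _).trans (min_le_left _ _))
    have hx2 := hx.trans_le ((min_le_left _ _).trans (min_le_right _ _))
    have h1 := hsmall (Ψ n) ρ 2 zero_le_two (hΨ n).1 (hΨ n).2.2 (fun z hz => (hΨd n z hz).1) x hx1
    obtain ⟨h2, -, h3, -⟩ := hpd n (-n) (Ψ n x) (by linarith)
    have h4 := HasFDerivAt.comp (f := Ψ n) x h2 (hasFDerivAt_of_contDiff (hΨ n).1 x)
    change ‖fderiv ℝ (Prod.map (ψs n) (ψu (-n)) ∘ Ψ n) x‖ ≤ _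
    rw [h4.fderiv, mul_comm]
    exact (ContinuousLinearMap.opNorm_comp_le _ _).trans
      (mul_le_mul h3 (hΨd n x hx1).1 (norm_nonneg _) hM0.le)
  · have hx1 := hx.trans_le ((min_le_right _ _).trans (min_le_left _ _))
    have hx2 := hx.trans_le ((min_le_right _ _).trans (min_le_right _ _))
    rw [lt_div_iff₀ hM0, mul_comm] at hx2
    obtain ⟨-, h2, -, h3⟩ := hpd n (-n) x hx1
    have h1 := hsmall (Prod.map (ψs n).symm (ψu (-n)).symm) (min ρs ρu) M hM0.le
      ((hψs n).2.1.prodMap (hψu (-n)).2.1)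
      (Prod.ext ((Equiv.symm_apply_eq _).2 (hψs n).2.2.symm)
        ((Equiv.symm_apply_eq _).2 (hψu _).2.2.symm))
      (fun z hz => by
        obtain ⟨-, e2, -, e3⟩ := hpd n (-n) z hz
        rwa [e2.fderiv]) x hx1
    have h4 := HasFDerivAt.comp (f := Prod.map (ψs n).symm (ψu (-n)).symm) x
      (hasFDerivAt_of_contDiff (hΨ n).2.1 _) h2
    change ‖fderiv ℝ ((Ψ n).symm ∘ Prod.map (ψs n).symm (ψu (-n)).symm) x‖ ≤ _
    rw [h4.fderiv]
    exact (ContinuousLinearMap.opNorm_comp_le _ _).trans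
      (mul_le_mul (hΨd n _ (h1.trans_lt hx2)).2 h3 (norm_nonneg _) zero_le_two)

end Saddle

section Conjugation

variable {X Y : Type*} [NormedAddCommGroup X] [NormedSpace ℝ X] [NormedAddCommGroup Y]
  [NormedSpace ℝ Y]

theorem C11.clm_comp_clm {Z W : Type*} [NormedAddCommGroup Z] [NormedSpace ℝ Z]
    [NormedAddCommGroup W] [NormedSpace ℝ W] {g : X → Y} {c L p q : ℝ} (hg : C11 g c L)
    (hL : 0 ≤ L) (T : Y →L[ℝ] Z) (S : W →L[ℝ] X) (hp : 0 ≤ p) (hq : 0 ≤ q)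
    (hT : ∀ y, ‖T y‖ ≤ q * ‖y‖) (hS : ∀ w, ‖S w‖ ≤ p * ‖w‖) :
    C11 (fun w => T (g (S w))) (q * (c * p)) (q * (L * p ^ 2)) :=
  ((C11.clm_of_le T hq hT).comp (hg.comp (C11.clm_of_le S hp hS) hL) le_rfl).mono le_rfl (by simp)

theorem fderiv_clm_comp_clm_zero {Z W : Type*} [NormedAddCommGroup Z] [NormedSpace ℝ Z]
    [NormedAddCommGroup W] [NormedSpace ℝ W] {g : X → Y} (hg : ContDiff ℝ 1 g)
    (hg0 : fderiv ℝ g 0 = 0) (T : Y →L[ℝ] Z) (S : W →L[ℝ] X) :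
    fderiv ℝ (fun w => T (g (S w))) 0 = 0 := by
  have h1 : HasFDerivAt g (0 : X →L[ℝ] Y) (S 0) := by
    rw [map_zero, ← hg0]
    exact hasFDerivAt_of_contDiff hg 0
  have h2 := T.hasFDerivAt.comp (f := fun w => g (S w)) 0 (h1.comp (f := S) 0 S.hasFDerivAt)
  exact h2.fderiv.trans (by simp)

/-- The conjugate of a bijection by a linear equivalence. -/
def conjE (e : X ≃L[ℝ] Y) (Ψ : Y ≃ Y) : X ≃ X := (e.toEquiv.trans Ψ).trans e.symm.toEquiv

theorem conjE_apply (e : X ≃L[ℝ] Y) (Ψ : Y ≃ Y) (x : X) : conjE e Ψ x = e.symm (Ψ (e x)) := rfl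

theorem conjE_symm (e : X ≃L[ℝ] Y) (Ψ : Y ≃ Y) : (conjE e Ψ).symm = conjE e Ψ.symm := rfl

theorem conjE_contDiff (e : X ≃L[ℝ] Y) {Ψ : Y ≃ Y} (h : ContDiff ℝ 1 Ψ) :
    ContDiff ℝ 1 (conjE e Ψ) :=
  e.symm.contDiff.comp (h.comp e.contDiff)

theorem norm_fderiv_conjE_le (e : X ≃L[ℝ] Y) {Ψ : Y ≃ Y} (h : ContDiff ℝ 1 Ψ) {p q M : ℝ}
    (hp : 0 ≤ p) (hq : 0 ≤ q) (he : ∀ x, ‖e x‖ ≤ p * ‖x‖) (he' : ∀ y, ‖e.symm y‖ ≤ q * ‖y‖) {x : X}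
    (hx : ‖fderiv ℝ Ψ (e x)‖ ≤ M) : ‖fderiv ℝ (conjE e Ψ) x‖ ≤ q * (M * p) := by
  have hM := (norm_nonneg _).trans hx
  have h1 : HasFDerivAt (fun x => e.symm (Ψ (e x))) _ x :=
    (e.symm : Y →L[ℝ] X).hasFDerivAt.comp (f := fun x => Ψ (e x)) x
      ((hasFDerivAt_of_contDiff h (e x)).comp (f := e) x (e : X →L[ℝ] Y).hasFDerivAt)
  have h2 : fderiv ℝ (conjE e Ψ) x = _ := h1.fderiv
  rw [h2]
  refine (ContinuousLinearMap.opNorm_comp_le _ _).trans ?_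
  refine mul_le_mul (ContinuousLinearMap.opNorm_le_bound _ hq he') ?_ (norm_nonneg _) hq
  exact (ContinuousLinearMap.opNorm_comp_le _ _).trans
    (mul_le_mul hx (ContinuousLinearMap.opNorm_le_bound _ hp he) (norm_nonneg _) hM)

end Conjugation

section Restrict

variable {ι : Type*} [Fintype ι] {ℓ : ι → ℕ}

/-- Restriction to the coordinates satisfying `p`. -/
def resCLM (p : ι → Prop) : (ι → ℝ) →L[ℝ] ({i // p i} → ℝ) :=
  ContinuousLinearMap.pi fun i => ContinuousLinearMap.proj i.1

open Classical in
/-- Extension by zero from the coordinates satisfying `p`. -/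
def extCLM (p : ι → Prop) : ({i // p i} → ℝ) →L[ℝ] (ι → ℝ) :=
  ContinuousLinearMap.pi fun i => if h : p i then ContinuousLinearMap.proj ⟨i, h⟩ else 0

theorem resCLM_apply (p : ι → Prop) (x : ι → ℝ) (i : {i // p i}) : resCLM p x i = x i.1 := rfl

theorem extCLM_of_pos {p : ι → Prop} (x : {i // p i} → ℝ) {i : ι} (h : p i) :
    extCLM p x i = x ⟨i, h⟩ := by
  simp [extCLM, h]

theorem extCLM_of_neg {p : ι → Prop} (x : {i // p i} → ℝ) {i : ι} (h : ¬ p i) :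
    extCLM p x i = 0 := by
  simp [extCLM, h]

theorem norm_resCLM_le (p : ι → Prop) [Fintype {i // p i}] (x : ι → ℝ) :
    ‖resCLM p x‖ ≤ ‖x‖ :=
  (pi_norm_le_iff_of_nonneg (norm_nonneg _)).2 fun i => norm_le_pi_norm x i.1

theorem norm_extCLM (p : ι → Prop) [Fintype {i // p i}] (x : {i // p i} → ℝ) :
    ‖extCLM p x‖ = ‖x‖ := by
  refine le_antisymm ((pi_norm_le_iff_of_nonneg (norm_nonneg _)).2 fun i => ?_)
    ((pi_norm_le_iff_of_nonneg (norm_nonneg _)).2 fun i => ?_)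
  · by_cases h : p i
    · rw [extCLM_of_pos x h]
      exact norm_le_pi_norm x ⟨i, h⟩
    · rw [extCLM_of_neg x h, norm_zero]
      positivity
  · rw [← extCLM_of_pos x i.2]
    exact norm_le_pi_norm (extCLM p x) i.1

theorem resCLM_extCLM (p : ι → Prop) (x : {i // p i} → ℝ) : resCLM p (extCLM p x) = x := by
  ext i
  rw [resCLM_apply, extCLM_of_pos x i.2]

theorem extCLM_resCLM (p : ℕ → Prop) (x : ι → ℝ) :
    extCLM (fun i : ι => p (ℓ i)) (resCLM (fun i : ι => p (ℓ i)) x) = rst ℓ p x := by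
  ext i
  rw [rst_apply]
  split_ifs with h
  · rw [extCLM_of_pos (p := fun i : ι => p (ℓ i)) _ h, resCLM_apply]
  · rw [extCLM_of_neg (p := fun i : ι => p (ℓ i)) _ h]

theorem resCLM_rst (p : ℕ → Prop) (x : ι → ℝ) :
    resCLM (fun i : ι => p (ℓ i)) (rst ℓ p x) = resCLM (fun i : ι => p (ℓ i)) x := by
  rw [← extCLM_resCLM, resCLM_extCLM]

variable {A : ℤ → (ι → ℝ) ≃L[ℝ] (ι → ℝ)} {lo hi : ℕ → ℝ}

theorem Banded.comm_rst_symm (h : Banded ℓ A lo hi) (p : ℕ → Prop) (n : ℤ) (x : ι → ℝ) :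
    rst ℓ p ((A n).symm x) = (A n).symm (rst ℓ p x) := by
  rw [ContinuousLinearEquiv.eq_symm_apply, ← h.comm_rst, ContinuousLinearEquiv.apply_symm_apply]

theorem rst_extCLM (p : ℕ → Prop) [Fintype {i // p (ℓ i)}] (k : ℕ) (x : {i // p (ℓ i)} → ℝ) :
    rst ℓ (· = k) (extCLM (fun i : ι => p (ℓ i)) x)
      = extCLM (fun i : ι => p (ℓ i)) (rst (fun i : {i // p (ℓ i)} => ℓ i.1) (· = k) x) := by
  ext i
  by_cases h : p (ℓ i)
  · rw [rst_apply, extCLM_of_pos (p := fun i : ι => p (ℓ i)) _ h,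
      extCLM_of_pos (p := fun i : ι => p (ℓ i)) _ h, rst_apply]
  · rw [rst_apply, extCLM_of_neg (p := fun i : ι => p (ℓ i)) _ h,
      extCLM_of_neg (p := fun i : ι => p (ℓ i)) _ h, ite_self]

theorem Banded.restrict (h : Banded ℓ A lo hi) (p : ℕ → Prop) [Fintype {i // p (ℓ i)}] :
    ∃ S : ℤ → ({i // p (ℓ i)} → ℝ) ≃L[ℝ] ({i // p (ℓ i)} → ℝ),
      (∀ n x, resCLM (fun i : ι => p (ℓ i)) (A n x) = S n (resCLM (fun i : ι => p (ℓ i)) x)) ∧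
      Banded (fun i : {i // p (ℓ i)} => ℓ i.1) S lo hi := by
  set R := resCLM (fun i : ι => p (ℓ i)) with hR
  set X := extCLM (fun i : ι => p (ℓ i)) with hX
  have hRX : ∀ x, R (X x) = x := resCLM_extCLM _
  have hRr : ∀ x, R (rst ℓ p x) = R x := resCLM_rst p
  have hXR : ∀ x, X (R x) = rst ℓ p x := extCLM_resCLM p
  let S : ℤ → ({i // p (ℓ i)} → ℝ) ≃L[ℝ] ({i // p (ℓ i)} → ℝ) := fun n =>
    ContinuousLinearEquiv.equivOfInverse (R.comp ((A n : (ι → ℝ) →L[ℝ] (ι → ℝ)).comp X))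
      (R.comp (((A n).symm : (ι → ℝ) →L[ℝ] (ι → ℝ)).comp X))
      (fun x => by
        change R ((A n).symm (X (R (A n (X x))))) = x
        rw [hXR, ← h.comm_rst_symm, hRr, ContinuousLinearEquiv.symm_apply_apply, hRX])
      (fun x => by
        change R (A n (X (R ((A n).symm (X x))))) = x
        rw [hXR, ← h.comm_rst, hRr, ContinuousLinearEquiv.apply_symm_apply, hRX])
  have hS : ∀ n x, S n x = R (A n (X x)) := fun n x => rfl
  have hXS : ∀ n x, X (S n x) = A n (X x) := fun n x => by
    rw [hS, hXR, h.comm_rst, ← hXR, hRX]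
  refine ⟨S, fun n x => ?_, ⟨fun n k x => ?_, fun n k x hx => ?_, fun n k x hx => ?_⟩⟩
  · rw [hS, hXR, ← h.comm_rst, hRr]
  · rw [hS n (rst _ _ x), ← rst_extCLM, ← h.comm, ← hXS, rst_extCLM, hRX]
  · rw [← norm_extCLM, ← norm_extCLM _ x, ← hX, hXS]
    exact h.up n k _ (by rw [rst_extCLM, hx])
  · rw [← norm_extCLM, ← norm_extCLM _ (S n x), ← hX, hXS]
    exact h.low n k _ (by rw [rst_extCLM, hx])

theorem Banded.symm_rev {r : ℕ} (h : Banded ℓ A lo hi) (hℓ : ∀ i, ℓ i < r)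
    (hpos : ∀ j < r, 0 < lo j ∧ 0 < hi j) :
    Banded (fun i => r - 1 - ℓ i) (fun n => (A n).symm) (fun j => (hi (r - 1 - j))⁻¹)
      (fun j => (lo (r - 1 - j))⁻¹) := by
  have key : ∀ (k : ℕ) (x : ι → ℝ), rst (fun i => r - 1 - ℓ i) (· = k) x
      = if k < r then rst ℓ (· = r - 1 - k) x else 0 := by
    intro k x
    ext i
    have := hℓ i
    split_ifs with hk
    · simp only [rst_apply]
      split_ifs <;> first | rfl | omega
    · simp only [rst_apply]
      rw [if_neg (by omega)]
      rfl
  refine ⟨fun n k x => ?_, fun n k x hx => ?_, fun n k x hx => ?_⟩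
  · rw [key, key]
    split_ifs
    · exact h.comm_rst_symm _ n x
    · rw [map_zero]
  · rw [key] at hx
    split_ifs at hx with hk
    · have h1 := h.low n (r - 1 - k) ((A n).symm x) (by rw [h.comm_rst_symm, hx])
      rw [ContinuousLinearEquiv.apply_symm_apply] at h1
      rw [inv_mul_eq_div, le_div_iff₀ (hpos _ (by omega)).1, mul_comm]
      exact h1
    · simp [← hx]
  · rw [key] at hx
    split_ifs at hx with hk
    · have h1 := h.up n (r - 1 - k) ((A n).symm x) (by rw [h.comm_rst_symm, hx])
      rw [ContinuousLinearEquiv.apply_symm_apply] at h1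
      rw [inv_mul_eq_div, div_le_iff₀ (hpos _ (by omega)).2, mul_comm]
      exact h1
    · simp [← hx]

theorem exists_split {p q : ι → Prop} [Fintype {i // p i}] [Fintype {i // q i}]
    (hpq : ∀ i, q i ↔ ¬ p i) :
    ∃ e : (ι → ℝ) ≃L[ℝ] ({i // p i} → ℝ) × ({i // q i} → ℝ),
      (∀ x, e x = (resCLM p x, resCLM q x)) ∧ (∀ x, ‖e x‖ ≤ 1 * ‖x‖) ∧
      ∀ y, ‖e.symm y‖ ≤ 1 * ‖y‖ := by
  have hsum : ∀ x, extCLM p (resCLM p x) + extCLM q (resCLM q x) = x := fun x => by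
    ext i
    rw [Pi.add_apply]
    by_cases h : p i
    · rw [extCLM_of_pos _ h, extCLM_of_neg _ (by simpa [hpq] using h), add_zero, resCLM_apply]
    · rw [extCLM_of_neg _ h, extCLM_of_pos _ ((hpq i).2 h), zero_add, resCLM_apply]
  have h1 : ∀ y, resCLM p (extCLM q y) = 0 := fun y => by
    ext i
    rw [resCLM_apply, extCLM_of_neg _ (by simpa [hpq] using i.2)]
    rfl
  have h2 : ∀ y, resCLM q (extCLM p y) = 0 := fun y => by
    ext i
    rw [resCLM_apply, extCLM_of_neg _ ((hpq _).1 i.2)]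
    rfl
  refine ⟨ContinuousLinearEquiv.equivOfInverse ((resCLM p).prod (resCLM q))
      ((extCLM p).comp (ContinuousLinearMap.fst ℝ _ _)
        + (extCLM q).comp (ContinuousLinearMap.snd ℝ _ _)) (fun x => hsum x) (fun x => ?_), fun x => rfl,
      fun x => ?_, fun y => ?_⟩
  · change (resCLM p (extCLM p x.1 + extCLM q x.2), resCLM q (extCLM p x.1 + extCLM q x.2)) = x
    rw [map_add, map_add, h1, h2, add_zero, zero_add]
    exact Prod.ext (resCLM_extCLM _ _) (resCLM_extCLM _ _)
  · rw [one_mul]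
    exact max_le (norm_resCLM_le _ x) (norm_resCLM_le _ x)
  · rw [one_mul]
    refine (pi_norm_le_iff_of_nonneg (norm_nonneg _)).2 fun i => ?_
    change ‖extCLM p y.1 i + extCLM q y.2 i‖ ≤ _
    by_cases h : p i
    · rw [extCLM_of_pos _ h, extCLM_of_neg _ (by simpa [hpq] using h), add_zero]
      exact (norm_le_pi_norm y.1 _).trans (norm_fst_le y)
    · rw [extCLM_of_neg _ h, extCLM_of_pos _ ((hpq i).2 h), zero_add]
      exact (norm_le_pi_norm y.2 _).trans (norm_snd_le y)

/-- Linearization of a banded hyperbolic family, the first `k` of the `r` bands being stable. -/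
theorem exists_banded_linearization {r k : ℕ} {a b α β : ℝ} (hℓ : ∀ i, ℓ i < r) (hkr : k ≤ r)
    (ha : 1 < a) (hb0 : 0 < b) (hb : b < 1) (hα0 : 0 < α) (hβ0 : 0 < β) (hbβ : b * β < a)
    (hbα : b / α < a) (hpos : ∀ j < r, 0 < lo j ∧ lo j ≤ hi j)
    (hord : ∀ i j, i < j → j < r → hi i < lo j)
    (hs : ∀ j < k, α ≤ lo j ∧ hi j ≤ b ∧ hi j * b < lo j)
    (hu : ∀ j, k ≤ j → j < r → a ≤ lo j ∧ hi j ≤ β ∧ hi j < lo j * a) :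
    ∃ c₀ > 0, ∀ c, 0 < c → c ≤ c₀ → ∀ L, 0 ≤ L → ∀ A : ℤ → (ι → ℝ) ≃L[ℝ] (ι → ℝ),
      Banded ℓ A lo hi → ∀ g : ℤ → (ι → ℝ) → (ι → ℝ),
      (∀ n, C11 (g n) c L ∧ g n 0 = 0 ∧ fderiv ℝ (g n) 0 = 0) →
      ∃ (Ψ : ℤ → ((ι → ℝ) ≃ (ι → ℝ))) (M ρ : ℝ), 0 < M ∧ 0 < ρ ∧
        (∀ n, ContDiff ℝ 1 (Ψ n) ∧ ContDiff ℝ 1 (Ψ n).symm ∧ Ψ n 0 = 0) ∧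
        (∀ n x, Ψ (n + 1) (A n x + g n x) = A n (Ψ n x)) ∧
        (∀ n x, ‖x‖ < ρ → ‖fderiv ℝ (Ψ n) x‖ ≤ M ∧ ‖fderiv ℝ (Ψ n).symm x‖ ≤ M) := by
  classical
  obtain ⟨ps, hps⟩ : ∃ p : ℕ → Prop, ∀ j, p j ↔ j < k := ⟨(· < k), fun _ => Iff.rfl⟩
  obtain ⟨pu, hpu⟩ : ∃ p : ℕ → Prop, ∀ j, p j ↔ k ≤ j := ⟨(k ≤ ·), fun _ => Iff.rfl⟩
  have ha0 : 0 < a := one_pos.trans ha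
  have ha1 : a⁻¹ < 1 := inv_lt_one_of_one_lt₀ ha
  obtain ⟨c₀, hc₀, hmain⟩ := exists_saddle_linearization
    (ℓs := fun i : {i // ps (ℓ i)} => ℓ i.1) (ℓu := fun i : {i // pu (ℓ i)} => r - 1 - ℓ i.1)
    (ks := k) (ku := r - k) (los := lo) (his := hi) (lou := fun j => (hi (r - 1 - j))⁻¹)
    (hiu := fun j => (lo (r - 1 - j))⁻¹) ha hb0 hb hα0 hβ0 hbβ hbα (fun j hj => (hs j hj).1)
    (fun j hj => by
      have h1 := hu (r - 1 - j) (by omega) (by omega)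
      exact inv_anti₀ (by linarith [hpos (r - 1 - j) (by omega)]) h1.2.1)
  refine ⟨c₀, hc₀, fun c hc hcc L hL A hA g hg => ?_⟩
  obtain ⟨S, hS, hSb⟩ := hA.restrict ps
  obtain ⟨U, hU, hUb⟩ := hA.restrict pu
  set Rs := resCLM (fun i : ι => ps (ℓ i)) with hRs
  set Ru := resCLM (fun i : ι => pu (ℓ i)) with hRu
  obtain ⟨e, he, hen, hen'⟩ := exists_split (p := fun i : ι => ps (ℓ i)) (q := fun i => pu (ℓ i))
    fun i => by rw [hps, hpu, not_lt]
  let F : Sys ({i // ps (ℓ i)} → ℝ) ({i // pu (ℓ i)} → ℝ) :=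
    { A := S, B := U, gs := fun n y => Rs (g n (e.symm y)), gu := fun n y => Ru (g n (e.symm y)) }
  have hC : ∀ n, C11 (F.gs n) c L ∧ F.gs n 0 = 0 ∧ fderiv ℝ (F.gs n) 0 = 0 := by
    intro n
    refine ⟨?_, ?_, ?_⟩
    · have h1 := (hg n).1.clm_comp_clm hL Rs e.symm.toContinuousLinearMap zero_le_one zero_le_one
        (fun y => by rw [one_mul]; exact norm_resCLM_le _ y) hen'
      rw [one_mul, one_mul, mul_one, one_pow, mul_one] at h1
      exact h1
    · change Rs (g n (e.symm 0)) = 0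
      rw [map_zero, (hg n).2.1, map_zero]
    · exact fderiv_clm_comp_clm_zero (hg n).1.contDiff (hg n).2.2 Rs e.symm.toContinuousLinearMap
  have hC' : ∀ n, C11 (F.gu n) c L ∧ F.gu n 0 = 0 ∧ fderiv ℝ (F.gu n) 0 = 0 := by
    intro n
    refine ⟨?_, ?_, ?_⟩
    · have h1 := (hg n).1.clm_comp_clm hL Ru e.symm.toContinuousLinearMap zero_le_one zero_le_one
        (fun y => by rw [one_mul]; exact norm_resCLM_le _ y) hen'
      rw [one_mul, one_mul, mul_one, one_pow, mul_one] at h1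
      exact h1
    · change Ru (g n (e.symm 0)) = 0
      rw [map_zero, (hg n).2.1, map_zero]
    · exact fderiv_clm_comp_clm_zero (hg n).1.contDiff (hg n).2.2 Ru e.symm.toContinuousLinearMap
  obtain ⟨Ψ, M, ρ, hM, hρ, h1, h2, h3⟩ := hmain c hc hcc L hL F
    { banded := hSb
      label_lt := fun i => (hps _).1 i.2
      band := fun j hj => ⟨(hpos j (by omega)).1, (hpos j (by omega)).2, (hs j hj).2⟩
      ord := fun i j hij hj => hord i j hij (by omega)
      nonneg := hb0.le
      lt_one := hb }
    { banded := hUb.symm_rev (fun i => hℓ i.1) fun j hj =>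
        ⟨(hpos j hj).1, (hpos j hj).1.trans_le (hpos j hj).2⟩
      label_lt := fun i => by
        have := hℓ i.1
        have : k ≤ ℓ i.1 := (hpu _).1 i.2
        omega
      band := fun j hj => by
        have e1 := hpos (r - 1 - j) (by omega)
        obtain ⟨e2, e3, e4⟩ := hu (r - 1 - j) (by omega) (by omega)
        have e5 := e1.1.trans_le e1.2
        refine ⟨inv_pos.2 e5, inv_anti₀ e1.1 e1.2, inv_anti₀ ha0 e2, ?_⟩
        rw [← mul_inv]
        exact inv_strictAnti₀ e5 e4
      ord := fun i j hij hj => by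
        have e1 := hpos (r - 1 - j) (by omega)
        exact inv_strictAnti₀ (e1.1.trans_le e1.2) (hord (r - 1 - j) (r - 1 - i) (by omega)
          (by omega))
      nonneg := (inv_pos.2 ha0).le
      lt_one := ha1 } hC hC'
  refine ⟨fun n => conjE e (Ψ n), M, ρ, hM, hρ,
    fun n => ⟨conjE_contDiff e (h1 n).1, conjE_contDiff e (h1 n).2.1, ?_⟩, fun n x => ?_,
    fun n x hx => ⟨?_, ?_⟩⟩
  · rw [conjE_apply, map_zero, (h1 n).2.2, map_zero]
  · have h4 := h2 n (e x)
    have h5 : (F.s n (e x), F.u n (e x)) = e (A n x + g n x) := by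
      rw [map_add, he (A n x), he (g n x), hS, hU]
      change (S n (e x).1 + Rs (g n (e.symm (e x))), U n (e x).2 + Ru (g n (e.symm (e x)))) = _
      rw [ContinuousLinearEquiv.symm_apply_apply, he x]
      rfl
    rw [h5] at h4
    have h6 : ∀ y, (Rs (e.symm y), Ru (e.symm y)) = y := fun y => by
      rw [← he, e.apply_symm_apply]
    have h8 : ∀ y : ({i // ps (ℓ i)} → ℝ) × ({i // pu (ℓ i)} → ℝ),
        e (A n (e.symm y)) = (S n y.1, U n y.2) := fun y => by
      rw [he (A n _), hS, hU]
      exact congrArg (fun z : ({i // ps (ℓ i)} → ℝ) × ({i // pu (ℓ i)} → ℝ) =>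
        (S n z.1, U n z.2)) (h6 y)
    rw [conjE_apply, conjE_apply, h4, ContinuousLinearEquiv.symm_apply_eq, h8]
  · refine (norm_fderiv_conjE_le e (h1 n).1 zero_le_one zero_le_one hen hen'
      (h3 n (e x) ((hen x).trans_lt (by rwa [one_mul]))).1).trans (by simp)
  · refine (norm_fderiv_conjE_le e (h1 n).2.1 zero_le_one zero_le_one hen hen'
      (h3 n (e x) ((hen x).trans_lt (by rwa [one_mul]))).2).trans (by simp)

end Restrict

section Evolution

variable {X : Type*} [NormedAddCommGroup X] [NormedSpace ℝ X]

theorem fwd_succ (B : ℕ → (X ≃L[ℝ] X)) (n J : ℕ) (x : X) :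
    fwd B n (J + 1) x = B (n + J) (fwd B n J x) := rfl

/-- The evolution `F (n+J-1) ∘ ⋯ ∘ F n`. -/
def evolE (F : ℕ → X ≃ X) (n : ℕ) : ℕ → X ≃ X
  | 0 => Equiv.refl X
  | J + 1 => (evolE F n J).trans (F (n + J))

theorem evolE_succ (F : ℕ → X ≃ X) (n J : ℕ) (x : X) :
    evolE F n (J + 1) x = F (n + J) (evolE F n J x) := rfl

theorem evolE_contDiff {F : ℕ → X ≃ X} {n : ℕ} (hn : 1 ≤ n)
    (hF : ∀ n, 1 ≤ n → ContDiff ℝ 1 (F n) ∧ ContDiff ℝ 1 (F n).symm) (J : ℕ) :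
    ContDiff ℝ 1 (evolE F n J) ∧ ContDiff ℝ 1 (evolE F n J).symm := by
  induction J with
  | zero => exact ⟨contDiff_id, contDiff_id⟩
  | succ J ih =>
    have h := hF (n + J) (by omega)
    exact ⟨h.1.comp ih.1, ih.2.comp h.2⟩

/-- A sequence of conjugacies intertwines the evolutions. -/
theorem conj_evolE {F ψ : ℕ → X ≃ X} {B : ℕ → (X ≃L[ℝ] X)} {n : ℕ} (hn : 1 ≤ n)
    (h : ∀ n, 1 ≤ n → ∀ x, ψ (n + 1) (F n x) = B n (ψ n x)) (J : ℕ) (x : X) :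
    ψ (n + J) (evolE F n J x) = fwd B n J (ψ n x) := by
  induction J with
  | zero => rfl
  | succ J ih => rw [evolE_succ, fwd_succ, ← ih, ← h _ (by omega)]; rfl

/-- Over a block of times comparable with its starting time, a perturbation of size `1 / n`
amounts to a near-identity change of the linear evolution. -/
theorem evolE_eq_fwd_add {F : ℕ → X ≃ X} {B : ℕ → (X ≃L[ℝ] X)} {g : ℕ → X → X} {c L D : ℝ} {M : ℕ}
    (hL : 0 ≤ L) (hD : 0 ≤ D) (hF : ∀ n, 1 ≤ n → ∀ x, F n x = B n x + g n x)
    (hg : ∀ n : ℕ, 1 ≤ n → C11 (g n) (c / (n + 1)) (L / (n + 1)) ∧ g n 0 = 0 ∧ fderiv ℝ (g n) 0 = 0)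
    (hB : ∀ n J : ℕ, 1 ≤ n → J ≤ M * n → ∀ x, ‖fwd B n J x‖ ≤ D * ‖x‖ ∧
      ‖(fwd B n J).symm x‖ ≤ D * ‖x‖)
    (hc0 : 0 ≤ c) (hc : 2 * M * D ^ 2 * c ≤ 1) (n : ℕ) (hn : 1 ≤ n) (J : ℕ) (hJ : J ≤ M * n) :
    ∃ H : X → X, C11 H (2 * J * (D ^ 2 * c / n)) (8 * J * (D ^ 3 * L / n)) ∧ H 0 = 0 ∧
      fderiv ℝ H 0 = 0 ∧ ∀ x, evolE F n J x = fwd B n J (x + H x) := by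
  have hn0 : (0 : ℝ) < n := by exact_mod_cast hn
  induction J with
  | zero =>
    refine ⟨fun _ => 0, C11.zero (by positivity) (by positivity), rfl, by simp, fun x => ?_⟩
    simp [evolE, fwd]
  | succ J ih =>
    obtain ⟨H, hH, H0, dH0, hHe⟩ := ih (by omega)
    set c' := D ^ 2 * c / n with hc'
    set L' := D ^ 3 * L / n with hL'
    have hc'0 : 0 ≤ c' := by positivity
    have hL'0 : 0 ≤ L' := by positivity
    have hJc : 2 * J * c' ≤ 1 := by
      have h1 : (J : ℝ) ≤ M * n := by exact_mod_cast (by omega : J ≤ M * n)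
      calc 2 * J * c' ≤ 2 * (M * n) * c' := by gcongr
        _ = 2 * M * D ^ 2 * c := by rw [hc']; field_simp
        _ ≤ 1 := hc
    obtain ⟨hgC, g0, dg0⟩ := hg (n + J) (by omega)
    let T : X →L[ℝ] X := (fwd B n (J + 1)).symm.toContinuousLinearMap
    let S : X →L[ℝ] X := (fwd B n J).toContinuousLinearMap
    have hden : (n : ℝ) ≤ ((n + J : ℕ) : ℝ) + 1 := by push_cast; linarith [J.cast_nonneg (α := ℝ)]
    have hh : C11 (fun y => T (g (n + J) (S y))) c' L' := by
      refine (hgC.clm_comp_clm (by positivity) T S hD hD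
        (fun y => (hB n (J + 1) hn hJ y).2) (fun y => (hB n J hn (by omega) y).1)).mono ?_ ?_
      · calc D * (c / (((n + J : ℕ) : ℝ) + 1) * D) ≤ D * (c / n * D) := by gcongr
          _ = c' := by rw [hc']; ring
      · calc D * (L / (((n + J : ℕ) : ℝ) + 1) * D ^ 2) ≤ D * (L / n * D ^ 2) := by gcongr
          _ = L' := by rw [hL']; ring
    have hh0 : fderiv ℝ (fun y => T (g (n + J) (S y))) 0 = 0 :=
      fderiv_clm_comp_clm_zero hgC.contDiff dg0 T S
    have hid : C11 (fun x : X => x) 1 0 :=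
      C11.clm_of_le (ContinuousLinearMap.id ℝ X) zero_le_one (fun x => by simp)
    have hsum := hid.add hH
    have hcomp := hh.comp hsum hL'0
    refine ⟨fun x => H x + T (g (n + J) (S (x + H x))), (hH.add hcomp).mono ?_ ?_, ?_, ?_,
      fun x => ?_⟩
    · push_cast
      nlinarith
    · push_cast
      have h1 : (1 + 2 * J * c') ^ 2 ≤ 4 := by
        have : 0 ≤ 2 * J * c' := by positivity
        nlinarith
      have h2 : L' * (1 + 2 * J * c') ^ 2 ≤ L' * 4 := by gcongr
      have h3 : c' * (0 + 8 * J * L') ≤ 4 * L' := by nlinarith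
      linarith
    · change H 0 + T (g (n + J) (S (0 + H 0))) = 0
      rw [H0, add_zero, map_zero, g0, map_zero, add_zero]
    · have h1 : HasFDerivAt H (0 : X →L[ℝ] X) 0 := by rw [← dH0]; exact hH.hasFDerivAt 0
      have h2 : HasFDerivAt (fun y => T (g (n + J) (S y))) (0 : X →L[ℝ] X) (0 + H 0) := by
        rw [H0, add_zero, ← hh0]; exact hh.hasFDerivAt 0
      have h3 := h1.add (h2.comp (f := fun x => x + H x) 0 ((hasFDerivAt_id (0 : X)).add h1))
      exact h3.fderiv.trans (by simp)
    · have h1 : fwd B n (J + 1) (T (g (n + J) (S (x + H x)))) = g (n + J) (S (x + H x)) :=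
        (fwd B n (J + 1)).apply_symm_apply _
      rw [evolE_succ, hF _ (by omega), hHe, ← add_assoc, map_add (fwd B n (J + 1)), h1, fwd_succ]
      rfl

/-- The nonlinear evolution over a block is bi-Lipschitz. -/
theorem evolE_lipschitz {F : ℕ → X ≃ X} {B : ℕ → (X ≃L[ℝ] X)} {H : X → X} {c L D : ℝ} {n J : ℕ}
    (hD : 0 ≤ D) (hB : ∀ x, ‖fwd B n J x‖ ≤ D * ‖x‖ ∧ ‖(fwd B n J).symm x‖ ≤ D * ‖x‖)
    (hH : C11 H c L) (hc : c ≤ 1 / 2) (h : ∀ x, evolE F n J x = fwd B n J (x + H x)) (x y : X) :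
    ‖evolE F n J x - evolE F n J y‖ ≤ 2 * D * ‖x - y‖ ∧
      ‖x - y‖ ≤ 2 * D * ‖evolE F n J x - evolE F n J y‖ := by
  have h1 := hH.lipschitz x y
  have h2 : c * ‖x - y‖ ≤ 1 / 2 * ‖x - y‖ := by gcongr
  have e : evolE F n J x - evolE F n J y = fwd B n J ((x - y) + (H x - H y)) := by
    rw [h, h, ← map_sub]
    congr 1
    abel
  constructor
  · rw [e]
    refine (hB _).1.trans ?_
    rw [mul_comm 2 D, mul_assoc]
    gcongr
    linarith [norm_add_le (x - y) (H x - H y), norm_nonneg (x - y)]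
  · have h3 := (hB (evolE F n J x - evolE F n J y)).2
    rw [e, ContinuousLinearEquiv.symm_apply_apply, ← e] at h3
    have h4 := norm_sub_le ((x - y) + (H x - H y)) (H x - H y)
    rw [add_sub_cancel_right] at h4
    linarith

end Evolution

section Calculus

variable {X : Type*} [NormedAddCommGroup X] [NormedSpace ℝ X]

theorem norm_fderiv_comp_le {f g : X → X} (hf : ContDiff ℝ 1 f) (hg : ContDiff ℝ 1 g) {x : X}
    {a b : ℝ} (ha : ‖fderiv ℝ f (g x)‖ ≤ a) (hb : ‖fderiv ℝ g x‖ ≤ b) :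
    ‖fderiv ℝ (fun x => f (g x)) x‖ ≤ a * b := by
  have h : HasFDerivAt (fun x => f (g x)) _ x :=
    (hasFDerivAt_of_contDiff hf (g x)).comp (f := g) x (hasFDerivAt_of_contDiff hg x)
  rw [h.fderiv]
  exact (ContinuousLinearMap.opNorm_comp_le _ _).trans
    (mul_le_mul ha hb (norm_nonneg _) ((norm_nonneg _).trans ha))

theorem norm_fderiv_le_of_norm_sub_le {f : X → X} {a : ℝ} (ha : 0 ≤ a)
    (h : ∀ x y, ‖f x - f y‖ ≤ a * ‖x - y‖) (x : X) : ‖fderiv ℝ f x‖ ≤ a :=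
  norm_fderiv_le_of_lip' ℝ ha (Eventually.of_forall fun y => h y x)

end Calculus

section Rates

theorem exists_nat_mul_rpow_lt {K η : ℝ} (hK : 0 < K) (hη : 0 < η) :
    ∃ M : ℕ, 2 ≤ M ∧ ∀ e f : ℝ, e - f ≤ -η → K * (M : ℝ) ^ e < (M : ℝ) ^ f := by
  have h1 : Tendsto (fun M : ℕ => (M : ℝ) ^ (-η)) atTop (𝓝 0) :=
    (tendsto_rpow_neg_atTop hη).comp tendsto_natCast_atTop_atTop
  obtain ⟨M, hM, hM2⟩ := ((h1.eventually (gt_mem_nhds (inv_pos.2 hK))).and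
    (eventually_ge_atTop 2)).exists
  refine ⟨M, hM2, fun e f h => ?_⟩
  have hM1 : (1 : ℝ) ≤ M := by exact_mod_cast (by omega : 1 ≤ M)
  have hM0 : (0 : ℝ) < M := by linarith
  have h2 : (M : ℝ) ^ e ≤ (M : ℝ) ^ f * (M : ℝ) ^ (-η) := by
    rw [← Real.rpow_add hM0]
    exact Real.rpow_le_rpow_of_exponent_le hM1 (by linarith)
  have h3 : 0 < (M : ℝ) ^ f := Real.rpow_pos_of_pos hM0 f
  calc K * (M : ℝ) ^ e ≤ K * ((M : ℝ) ^ f * (M : ℝ) ^ (-η)) := by gcongr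
    _ = (M : ℝ) ^ f * (K * (M : ℝ) ^ (-η)) := by ring
    _ < (M : ℝ) ^ f * (K * K⁻¹) := by gcongr
    _ = (M : ℝ) ^ f := by rw [mul_inv_cancel₀ hK.ne', mul_one]

variable {ι : Type*} [Fintype ι] {ℓ : ι → ℕ} {B : ℕ → ((ι → ℝ) ≃L[ℝ] (ι → ℝ))}

theorem rst_fwd (hcomm : ∀ n, 1 ≤ n → ∀ j x, rst ℓ (· = j) (B n x) = B n (rst ℓ (· = j) x))
    {n : ℕ} (hn : 1 ≤ n) (J j : ℕ) (x : ι → ℝ) :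
    rst ℓ (· = j) (fwd B n J x) = fwd B n J (rst ℓ (· = j) x) := by
  induction J with
  | zero => rfl
  | succ J ih => rw [fwd_succ, hcomm _ (by omega), ih, ← fwd_succ]

variable {r k : ℕ} {K p η α₁ βs αu βr : ℝ} {dn up : ℕ → ℝ}

/-- Linearization of small perturbations of a one-sided family with polynomial band rates. -/
theorem exists_linearization_of_rates (hK : 1 ≤ K) (hp : 0 ≤ p) (hη : 0 < η) (hℓ : ∀ i, ℓ i < r)
    (hkr : k ≤ r)
    (hB : ∀ n J : ℕ, 1 ≤ n → ∀ x, ‖fwd B n J x‖ ≤ K * (((n : ℝ) + J) / n) ^ p * ‖x‖ ∧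
      ‖(fwd B n J).symm x‖ ≤ K * (((n : ℝ) + J) / n) ^ p * ‖x‖)
    (hcomm : ∀ n, 1 ≤ n → ∀ j x, rst ℓ (· = j) (B n x) = B n (rst ℓ (· = j) x))
    (hrate : ∀ j < r, ∀ n J : ℕ, 1 ≤ n → ∀ x, rst ℓ (· = j) x = x →
      ‖fwd B n J x‖ ≤ K * (((n : ℝ) + J) / n) ^ (up j) * ‖x‖ ∧
      (((n : ℝ) + J) / n) ^ (dn j) * ‖x‖ ≤ K * ‖fwd B n J x‖)
    (hdu : ∀ j < r, dn j ≤ up j) (hβs : βs ≤ -η) (hαu : η ≤ αu) (h₁ : βs + βr - αu ≤ -η)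
    (h₂ : βs - α₁ - αu ≤ -η)
    (hs : ∀ j < k, α₁ ≤ dn j ∧ up j ≤ βs ∧ up j + βs - dn j ≤ -η)
    (hu : ∀ j, k ≤ j → j < r → αu ≤ dn j ∧ up j ≤ βr ∧ up j - dn j - αu ≤ -η)
    (hord : ∀ i j, i < j → j < r → up i - dn j ≤ -η) {L : ℝ} (hL : 0 ≤ L) :
    ∃ c₀ > 0, ∀ c, 0 < c → c ≤ c₀ → ∀ g : ℕ → (ι → ℝ) → (ι → ℝ),
      (∀ n : ℕ, 1 ≤ n → C11 (g n) (c / (n + 1)) (L / (n + 1)) ∧ g n 0 = 0 ∧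
        fderiv ℝ (g n) 0 = 0) →
      ∃ (ψ : ℕ → ((ι → ℝ) ≃ (ι → ℝ))) (M ρ : ℝ), 0 < M ∧ 0 < ρ ∧
        (∀ n, 1 ≤ n → ContDiff ℝ 1 (ψ n) ∧ ContDiff ℝ 1 (ψ n).symm) ∧
        (∀ n, 1 ≤ n → ∀ x, ψ (n + 1) (B n x + g n x) = B n (ψ n x)) ∧
        (∀ n, 1 ≤ n → ∀ x, ‖x‖ < ρ →
          ‖fderiv ℝ (ψ n) x‖ ≤ M ∧ ‖fderiv ℝ (ψ n).symm x‖ ≤ M) := by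
  have hK0 : 0 < K := by linarith
  obtain ⟨M, hM2, hM⟩ := exists_nat_mul_rpow_lt (pow_pos hK0 3) hη
  have hM1 : (1 : ℝ) ≤ M := by exact_mod_cast (by omega : 1 ≤ M)
  have hM0 : (0 : ℝ) < M := by linarith
  have pos : ∀ e : ℝ, 0 < (M : ℝ) ^ e := fun e => Real.rpow_pos_of_pos hM0 e
  have hK13 : K ≤ K ^ 3 := le_self_pow₀ hK (by norm_num)
  have hK23 : K ^ 2 ≤ K ^ 3 := pow_le_pow_right₀ hK (by norm_num)
  have hM' : ∀ e f : ℝ, e - f ≤ -η → K * (M : ℝ) ^ e < (M : ℝ) ^ f := fun e f h =>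
    (mul_le_mul_of_nonneg_right hK13 (pos e).le).trans_lt (hM e f h)
  obtain ⟨c₁, hc₁, hlin⟩ := exists_banded_linearization (ℓ := ℓ) (r := r) (k := k)
    (a := K⁻¹ * (M : ℝ) ^ αu) (b := K * (M : ℝ) ^ βs) (α := K⁻¹ * (M : ℝ) ^ α₁)
    (β := K * (M : ℝ) ^ βr) (lo := fun j => K⁻¹ * (M : ℝ) ^ dn j)
    (hi := fun j => K * (M : ℝ) ^ up j) hℓ hkr
    (by
      rw [lt_inv_mul_iff₀ hK0]
      have := hM' 0 αu (by linarith)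
      rwa [Real.rpow_zero] at this)
    (mul_pos hK0 (pos _))
    (by
      have := hM' βs 0 (by linarith)
      rwa [Real.rpow_zero] at this)
    (mul_pos (inv_pos.2 hK0) (pos _)) (mul_pos hK0 (pos _))
    (by
      rw [lt_inv_mul_iff₀ hK0]
      have := hM (βs + βr) αu h₁
      rw [Real.rpow_add hM0] at this
      linarith)
    (by
      rw [div_lt_iff₀ (mul_pos (inv_pos.2 hK0) (pos _)), mul_assoc, lt_inv_mul_iff₀ hK0,
        mul_left_comm ((M : ℝ) ^ αu), lt_inv_mul_iff₀ hK0]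
      have := hM βs (αu + α₁) (by linarith)
      rw [Real.rpow_add hM0] at this
      linarith)
    (fun j hj => ⟨mul_pos (inv_pos.2 hK0) (pos _), by
      rw [inv_mul_le_iff₀ hK0]
      have h1 := Real.rpow_le_rpow_of_exponent_le hM1 (hdu j hj)
      have h2 := pos (up j)
      have h3 : 1 ≤ K * K := by nlinarith
      nlinarith⟩)
    (fun i j hij hj => by
      rw [lt_inv_mul_iff₀ hK0]
      have h1 := hM (up i) (dn j) (hord i j hij hj)
      have h2 := pos (up i)
      nlinarith)
    (fun j hj => by
      obtain ⟨e1, e2, e3⟩ := hs j hj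
      refine ⟨by gcongr, by gcongr, ?_⟩
      rw [lt_inv_mul_iff₀ hK0]
      have := hM (up j + βs) (dn j) (by linarith)
      rw [Real.rpow_add hM0] at this
      linarith)
    (fun j hj hj' => by
      obtain ⟨e1, e2, e3⟩ := hu j hj hj'
      refine ⟨by gcongr, by gcongr, ?_⟩
      rw [mul_assoc, lt_inv_mul_iff₀ hK0, mul_left_comm ((M : ℝ) ^ dn j), lt_inv_mul_iff₀ hK0]
      have := hM (up j) (dn j + αu) (by linarith)
      rw [Real.rpow_add hM0] at this
      linarith)
  set D : ℝ := K * (1 + M) ^ p with hD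
  have hD1 : 1 ≤ D := by
    have : 1 ≤ (1 + (M : ℝ)) ^ p := Real.one_le_rpow (by linarith) hp
    nlinarith
  have hD0 : 0 < D := by linarith
  have hBD : ∀ n J : ℕ, 1 ≤ n → J ≤ M * n → ∀ x, ‖fwd B n J x‖ ≤ D * ‖x‖ ∧
      ‖(fwd B n J).symm x‖ ≤ D * ‖x‖ := by
    intro n J hn hJ x
    have hn0 : (0 : ℝ) < n := by exact_mod_cast hn
    have h1 : ((n : ℝ) + J) / n ≤ 1 + M := by
      rw [div_le_iff₀ hn0]
      have : (J : ℝ) ≤ M * n := by exact_mod_cast hJ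
      linarith
    have h2 : K * (((n : ℝ) + J) / n) ^ p * ‖x‖ ≤ D * ‖x‖ := by
      rw [hD]
      gcongr
    exact ⟨((hB n J hn x).1).trans h2, ((hB n J hn x).2).trans h2⟩
  refine ⟨min (c₁ / (2 * M * D ^ 3)) (1 / (4 * M * D ^ 2)), lt_min (by positivity) (by positivity),
    fun c hc hcc g hg => ?_⟩
  have hcA : 2 * M * D ^ 3 * c ≤ c₁ := by
    have := hcc.trans (min_le_left _ _)
    rw [le_div_iff₀ (by positivity)] at this
    linarith
  have hcB : 4 * M * D ^ 2 * c ≤ 1 := by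
    have := hcc.trans (min_le_right _ _)
    rw [le_div_iff₀ (by positivity)] at this
    linarith
  have hcD : 2 * D * c ≤ 1 := by
    have : 2 * D * c ≤ 4 * M * D ^ 2 * c := by
      have : 1 ≤ M * D := by nlinarith
      have : 0 < D * c := by positivity
      nlinarith
    linarith
  have hF : ∀ n : ℕ, ∃ e : (ι → ℝ) ≃ (ι → ℝ), 1 ≤ n →
      (∀ x, e x = B n x + g n x) ∧ ContDiff ℝ 1 e ∧ ContDiff ℝ 1 e.symm := by
    intro n
    by_cases hn : 1 ≤ n
    · have hn' : c / ((n : ℝ) + 1) ≤ c := div_le_self hc.le (by linarith [n.cast_nonneg (α := ℝ)])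
      obtain ⟨hgC, g0, dg0⟩ := hg n hn
      have hBn : ∀ x, ‖(B n).symm x‖ ≤ D * ‖x‖ := fun x =>
        (hBD n 1 hn (by nlinarith) x).2
      obtain ⟨e, γ, h1, h2, h3, -⟩ := exists_perturb_inverse (B n) hD0 hBn
        (hgC.mono hn' le_rfl) (by positivity) g0 dg0 hcD
      refine ⟨e, fun _ => ⟨h1, ?_, ?_⟩⟩
      · rw [show (e : (ι → ℝ) → (ι → ℝ)) = fun x => B n x + g n x from funext h1]
        exact (B n).contDiff.add hgC.contDiff
      · rw [show (e.symm : (ι → ℝ) → (ι → ℝ)) = fun x => (B n).symm x + γ x from funext h2]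
        exact (B n).symm.contDiff.add h3.contDiff
    · exact ⟨Equiv.refl _, fun h => absurd h hn⟩
  choose F hF using hF
  have hFC := fun (n : ℕ) (hn : 1 ≤ n) => evolE_contDiff hn fun n hn => (hF n hn).2
  have hH := evolE_eq_fwd_add hL hD0.le (fun n hn => (hF n hn).1) hg hBD hc.le (by linarith)
  have hblock : ∀ s : ℕ, 1 ≤ M ^ s ∧ M ^ (s + 1) - M ^ s ≤ M * M ^ s ∧
      M ^ s + (M ^ (s + 1) - M ^ s) = M ^ (s + 1) := by
    intro s
    have h1 : 1 ≤ M ^ s := Nat.one_le_pow _ _ (by omega)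
    have h2 : M ^ (s + 1) = M * M ^ s := pow_succ' M s
    have h3 : M ^ s ≤ M * M ^ s := Nat.le_mul_of_pos_left _ (by omega)
    omega
  choose H hHC hH0 hHd hHe using fun s : ℕ => hH (M ^ s) (hblock s).1 (M ^ (s + 1) - M ^ s)
    (hblock s).2.1
  have hHC' : ∀ s, C11 (H s) (2 * M * D ^ 2 * c) (8 * M * D ^ 3 * L) := by
    intro s
    have h1 : (0 : ℝ) < (M ^ s : ℕ) := by exact_mod_cast (hblock s).1
    have h2 : ((M ^ (s + 1) - M ^ s : ℕ) : ℝ) ≤ M * (M ^ s : ℕ) := by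
      exact_mod_cast (hblock s).2.1
    refine (hHC s).mono ?_ ?_
    · calc _ ≤ 2 * (M * ((M ^ s : ℕ) : ℝ)) * (D ^ 2 * c / ((M ^ s : ℕ) : ℝ)) := by gcongr
        _ = _ := by field_simp
    · calc _ ≤ 8 * (M * ((M ^ s : ℕ) : ℝ)) * (D ^ 3 * L / ((M ^ s : ℕ) : ℝ)) := by gcongr
        _ = _ := by field_simp
  have hBs : ∀ s x, ‖fwd B (M ^ s) (M ^ (s + 1) - M ^ s) x‖ ≤ D * ‖x‖ := fun s x =>
    (hBD _ _ (hblock s).1 (hblock s).2.1 x).1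
  have hratio : ∀ s : ℕ, (((M ^ s : ℕ) : ℝ) + ((M ^ (s + 1) - M ^ s : ℕ) : ℝ)) / ((M ^ s : ℕ) : ℝ)
      = M := by
    intro s
    have h1 : (0 : ℝ) < (M ^ s : ℕ) := by exact_mod_cast (hblock s).1
    rw [← Nat.cast_add, (hblock s).2.2, div_eq_iff h1.ne', pow_succ']
    push_cast
    rfl
  obtain ⟨Ψ, M', ρ, hM', hρ, hΨ, hΨc, hΨb⟩ := hlin (2 * M * D ^ 3 * c) (by positivity) hcA
    (8 * M * D ^ 4 * L) (by positivity)
    (fun n => fwd B (M ^ n.toNat) (M ^ (n.toNat + 1) - M ^ n.toNat))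
    { comm := fun n j x => rst_fwd hcomm (hblock n.toNat).1 _ j x
      up := fun n j x hx => by
        by_cases hj : j < r
        · have h := (hrate j hj (M ^ n.toNat) (M ^ (n.toNat + 1) - M ^ n.toNat)
            (hblock n.toNat).1 x hx).1
          rwa [hratio] at h
        · rw [← hx, rst_eq_zero ℓ (fun i (hi : ℓ i = j) => hj (hi ▸ hℓ i))]
          simp
      low := fun n j x hx => by
        by_cases hj : j < r
        · have h := (hrate j hj (M ^ n.toNat) (M ^ (n.toNat + 1) - M ^ n.toNat)
            (hblock n.toNat).1 x hx).2
          rwa [hratio, ← inv_mul_le_iff₀ hK0, ← mul_assoc] at h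
        · rw [← hx, rst_eq_zero ℓ (fun i (hi : ℓ i = j) => hj (hi ▸ hℓ i))]
          simp }
    (fun n x => fwd B (M ^ n.toNat) (M ^ (n.toNat + 1) - M ^ n.toNat) (H n.toNat x))
    (fun n => by
      refine ⟨?_, ?_, ?_⟩
      · exact ((hHC' n.toNat).clm_comp_clm (by positivity)
          (fwd B (M ^ n.toNat) (M ^ (n.toNat + 1) - M ^ n.toNat)).toContinuousLinearMap
          (ContinuousLinearMap.id ℝ _) zero_le_one hD0.le (hBs _) (fun w => by simp)).mono
          (le_of_eq (by ring)) (le_of_eq (by ring))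
      · simp only [hH0, map_zero]
      · exact fderiv_clm_comp_clm_zero (hHC' n.toNat).contDiff (hHd _)
          (fwd B (M ^ n.toNat) (M ^ (n.toNat + 1) - M ^ n.toNat)).toContinuousLinearMap
          (ContinuousLinearMap.id ℝ _))
  have hΨc' : ∀ (s : ℕ) x, Ψ ((s + 1 : ℕ) : ℤ) (evolE F (M ^ s) (M ^ (s + 1) - M ^ s) x) =
      fwd B (M ^ s) (M ^ (s + 1) - M ^ s) (Ψ (s : ℤ) x) := by
    intro s x
    have h := hΨc (s : ℤ) x
    rw [Int.toNat_natCast, ← map_add, ← hHe] at h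
    exact h
  let ψ : ℕ → ((ι → ℝ) ≃ (ι → ℝ)) := fun n =>
    (evolE F 1 (n - 1)).symm.trans ((Ψ 0).trans (fwd B 1 (n - 1)).toEquiv)
  have hψc : ∀ n, 1 ≤ n → ∀ x, ψ (n + 1) (F n x) = B n (ψ n x) := by
    intro n hn x
    obtain ⟨J, rfl⟩ : ∃ J, n = 1 + J := ⟨n - 1, by omega⟩
    have e1 : ψ (1 + J + 1) = (evolE F 1 (J + 1)).symm.trans
        ((Ψ 0).trans (fwd B 1 (J + 1)).toEquiv) := by
      change (evolE F 1 (1 + J + 1 - 1)).symm.trans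
        ((Ψ 0).trans (fwd B 1 (1 + J + 1 - 1)).toEquiv) = _
      rw [show 1 + J + 1 - 1 = J + 1 by omega]
    have e2 : ψ (1 + J) = (evolE F 1 J).symm.trans ((Ψ 0).trans (fwd B 1 J).toEquiv) := by
      change (evolE F 1 (1 + J - 1)).symm.trans
        ((Ψ 0).trans (fwd B 1 (1 + J - 1)).toEquiv) = _
      rw [show 1 + J - 1 = J by omega]
    rw [e1, e2]
    change B (1 + J) (fwd B 1 J (Ψ 0 ((evolE F 1 J).symm ((F (1 + J)).symm (F (1 + J) x))))) =
      B (1 + J) (fwd B 1 J (Ψ 0 ((evolE F 1 J).symm x)))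
    rw [Equiv.symm_apply_apply]
  have hψΨ : ∀ s : ℕ, ψ (M ^ s) = Ψ (s : ℤ) := by
    intro s
    induction s with
    | zero => exact Equiv.ext fun x => rfl
    | succ s ih =>
      refine Equiv.ext fun y => ?_
      obtain ⟨x, rfl⟩ := (evolE F (M ^ s) (M ^ (s + 1) - M ^ s)).surjective y
      have h := conj_evolE (hblock s).1 hψc (M ^ (s + 1) - M ^ s) x
      rw [(hblock s).2.2, ih, ← hΨc'] at h
      exact h
  have hψC : ∀ n, 1 ≤ n → ContDiff ℝ 1 (ψ n) ∧ ContDiff ℝ 1 (ψ n).symm := fun n hn =>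
    ⟨(fwd B 1 (n - 1)).contDiff.comp ((hΨ 0).1.comp (hFC 1 le_rfl (n - 1)).2),
      (hFC 1 le_rfl (n - 1)).1.comp ((hΨ 0).2.1.comp (fwd B 1 (n - 1)).symm.contDiff)⟩
  refine ⟨ψ, 2 * D * (M' * D), ρ / (2 * D), by positivity, by positivity, hψC,
    fun n hn x => ?_, fun n hn x hx => ?_⟩
  · rw [← hψc n hn, (hF n hn).1]
  · set s := Nat.log M n with hs'
    obtain ⟨J, hJ⟩ : ∃ J, n = M ^ s + J :=
      ⟨n - M ^ s, by have := Nat.pow_log_le_self M (x := n) (by omega); rw [← hs'] at this; omega⟩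
    have hJM : J ≤ M * M ^ s := by
      have h1 := Nat.lt_pow_succ_log_self (b := M) (by omega) n
      rw [← hs', pow_succ'] at h1
      omega
    have ht := (hblock s).1
    have hψn : ψ n = (evolE F (M ^ s) J).symm.trans ((Ψ (s : ℤ)).trans
        (fwd B (M ^ s) J).toEquiv) := by
      refine Equiv.ext fun y => ?_
      obtain ⟨x, rfl⟩ := (evolE F (M ^ s) J).surjective y
      have h := conj_evolE ht hψc J x
      rw [← hJ, hψΨ] at h
      rw [h]
      change _ = fwd B (M ^ s) J (Ψ s ((evolE F (M ^ s) J).symm (evolE F (M ^ s) J x)))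
      rw [Equiv.symm_apply_apply]
    obtain ⟨G, hG, G0, -, hGe⟩ := hH (M ^ s) ht J hJM
    have hGc : 2 * J * (D ^ 2 * c / ((M ^ s : ℕ) : ℝ)) ≤ 1 / 2 := by
      have h1 : (0 : ℝ) < (M ^ s : ℕ) := by exact_mod_cast ht
      have h2 : (J : ℝ) ≤ M * (M ^ s : ℕ) := by exact_mod_cast hJM
      calc _ ≤ 2 * (M * ((M ^ s : ℕ) : ℝ)) * (D ^ 2 * c / ((M ^ s : ℕ) : ℝ)) := by gcongr
        _ = 2 * M * D ^ 2 * c := by field_simp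
        _ ≤ 1 / 2 := by linarith
    have hlip := evolE_lipschitz hD0.le (hBD _ _ ht hJM) hG hGc hGe
    have hlip' : ∀ x y, ‖(evolE F (M ^ s) J).symm x - (evolE F (M ^ s) J).symm y‖ ≤
        2 * D * ‖x - y‖ := fun x y => by
      have := (hlip ((evolE F (M ^ s) J).symm x) ((evolE F (M ^ s) J).symm y)).2
      rwa [Equiv.apply_symm_apply, Equiv.apply_symm_apply] at this
    have hev0 : (evolE F (M ^ s) J).symm 0 = 0 := by
      rw [Equiv.symm_apply_eq, hGe, G0, add_zero, map_zero]
    have hCE := hFC _ ht J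
    have hx0 := norm_nonneg x
    rw [lt_div_iff₀ (by positivity)] at hx
    have hy1 : ‖(evolE F (M ^ s) J).symm x‖ < ρ := by
      have := hlip' x 0
      rw [hev0, sub_zero, sub_zero] at this
      linarith
    have hy2 : ‖(fwd B (M ^ s) J).symm x‖ < ρ := by
      have := (hBD _ _ ht hJM x).2
      nlinarith
    have hfwd : ∀ y, ‖fderiv ℝ (fwd B (M ^ s) J) y‖ ≤ D := fun y => by
      rw [ContinuousLinearEquiv.fderiv]
      exact ContinuousLinearMap.opNorm_le_bound _ hD0.le fun x => (hBD _ _ ht hJM x).1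
    have hfwd' : ∀ y, ‖fderiv ℝ (fwd B (M ^ s) J).symm y‖ ≤ D := fun y => by
      rw [ContinuousLinearEquiv.fderiv]
      exact ContinuousLinearMap.opNorm_le_bound _ hD0.le fun x => (hBD _ _ ht hJM x).2
    rw [hψn]
    constructor
    · refine (norm_fderiv_comp_le (f := fwd B (M ^ s) J)
        (g := fun x => Ψ s ((evolE F (M ^ s) J).symm x)) (fwd B (M ^ s) J).contDiff
        ((hΨ s).1.comp hCE.2) (hfwd _) (norm_fderiv_comp_le (hΨ s).1 hCE.2 (hΨb s _ hy1).1
          (norm_fderiv_le_of_norm_sub_le (by positivity) hlip' x))).trans (le_of_eq (by ring))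
    · refine norm_fderiv_comp_le (f := evolE F (M ^ s) J)
        (g := fun x => (Ψ s).symm ((fwd B (M ^ s) J).symm x)) hCE.1
        ((hΨ s).2.1.comp (fwd B (M ^ s) J).symm.contDiff)
        (norm_fderiv_le_of_norm_sub_le (by positivity) (fun x y => (hlip x y).1) _)
        (norm_fderiv_comp_le (hΨ s).2.1 (fwd B (M ^ s) J).symm.contDiff (hΨb s _ hy2).2 (hfwd' x))

end Rates

section Auerbach

variable {V : Type*} [NormedAddCommGroup V] [NormedSpace ℝ V]

theorem IsNormOn.norm_neg {N : V → ℝ} (h : IsNormOn N) (x : V) : N (-x) = N x := by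
  have := h.2.2.1 (-1) x
  rwa [neg_one_smul, abs_neg, abs_one, one_mul] at this

theorem IsNormOn.norm_zero {N : V → ℝ} (h : IsNormOn N) : N 0 = 0 := (h.2.1 0).2 rfl

theorem IsNormOn.norm_sub_le {N : V → ℝ} (h : IsNormOn N) (x y : V) : N (x - y) ≤ N x + N y := by
  rw [sub_eq_add_neg, ← h.norm_neg y]
  exact h.2.2.2 x (-y)

theorem IsNormOn.norm_sum_le {N : V → ℝ} (h : IsNormOn N) {ι : Type*} (s : Finset ι) (f : ι → V) :
    N (∑ i ∈ s, f i) ≤ ∑ i ∈ s, N (f i) := by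
  classical
  induction s using Finset.induction_on with
  | empty => simp [h.norm_zero]
  | insert a s ha ih =>
    rw [Finset.sum_insert ha, Finset.sum_insert ha]
    exact (h.2.2.2 _ _).trans (by gcongr)

theorem IsNormOn.continuous {N : V → ℝ} (h : IsNormOn N) {C : ℝ} (hC : ∀ x, N x ≤ C * ‖x‖) :
    Continuous N := by
  have h1 : ∀ x y, N x - N y ≤ C * ‖x - y‖ := fun x y => by
    have := h.2.2.2 (x - y) y
    rw [sub_add_cancel] at this
    linarith [hC (x - y)]
  refine continuous_of_norm_sub_le (L := C) fun x y => ?_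
  rw [Real.norm_eq_abs, abs_le]
  have := h1 y x
  rw [norm_sub_rev] at this
  exact ⟨by linarith, h1 x y⟩

/-- An Auerbach basis: unit vectors whose coordinate functionals have norm at most one. -/
theorem exists_auerbach_basis [FiniteDimensional ℝ V] {N : V → ℝ} (hN : IsNormOn N) {C : ℝ}
    (h1 : ∀ x, ‖x‖ ≤ N x) (h2 : ∀ x, N x ≤ C * ‖x‖) {d : ℕ} (hd : Module.finrank ℝ V = d) :
    ∃ b : Module.Basis (Fin d) ℝ V, ∀ i, N (b i) ≤ 1 ∧ ∀ x, |b.repr x i| ≤ N x := by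
  have hpos : ∀ x, x ≠ 0 → 0 < N x := fun x hx => (norm_pos_iff.2 hx).trans_le (h1 x)
  have hball : ∀ x, N ((N x)⁻¹ • x) ≤ 1 := by
    intro x
    rw [hN.2.2.1, abs_of_nonneg (inv_nonneg.2 (hN.1 x))]
    exact inv_mul_le_one
  set e : Module.Basis (Fin d) ℝ V := Module.finBasisOfFinrankEq ℝ V hd
  have hcompact : IsCompact {x : V | N x ≤ 1} :=
    (isCompact_closedBall (0 : V) 1).of_isClosed_subset
      (isClosed_le (hN.continuous h2) continuous_const) fun x hx => by
        rw [mem_closedBall_zero_iff]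
        exact (h1 x).trans hx
  have hK : IsCompact (Set.univ.pi fun _ : Fin d => {x : V | N x ≤ 1}) :=
    isCompact_univ_pi fun _ => hcompact
  have hcont : Continuous fun v : Fin d → V => |e.det v| := by
    refine Continuous.abs ?_
    rw [show (e.det : (Fin d → V) → ℝ) = fun v => (e.toMatrix v).det from
      funext fun v => e.det_apply v]
    refine Continuous.matrix_det (continuous_matrix fun i j => ?_)
    exact (LinearMap.continuous_of_finiteDimensional (e.coord i)).comp (continuous_apply j)
  obtain ⟨v, hv, hmax⟩ := hK.exists_isMaxOn ⟨0, fun i _ => by simp [hN.norm_zero]⟩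
    hcont.continuousOn
  have hv' : ∀ i, N (v i) ≤ 1 := fun i => hv i trivial
  have hdet : 0 < |e.det v| := by
    have h3 := hmax (show (fun i => (N (e i))⁻¹ • e i) ∈ _ from fun i _ => hball (e i))
    refine lt_of_lt_of_le ?_ h3
    change 0 < |e.det fun i => (N (e i))⁻¹ • e i|
    rw [AlternatingMap.map_smul_univ, Module.Basis.det_self, smul_eq_mul, mul_one, abs_pos]
    exact Finset.prod_ne_zero_iff.2 fun i _ => inv_ne_zero (hpos _ (e.ne_zero i)).ne'
  obtain ⟨hli, hsp⟩ := (e.is_basis_iff_det (v := v)).2 (isUnit_iff_ne_zero.2 (abs_pos.1 hdet))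
  refine ⟨Module.Basis.mk hli hsp.ge, fun i => ⟨?_, fun x => ?_⟩⟩
  · rw [Module.Basis.mk_apply]
    exact hv' i
  · have h3 := LinearMap.congr_fun (e.det_smul_mk_coord_eq_det_update hli hsp.ge i) x
    have h4 : e.det v * (Module.Basis.mk hli hsp.ge).repr x i = e.det (Function.update v i x) := h3
    by_cases hx : x = 0
    · rw [hx, hN.norm_zero, map_zero, Finsupp.zero_apply, abs_zero]
    have hx0 := hpos x hx
    have h5 : |e.det (Function.update v i ((N x)⁻¹ • x))| ≤ |e.det v| := by
      refine hmax (show Function.update v i ((N x)⁻¹ • x) ∈ _ from fun j _ => ?_)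
      by_cases hj : j = i
      · subst hj
        simpa using hball x
      · simpa [hj] using hv' j
    rw [AlternatingMap.map_update_smul, smul_eq_mul, ← h4, abs_mul, abs_mul,
      abs_of_pos (inv_pos.2 hx0)] at h5
    rw [inv_mul_le_iff₀ hx0] at h5
    nlinarith

end Auerbach

section Coordinates

variable {E : Type*} [NormedAddCommGroup E] [NormedSpace ℝ E] [FiniteDimensional ℝ E]

/-- Coordinates adapted to a decomposition into bands, with distortion independent of the norm. -/
theorem exists_band_coordinates {r : ℕ} {N : E → ℝ} (hN : IsNormOn N) {C K : ℝ}
    (h1 : ∀ x, ‖x‖ ≤ N x) (h2 : ∀ x, N x ≤ C * ‖x‖) {e : Fin r → (E →L[ℝ] E)}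
    (he : ∀ i j x, e i (e j x) = if i = j then e j x else 0) (hsum : ∀ x, ∑ j, e j x = x)
    (hK : 0 ≤ K) (hbd : ∀ j x, N (e j x) ≤ K * N x) {d : Fin r → ℕ}
    (hd : ∀ j, Module.finrank ℝ (LinearMap.range (e j : E →ₗ[ℝ] E)) = d j) :
    ∃ T : E ≃L[ℝ] ((Σ j : Fin r, Fin (d j)) → ℝ), (∀ x, ‖T x‖ ≤ K * N x) ∧
      (∀ x, N x ≤ Fintype.card (Σ j : Fin r, Fin (d j)) * ‖T x‖) ∧
      ∀ (j : Fin r) x, T (e j x) =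
        rst (fun p : Σ j : Fin r, Fin (d j) => (p.1 : ℕ)) (· = (j : ℕ)) (T x) := by
  have hb := fun j => exists_auerbach_basis (V := LinearMap.range (e j : E →ₗ[ℝ] E))
    (N := fun x => N x) ⟨fun x => hN.1 x, fun x => (hN.2.1 x).trans (by simp),
      fun c x => hN.2.2.1 c x, fun x y => hN.2.2.2 x y⟩ (fun x => h1 x) (fun x => h2 x) (hd j)
  choose b hb using hb
  set w : (Σ j : Fin r, Fin (d j)) → E := fun p => (b p.1 p.2 : E) with hw
  have hew : ∀ j p, e j (w p) = if j = p.1 then w p else 0 := by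
    intro j p
    obtain ⟨y, hy⟩ := (b p.1 p.2).2
    have hy' : e p.1 y = w p := hy
    rw [← hy', he]
  let S : ((Σ j : Fin r, Fin (d j)) → ℝ) →ₗ[ℝ] E := Fintype.linearCombination ℝ w
  have hS : ∀ v, S v = ∑ p, v p • w p := fun v => Fintype.linearCombination_apply ℝ w v
  let T : E →ₗ[ℝ] ((Σ j : Fin r, Fin (d j)) → ℝ) := LinearMap.pi fun p =>
    ((b p.1).coord p.2).comp (e p.1 : E →ₗ[ℝ] E).rangeRestrict
  have hT : ∀ x p, T x p = (b p.1).repr ((e p.1 : E →ₗ[ℝ] E).rangeRestrict x) p.2 :=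
    fun x p => rfl
  have hST : ∀ x, S (T x) = x := by
    intro x
    rw [hS, ← Finset.univ_sigma_univ, Finset.sum_sigma]
    refine Eq.trans (Finset.sum_congr rfl fun j _ => ?_) (hsum x)
    have h3 := congrArg Subtype.val ((b j).sum_repr ((e j : E →ₗ[ℝ] E).rangeRestrict x))
    rw [Submodule.coe_sum] at h3
    exact h3
  have hTe : ∀ (j : Fin r) x, T (e j x) =
        rst (fun p : Σ j : Fin r, Fin (d j) => (p.1 : ℕ)) (· = (j : ℕ)) (T x) := by
    intro j x
    ext p
    rw [rst_apply, hT, hT]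
    have h3 : (e p.1 : E →ₗ[ℝ] E).rangeRestrict (e j x) =
        if (p.1 : ℕ) = j then (e p.1 : E →ₗ[ℝ] E).rangeRestrict x else 0 := by
      apply Subtype.ext
      change e p.1 (e j x) = _
      rw [he]
      by_cases h : p.1 = j
      · rw [if_pos h, if_pos (congrArg Fin.val h), ← h]
        rfl
      · rw [if_neg h, if_neg (fun h' => h (Fin.ext h'))]
        rfl
    rw [h3]
    split_ifs <;> simp
  have hTw : ∀ p, T (w p) = Pi.single p 1 := by
    rintro ⟨j, i⟩
    ext ⟨j', i'⟩
    rw [hT]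
    have h3 : (e j' : E →ₗ[ℝ] E).rangeRestrict (w ⟨j, i⟩) = if h : j = j' then
        h ▸ b j i else 0 := by
      apply Subtype.ext
      change e j' (w ⟨j, i⟩) = _
      rw [hew]
      by_cases h : j = j'
      · subst h
        simp [hw]
      · rw [if_neg (fun h' => h h'.symm), dif_neg h]
        rfl
    change (b j').repr ((e j' : E →ₗ[ℝ] E).rangeRestrict (w ⟨j, i⟩)) i' = _
    rw [h3]
    by_cases h : j = j'
    · subst h
      rw [dif_pos rfl, Module.Basis.repr_self, Finsupp.single_apply, Pi.single_apply]
      simp [eq_comm]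
    · rw [dif_neg h, map_zero, Pi.single_apply, if_neg (fun h' => h (congrArg Sigma.fst h').symm)]
      rfl
  have hTS : ∀ v, T (S v) = v := by
    intro v
    rw [hS, map_sum]
    simp only [map_smul, hTw]
    ext p
    simp [Finset.sum_apply, Pi.single_apply]
  let Te : E ≃ₗ[ℝ] ((Σ j : Fin r, Fin (d j)) → ℝ) :=
    LinearEquiv.ofLinearMap T S (LinearMap.ext hTS) (LinearMap.ext hST)
  refine ⟨Te.toContinuousLinearEquiv, fun x => ?_, fun x => ?_, hTe⟩
  · change ‖T x‖ ≤ _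
    refine (pi_norm_le_iff_of_nonneg (mul_nonneg hK (hN.1 x))).2 fun p => ?_
    exact ((hb p.1 p.2).2 _).trans (hbd p.1 x)
  · change N x ≤ _ * ‖T x‖
    have h3 : N (S (T x)) ≤ ∑ p, N (T x p • w p) := by
      rw [hS]
      exact hN.norm_sum_le _ _
    rw [hST] at h3
    refine h3.trans ?_
    rw [← nsmul_eq_mul]
    refine Finset.sum_le_card_nsmul _ _ _ fun p _ => ?_
    rw [hN.2.2.1]
    have h4 : |T x p| ≤ ‖T x‖ := norm_le_pi_norm (T x) p
    have h5 : N (w p) ≤ 1 := (hb p.1 p.2).1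
    nlinarith [hN.1 (w p), norm_nonneg (T x)]

end Coordinates

section Spectrum

variable {E : Type*} [NormedAddCommGroup E] [NormedSpace ℝ E]

theorem scale_apply {c : ℝ} (hc : c ≠ 0) (A : E ≃L[ℝ] E) (x : E) : scale c A x = c • A x := by
  simp only [scale, smulCLE, dif_neg hc]
  rfl

theorem coc_add (A : ℕ → (E ≃L[ℝ] E)) (n J : ℕ) : coc A (n + J) n = fwd A n J := by
  rw [coc, if_pos (Nat.le_add_right n J), Nat.add_sub_cancel_left]

theorem coc_add_symm (A : ℕ → (E ≃L[ℝ] E)) (n J : ℕ) : coc A n (n + J) = (fwd A n J).symm := by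
  rcases Nat.eq_zero_or_pos J with rfl | hJ
  · change coc A n n = _
    rw [coc, if_pos le_rfl, Nat.sub_self]
    rfl
  · rw [coc, if_neg (by omega), Nat.add_sub_cancel_left]

theorem ratio_one_le {n : ℕ} (hn : 1 ≤ n) (J : ℕ) : (1 : ℝ) ≤ ((n : ℝ) + J) / n := by
  have hn0 : (0 : ℝ) < n := by exact_mod_cast hn
  rw [one_le_div hn0]
  linarith [J.cast_nonneg (α := ℝ)]

theorem tendsto_ratio {n : ℕ} (hn : 1 ≤ n) :
    Tendsto (fun J : ℕ => ((n : ℝ) + J) / n) atTop atTop :=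
  (tendsto_atTop_add_const_left _ _ tendsto_natCast_atTop_atTop).atTop_div_const
    (by exact_mod_cast hn)

theorem fwd_scale (A : ℕ → (E ≃L[ℝ] E)) (τ : ℝ) {n : ℕ} (hn : 1 ≤ n) (J : ℕ) (x : E) :
    fwd (fun n : ℕ => scale ((((n : ℝ) + 1) / n) ^ (-τ)) (A n)) n J x =
      (((n : ℝ) + J) / n) ^ (-τ) • fwd A n J x := by
  have hn0 : (0 : ℝ) < n := by exact_mod_cast hn
  induction J with
  | zero =>
    simp only [Nat.cast_zero, add_zero, div_self hn0.ne', Real.one_rpow, one_smul]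
    rfl
  | succ J ih =>
    have hJ : (0 : ℝ) < ((n + J : ℕ) : ℝ) := by exact_mod_cast (by omega : 0 < n + J)
    rw [fwd_succ, ih, scale_apply (Real.rpow_pos_of_pos (by positivity) _).ne', map_smul,
      smul_smul, ← Real.mul_rpow (by positivity) (by positivity), fwd_succ]
    congr 2
    push_cast at hJ ⊢
    field_simp
    ring

theorem fwd_comm {A : ℕ → (E ≃L[ℝ] E)} {P : ℕ → (E →L[ℝ] E)}
    (h : ∀ n, 1 ≤ n → ∀ x, A n (P n x) = P (n + 1) (A n x)) {n : ℕ} (hn : 1 ≤ n) (J : ℕ) (x : E) :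
    fwd A n J (P n x) = P (n + J) (fwd A n J x) := by
  induction J with
  | zero => rfl
  | succ J ih => rw [fwd_succ, ih, h _ (by omega)]; rfl

/-- An invariant splitting with a spectral gap at the exponent `τ`. -/
structure Split (A : ℕ → (E ≃L[ℝ] E)) (N : ℕ → E → ℝ) (K s u : ℝ) (P : ℕ → (E →L[ℝ] E)) :
    Prop where
  idem : ∀ n, 1 ≤ n → ∀ x, P n (P n x) = P n x
  comm : ∀ n, 1 ≤ n → ∀ x, A n (P n x) = P (n + 1) (A n x)
  bdd : ∀ n, 1 ≤ n → ∀ x, N n (P n x) ≤ K * N n x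
  up : ∀ n, 1 ≤ n → ∀ (J : ℕ) x, P n x = x →
    N (n + J) (fwd A n J x) ≤ K * (((n : ℝ) + J) / n) ^ s * N n x
  low : ∀ n, 1 ≤ n → ∀ (J : ℕ) x, P n x = 0 →
    (((n : ℝ) + J) / n) ^ u * N n x ≤ K * N (n + J) (fwd A n J x)

variable {A : ℕ → (E ≃L[ℝ] E)} {N : ℕ → E → ℝ}

theorem exists_split_of_dichotomy (hN : ∀ n, 1 ≤ n → IsNormOn (N n)) {τ : ℝ}
    (h : StrongPolyDichotomyWRT (fun n => scale ((((n : ℝ) + 1) / n) ^ (-τ)) (A n)) N) :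
    ∃ K lam P, 0 < lam ∧ Split A N K (τ - lam) (τ + lam) P := by
  obtain ⟨K, lam, a, hK, hlam, -, P, hidem, hcomm, hrate⟩ := h
  set B : ℕ → (E ≃L[ℝ] E) := fun n => scale ((((n : ℝ) + 1) / n) ^ (-τ)) (A n) with hB
  have hcB : ∀ n, 1 ≤ n → ∀ x, B n (P n x) = P (n + 1) (B n x) := fun n hn x =>
    DFunLike.congr_fun (hcomm n hn) x
  refine ⟨K, lam, P, hlam, fun n hn x => DFunLike.congr_fun (hidem n hn) x,
    fun n hn x => ?_, fun n hn x => ?_, fun n hn J x hx => ?_, fun n hn J x hx => ?_⟩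
  · have hn0 : (0 : ℝ) < n := by exact_mod_cast hn
    have hc : (((n : ℝ) + 1) / n) ^ (-τ) ≠ 0 := (Real.rpow_pos_of_pos (by positivity) _).ne'
    have h1 := hcB n hn x
    simp only [hB] at h1
    rw [scale_apply hc, scale_apply hc, map_smul] at h1
    exact smul_right_injective E hc h1
  · have hn0 : (0 : ℝ) < n := by exact_mod_cast hn
    have h1 := (hrate (n + 0) n hn le_rfl x).1
    rw [coc_add, Nat.add_zero, div_self hn0.ne', Real.one_rpow, mul_one] at h1
    exact h1
  · have hρ : (0 : ℝ) < ((n : ℝ) + J) / n := by linarith [ratio_one_le hn J]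
    have h1 := (hrate (n + J) n hn (by omega) x).1
    rw [coc_add, hx, fwd_scale A τ hn, (hN _ (by omega)).2.2.1,
      abs_of_pos (Real.rpow_pos_of_pos hρ _), Nat.cast_add, Real.rpow_neg hρ.le τ,
      inv_mul_le_iff₀ (Real.rpow_pos_of_pos hρ _)] at h1
    rw [sub_eq_add_neg, Real.rpow_add hρ]
    linarith
  · have hρ : (0 : ℝ) < ((n : ℝ) + J) / n := by linarith [ratio_one_le hn J]
    have h1 := (hrate (n + J) n hn (by omega) (fwd B n J x)).2.1
    rw [← fwd_comm hcB hn, hx, map_zero, sub_zero, coc_add_symm,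
      ContinuousLinearEquiv.symm_apply_apply, fwd_scale A τ hn, (hN _ (by omega)).2.2.1,
      abs_of_pos (Real.rpow_pos_of_pos hρ _), Nat.cast_add, Real.rpow_neg hρ.le τ,
      Real.rpow_neg hρ.le lam] at h1
    rw [Real.rpow_add hρ]
    have h2 := Real.rpow_pos_of_pos hρ τ
    have h3 := Real.rpow_pos_of_pos hρ lam
    calc _ ≤ (((n : ℝ) + J) / n) ^ τ * (((n : ℝ) + J) / n) ^ lam *
        (K * ((((n : ℝ) + J) / n) ^ lam)⁻¹ * (((((n : ℝ) + J) / n) ^ τ)⁻¹ *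
          N (n + J) (fwd A n J x))) := by gcongr
      _ = _ := by field_simp

theorem Split.mono (hN : ∀ n, 1 ≤ n → IsNormOn (N n)) {K s u K' s' u' : ℝ} {P : ℕ → (E →L[ℝ] E)}
    (h : Split A N K s u P) (hK0 : 0 ≤ K') (hK : K ≤ K') (hs : s ≤ s') (hu : u' ≤ u) :
    Split A N K' s' u' P where
  idem := h.idem
  comm := h.comm
  bdd n hn x := (h.bdd n hn x).trans (mul_le_mul_of_nonneg_right hK ((hN n hn).1 x))
  up n hn J x hx := by
    have hρ := ratio_one_le hn J
    have := (hN n hn).1 x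
    refine (h.up n hn J x hx).trans ?_
    gcongr
  low n hn J x hx := by
    have hρ := ratio_one_le hn J
    have h1 := (hN n hn).1 x
    have h2 := (hN (n + J) (by omega)).1 (fwd A n J x)
    calc _ ≤ (((n : ℝ) + J) / n) ^ u * N n x := by gcongr
      _ ≤ K * N (n + J) (fwd A n J x) := h.low n hn J x hx
      _ ≤ _ := by gcongr

/-- The vectors whose orbit grows at most like the power `τ` of time. -/
def slow (A : ℕ → (E ≃L[ℝ] E)) (N : ℕ → E → ℝ) (n : ℕ) (τ : ℝ) : Set E :=
  {x | ∃ M, ∀ J : ℕ, N (n + J) (fwd A n J x) ≤ M * (((n : ℝ) + J) / n) ^ τ}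

theorem slow_mono (hN : ∀ n, 1 ≤ n → IsNormOn (N n)) {n : ℕ} (hn : 1 ≤ n) {τ τ' : ℝ}
    (h : τ ≤ τ') : slow A N n τ ⊆ slow A N n τ' := by
  rintro x ⟨M, hM⟩
  refine ⟨M, fun J => (hM J).trans ?_⟩
  have hn0 : (0 : ℝ) < n := by exact_mod_cast hn
  have h0 : N (n + 0) (fwd A n 0 x) ≤ M := (hM 0).trans (le_of_eq (by simp [hn0.ne']))
  have hM0 : 0 ≤ M := ((hN (n + 0) hn).1 _).trans h0
  have hρ := ratio_one_le hn J
  gcongr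

theorem eq_zero_of_rates (hN : ∀ n, 1 ≤ n → IsNormOn (N n)) {n : ℕ} (hn : 1 ≤ n) {x : E}
    {K u τ : ℝ} (hτ : τ < u) (hx : x ∈ slow A N n τ) (hK : 0 ≤ K)
    (hlow : ∀ J : ℕ, (((n : ℝ) + J) / n) ^ u * N n x ≤ K * N (n + J) (fwd A n J x)) : x = 0 := by
  obtain ⟨M, hM⟩ := hx
  have h1 : Tendsto (fun J : ℕ => K * M * (((n : ℝ) + J) / n) ^ (-(u - τ))) atTop (𝓝 (K * M * 0)) :=
    ((tendsto_rpow_neg_atTop (sub_pos.2 hτ)).comp (tendsto_ratio hn)).const_mul _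
  have h2 : N n x ≤ K * M * 0 := ge_of_tendsto' h1 fun J => by
    have hρ : (0 : ℝ) < ((n : ℝ) + J) / n := by linarith [ratio_one_le hn J]
    have h3 := (hlow J).trans (mul_le_mul_of_nonneg_left (hM J) hK)
    rw [neg_sub, Real.rpow_sub hρ, ← mul_div_assoc, le_div_iff₀ (Real.rpow_pos_of_pos hρ u)]
    linarith
  rw [mul_zero] at h2
  exact ((hN n hn).2.1 x).1 (le_antisymm h2 ((hN n hn).1 x))

theorem Split.mem_slow_iff (hN : ∀ n, 1 ≤ n → IsNormOn (N n)) {K s u τ : ℝ} {P : ℕ → (E →L[ℝ] E)}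
    (h : Split A N K s u P) (hK : 0 ≤ K) (hs : s ≤ τ) (hu : τ < u) {n : ℕ} (hn : 1 ≤ n) (x : E) :
    x ∈ slow A N n τ ↔ P n x = x := by
  have hmem : ∀ y, P n y = y → y ∈ slow A N n τ := fun y hy =>
    slow_mono hN hn hs ⟨K * N n y, fun J => (h.up n hn J y hy).trans (le_of_eq (by ring))⟩
  refine ⟨fun hx => ?_, hmem x⟩
  have hP : P n (x - P n x) = 0 := by rw [map_sub, h.idem n hn, sub_self]
  have hsub : x - P n x ∈ slow A N n τ := by
    obtain ⟨M, hM⟩ := hx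
    obtain ⟨M', hM'⟩ := hmem (P n x) (h.idem n hn x)
    refine ⟨M + M', fun J => ?_⟩
    rw [map_sub, add_mul]
    exact ((hN _ (by omega)).norm_sub_le _ _).trans (add_le_add (hM J) (hM' J))
  have h0 := eq_zero_of_rates hN hn hu hsub hK fun J => h.low n hn J _ hP
  exact (sub_eq_zero.1 h0).symm

theorem Split.nonneg_const (hN : ∀ n, 1 ≤ n → IsNormOn (N n)) {K s u : ℝ} {P : ℕ → (E →L[ℝ] E)}
    (h : Split A N K s u P) : Split A N |K| s u P :=
  h.mono hN (abs_nonneg K) (le_abs_self K) le_rfl le_rfl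

/-- The growth filtration is constant on intervals avoiding the spectrum. -/
theorem slow_eq_of_isPreconnected (hN : ∀ n, 1 ≤ n → IsNormOn (N n)) {S : Set ℝ}
    (hS : IsPreconnected S)
    (hres : ∀ τ ∈ S, ∃ K lam P, 0 < lam ∧ Split A N K (τ - lam) (τ + lam) P) {n : ℕ} (hn : 1 ≤ n)
    {τ₁ τ₂ : ℝ} (h₁ : τ₁ ∈ S) (h₂ : τ₂ ∈ S) : slow A N n τ₁ = slow A N n τ₂ := by
  let _ : TopologicalSpace (Set E) := ⊥
  have _ : DiscreteTopology (Set E) := ⟨rfl⟩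
  refine hS.constant (f := slow A N n) (fun τ hτ => ?_) h₁ h₂
  obtain ⟨K, lam, P, hlam, hP⟩ := hres τ hτ
  have hP' := hP.nonneg_const hN
  have hev : ∀ᶠ τ' in 𝓝 τ, slow A N n τ' = slow A N n τ := by
    filter_upwards [Ioo_mem_nhds (sub_lt_self τ hlam) (lt_add_of_pos_right τ hlam)] with τ' hτ'
    ext x
    rw [hP'.mem_slow_iff hN (abs_nonneg K) hτ'.1.le hτ'.2 hn,
      hP'.mem_slow_iff hN (abs_nonneg K) (by linarith) (by linarith) hn]
  exact (continuousAt_const.congr (EventuallyEq.symm hev)).continuousWithinAt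

end Spectrum

section Bands

variable {E : Type*} [NormedAddCommGroup E] [NormedSpace ℝ E]
variable {A : ℕ → (E ≃L[ℝ] E)} {N : ℕ → E → ℝ}

theorem exists_growth (h : StrongPolyDichotomyWRT A N) :
    ∃ K a : ℝ, 0 < K ∧ 0 < a ∧ ∀ n, 1 ≤ n → ∀ (J : ℕ) x,
      N (n + J) (fwd A n J x) ≤ K * (((n : ℝ) + J) / n) ^ a * N n x ∧
      (((n : ℝ) + J) / n) ^ (-a) * N n x ≤ K * N (n + J) (fwd A n J x) := by
  obtain ⟨K, lam, a, hK, hlam, ha, P, -, -, hrate⟩ := h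
  refine ⟨K, a, hK, hlam.trans_le ha, fun n hn J x => ⟨?_, ?_⟩⟩
  · have h1 := (hrate (n + J) n hn (by omega) x).2.2.1
    rwa [coc_add, Nat.cast_add] at h1
  · have h1 := (hrate (n + J) n hn (by omega) (fwd A n J x)).2.2.2
    rw [coc_add_symm, ContinuousLinearEquiv.symm_apply_apply, Nat.cast_add] at h1
    have hρ : (0 : ℝ) < ((n : ℝ) + J) / n := by linarith [ratio_one_le hn J]
    rw [Real.rpow_neg hρ.le, inv_mul_le_iff₀ (Real.rpow_pos_of_pos hρ a)]
    linarith

theorem exists_split_of_resolvent (hN : ∀ n, 1 ≤ n → IsNormOn (N n)) {s u : ℝ} (hsu : s ≤ u)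
    (hres : ∀ τ ∈ Set.Icc s u, τ ∉ SigmaPD A N) : ∃ K P, 0 ≤ K ∧ Split A N K s u P := by
  have hres' : ∀ τ ∈ Set.Icc s u, ∃ K lam P, 0 < lam ∧ Split A N K (τ - lam) (τ + lam) P :=
    fun τ hτ => exists_split_of_dichotomy hN (not_not.1 (hres τ hτ))
  obtain ⟨K₁, l₁, P₁, hl₁, h₁⟩ := hres' s (Set.left_mem_Icc.2 hsu)
  obtain ⟨K₂, l₂, P₂, hl₂, h₂⟩ := hres' u (Set.right_mem_Icc.2 hsu)
  have k₁ := abs_nonneg K₁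
  have k₂ := abs_nonneg K₂
  have h₁' := (h₁.nonneg_const hN).mono hN (K' := |K₁| + |K₂|) (by positivity) (by linarith)
    (s' := s) (by linarith) le_rfl
  have h₂' := (h₂.nonneg_const hN).mono hN (K' := |K₁| + |K₂|) (by positivity) (by linarith)
    le_rfl (u' := u) (by linarith)
  refine ⟨|K₁| + |K₂|, P₂, by positivity, h₂'.idem, h₂'.comm, h₂'.bdd, fun n hn J x hx => ?_,
    h₂'.low⟩
  refine h₁'.up n hn J x ?_
  rw [← h₁'.mem_slow_iff hN (by positivity) (τ := s) le_rfl (by linarith) hn,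
    slow_eq_of_isPreconnected hN isPreconnected_Icc hres' hn (Set.left_mem_Icc.2 hsu)
      (Set.right_mem_Icc.2 hsu),
    (h₂.nonneg_const hN).mem_slow_iff hN k₂ (by linarith) (by linarith) hn]
  exact hx

theorem split_zero_of_resolvent (hN : ∀ n, 1 ≤ n → IsNormOn (N n))
    (h : StrongPolyDichotomyWRT A N) (s : ℝ) {u : ℝ} (hres : ∀ τ ≤ u, τ ∉ SigmaPD A N) :
    ∃ K, 0 ≤ K ∧ Split A N K s u fun _ => 0 := by
  obtain ⟨Kg, a, hKg, ha, hg⟩ := exists_growth h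
  obtain ⟨K, P, hK, hP⟩ := exists_split_of_resolvent hN (min_le_left u (-a - 1))
    fun τ hτ => hres τ hτ.2
  have hP0 : ∀ n, 1 ≤ n → ∀ x, P n x = 0 := fun n hn x => by
    refine eq_zero_of_rates hN hn (u := -a) (τ := min u (-a - 1))
      ((min_le_right _ _).trans_lt (by linarith)) ?_ hKg.le fun J => (hg n hn J _).2
    exact ⟨K * N n (P n x), fun J =>
      (hP.up n hn J _ (hP.idem n hn x)).trans (le_of_eq (by ring))⟩
  refine ⟨K, hK, fun n hn x => rfl, fun n hn x => by simp, fun n hn x => ?_,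
    fun n hn J x hx => ?_, fun n hn J x hx => hP.low n hn J x (hP0 n hn x)⟩
  · have := (hN n hn).1 x
    simp only [zero_apply, (hN n hn).norm_zero]
    positivity
  · obtain rfl : 0 = x := hx
    simp [(hN _ (by omega : 1 ≤ n + J)).norm_zero, (hN n hn).norm_zero]

theorem split_id_of_resolvent (hN : ∀ n, 1 ≤ n → IsNormOn (N n))
    (h : StrongPolyDichotomyWRT A N) {s : ℝ} (u : ℝ) (hres : ∀ τ, s ≤ τ → τ ∉ SigmaPD A N) :
    ∃ K, 0 ≤ K ∧ Split A N K s u fun _ => ContinuousLinearMap.id ℝ E := by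
  obtain ⟨Kg, a, hKg, ha, hg⟩ := exists_growth h
  obtain ⟨K, P, hK, hP⟩ := exists_split_of_resolvent hN (u := max s a + 1)
    (by linarith [le_max_left s a] : s ≤ max s a + 1) fun τ hτ => hres τ hτ.1
  have hPid : ∀ n, 1 ≤ n → ∀ x, P n x = x := fun n hn x => by
    rw [← hP.mem_slow_iff hN hK (τ := max s a) (le_max_left _ _) (by linarith) hn]
    refine slow_mono hN hn (le_max_right s a) ?_
    exact ⟨Kg * N n x, fun J => ((hg n hn J x).1).trans (le_of_eq (by ring))⟩
  refine ⟨K + 1, by linarith, fun n hn x => rfl, fun n hn x => rfl, fun n hn x => ?_,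
    fun n hn J x hx => ?_, fun n hn J x hx => ?_⟩
  · have := (hN n hn).1 x
    simp only [ContinuousLinearMap.id_apply]
    nlinarith
  · exact (hP.mono hN (by linarith : 0 ≤ K + 1) (by linarith) le_rfl le_rfl).up n hn J x
      (hPid n hn x)
  · obtain rfl : x = 0 := hx
    simp [(hN _ (by omega : 1 ≤ n + J)).norm_zero, (hN n hn).norm_zero]

theorem mono_of_interlaced {r : ℕ} {lo hi : ℕ → ℝ} (hle : ∀ i, 1 ≤ i → i ≤ r → lo i ≤ hi i)
    (hgap : ∀ i, 1 ≤ i → i < r → hi i < lo (i + 1)) {i j : ℕ} (hi1 : 1 ≤ i) (hij : i ≤ j)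
    (hj : j ≤ r) : lo i ≤ lo j ∧ hi i ≤ hi j := by
  induction j, hij using Nat.le_induction with
  | base => exact ⟨le_rfl, le_rfl⟩
  | succ j hij ih =>
    have h1 := ih (by omega)
    have h2 := hgap j (by omega) (by omega)
    have h3 := hle j (by omega) (by omega)
    have h4 := hle (j + 1) (by omega) hj
    constructor <;> linarith

/-- Nested splittings at the gaps of a spectrum that is a union of ordered intervals. -/
theorem exists_nested_splits (hN : ∀ n, 1 ≤ n → IsNormOn (N n))
    (h : StrongPolyDichotomyWRT A N) {r : ℕ} (hr : 1 ≤ r) {lo hi : ℕ → ℝ} {δ : ℝ} (hδ : 0 < δ)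
    (hle : ∀ i, 1 ≤ i → i ≤ r → lo i ≤ hi i)
    (hgap : ∀ i, 1 ≤ i → i < r → hi i + δ < lo (i + 1) - δ)
    (hspec : SigmaPD A N = ⋃ i ∈ Finset.Icc 1 r, Set.Icc (lo i) (hi i)) :
    ∃ (K : ℝ) (P : ℕ → ℕ → (E →L[ℝ] E)), 0 ≤ K ∧ (∀ i ≤ r, Split A N K (hi i + δ) (lo (i + 1) - δ) (P i)) ∧
      (∀ n, P 0 n = 0) ∧ (∀ n, P r n = ContinuousLinearMap.id ℝ E) ∧
      ∀ i j, i ≤ j → j ≤ r → ∀ n, 1 ≤ n → ∀ x, P i n x = x → P j n x = x := by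
  have hmono := fun i hi1 j => mono_of_interlaced (i := i) (j := j) hle
    (fun i h1 h2 => by linarith [hgap i h1 h2]) hi1
  have hres : ∀ i ≤ r, ∀ τ, (1 ≤ i → hi i + δ ≤ τ) → (i < r → τ ≤ lo (i + 1) - δ) →
      τ ∉ SigmaPD A N := by
    intro i hir τ h1 h2 hτ
    rw [hspec] at hτ
    simp only [Set.mem_iUnion, Finset.mem_Icc] at hτ
    obtain ⟨j, ⟨hj1, hjr⟩, hjl, hju⟩ := hτ
    rcases Nat.lt_or_ge i j with hij | hij
    · have h3 := h2 (by omega)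
      have h4 := (hmono (i + 1) (by omega) j (by omega) hjr).1
      linarith
    · have h3 := h1 (by omega)
      have h4 := (hmono j hj1 i hij hir).2
      linarith
  have hex : ∀ i, ∃ K P, 0 ≤ K ∧ (i ≤ r → Split A N K (hi i + δ) (lo (i + 1) - δ) P) ∧
      (i = 0 → P = fun _ => 0) ∧ (i = r → P = fun _ => ContinuousLinearMap.id ℝ E) := by
    intro i
    rcases Nat.eq_zero_or_pos i with rfl | hi0
    · obtain ⟨K, hK, hP⟩ := split_zero_of_resolvent hN h (hi 0 + δ) (u := lo (0 + 1) - δ)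
        fun τ hτ => hres 0 (by omega) τ (by omega) fun _ => hτ
      exact ⟨K, _, hK, fun _ => hP, fun _ => rfl, by omega⟩
    rcases Nat.lt_trichotomy i r with hir | rfl | hir
    · obtain ⟨K, P, hK, hP⟩ := exists_split_of_resolvent hN (hgap i hi0 hir).le
        fun τ hτ => hres i hir.le τ (fun _ => hτ.1) fun _ => hτ.2
      exact ⟨K, P, hK, fun _ => hP, by omega, by omega⟩
    · obtain ⟨K, hK, hP⟩ := split_id_of_resolvent hN h (s := hi i + δ) (lo (i + 1) - δ)
        fun τ hτ => hres i le_rfl τ (fun _ => hτ) (by omega)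
      exact ⟨K, _, hK, fun _ => hP, by omega, fun _ => rfl⟩
    · exact ⟨0, fun _ => 0, le_rfl, by omega, by omega, by omega⟩
  choose K P hK hP hP0 hPr using hex
  have hsum : ∀ i ≤ r, K i ≤ ∑ i ∈ Finset.range (r + 1), K i := fun i hir =>
    Finset.single_le_sum (fun j _ => hK j) (Finset.mem_range.2 (by omega))
  have hsum0 : 0 ≤ ∑ i ∈ Finset.range (r + 1), K i := Finset.sum_nonneg fun j _ => hK j
  refine ⟨∑ i ∈ Finset.range (r + 1), K i, P, hsum0,
    fun i hir => (hP i hir).mono hN hsum0 (hsum i hir) le_rfl le_rfl,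
    fun n => by rw [hP0 0 rfl], fun n => by rw [hPr r rfl], fun i j hij hjr n hn x hx => ?_⟩
  rcases Nat.eq_zero_or_pos i with rfl | hi0
  · rw [hP0 0 rfl] at hx
    obtain rfl : 0 = x := hx
    exact map_zero _
  rcases hjr.lt_or_eq with hjr | rfl
  · rw [← (hP i (by omega)).mem_slow_iff hN (hK i) le_rfl (hgap i hi0 (by omega)) hn] at hx
    rw [← (hP j (by omega)).mem_slow_iff hN (hK j) le_rfl (hgap j (by omega) (by omega)) hn]
    exact slow_mono hN hn (by linarith [(hmono i hi0 j hij hjr.le).2]) hx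
  · rw [hPr j rfl]
    rfl

theorem exists_stack {X : Type*} (r : ℕ) (z : X) (f : ℕ → X → X) :
    ∃ R : ℕ → X, R r = z ∧ ∀ i < r, R i = f i (R (i + 1)) := by
  induction r generalizing z with
  | zero => exact ⟨fun _ => z, rfl, fun i hi => absurd hi (Nat.not_lt_zero i)⟩
  | succ r ih =>
    obtain ⟨R, hR, hR'⟩ := ih (f r z)
    refine ⟨fun i => if i ≤ r then R i else z, by simp, fun i hi => ?_⟩
    rcases Nat.lt_succ_iff_lt_or_eq.1 hi with h | rfl
    · simp only [if_pos h.le, if_pos (by omega : i + 1 ≤ r), hR' i h]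
    · simp [hR]

/-- Invariant projections onto the spectral bands. -/
theorem exists_band_projections (hN : ∀ n, 1 ≤ n → IsNormOn (N n))
    (h : StrongPolyDichotomyWRT A N) {r : ℕ} (hr : 1 ≤ r) {lo hi : ℕ → ℝ} {δ : ℝ} (hδ : 0 < δ)
    (hle : ∀ i, 1 ≤ i → i ≤ r → lo i ≤ hi i)
    (hgap : ∀ i, 1 ≤ i → i < r → hi i + δ < lo (i + 1) - δ)
    (hspec : SigmaPD A N = ⋃ i ∈ Finset.Icc 1 r, Set.Icc (lo i) (hi i)) :
    ∃ (K : ℝ) (e : ℕ → ℕ → (E →L[ℝ] E)), 0 ≤ K ∧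
      (∀ n, 1 ≤ n → ∀ i < r, ∀ j < r, ∀ x, e i n (e j n x) = if i = j then e j n x else 0) ∧
      (∀ n, ∀ x, ∑ j ∈ Finset.range r, e j n x = x) ∧
      (∀ n, 1 ≤ n → ∀ j < r, ∀ x, A n (e j n x) = e j (n + 1) (A n x)) ∧
      (∀ n, 1 ≤ n → ∀ j < r, ∀ x, N n (e j n x) ≤ K * N n x) ∧
      ∀ n, 1 ≤ n → ∀ j < r, ∀ (J : ℕ) x, e j n x = x →
        N (n + J) (fwd A n J x) ≤ K * (((n : ℝ) + J) / n) ^ (hi (j + 1) + δ) * N n x ∧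
        (((n : ℝ) + J) / n) ^ (lo (j + 1) - δ) * N n x ≤ K * N (n + J) (fwd A n J x) := by
  obtain ⟨K, P, hK, hP, hP0, hPr, hnest⟩ := exists_nested_splits hN h hr hδ hle hgap hspec
  obtain ⟨R, hRr, hRs⟩ := exists_stack r (fun _ : ℕ => ContinuousLinearMap.id ℝ E)
    fun i (T : ℕ → (E →L[ℝ] E)) n => (P i n).comp (T n)
  have hRs' : ∀ i < r, ∀ n x, R i n x = P i n (R (i + 1) n x) := fun i hi n x => by
    rw [hRs i hi]; rfl
  have hRr' : ∀ n x, R r n x = x := fun n x => by rw [hRr]; rfl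
  have hPR : ∀ i ≤ r, ∀ n, 1 ≤ n → ∀ x, P i n (R i n x) = R i n x := by
    intro i hi n hn x
    rcases hi.lt_or_eq with hi | rfl
    · rw [hRs' i hi, (hP i hi.le).idem n hn]
    · rw [hPr]; rfl
  have hfix : ∀ i ≤ r, ∀ n, 1 ≤ n → ∀ x, P i n x = x → R i n x = x := by
    intro i hi
    induction hi using Nat.decreasingInduction with
    | self => exact fun n _ x _ => hRr' n x
    | of_succ i hi ih =>
      intro n hn x hx
      rw [hRs' i hi, ih n hn x (hnest i (i + 1) (by omega) hi n hn x hx), hx]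
  have hRR₁ : ∀ i j, i ≤ j → j ≤ r → ∀ n, 1 ≤ n → ∀ x, R j n (R i n x) = R i n x :=
    fun i j hij hj n hn x => hfix j hj n hn _
      (hnest i j hij hj n hn _ (hPR i (hij.trans hj) n hn x))
  have hRR₂ : ∀ j ≤ r, ∀ i, i ≤ j → ∀ n, 1 ≤ n → ∀ x, R i n (R j n x) = R i n x := by
    intro j hj i hij
    induction hij using Nat.decreasingInduction with
    | self => exact fun n hn x => hRR₁ j j le_rfl hj n hn x
    | of_succ i hi ih =>
      intro n hn x
      rw [hRs' i (by omega), ih n hn, ← hRs' i (by omega)]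
  have hcomm : ∀ i ≤ r, ∀ n, 1 ≤ n → ∀ x, A n (R i n x) = R i (n + 1) (A n x) := by
    intro i hi
    induction hi using Nat.decreasingInduction with
    | self => intro n _ x; rw [hRr', hRr']
    | of_succ i hi ih =>
      intro n hn x
      rw [hRs' i hi, (hP i hi.le).comm n hn, ih n hn, ← hRs' i hi]
  have hbdd : ∀ i ≤ r, ∀ n, 1 ≤ n → ∀ x, N n (R i n x) ≤ (K + 1) ^ (r - i) * N n x := by
    intro i hi
    induction hi using Nat.decreasingInduction with
    | self => intro n _ x; rw [hRr', Nat.sub_self, pow_zero, one_mul]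
    | of_succ i hi ih =>
      intro n hn x
      have h0 := (hN n hn).1 (R (i + 1) n x)
      rw [hRs' i hi, (by omega : r - i = r - (i + 1) + 1), pow_succ']
      calc _ ≤ K * N n (R (i + 1) n x) := (hP i hi.le).bdd n hn _
        _ ≤ (K + 1) * ((K + 1) ^ (r - (i + 1)) * N n x) := by
          gcongr
          · linarith
          · exact ih n hn x
        _ = _ := by ring
  have hbdd' : ∀ i ≤ r, ∀ n, 1 ≤ n → ∀ x, N n (R i n x) ≤ (K + 1) ^ r * N n x := by
    intro i hi n hn x
    have h0 := (hN n hn).1 x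
    refine (hbdd i hi n hn x).trans ?_
    gcongr
    · linarith
    · omega
  have hR0 : ∀ n x, R 0 n x = 0 := fun n x => by
    rw [hRs' 0 (by omega), hP0]; rfl
  have hK1 : 1 ≤ (K + 1) ^ r := one_le_pow₀ (by linarith)
  refine ⟨2 * (K + 1) ^ r + K, fun j n => R (j + 1) n - R j n, by positivity,
    fun n hn i hi j hj x => ?_, fun n x => ?_, fun n hn j hj x => ?_, fun n hn j hj x => ?_,
    fun n hn j hj J x hx => ?_⟩
  · simp only [sub_apply, map_sub]
    rcases Nat.lt_trichotomy i j with hij | rfl | hij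
    · rw [hRR₂ (j + 1) (by omega) (i + 1) (by omega) n hn, hRR₂ j (by omega) (i + 1) (by omega) n hn,
        hRR₂ (j + 1) (by omega) i (by omega) n hn, hRR₂ j (by omega) i (by omega) n hn,
        if_neg hij.ne]
      abel
    · rw [hRR₁ (i + 1) (i + 1) le_rfl (by omega) n hn, hRR₁ i (i + 1) (by omega) (by omega) n hn,
        hRR₂ (i + 1) (by omega) i (by omega) n hn, hRR₁ i i le_rfl (by omega) n hn, if_pos rfl]
      abel
    · rw [hRR₁ (j + 1) (i + 1) (by omega) (by omega) n hn, hRR₁ j (i + 1) (by omega) (by omega) n hn,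
        hRR₁ (j + 1) i (by omega) (by omega) n hn, hRR₁ j i (by omega) (by omega) n hn,
        if_neg hij.ne']
      abel
  · simp only [sub_apply]
    rw [Finset.sum_range_sub fun j => R j n x, hRr', hR0, sub_zero]
  · simp only [sub_apply, map_sub]
    rw [hcomm (j + 1) (by omega) n hn, hcomm j (by omega) n hn]
  · simp only [sub_apply]
    have h0 := (hN n hn).1 x
    have h1 := hbdd' (j + 1) (by omega) n hn x
    have h2 := hbdd' j (by omega) n hn x
    have h3 := (hN n hn).norm_sub_le (R (j + 1) n x) (R j n x)
    nlinarith [mul_nonneg hK h0]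
  · simp only [sub_apply] at hx
    have hR1 : R (j + 1) n x = x := by
      conv_lhs => rw [← hx]
      rw [map_sub, hRR₁ (j + 1) (j + 1) le_rfl (by omega) n hn,
        hRR₁ j (j + 1) (by omega) (by omega) n hn, hx]
    have hR2 : R j n x = 0 := by
      rw [hR1] at hx
      exact sub_eq_self.1 hx
    have h1 : P (j + 1) n x = x := by
      have := hPR (j + 1) (by omega) n hn x
      rwa [hR1] at this
    have h2 : P j n x = 0 := by rwa [hRs' j hj, hR1] at hR2
    have hK' : K ≤ 2 * (K + 1) ^ r + K := by linarith
    exact ⟨((hP (j + 1) (by omega)).mono hN (by positivity) hK' le_rfl le_rfl).up n hn J x h1,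
      ((hP j hj.le).mono hN (by positivity) hK' le_rfl le_rfl).low n hn J x h2⟩

end Bands

section Coordinates

variable {E : Type*} [NormedAddCommGroup E] [NormedSpace ℝ E] {A : ℕ → (E ≃L[ℝ] E)}

theorem finrank_range_eq_of_commute {e : ℕ → (E →L[ℝ] E)}
    (h : ∀ n, 1 ≤ n → ∀ x, A n (e n x) = e (n + 1) (A n x)) {n : ℕ} (hn : 1 ≤ n) :
    Module.finrank ℝ (LinearMap.range (e n : E →ₗ[ℝ] E)) =
      Module.finrank ℝ (LinearMap.range (e 1 : E →ₗ[ℝ] E)) := by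
  induction n, hn using Nat.le_induction with
  | base => rfl
  | succ n hn ih =>
    have hr : LinearMap.range (e (n + 1) : E →ₗ[ℝ] E) =
        (LinearMap.range (e n : E →ₗ[ℝ] E)).map ((A n).toLinearEquiv : E →ₗ[ℝ] E) := by
      ext y
      simp only [LinearMap.mem_range, Submodule.mem_map]
      constructor
      · rintro ⟨x, rfl⟩
        refine ⟨e n ((A n).symm x), ⟨_, rfl⟩, ?_⟩
        change A n (e n ((A n).symm x)) = e (n + 1) x
        rw [h n hn, ContinuousLinearEquiv.apply_symm_apply]
      · rintro ⟨-, ⟨x, rfl⟩, rfl⟩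
        exact ⟨A n x, (h n hn x).symm⟩
    rw [← ih, hr]
    exact LinearEquiv.finrank_map_eq (A n).toLinearEquiv _

variable {X : Type*} [NormedAddCommGroup X] [NormedSpace ℝ X]

/-- The sequence `A` in the time-dependent coordinates `T`. -/
def conjSeq (T : ℕ → (E ≃L[ℝ] X)) (A : ℕ → (E ≃L[ℝ] E)) (n : ℕ) : X ≃L[ℝ] X :=
  ((T n).symm.trans (A n)).trans (T (n + 1))

theorem conjSeq_apply (T : ℕ → (E ≃L[ℝ] X)) (A : ℕ → (E ≃L[ℝ] E)) (n : ℕ) (x : E) :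
    conjSeq T A n (T n x) = T (n + 1) (A n x) := by
  simp [conjSeq]

theorem fwd_conjSeq (T : ℕ → (E ≃L[ℝ] X)) (A : ℕ → (E ≃L[ℝ] E)) (n J : ℕ) (x : E) :
    fwd (conjSeq T A) n J (T n x) = T (n + J) (fwd A n J x) := by
  induction J with
  | zero => rfl
  | succ J ih => rw [fwd_succ, ih, conjSeq_apply]; rfl

theorem norm_fwd_conjSeq_le {N : ℕ → E → ℝ} {T : ℕ → (E ≃L[ℝ] X)} {K D G s : ℝ} (hK : 0 ≤ K)
    (hG : 0 ≤ G) (h1 : ∀ n, 1 ≤ n → ∀ x, ‖T n x‖ ≤ K * N n x)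
    (h2 : ∀ n, 1 ≤ n → ∀ x, N n x ≤ D * ‖T n x‖) {n J : ℕ} (hn : 1 ≤ n) {x : E}
    (h : N (n + J) (fwd A n J x) ≤ G * (((n : ℝ) + J) / n) ^ s * N n x) :
    ‖fwd (conjSeq T A) n J (T n x)‖ ≤ K * D * G * (((n : ℝ) + J) / n) ^ s * ‖T n x‖ := by
  have hρ := ratio_one_le hn J
  rw [fwd_conjSeq]
  calc _ ≤ K * N (n + J) (fwd A n J x) := h1 _ (by omega) _
    _ ≤ K * (G * (((n : ℝ) + J) / n) ^ s * (D * ‖T n x‖)) := by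
      refine mul_le_mul_of_nonneg_left (h.trans ?_) hK
      gcongr
      exact h2 n hn x
    _ = _ := by ring

theorem le_norm_fwd_conjSeq {N : ℕ → E → ℝ} {T : ℕ → (E ≃L[ℝ] X)} {K D G s : ℝ} (hK : 0 ≤ K)
    (hG : 0 ≤ G) (h1 : ∀ n, 1 ≤ n → ∀ x, ‖T n x‖ ≤ K * N n x)
    (h2 : ∀ n, 1 ≤ n → ∀ x, N n x ≤ D * ‖T n x‖) {n J : ℕ} (hn : 1 ≤ n) {x : E}
    (h : (((n : ℝ) + J) / n) ^ s * N n x ≤ G * N (n + J) (fwd A n J x)) :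
    (((n : ℝ) + J) / n) ^ s * ‖T n x‖ ≤ K * D * G * ‖fwd (conjSeq T A) n J (T n x)‖ := by
  have hρ := ratio_one_le hn J
  rw [fwd_conjSeq]
  calc _ ≤ (((n : ℝ) + J) / n) ^ s * (K * N n x) := by
        gcongr
        exact h1 n hn x
    _ = K * ((((n : ℝ) + J) / n) ^ s * N n x) := by ring
    _ ≤ K * (G * (D * ‖T (n + J) (fwd A n J x)‖)) := by
      refine mul_le_mul_of_nonneg_left (h.trans ?_) hK
      gcongr
      exact h2 _ (by omega) _
    _ = _ := by ring

/-- Coordinates in which `A` is block diagonal, with the growth rates given by its spectrum. -/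
theorem exists_block_coordinates [FiniteDimensional ℝ E] {N : ℕ → E → ℝ}
    (hN : ∀ n, 1 ≤ n → IsNormOn (N n)) (h : StrongPolyDichotomyWRT A N)
    (hc₁ : ∀ n, 1 ≤ n → ∀ x, ‖x‖ ≤ N n x) (hc₂ : ∀ n, 1 ≤ n → ∃ C, ∀ x, N n x ≤ C * ‖x‖)
    {r : ℕ} (hr : 1 ≤ r) {lo hi : ℕ → ℝ} {δ : ℝ} (hδ : 0 < δ)
    (hle : ∀ i, 1 ≤ i → i ≤ r → lo i ≤ hi i)
    (hgap : ∀ i, 1 ≤ i → i < r → hi i + δ < lo (i + 1) - δ)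
    (hspec : SigmaPD A N = ⋃ i ∈ Finset.Icc 1 r, Set.Icc (lo i) (hi i)) :
    ∃ (ι : Type) (_ : Fintype ι) (ℓ : ι → ℕ) (T : ℕ → (E ≃L[ℝ] (ι → ℝ))) (K p : ℝ),
      1 ≤ K ∧ 0 ≤ p ∧ (∀ i, ℓ i < r) ∧
      (∀ n, 1 ≤ n → ∀ x, ‖T n x‖ ≤ K * N n x ∧ N n x ≤ K * ‖T n x‖) ∧
      (∀ n J : ℕ, 1 ≤ n → ∀ x,
        ‖fwd (conjSeq T A) n J x‖ ≤ K * (((n : ℝ) + J) / n) ^ p * ‖x‖ ∧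
        ‖(fwd (conjSeq T A) n J).symm x‖ ≤ K * (((n : ℝ) + J) / n) ^ p * ‖x‖) ∧
      (∀ n, 1 ≤ n → ∀ j x, rst ℓ (· = j) (conjSeq T A n x) = conjSeq T A n (rst ℓ (· = j) x)) ∧
      ∀ j < r, ∀ n J : ℕ, 1 ≤ n → ∀ x, rst ℓ (· = j) x = x →
        ‖fwd (conjSeq T A) n J x‖ ≤ K * (((n : ℝ) + J) / n) ^ (hi (j + 1) + δ) * ‖x‖ ∧
        (((n : ℝ) + J) / n) ^ (lo (j + 1) - δ) * ‖x‖ ≤ K * ‖fwd (conjSeq T A) n J x‖ := by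
  obtain ⟨G₁, a, hG₁, ha, hgr⟩ := exists_growth h
  obtain ⟨K₀, e, hK₀, hee, hes, hec, heb, her⟩ :=
    exists_band_projections hN h hr hδ hle hgap hspec
  set d : Fin r → ℕ := fun j => Module.finrank ℝ (LinearMap.range (e j 1 : E →ₗ[ℝ] E)) with hd
  have hT : ∀ n, 1 ≤ n → ∃ T : E ≃L[ℝ] ((Σ j : Fin r, Fin (d j)) → ℝ),
      (∀ x, ‖T x‖ ≤ K₀ * N n x) ∧
      (∀ x, N n x ≤ Fintype.card (Σ j : Fin r, Fin (d j)) * ‖T x‖) ∧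
      ∀ (j : Fin r) x, T (e j n x) =
        rst (fun p : Σ j : Fin r, Fin (d j) => (p.1 : ℕ)) (· = (j : ℕ)) (T x) := by
    intro n hn
    obtain ⟨C, hC⟩ := hc₂ n hn
    refine exists_band_coordinates (hN n hn) (hc₁ n hn) hC (e := fun j => e j n)
      (fun i j x => ?_) (fun x => ?_) hK₀ (fun j x => heb n hn j j.2 x) fun j =>
        finrank_range_eq_of_commute (e := fun n => e j n) (fun n hn x => hec n hn j j.2 x) hn
    · rw [hee n hn i i.2 j j.2]
      simp only [Fin.ext_iff]
    · rw [Fin.sum_univ_eq_sum_range fun j => e j n x, hes]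
  have hT' : ∀ n, ∃ T : E ≃L[ℝ] ((Σ j : Fin r, Fin (d j)) → ℝ), 1 ≤ n →
      (∀ x, ‖T x‖ ≤ K₀ * N n x) ∧
      (∀ x, N n x ≤ Fintype.card (Σ j : Fin r, Fin (d j)) * ‖T x‖) ∧
      ∀ (j : Fin r) x, T (e j n x) =
        rst (fun p : Σ j : Fin r, Fin (d j) => (p.1 : ℕ)) (· = (j : ℕ)) (T x) := by
    intro n
    rcases Nat.eq_zero_or_pos n with rfl | hn
    · exact ⟨(hT 1 le_rfl).choose, by omega⟩
    · obtain ⟨T, hT⟩ := hT n hn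
      exact ⟨T, fun _ => hT⟩
  choose T hT using hT'
  set D : ℝ := (Fintype.card (Σ j : Fin r, Fin (d j)) : ℝ) with hD
  have hD0 : 0 ≤ D := Nat.cast_nonneg _
  set ℓ : (Σ j : Fin r, Fin (d j)) → ℕ := fun p => (p.1 : ℕ) with hℓ
  have hT1 : ∀ n, 1 ≤ n → ∀ x, ‖T n x‖ ≤ (K₀ + 1) * N n x := fun n hn x =>
    ((hT n hn).1 x).trans (mul_le_mul_of_nonneg_right (by linarith) ((hN n hn).1 x))
  have hT2 : ∀ n, 1 ≤ n → ∀ x, N n x ≤ (D + 1) * ‖T n x‖ := fun n hn x =>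
    ((hT n hn).2.1 x).trans (mul_le_mul_of_nonneg_right (by linarith) (norm_nonneg _))
  have hTj : ∀ n, 1 ≤ n → ∀ j < r, ∀ x, rst ℓ (· = j) (T n x) = T n (e j n x) :=
    fun n hn j hj x => ((hT n hn).2.2 ⟨j, hj⟩ x).symm
  have hsurj : ∀ n x, ∃ z, T n z = x := fun n x => ⟨(T n).symm x, by simp⟩
  set Q := (K₀ + 1) * (D + 1) with hQ
  have hQ1 : 1 ≤ Q := by nlinarith
  have hKQ : K₀ + 1 ≤ Q := by nlinarith
  have hDQ : D + 1 ≤ Q := by nlinarith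
  set K := Q * (G₁ + K₀ + 1) with hKdef
  have hQK : Q ≤ K := by nlinarith
  have hK1 : Q * G₁ ≤ K := by nlinarith
  have hK2 : Q * K₀ ≤ K := by nlinarith
  refine ⟨_, inferInstance, ℓ, T, K, a, by linarith, ha.le, fun i => i.1.2,
    fun n hn x => ⟨(hT1 n hn x).trans ?_, (hT2 n hn x).trans ?_⟩, fun n J hn x => ⟨?_, ?_⟩,
    fun n hn j x => ?_, fun j hj n J hn x hx => ?_⟩
  · exact mul_le_mul_of_nonneg_right (by linarith) ((hN n hn).1 x)
  · exact mul_le_mul_of_nonneg_right (by linarith) (norm_nonneg _)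
  · obtain ⟨z, rfl⟩ := hsurj n x
    have hρ := ratio_one_le hn J
    refine (norm_fwd_conjSeq_le (by linarith) hG₁.le hT1 hT2 hn (hgr n hn J z).1).trans ?_
    gcongr
  · obtain ⟨y, rfl⟩ := (fwd (conjSeq T A) n J).surjective x
    rw [ContinuousLinearEquiv.symm_apply_apply]
    obtain ⟨z, rfl⟩ := hsurj n y
    have hρ := ratio_one_le hn J
    have hρ0 : 0 < ((n : ℝ) + J) / n := by linarith
    have h1 := le_norm_fwd_conjSeq (by linarith) hG₁.le hT1 hT2 hn (hgr n hn J z).2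
    rw [Real.rpow_neg hρ0.le, inv_mul_le_iff₀ (Real.rpow_pos_of_pos hρ0 a)] at h1
    refine (h1.trans (le_of_eq ?_)).trans (b := Q * G₁ * (((n : ℝ) + J) / n) ^ a *
      ‖fwd (conjSeq T A) n J (T n z)‖) (by gcongr)
    rw [hQ]
    ring
  · obtain ⟨z, rfl⟩ := hsurj n x
    rcases Nat.lt_or_ge j r with hj | hj
    · rw [conjSeq_apply, hTj _ (by omega) j hj, hTj n hn j hj, conjSeq_apply, hec n hn j hj]
    · have hne : ∀ i, ¬ ℓ i = j := fun i => by have : ℓ i < r := i.1.2; omega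
      rw [rst_eq_zero ℓ hne, rst_eq_zero ℓ hne, map_zero]
  · obtain ⟨z, rfl⟩ := hsurj n x
    rw [hTj n hn j hj] at hx
    have hρ := ratio_one_le hn J
    have h1 := her n hn j hj J z ((T n).injective hx)
    refine ⟨(norm_fwd_conjSeq_le (by linarith) hK₀ hT1 hT2 hn h1.1).trans ?_,
      (le_norm_fwd_conjSeq (by linarith) hK₀ hT1 hT2 hn h1.2).trans ?_⟩ <;> gcongr

end Coordinates

theorem exists_exponent_margin {r k : ℕ} {lo hi : ℕ → ℝ} (h₁ : hi k < 0) (h₂ : 0 < lo (k + 1))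
    (h₃ : hi k + hi r < lo (k + 1)) (h₄ : hi k - lo 1 < lo (k + 1))
    (h₅ : ∀ i, 1 ≤ i → i ≤ k → hi i + hi k < lo i)
    (h₆ : ∀ j, k + 1 ≤ j → j ≤ r → hi j - lo j < lo (k + 1))
    (h₇ : ∀ i, 1 ≤ i → i < r → hi i < lo (i + 1)) :
    ∃ δ > 0, hi k + 6 * δ ≤ 0 ∧ 6 * δ ≤ lo (k + 1) ∧ hi k + hi r + 6 * δ ≤ lo (k + 1) ∧
      hi k - lo 1 + 6 * δ ≤ lo (k + 1) ∧ (∀ i, 1 ≤ i → i ≤ k → hi i + hi k + 6 * δ ≤ lo i) ∧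
      (∀ j, k + 1 ≤ j → j ≤ r → hi j - lo j + 6 * δ ≤ lo (k + 1)) ∧
      ∀ i, 1 ≤ i → i < r → hi i + 6 * δ ≤ lo (i + 1) := by
  have ev : ∀ p q : ℝ, p < q → ∀ᶠ δ in 𝓝[>] (0 : ℝ), p + 6 * δ ≤ q := fun p q hpq => by
    filter_upwards [Ioo_mem_nhdsGT (by linarith : 0 < (q - p) / 6)] with δ hδ
    linarith [hδ.2]
  have ev₅ : ∀ᶠ δ in 𝓝[>] (0 : ℝ), ∀ i ∈ Finset.Icc 1 k, hi i + hi k + 6 * δ ≤ lo i :=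
    (Filter.eventually_all_finset _).2 fun i hi => by
      rw [Finset.mem_Icc] at hi
      exact ev _ _ (h₅ i hi.1 hi.2)
  have ev₆ : ∀ᶠ δ in 𝓝[>] (0 : ℝ), ∀ j ∈ Finset.Icc (k + 1) r,
      hi j - lo j + 6 * δ ≤ lo (k + 1) :=
    (Filter.eventually_all_finset _).2 fun i hi => by
      rw [Finset.mem_Icc] at hi
      exact ev _ _ (h₆ i hi.1 hi.2)
  have ev₇ : ∀ᶠ δ in 𝓝[>] (0 : ℝ), ∀ i ∈ Finset.Ico 1 r, hi i + 6 * δ ≤ lo (i + 1) :=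
    (Filter.eventually_all_finset _).2 fun i hi => by
      rw [Finset.mem_Ico] at hi
      exact ev _ _ (h₇ i hi.1 hi.2)
  have ev₀ : ∀ᶠ δ in 𝓝[>] (0 : ℝ), 0 < δ := self_mem_nhdsWithin
  obtain ⟨δ, d₀, d₁, d₂, d₃, d₄, d₅, d₆, d₇⟩ := (ev₀.and ((ev _ _ h₁).and ((ev _ _ h₂).and
    ((ev _ _ h₃).and ((ev _ _ h₄).and (ev₅.and (ev₆.and ev₇))))))).exists
  exact ⟨δ, d₀, d₁, by linarith, d₃, d₄, fun i a b => d₅ i (Finset.mem_Icc.2 ⟨a, b⟩),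
    fun i a b => d₆ i (Finset.mem_Icc.2 ⟨a, b⟩), fun i a b => d₇ i (Finset.mem_Ico.2 ⟨a, b⟩)⟩

end

/-- Theorem: `C¹` linearization under nonuniform polynomial
dichotomy. -/
theorem c1_linearization_polyDichotomy {d : ℕ}
    (A : ℕ → (EuclideanSpace ℝ (Fin d) ≃L[ℝ] EuclideanSpace ℝ (Fin d)))
    (ε : ℝ) (hε : 0 ≤ ε)
    (hnupd : NonuniformStrongPolyDichotomyWith A ε)
    (N : ℕ → EuclideanSpace ℝ (Fin d) → ℝ)
    (hN : ∀ n : ℕ, 1 ≤ n → IsNormOn (N n))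
    (hdich : StrongPolyDichotomyWRT A N)
    (C : ℝ) (hC : 0 < C)
    (hcomp : ∀ (n : ℕ), 1 ≤ n → ∀ x : EuclideanSpace ℝ (Fin d),
      ‖x‖ ≤ N n x ∧ N n x ≤ C * (n : ℝ) ^ (2 * ε) * ‖x‖)
    (r k : ℕ) (aa bb : ℕ → ℝ)
    (hk : 1 ≤ k) (hkr : k < r)
    (hab : ∀ i : ℕ, 1 ≤ i → i ≤ r → 0 < aa i ∧ aa i ≤ bb i)
    (hord : ∀ i : ℕ, 1 ≤ i → i < r → bb i < aa (i + 1))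
    (hbk : bb k < 1) (hak : 1 < aa (k + 1))
    (hgap : max (bb r) (aa 1)⁻¹ < aa (k + 1) / bb k)
    (hband₁ : ∀ i : ℕ, 1 ≤ i → i ≤ k → bb i / aa i < (bb k)⁻¹)
    (hband₂ : ∀ j : ℕ, k + 1 ≤ j → j ≤ r → bb j / aa j < aa (k + 1))
    (hspec : SigmaPD A N =
      ⋃ i ∈ Finset.Icc 1 r,
        Set.Icc (Real.log (aa i) / Real.log 2) (Real.log (bb i) / Real.log 2))
    (L : ℝ) (hL : 0 < L) :
    ∃ c₀ : ℝ, 0 < c₀ ∧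
      ∀ c : ℝ, 0 < c → c ≤ c₀ →
        ∀ g : ℕ → EuclideanSpace ℝ (Fin d) → EuclideanSpace ℝ (Fin d),
          (∀ n : ℕ, 1 ≤ n → ContDiff ℝ 1 (g n)) →
          (∀ n : ℕ, 1 ≤ n → g n 0 = 0) →
          (∀ n : ℕ, 1 ≤ n → fderiv ℝ (g n) 0 = 0) →
          (∀ n : ℕ, 1 ≤ n → ∀ x : EuclideanSpace ℝ (Fin d),
            ‖fderiv ℝ (g n) x‖ ≤ c / ((n : ℝ) + 1) ^ (1 + 2 * ε)) →
          (∀ n : ℕ, 1 ≤ n → ∀ x y : EuclideanSpace ℝ (Fin d),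
            ‖fderiv ℝ (g n) x - fderiv ℝ (g n) y‖
              ≤ L / ((n : ℝ) + 1) ^ (1 + 2 * ε) * ‖x - y‖) →
          ∃ ψ : ℕ → (EuclideanSpace ℝ (Fin d) ≃ EuclideanSpace ℝ (Fin d)),
            (∀ n : ℕ, 1 ≤ n → ContDiff ℝ 1 (ψ n) ∧ ContDiff ℝ 1 (ψ n).symm) ∧
            (∀ n : ℕ, 1 ≤ n → ∀ x : EuclideanSpace ℝ (Fin d),
              ψ (n + 1) (A n x + g n x) = A n (ψ n x)) ∧
            ∃ Mt ρt : ℝ, 0 < Mt ∧ 0 < ρt ∧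
              ∀ n : ℕ, 1 ≤ n → ∀ x : EuclideanSpace ℝ (Fin d),
                ‖x‖ ≤ ρt / (n : ℝ) ^ (2 * ε) →
                  ‖fderiv ℝ (ψ n) x‖ ≤ Mt * (n : ℝ) ^ (2 * ε) ∧
                  ‖fderiv ℝ (ψ n).symm x‖ ≤ Mt * (n : ℝ) ^ (2 * ε) := by
  have hlog2 : 0 < Real.log 2 := Real.log_pos (by norm_num)
  have ha : ∀ i, 1 ≤ i → i ≤ r → 0 < aa i := fun i h1 h2 => (hab i h1 h2).1
  have hb : ∀ i, 1 ≤ i → i ≤ r → 0 < bb i := fun i h1 h2 => (ha i h1 h2).trans_le (hab i h1 h2).2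
  set lo : ℕ → ℝ := fun i => Real.log (aa i) / Real.log 2 with hlo
  set hi : ℕ → ℝ := fun i => Real.log (bb i) / Real.log 2 with hhi
  have hlt : ∀ {x y : ℝ}, 0 < x → x < y → Real.log x / Real.log 2 < Real.log y / Real.log 2 :=
    fun hx hxy => div_lt_div_of_pos_right (Real.log_lt_log hx hxy) hlog2
  have hle : ∀ i, 1 ≤ i → i ≤ r → lo i ≤ hi i := fun i h1 h2 =>
    div_le_div_of_nonneg_right (Real.log_le_log (ha i h1 h2) (hab i h1 h2).2) hlog2.le
  have hak0 := ha (k + 1) (by omega) (by omega)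
  have hbk0 := hb k hk hkr.le
  have e₃ := hlt (hb r (by omega) le_rfl) ((le_max_left _ _).trans_lt hgap)
  have e₄ := hlt (inv_pos.2 (ha 1 le_rfl (by omega))) ((le_max_right _ _).trans_lt hgap)
  rw [Real.log_div hak0.ne' hbk0.ne', sub_div] at e₃ e₄
  rw [Real.log_inv, neg_div] at e₄
  have e₇ : ∀ i, 1 ≤ i → i < r → hi i < lo (i + 1) := fun i h1 h2 =>
    hlt (hb i h1 h2.le) (hord i h1 h2)
  obtain ⟨δ, hδ, m₁, m₂, m₃, m₄, m₅, m₆, m₇⟩ := exists_exponent_margin (r := r) (k := k)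
    (lo := lo) (hi := hi)
    (div_neg_of_neg_of_pos (Real.log_neg hbk0 hbk) hlog2) (div_pos (Real.log_pos hak) hlog2)
    (by simp only [hlo, hhi]; linarith) (by simp only [hlo, hhi]; linarith)
    (fun i h1 h2 => by
      have h := hlt (div_pos (hb i h1 (by omega)) (ha i h1 (by omega))) (hband₁ i h1 h2)
      rw [Real.log_div (hb i h1 (by omega)).ne' (ha i h1 (by omega)).ne', Real.log_inv, sub_div,
        neg_div] at h
      simp only [hlo, hhi]
      linarith)
    (fun i h1 h2 => by
      have h := hlt (div_pos (hb i (by omega) h2) (ha i (by omega) h2)) (hband₂ i h1 h2)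
      rwa [Real.log_div (hb i (by omega) h2).ne' (ha i (by omega) h2).ne', sub_div] at h)
    e₇
  have hmono := fun i hi1 j => mono_of_interlaced (i := i) (j := j) hle e₇ hi1
  obtain ⟨ι, _, ℓ, T, K, p, hK, hp, hℓ, hT, hB, hcomm, hrate⟩ :=
    exists_block_coordinates hN hdich (fun n hn x => (hcomp n hn x).1)
      (fun n hn => ⟨_, fun x => (hcomp n hn x).2⟩) (by omega : 1 ≤ r) hδ hle
      (fun i h1 h2 => by linarith [m₇ i h1 h2]) hspec
  have hK0 : 0 < K := by linarith
  have hTsymm : ∀ n, 1 ≤ n → ∀ y, ‖(T n).symm y‖ ≤ K * ‖y‖ := fun n hn y => by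
    refine ((hcomp n hn _).1.trans (hT n hn _).2).trans ?_
    rw [ContinuousLinearEquiv.apply_symm_apply]
  have hTn : ∀ n : ℕ, 1 ≤ n → ∀ x, ‖T n x‖ ≤ K * (C * (n : ℝ) ^ (2 * ε)) * ‖x‖ := fun n hn x => by
    refine ((hT n hn x).1.trans (mul_le_mul_of_nonneg_left (hcomp n hn x).2 hK0.le)).trans ?_
    rw [mul_assoc K]
  obtain ⟨c₁, hc₁, hlin⟩ := exists_linearization_of_rates (α₁ := lo 1 - δ) (βs := hi k + δ)
    (αu := lo (k + 1) - δ) (βr := hi r + δ) (η := δ) (dn := fun j => lo (j + 1) - δ)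
    (up := fun j => hi (j + 1) + δ) hK hp hδ hℓ hkr.le hB hcomm hrate
    (fun j hj => by linarith [hle (j + 1) (by omega) (by omega)]) (by linarith) (by linarith)
    (by linarith) (by linarith)
    (fun j hj => ⟨by linarith [(hmono 1 le_rfl (j + 1) (by omega) (by omega)).1],
      by linarith [(hmono (j + 1) (by omega) k (by omega) (by omega)).2],
      by linarith [m₅ (j + 1) (by omega) (by omega)]⟩)
    (fun j hj hjr => ⟨by linarith [(hmono (k + 1) (by omega) (j + 1) (by omega) (by omega)).1],
      by linarith [(hmono (j + 1) (by omega) r (by omega) (by omega)).2],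
      by linarith [m₆ (j + 1) (by omega) (by omega)]⟩)
    (fun i j hij hj => by
      have h1 := m₇ (i + 1) (by omega) (by omega)
      have h2 := (hmono (i + 1 + 1) (by omega) (j + 1) (by omega) (by omega)).1
      linarith)
    (L := K * C * (L * K ^ 2)) (by positivity)
  refine ⟨c₁ / (K * C * K), by positivity, fun c hc hcc g hg hg0 hdg hgc hgL => ?_⟩
  have hgC : ∀ n : ℕ, 1 ≤ n → C11 (g n) (c / ((n : ℝ) + 1) ^ (1 + 2 * ε))
      (L / ((n : ℝ) + 1) ^ (1 + 2 * ε)) := fun n hn => ⟨hg n hn, hgc n hn, hgL n hn⟩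
  have hg' : ∀ n : ℕ, 1 ≤ n → C11 (fun x => T (n + 1) (g n ((T n).symm x)))
      (K * C * (c * K) / (n + 1)) (K * C * (L * K ^ 2) / (n + 1)) ∧
      T (n + 1) (g n ((T n).symm 0)) = 0 ∧
      fderiv ℝ (fun x => T (n + 1) (g n ((T n).symm x))) 0 = 0 := by
    refine fun n hn => ⟨?_, by simp [hg0 n hn], fderiv_clm_comp_clm_zero (hg n hn) (hdg n hn)
      (T (n + 1)).toContinuousLinearMap (T n).symm.toContinuousLinearMap⟩
    have hn1 : (0 : ℝ) < (n : ℝ) + 1 := by positivity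
    have hpow := Real.rpow_pos_of_pos hn1 (2 * ε)
    have h := (hgC n hn).clm_comp_clm (by positivity) (T (n + 1)).toContinuousLinearMap
      (T n).symm.toContinuousLinearMap hK0.le
      (by positivity : 0 ≤ K * (C * ((n + 1 : ℕ) : ℝ) ^ (2 * ε))) (hTn (n + 1) (by omega))
      (hTsymm n hn)
    refine h.mono (le_of_eq ?_) (le_of_eq ?_) <;>
    · rw [Real.rpow_add hn1, Real.rpow_one]
      push_cast
      field_simp
  obtain ⟨ψ, M, ρ, hM, hρ, hψ, hψc, hψb⟩ := hlin (K * C * (c * K)) (by positivity)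
    (by rw [le_div_iff₀ (by positivity)] at hcc; linarith)
    (fun n x => T (n + 1) (g n ((T n).symm x))) hg'
  refine ⟨fun n => conjE (T n) (ψ n), fun n hn => ⟨conjE_contDiff _ (hψ n hn).1, ?_⟩,
    fun n hn x => ?_, K * (M * (K * C)), ρ / (2 * (K * C)), by positivity, by positivity,
    fun n hn x hx => ?_⟩
  · rw [conjE_symm]
    exact conjE_contDiff _ (hψ n hn).2
  · have h := hψc n hn (T n x)
    rw [conjSeq_apply, ContinuousLinearEquiv.symm_apply_apply, ← map_add] at h
    simp only [conjE_apply]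
    rw [h, ContinuousLinearEquiv.symm_apply_eq, ← conjSeq_apply,
      ContinuousLinearEquiv.apply_symm_apply]
  · have hn0 : (0 : ℝ) < n := by exact_mod_cast hn
    have hpow := Real.rpow_pos_of_pos hn0 (2 * ε)
    have hx' : ‖T n x‖ < ρ := by
      refine ((hTn n hn x).trans (mul_le_mul_of_nonneg_left hx (by positivity))).trans_lt ?_
      have : K * (C * (n : ℝ) ^ (2 * ε)) * (ρ / (2 * (K * C)) / (n : ℝ) ^ (2 * ε)) = ρ / 2 := by
        field_simp
      linarith
    have hb' := hψb n hn _ hx'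
    have hMn : K * (M * (K * C)) * (n : ℝ) ^ (2 * ε) =
        K * (M * (K * (C * (n : ℝ) ^ (2 * ε)))) := by ring
    rw [conjE_symm, hMn]
    exact ⟨norm_fderiv_conjE_le (T n) (hψ n hn).1 (by positivity) hK0.le (hTn n hn) (hTsymm n hn)
      hb'.1, norm_fderiv_conjE_le (T n) (hψ n hn).2 (by positivity) hK0.le (hTn n hn)
      (hTsymm n hn) hb'.2⟩

end NonautLin
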